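/- Let q be a prime with q ≡ 1 (mod 4). There exists a polynomial P of degree 3 (depending only on q), whose leading coefficient is B(1/q)(1 − 1/q)/24 where B(u) = ∏_P (1 + u^{d(P)}(u^{d(P)} − 3)/((|P|+1)(1 + u^{d(P)}))) (product over monic irreducible P), such that for every ε > 0, as g → ∞, Σ_{D ∈ H_{2g+1}} L(1/2, χ_D)^2 = (q^{2g+1}/ζ(2)) · P(2g+1) + O_ε(q^{g(1+ε)}). -/

import Mathlib

/- Setting: `F_q[x]` with `q` prime, `q ≡ 1 (mod 4)`.  `M_n` denotes the monic
polynomials of degree `n`, `M_{≤n}` those of degree at most `n`, `H_n` the monic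
squarefree polynomials of degree `n`. -/

open Polynomial

noncomputable section

attribute [local instance] Classical.propDecidable

abbrev Fqx (q : ℕ) := Polynomial (ZMod q)

/-- The (sub)type of monic irreducible polynomials over `F_q`. -/
abbrev MIrr (q : ℕ) := {P : Fqx q // P.Monic ∧ Irreducible P}

/-- The norm `|f| = q ^ deg f`, as a complex number. -/
def nm (q : ℕ) (f : Fqx q) : ℂ := (q : ℂ) ^ f.natDegree

/-- The monic polynomial `X ^ n + ∑ i < n, c i * X ^ i` of degree `n`; as `c` runs over
`Fin n → ZMod q`, this enumerates the monic polynomials of degree `n` exactly once. -/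
def monicOf (q n : ℕ) (c : Fin n → ZMod q) : Fqx q :=
  X ^ n + ∑ i : Fin n, C (c i) * X ^ (i : ℕ)

/-- The polynomial `∑ i < n, c i * X ^ i` of degree `< n`; as `c` runs over
`Fin n → ZMod q`, this enumerates the residues modulo a polynomial of degree `n`. -/
def polyOf (q n : ℕ) (c : Fin n → ZMod q) : Fqx q :=
  ∑ i : Fin n, C (c i) * X ^ (i : ℕ)

/-- The sum of `F` over the monic polynomials of degree `n` (empty if `n < 0`). -/
def sumMn (q : ℕ) [NeZero q] (n : ℤ) (F : Fqx q → ℂ) : ℂ :=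
  if 0 ≤ n then ∑ c : Fin n.toNat → ZMod q, F (monicOf q n.toNat c) else 0

/-- The sum of `F` over the monic polynomials of degree at most `n` (empty if `n < 0`). -/
def sumMle (q : ℕ) [NeZero q] (n : ℤ) (F : Fqx q → ℂ) : ℂ :=
  ∑ m ∈ Finset.range (n + 1).toNat, sumMn q m F

/-- The sum of `F` over `H_n`, the monic squarefree polynomials of degree `n`. -/
def sumH (q : ℕ) [NeZero q] (n : ℕ) (F : Fqx q → ℂ) : ℂ :=
  ∑ c : Fin n → ZMod q,
    if Squarefree (monicOf q n c) then F (monicOf q n c) else 0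

/-- The quadratic residue symbol `(f | P)` for `P` monic irreducible:  it is `0` if
`P ∣ f`, `1` if `P ∤ f` and `f` is a square modulo `P`, and `-1` otherwise. -/
def legSym (q : ℕ) (f P : Fqx q) : ℤ :=
  if P ∣ f then 0 else if ∃ g : Fqx q, P ∣ (g ^ 2 - f) then 1 else -1

/-- The Jacobi symbol `(f | u)`, extending the quadratic residue symbol
multiplicatively in the lower entry. -/
def jacSym (q : ℕ) [Fact q.Prime] (f u : Fqx q) : ℤ :=
  if u = 0 then (if IsUnit f then 1 else 0)
  else ((UniqueFactorizationMonoid.factors u).map fun P => legSym q f P).prod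

/-- The character `χ_D(f) = (D | f)`, as a complex number. -/
def chi (q : ℕ) [Fact q.Prime] (D f : Fqx q) : ℂ := jacSym q D f

/-- `d_k(f)`: the number of ways of writing `f` as an ordered product of `k` monic
polynomials. -/
def dk (q k : ℕ) (f : Fqx q) : ℕ :=
  Nat.card {t : Fin k → Fqx q // (∀ i, (t i).Monic) ∧ ∏ i, t i = f}

/-- The exponential `e(a/f) = exp(2πi a₁/q)`, where `a₁ ∈ F_q ≅ ℤ/q` is the coefficient
of `1/x` in the Laurent expansion of `a/f` at infinity, i.e. the coefficient of
`x^(deg f - 1)` in `a mod f`. -/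
def eQ (q : ℕ) (f a : Fqx q) : ℂ :=
  Complex.exp (2 * (Real.pi : ℂ) * Complex.I * (((a %ₘ f).coeff (f.natDegree - 1)).val : ℂ) / q)

/-- The generalized Gauss sum `G(V, χ_f) = ∑_{u mod f} χ_f(u) e(uV/f)`. -/
def gSum (q : ℕ) [Fact q.Prime] (V f : Fqx q) : ℂ :=
  ∑ c : Fin f.natDegree → ZMod q,
    chi q f (polyOf q f.natDegree c) * eQ q f (polyOf q f.natDegree c * V)

/-- `L(1/2, χ_D)`: since `L(s, χ_D) = ∑_{f ∈ M} χ_D(f) |f|^{-s}` is a polynomial of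
degree `deg D - 1` in `q^{-s}` (for `D` squarefree of odd degree), this is the finite
sum `∑_{n < deg D} (∑_{f ∈ M_n} χ_D(f)) q^{-n/2}`. -/
def Lhalf (q : ℕ) [Fact q.Prime] (D : Fqx q) : ℂ :=
  ∑ n ∈ Finset.range D.natDegree,
    sumMn q n (fun f => chi q D f) / (Real.sqrt ((q : ℝ) ^ n) : ℂ)

/-- The L-series `L(w, χ_V) = ∑_{f ∈ M} χ_V(f) w^(deg f)`. -/
def Lser (q : ℕ) [Fact q.Prime] (V : Fqx q) (w : ℂ) : ℂ :=
  ∑' f : {f : Fqx q // f.Monic}, chi q V f.1 * w ^ f.1.natDegree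

/-- The Euler phi function: the number of units in `F_q[x]/(f)`. -/
def polyPhi (q : ℕ) [Fact q.Prime] (f : Fqx q) : ℕ :=
  Nat.card ((Fqx q ⧸ Ideal.span {f}))ˣ

/-- `Z(u) = (1 - qu)⁻¹`. -/
def Zf (q : ℕ) (u : ℂ) : ℂ := (1 - q * u)⁻¹

/-- The Euler product `B(u) = ∏_P (1 + u^d(u^d - 3)/((|P|+1)(1+u^d)))`, `d = d(P)`. -/
def Bfun (q : ℕ) (u : ℂ) : ℂ :=
  ∏' P : MIrr q, (1 + u ^ P.1.natDegree * (u ^ P.1.natDegree - 3) /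
    ((nm q P.1 + 1) * (1 + u ^ P.1.natDegree)))

/-- The Euler product `B_3(u)` from the third-moment main term. -/
def B3fun (q : ℕ) (u : ℂ) : ℂ :=
  ∏' P : MIrr q,
    (1 - (6 * u ^ P.1.natDegree - (15 - 6 * nm q P.1) * u ^ (2 * P.1.natDegree)
      + (20 - 8 * nm q P.1) * u ^ (3 * P.1.natDegree)
      - (15 - 3 * nm q P.1) * u ^ (4 * P.1.natDegree)
      + 6 * u ^ (5 * P.1.natDegree) - u ^ (6 * P.1.natDegree)) / (nm q P.1 + 1))

/-- `∑_{C ∈ M_{≤ g-1}, C | f^∞} |C|⁻²`, where `C | f^∞` means that every monic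
irreducible factor of `C` divides `f`. -/
def sumCdiv (q : ℕ) [NeZero q] (g : ℕ) (f : Fqx q) : ℂ :=
  sumMle q ((g : ℤ) - 1) fun Cp =>
    if ∀ P : Fqx q, P.Monic → Irreducible P → P ∣ Cp → P ∣ f
    then ((q : ℂ) ^ (2 * Cp.natDegree))⁻¹ else 0

/-- The main term `q^(2g+1) (1 - 1/q) ∑_{f ∈ M_{≤N}, f = □} d_k(f) φ(f) |f|^{-3/2}
∑_{C ∈ M_{≤g-1}, C|f^∞} |C|⁻²`. -/
def Mterm (q : ℕ) [Fact q.Prime] (k : ℕ) (N : ℤ) (g : ℕ) : ℂ :=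
  (q : ℂ) ^ (2 * g + 1) * (1 - 1 / q) * sumMle q N fun f =>
    if IsSquare f then
      (dk q k f : ℂ) * polyPhi q f / (Real.sqrt ((q : ℝ) ^ (3 * f.natDegree)) : ℂ)
        * sumCdiv q g f
    else 0

/-- The secondary main term `S_{kg}(V = □)` (with `N = kg` or `kg - 1`). -/
def Ssq (q : ℕ) [Fact q.Prime] (k : ℕ) (N : ℤ) (g : ℕ) : ℂ :=
  (q : ℂ) ^ (2 * g + 1) * sumMle q N fun f =>
    if Even f.natDegree then
      (dk q k f : ℂ) / (Real.sqrt ((q : ℝ) ^ (3 * f.natDegree)) : ℂ) *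
        sumMle q ((g : ℤ) - 1) (fun Cp =>
          if ∀ P : Fqx q, P.Monic → Irreducible P → P ∣ Cp → P ∣ f then
            ((q : ℂ) ^ (2 * Cp.natDegree))⁻¹ *
              ((q - 1) * sumMle q ((f.natDegree : ℤ) / 2 - g - 2 + Cp.natDegree)
                  (fun l => gSum q (l ^ 2) f)
                - sumMn q ((f.natDegree : ℤ) / 2 - g - 1 + Cp.natDegree)
                    (fun l => gSum q (l ^ 2) f)
                - (q - 1) / q * sumMle q ((f.natDegree : ℤ) / 2 - g - 1 + Cp.natDegree)
                    (fun l => gSum q (l ^ 2) f)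
                + (1 / q) * sumMn q ((f.natDegree : ℤ) / 2 - g + Cp.natDegree)
                    (fun l => gSum q (l ^ 2) f))
          else 0)
    else 0

/-- The odd-degree part `S_{kg,o}` (with `N = kg` or `kg - 1`). -/
def Sodd (q : ℕ) [Fact q.Prime] (k : ℕ) (N : ℤ) (g : ℕ) : ℂ :=
  (q : ℂ) ^ (2 * g + 1) * (Real.sqrt q : ℂ) * sumMle q N fun f =>
    if Odd f.natDegree then
      (dk q k f : ℂ) / (Real.sqrt ((q : ℝ) ^ (3 * f.natDegree)) : ℂ) *
        sumMle q ((g : ℤ) - 1) (fun Cp =>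
          if ∀ P : Fqx q, P.Monic → Irreducible P → P ∣ Cp → P ∣ f then
            ((q : ℂ) ^ (2 * Cp.natDegree))⁻¹ *
              (sumMn q ((f.natDegree : ℤ) - 2 * g - 2 + 2 * Cp.natDegree)
                  (fun V => gSum q V f)
                - (1 / q) * sumMn q ((f.natDegree : ℤ) - 2 * g + 2 * Cp.natDegree)
                    (fun V => gSum q V f))
          else 0)
    else 0

/-- The even-degree, non-square-`V` part `S_{kg,e}(V ≠ □)` (with `N = kg` or `kg-1`). -/
def SevNS (q : ℕ) [Fact q.Prime] (k : ℕ) (N : ℤ) (g : ℕ) : ℂ :=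
  (q : ℂ) ^ (2 * g + 1) * sumMle q N fun f =>
    if Even f.natDegree then
      (dk q k f : ℂ) / (Real.sqrt ((q : ℝ) ^ (3 * f.natDegree)) : ℂ) *
        sumMle q ((g : ℤ) - 1) (fun Cp =>
          if ∀ P : Fqx q, P.Monic → Irreducible P → P ∣ Cp → P ∣ f then
            ((q : ℂ) ^ (2 * Cp.natDegree))⁻¹ *
              ((q - 1) * sumMle q ((f.natDegree : ℤ) - 2 * g - 3 + 2 * Cp.natDegree)
                  (fun V => if IsSquare V then 0 else gSum q V f)
                - sumMn q ((f.natDegree : ℤ) - 2 * g - 2 + 2 * Cp.natDegree)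
                    (fun V => if IsSquare V then 0 else gSum q V f)
                - (q - 1) / q * sumMle q ((f.natDegree : ℤ) - 2 * g - 1 + 2 * Cp.natDegree)
                    (fun V => if IsSquare V then 0 else gSum q V f)
                + (1 / q) * sumMn q ((f.natDegree : ℤ) - 2 * g + 2 * Cp.natDegree)
                    (fun V => if IsSquare V then 0 else gSum q V f))
          else 0)
    else 0

/-- `∏_{P | f} (1 - |P|⁻² z^{-d(P)})`, a finite product written as a `tprod`. -/
def prodC (q : ℕ) (z : ℂ) (f : Fqx q) : ℂ :=
  ∏' P : {P : Fqx q // P.Monic ∧ Irreducible P ∧ P ∣ f},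
    (1 - 1 / (nm q P.1 ^ 2 * z ^ P.1.natDegree))

/-- `M(V; z, w) = ∑_{f ∈ M} d₂(f) G(V,χ_f) / (√|f| ∏_{P|f}(1 - |P|⁻²z^{-d(P)})) w^(deg f)`. -/
def Mser (q : ℕ) [Fact q.Prime] (V : Fqx q) (z w : ℂ) : ℂ :=
  ∑' f : {f : Fqx q // f.Monic},
    (dk q 2 f.1 : ℂ) * gSum q V f.1 /
      ((Real.sqrt ((q : ℝ) ^ f.1.natDegree) : ℂ) * prodC q z f.1) * w ^ f.1.natDegree

/-- The local factor `M_P(V; z, w)`. -/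
def MPf (q : ℕ) [Fact q.Prime] (V : Fqx q) (z w : ℂ) (P : Fqx q) : ℂ :=
  if P ∣ V then
    1 + (1 - 1 / (nm q P ^ 2 * z ^ P.natDegree))⁻¹ *
      ∑' b : ℕ, (dk q 2 (P ^ (b + 1)) : ℂ) * gSum q V (P ^ (b + 1)) /
        (Real.sqrt ((q : ℝ) ^ ((b + 1) * P.natDegree)) : ℂ) * w ^ ((b + 1) * P.natDegree)
  else
    1 + 2 * (jacSym q V P : ℂ) * w ^ P.natDegree / (nm q P ^ 2 * z ^ P.natDegree - 1)
      + w ^ (2 * P.natDegree)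
      - 4 * w ^ (2 * P.natDegree) / (1 - 1 / (nm q P ^ 2 * z ^ P.natDegree))
      + 2 * (jacSym q V P : ℂ) * w ^ (3 * P.natDegree) /
          (1 - 1 / (nm q P ^ 2 * z ^ P.natDegree))

/-- The local factor `R_P(l²; z, w)`. -/
def RPf (q : ℕ) [Fact q.Prime] (l : Fqx q) (z w : ℂ) (P : Fqx q) : ℂ :=
  if P ∣ l then
    (1 - w ^ P.natDegree) ^ 2 *
      (1 + (1 - 1 / (nm q P ^ 2 * z ^ P.natDegree))⁻¹ *
        ∑' b : ℕ, (dk q 2 (P ^ (b + 1)) : ℂ) * gSum q (l ^ 2) (P ^ (b + 1)) /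
          (Real.sqrt ((q : ℝ) ^ ((b + 1) * P.natDegree)) : ℂ) * w ^ ((b + 1) * P.natDegree))
  else
    1 + 2 * w ^ P.natDegree / (nm q P ^ 2 * z ^ P.natDegree - 1)
      + w ^ (2 * P.natDegree)
      - 4 * w ^ (2 * P.natDegree) / (1 - 1 / (nm q P ^ 2 * z ^ P.natDegree))
      + 2 * w ^ (3 * P.natDegree) / (1 - 1 / (nm q P ^ 2 * z ^ P.natDegree))

/-- `R(z, w) = ∑_{l ∈ M} z^(deg l) ∏_P R_P(l²; z, w)`. -/
def Rser (q : ℕ) [Fact q.Prime] (z w : ℂ) : ℂ :=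
  ∑' l : {l : Fqx q // l.Monic}, z ^ l.1.natDegree * ∏' P : MIrr q, RPf q l.1 z w P.1

/-- The local factor `F_P(z, w)`. -/
def FPf (q : ℕ) (z w : ℂ) (P : Fqx q) : ℂ :=
  (1 - w ^ P.natDegree) ^ 2 *
    (1 - (1 - 2 * nm q P ^ 2 * (w * z) ^ P.natDegree - 2 * nm q P * (w ^ 2 * z) ^ P.natDegree
        + 2 * nm q P ^ 2 * (w * z ^ 2) ^ P.natDegree
        + (-2 * nm q P ^ 3 + 3 * nm q P ^ 2) * (w ^ 2 * z ^ 2) ^ P.natDegree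
        + nm q P ^ 2 * (w ^ 4 * z ^ 2) ^ P.natDegree
        - nm q P ^ 3 * (w ^ 4 * z ^ 3) ^ P.natDegree) /
      (nm q P ^ 2 * z ^ P.natDegree * (1 - nm q P * w ^ (2 * P.natDegree) * z ^ P.natDegree)))

/-- `F(z, w) = ∏_P F_P(z, w)`. -/
def Ffull (q : ℕ) (z w : ℂ) : ℂ := ∏' P : MIrr q, FPf q z w P.1

/-- `F(z) = F(z, 1/q)`. -/
def Fone (q : ℕ) (z : ℂ) : ℂ := Ffull q z (1 / q)

/-- `α(z) = (1/q) ∂_w F(z, w)|_{w = 1/q} / F(z, 1/q)`. -/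
def alphaF (q : ℕ) (z : ℂ) : ℂ := (1 / (q : ℂ)) * deriv (Ffull q z) (1 / q) / Fone q z

/-- The explicit formula for `F(z)`:
`∏_P (1 - 1/|P|)² (1 + 2/|P| + 1/|P|³ - (z^d + z^{-d})/|P|²)`. -/
def Fexp (q : ℕ) (z : ℂ) : ℂ :=
  ∏' P : MIrr q,
    ((1 - 1 / nm q P.1) ^ 2 *
      (1 + 2 / nm q P.1 + 1 / nm q P.1 ^ 3 -
        (z ^ P.1.natDegree + z⁻¹ ^ P.1.natDegree) / nm q P.1 ^ 2))

/-- The explicit formula for `α(z)`. -/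
def alphaExp (q : ℕ) (z : ℂ) : ℂ :=
  ∑' P : MIrr q,
    2 * (P.1.natDegree : ℂ) *
      (nm q P.1 ^ 2 + z ^ P.1.natDegree * (-3 * nm q P.1 ^ 3 - 3 * nm q P.1 + nm q P.1 ^ 2)
        + z ^ (2 * P.1.natDegree) * (nm q P.1 ^ 4 - nm q P.1 ^ 3 + 4 * nm q P.1 ^ 2 - nm q P.1 + 2)
        + z ^ (3 * P.1.natDegree) * (nm q P.1 ^ 2 - 2 * nm q P.1)) /
      ((nm q P.1 - 1) * (z ^ P.1.natDegree - nm q P.1) *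
        (nm q P.1 - z ^ P.1.natDegree - 2 * nm q P.1 ^ 2 * z ^ P.1.natDegree
          - nm q P.1 ^ 3 * z ^ P.1.natDegree + nm q P.1 * z ^ (2 * P.1.natDegree)))

/-- `A(V; z, w) = ∑_{f ∈ M} w^(deg f) d₃(f) G(V,χ_f)/(√|f| ∏_{P|f}(1 - |P|⁻²z^{-d(P)}))`. -/
def Aser (q : ℕ) [Fact q.Prime] (V : Fqx q) (z w : ℂ) : ℂ :=
  ∑' f : {f : Fqx q // f.Monic},
    w ^ f.1.natDegree * (dk q 3 f.1 : ℂ) * gSum q V f.1 /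
      ((Real.sqrt ((q : ℝ) ^ f.1.natDegree) : ℂ) * prodC q z f.1)

/-- The local factor `H_P(V; z, w)` of `A(V; z, w)`. -/
def HP3f (q : ℕ) [Fact q.Prime] (V : Fqx q) (z w : ℂ) (P : Fqx q) : ℂ :=
  if P ∣ V then
    1 + (1 - 1 / (nm q P ^ 2 * z ^ P.natDegree))⁻¹ *
      ∑' i : ℕ, w ^ ((i + 1) * P.natDegree) * (dk q 3 (P ^ (i + 1)) : ℂ) *
        gSum q V (P ^ (i + 1)) / (Real.sqrt ((q : ℝ) ^ ((i + 1) * P.natDegree)) : ℂ)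
  else
    1 + 3 * (jacSym q V P : ℂ) * w ^ P.natDegree / (nm q P ^ 2 * z ^ P.natDegree - 1)
      + 3 * w ^ (2 * P.natDegree)
      - 9 * w ^ (2 * P.natDegree) / (1 - 1 / (nm q P ^ 2 * z ^ P.natDegree))
      - (jacSym q V P : ℂ) * w ^ (3 * P.natDegree)
      + 9 * (jacSym q V P : ℂ) * w ^ (3 * P.natDegree) /
          (1 - 1 / (nm q P ^ 2 * z ^ P.natDegree))
      - 3 * w ^ (4 * P.natDegree) / (1 - 1 / (nm q P ^ 2 * z ^ P.natDegree))

/-- The local factor `A_P(l²; z, w)`. -/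
def APf (q : ℕ) [Fact q.Prime] (l : Fqx q) (z w : ℂ) (P : Fqx q) : ℂ :=
  if P ∣ l then
    (1 - w ^ P.natDegree) ^ 3 *
      (1 + ∑' i : ℕ, w ^ ((i + 1) * P.natDegree) * (dk q 3 (P ^ (i + 1)) : ℂ) *
        gSum q (l ^ 2) (P ^ (i + 1)) /
          ((Real.sqrt ((q : ℝ) ^ ((i + 1) * P.natDegree)) : ℂ) *
            (1 - 1 / (nm q P ^ 2 * z ^ P.natDegree))))
  else
    1 + 3 * w ^ P.natDegree / (nm q P ^ 2 * z ^ P.natDegree - 1)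
      + 3 * w ^ (2 * P.natDegree)
      - 9 * w ^ (2 * P.natDegree) / (1 - 1 / (nm q P ^ 2 * z ^ P.natDegree))
      - w ^ (3 * P.natDegree)
      + 9 * w ^ (3 * P.natDegree) / (1 - 1 / (nm q P ^ 2 * z ^ P.natDegree))
      - 3 * w ^ (4 * P.natDegree) / (1 - 1 / (nm q P ^ 2 * z ^ P.natDegree))

/-- `C(z, w) = ∑_{l ∈ M} z^(deg l) ∏_P A_P(l²; z, w)`. -/
def Cser (q : ℕ) [Fact q.Prime] (z w : ℂ) : ℂ :=
  ∑' l : {l : Fqx q // l.Monic}, z ^ l.1.natDegree * ∏' P : MIrr q, APf q l.1 z w P.1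

/-- The local factor `H_P(z, w)`. -/
def HPf (q : ℕ) (z w : ℂ) (P : Fqx q) : ℂ :=
  (1 - w ^ P.natDegree) ^ 3 * (1 - nm q P * (w ^ 2 * z) ^ P.natDegree) ^ 3 *
    (1 + (w * z) ^ P.natDegree) ^ 3 *
    (1 + 3 * w ^ P.natDegree + 3 * nm q P * (z * w ^ 2) ^ P.natDegree
      + 3 * w ^ (2 * P.natDegree) / nm q P - 3 * (z * w) ^ P.natDegree
      - 1 / (nm q P ^ 2 * z ^ P.natDegree) - 6 * (z * w ^ 2) ^ P.natDegree
      + nm q P * (z * w ^ 3) ^ P.natDegree - 3 * (z * w ^ 4) ^ P.natDegree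
      - nm q P * (z ^ 2 * w ^ 3) ^ P.natDegree + 3 * nm q P * (z ^ 2 * w ^ 4) ^ P.natDegree
      + nm q P * (z ^ 2 * w ^ 6) ^ P.natDegree - nm q P ^ 2 * (z ^ 3 * w ^ 6) ^ P.natDegree)

/-- `H(z, w) = ∏_P H_P(z, w)`. -/
def Hfull (q : ℕ) (z w : ℂ) : ℂ := ∏' P : MIrr q, HPf q z w P.1

end

set_option linter.unusedSectionVars false

noncomputable section

open scoped Classical

variable {q : ℕ} [Fact q.Prime]

/-- The monic polynomials of degree `n`. -/
def mon (q : ℕ) [Fact q.Prime] (n : ℕ) : Finset (Fqx q) :=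
  Finset.univ.image (monicOf q n)

lemma degree_polyOf_lt (n : ℕ) (c : Fin n → ZMod q) :
    (∑ i : Fin n, C (c i) * X ^ (i : ℕ) : Fqx q).degree < n :=
  degree_sum_fin_lt c

lemma coeff_polyOf (n : ℕ) (c : Fin n → ZMod q) (j : Fin n) :
    (∑ i : Fin n, C (c i) * X ^ (i : ℕ) : Fqx q).coeff j = c j := by
  simp only [finsetSum_coeff, coeff_C_mul_X_pow]
  rw [Finset.sum_eq_single j]
  · simp
  · intro b _ hb
    rw [if_neg]
    intro h
    exact hb (Fin.ext h.symm)
  · simp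

lemma monicOf_injective (n : ℕ) : Function.Injective (monicOf q n) := by
  intro c d h
  have h' : (∑ i : Fin n, C (c i) * X ^ (i : ℕ) : Fqx q) = ∑ i : Fin n, C (d i) * X ^ (i : ℕ) :=
    add_left_cancel h
  funext j
  rw [← coeff_polyOf n c j, h', coeff_polyOf]

lemma mem_mon {n : ℕ} {f : Fqx q} : f ∈ mon q n ↔ f.Monic ∧ f.natDegree = n := by
  constructor
  · intro h
    obtain ⟨c, -, rfl⟩ := Finset.mem_image.1 h
    have hm : (monicOf q n c).Monic := monic_X_pow_add (degree_polyOf_lt n c)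
    refine ⟨hm, ?_⟩
    rw [monicOf, natDegree_add_eq_left_of_degree_lt, natDegree_X_pow]
    rw [degree_X_pow]
    exact degree_polyOf_lt n c
  · rintro ⟨hm, rfl⟩
    refine Finset.mem_image.2 ⟨fun i => f.coeff i, Finset.mem_univ _, ?_⟩
    conv_rhs => rw [hm.as_sum]
    rw [monicOf, Fin.sum_univ_eq_sum_range (fun i => C (f.coeff i) * X ^ i)]

lemma card_mon (n : ℕ) : (mon q n).card = q ^ n := by
  rw [mon, Finset.card_image_of_injective _ (monicOf_injective n)]
  simp [ZMod.card]

lemma sum_monicOf {R : Type*} [AddCommMonoid R] (n : ℕ) (F : Fqx q → R) :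
    ∑ c : Fin n → ZMod q, F (monicOf q n c) = ∑ f ∈ mon q n, F f := by
  rw [mon, Finset.sum_image (fun a _ b _ h => monicOf_injective n h)]

/-- The monic polynomials of degree at most `N`. -/
def monLE (q : ℕ) [Fact q.Prime] (N : ℕ) : Finset (Fqx q) :=
  (Finset.range (N + 1)).biUnion (mon q)

lemma mem_monLE {N : ℕ} {f : Fqx q} : f ∈ monLE q N ↔ f.Monic ∧ f.natDegree ≤ N := by
  simp only [monLE, Finset.mem_biUnion, Finset.mem_range, mem_mon]
  constructor
  · rintro ⟨a, ha, h1, rfl⟩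
    exact ⟨h1, by omega⟩
  · rintro ⟨h1, h2⟩
    exact ⟨_, by omega, h1, rfl⟩

lemma sum_monLE {R : Type*} [AddCommMonoid R] (N : ℕ) (F : Fqx q → R) :
    ∑ f ∈ monLE q N, F f = ∑ k ∈ Finset.range (N + 1), ∑ f ∈ mon q k, F f := by
  rw [monLE, Finset.sum_biUnion]
  intro a _ b _ hab
  rw [Function.onFun, Finset.disjoint_left]
  intro f hf hf'
  exact hab ((mem_mon.1 hf).2.symm.trans (mem_mon.1 hf').2)

/-- The primes of degree at most `N`. -/
def primesLE (q : ℕ) [Fact q.Prime] (N : ℕ) : Finset (MIrr q) :=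
  Finset.subtype (fun P => P.Monic ∧ Irreducible P) (monLE q N)

lemma mem_primesLE {N : ℕ} {P : MIrr q} : P ∈ primesLE q N ↔ P.1.natDegree ≤ N := by
  simp [primesLE, mem_monLE, P.2.1]

/-- The product of a finite set of primes. -/
def pr (T : Finset (MIrr q)) : Fqx q := ∏ P ∈ T, P.1

/-- The degree of the product of a finite set of primes. -/
def dg (T : Finset (MIrr q)) : ℕ := ∑ P ∈ T, P.1.natDegree

lemma monic_pr (T : Finset (MIrr q)) : (pr T).Monic := monic_prod_of_monic _ _ fun P _ => P.2.1

lemma natDegree_pr (T : Finset (MIrr q)) : (pr T).natDegree = dg T :=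
  natDegree_prod_of_monic _ _ fun P _ => P.2.1

lemma natDegree_pos_of_MIrr (P : MIrr q) : 0 < P.1.natDegree := P.2.2.natDegree_pos

lemma isCoprime_MIrr {P R : MIrr q} (h : P ≠ R) : IsCoprime P.1 R.1 := by
  refine (P.2.2.coprime_iff_not_dvd).2 fun hd => h ?_
  exact Subtype.ext (eq_of_monic_of_associated P.2.1 R.2.1
    ((Irreducible.dvd_irreducible_iff_associated P.2.2 R.2.2).1 hd))

lemma pr_dvd_iff (T : Finset (MIrr q)) (f : Fqx q) : pr T ∣ f ↔ ∀ P ∈ T, P.1 ∣ f := by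
  constructor
  · intro h P hP
    exact (Finset.dvd_prod_of_mem _ hP).trans h
  · intro h
    exact Finset.prod_dvd_of_coprime (fun a _ b _ hab => isCoprime_MIrr hab) h

lemma prime_dvd_pr_iff (T : Finset (MIrr q)) (P : MIrr q) : P.1 ∣ pr T ↔ P ∈ T := by
  constructor
  · intro h
    obtain ⟨R, hR, hd⟩ := (P.2.2.prime.dvd_finsetProd_iff _).1 h
    have : P = R := by
      by_contra hne
      exact P.2.2.not_isUnit ((isCoprime_MIrr hne).isUnit_of_dvd' dvd_rfl hd)
    exact this ▸ hR
  · exact fun h => Finset.dvd_prod_of_mem _ h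

lemma pr_injective : Function.Injective (pr (q := q)) := by
  intro T U h
  ext P
  rw [← prime_dvd_pr_iff, h, prime_dvd_pr_iff]

lemma squarefree_pr (T : Finset (MIrr q)) : Squarefree (pr T) := by
  rw [pr]
  exact Finset.squarefree_prod_of_pairwise_isCoprime
    (fun a _ b _ hab => (isCoprime_MIrr hab).isRelPrime) (fun P _ => P.2.2.squarefree)

/-- The set of primes of degree at most `deg f` that divide `f`. -/
def primeSet (f : Fqx q) : Finset (MIrr q) := (primesLE q f.natDegree).filter fun P => P.1 ∣ f

lemma mem_primeSet {f : Fqx q} (hf : f ≠ 0) {P : MIrr q} : P ∈ primeSet f ↔ P.1 ∣ f := by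
  rw [primeSet, Finset.mem_filter, mem_primesLE]
  exact ⟨fun h => h.2, fun h => ⟨natDegree_le_of_dvd h hf, h⟩⟩

lemma exists_prime_dvd {f : Fqx q} (hf : f.natDegree ≠ 0) : ∃ P : MIrr q, P.1 ∣ f := by
  have hu : ¬ IsUnit f := fun h => hf (natDegree_eq_zero_of_isUnit h)
  obtain ⟨g, hg, hd⟩ := WfDvdMonoid.exists_irreducible_factor hu (by rintro rfl; simp at hf)
  refine ⟨⟨normalize g, Polynomial.monic_normalize hg.ne_zero, ?_⟩, ?_⟩
  · exact (associated_normalize g).irreducible hg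
  · exact (normalize_dvd_iff).2 hd

lemma pr_primeSet {f : Fqx q} (hf : f.Monic) (hs : Squarefree f) : pr (primeSet f) = f := by
  obtain ⟨g, hg⟩ := (pr_dvd_iff (primeSet f) f).2 fun P hP => (mem_primeSet hf.ne_zero).1 hP
  have hgm : g.Monic := (monic_pr _).of_mul_monic_left (hg ▸ hf)
  have : g.natDegree = 0 := by
    by_contra hne
    obtain ⟨P, hP⟩ := exists_prime_dvd hne
    have h1 : P.1 ∣ f := (hP.mul_left _).trans (dvd_of_eq hg.symm)
    have h2 : P.1 ∣ pr (primeSet f) := (prime_dvd_pr_iff _ _).2 ((mem_primeSet hf.ne_zero).2 h1)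
    have h3 : P.1 * P.1 ∣ f := (mul_dvd_mul h2 hP).trans (dvd_of_eq hg.symm)
    exact P.2.2.not_isUnit (hs _ h3)
  rw [hgm.natDegree_eq_zero.1 this, mul_one] at hg
  exact hg.symm

/-- The sets of primes of total degree `m`. -/
def sqf (q : ℕ) [Fact q.Prime] (m : ℕ) : Finset (Finset (MIrr q)) :=
  (primesLE q m).powerset.filter fun T => dg T = m

lemma subset_primesLE {T : Finset (MIrr q)} {N : ℕ} (h : dg T ≤ N) : T ⊆ primesLE q N := by
  intro P hP
  rw [mem_primesLE]
  exact (Finset.single_le_sum (f := fun P : MIrr q => P.1.natDegree)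
    (fun _ _ => Nat.zero_le _) hP).trans h

lemma mem_sqf {m : ℕ} {T : Finset (MIrr q)} : T ∈ sqf q m ↔ dg T = m := by
  rw [sqf, Finset.mem_filter, Finset.mem_powerset]
  exact ⟨fun h => h.2, fun h => ⟨subset_primesLE h.le, h⟩⟩

lemma sum_squarefree {R : Type*} [AddCommMonoid R] (m : ℕ) (F : Fqx q → R) :
    ∑ c : Fin m → ZMod q, (if Squarefree (monicOf q m c) then F (monicOf q m c) else 0) =
      ∑ T ∈ sqf q m, F (pr T) := by
  rw [sum_monicOf m (fun f => if Squarefree f then F f else 0), ← Finset.sum_filter]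
  symm
  refine Finset.sum_bij (fun T _ => pr T) ?_ (fun a _ b _ h => pr_injective h) ?_ (fun _ _ => rfl)
  · intro T hT
    rw [Finset.mem_filter, mem_mon]
    exact ⟨⟨monic_pr T, (natDegree_pr T).trans (mem_sqf.1 hT)⟩, squarefree_pr T⟩
  · intro f hf
    rw [Finset.mem_filter, mem_mon] at hf
    obtain ⟨⟨h1, h2⟩, h3⟩ := hf
    have := pr_primeSet h1 h3
    exact ⟨primeSet f, mem_sqf.2 (by rw [← natDegree_pr, this, h2]), this⟩

end

noncomputable section

open scoped Classical

variable {q : ℕ} [Fact q.Prime]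

/-- The residue field of a prime. -/
abbrev resField (P : MIrr q) : Type := AdjoinRoot P.1

instance (P : MIrr q) : Fact (Irreducible P.1) := ⟨P.2.2⟩

instance (P : MIrr q) : Finite (resField P) :=
  have : Module.Finite (ZMod q) (resField P) := P.2.1.finite_adjoinRoot
  Module.finite_of_finite (ZMod q)

instance (P : MIrr q) : Fintype (resField P) := Fintype.ofFinite _

lemma legSym_eq_quadraticChar (f : Fqx q) (P : MIrr q) :
    legSym q f P.1 = quadraticChar (resField P) (AdjoinRoot.mk P.1 f) := by
  rw [legSym, quadraticChar_apply, quadraticCharFun]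
  have h0 : AdjoinRoot.mk P.1 f = 0 ↔ P.1 ∣ f := AdjoinRoot.mk_eq_zero
  by_cases h : P.1 ∣ f
  · rw [if_pos h, if_pos (h0.2 h)]
  · rw [if_neg h, if_neg (mt h0.1 h)]
    have : (∃ g : Fqx q, P.1 ∣ (g ^ 2 - f)) ↔ IsSquare (AdjoinRoot.mk P.1 f) := by
      constructor
      · rintro ⟨g, hg⟩
        refine ⟨AdjoinRoot.mk P.1 g, ?_⟩
        rw [← map_mul, ← pow_two, eq_comm, AdjoinRoot.mk_eq_mk]
        exact hg
      · rintro ⟨a, ha⟩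
        obtain ⟨g, rfl⟩ := AdjoinRoot.mk_surjective a
        refine ⟨g, ?_⟩
        rw [← map_mul, ← pow_two, eq_comm, AdjoinRoot.mk_eq_mk] at ha
        exact ha
    simp only [this]

lemma legSym_mul (f g : Fqx q) (P : MIrr q) :
    legSym q (f * g) P.1 = legSym q f P.1 * legSym q g P.1 := by
  simp only [legSym_eq_quadraticChar, map_mul]

lemma legSym_one (P : MIrr q) : legSym q 1 P.1 = 1 := by
  simp only [legSym_eq_quadraticChar, map_one]

lemma legSym_congr {f g : Fqx q} (P : MIrr q) (h : P.1 ∣ f - g) :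
    legSym q f P.1 = legSym q g P.1 := by
  rw [legSym_eq_quadraticChar, legSym_eq_quadraticChar, AdjoinRoot.mk_eq_mk.2 h]

lemma legSym_eq_zero {f : Fqx q} {P : MIrr q} (h : P.1 ∣ f) : legSym q f P.1 = 0 := by
  rw [legSym, if_pos h]

lemma legSym_eq_or {f : Fqx q} {P : MIrr q} (h : ¬ P.1 ∣ f) :
    legSym q f P.1 = 1 ∨ legSym q f P.1 = -1 := by
  rw [legSym, if_neg h]
  split_ifs <;> simp

lemma legSym_sq {f : Fqx q} {P : MIrr q} (h : ¬ P.1 ∣ f) : legSym q f P.1 ^ 2 = 1 := by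
  rcases legSym_eq_or h with h | h <;> rw [h] <;> norm_num

lemma abs_legSym_le (f : Fqx q) (P : MIrr q) : |legSym q f P.1| ≤ 1 := by
  by_cases h : P.1 ∣ f
  · rw [legSym_eq_zero h]; simp
  · rcases legSym_eq_or h with h | h <;> rw [h] <;> simp

lemma legSym_prod {ι : Type*} (s : Finset ι) (f : ι → Fqx q) (P : MIrr q) :
    legSym q (∏ i ∈ s, f i) P.1 = ∏ i ∈ s, legSym q (f i) P.1 := by
  induction s using Finset.induction_on with
  | empty => simp [legSym_one]
  | insert a s ha ih => rw [Finset.prod_insert ha, Finset.prod_insert ha, legSym_mul, ih]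

lemma legSym_associated (f : Fqx q) {P R : Fqx q} (h : Associated P R) :
    legSym q f P = legSym q f R := by
  simp only [legSym, h.dvd_iff_dvd_left]

lemma jacSym_one_right (D : Fqx q) : jacSym q D 1 = 1 := by
  rw [jacSym, if_neg one_ne_zero, UniqueFactorizationMonoid.factors_one]
  simp

lemma map_prod_eq_of_rel (D : Fqx q) {s t : Multiset (Fqx q)} (h : Multiset.Rel Associated s t) :
    (s.map fun P => legSym q D P).prod = (t.map fun P => legSym q D P).prod := by
  induction h with
  | zero => rfl
  | cons h1 _ ih => simp only [Multiset.map_cons, Multiset.prod_cons, ih, legSym_associated D h1]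

lemma jacSym_mul_right (D : Fqx q) {f g : Fqx q} (hf : f ≠ 0) (hg : g ≠ 0) :
    jacSym q D (f * g) = jacSym q D f * jacSym q D g := by
  rw [jacSym, jacSym, jacSym, if_neg hf, if_neg hg, if_neg (mul_ne_zero hf hg),
    map_prod_eq_of_rel D (UniqueFactorizationMonoid.factors_mul hf hg), Multiset.map_add,
    Multiset.prod_add]

lemma jacSym_prime (D : Fqx q) (P : MIrr q) : jacSym q D P.1 = legSym q D P.1 := by
  have hr : Multiset.Rel Associated (UniqueFactorizationMonoid.factors P.1) {P.1} := by
    refine UniqueFactorizationMonoid.factors_unique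
      (fun x hx => UniqueFactorizationMonoid.irreducible_of_factor x hx) (by simpa using P.2.2) ?_
    rw [Multiset.prod_singleton]
    exact UniqueFactorizationMonoid.factors_prod P.2.2.ne_zero
  rw [jacSym, if_neg P.2.2.ne_zero, map_prod_eq_of_rel D hr]
  simp

/-- The quadratic character modulo the product of the primes in `T`. -/
def qchar (T : Finset (MIrr q)) (f : Fqx q) : ℤ := ∏ P ∈ T, legSym q f P.1

lemma qchar_mul (T : Finset (MIrr q)) (f g : Fqx q) :
    qchar T (f * g) = qchar T f * qchar T g := by
  simp only [qchar, legSym_mul, Finset.prod_mul_distrib]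

lemma qchar_one (T : Finset (MIrr q)) : qchar T 1 = 1 := by
  simp [qchar, legSym_one]

lemma qchar_congr (T : Finset (MIrr q)) {f g : Fqx q} (h : pr T ∣ f - g) :
    qchar T f = qchar T g :=
  Finset.prod_congr rfl fun P hP =>
    legSym_congr P (((prime_dvd_pr_iff T P).2 hP).trans h)

lemma qchar_prod {ι : Type*} (T : Finset (MIrr q)) (s : Finset ι) (f : ι → Fqx q) :
    qchar T (∏ i ∈ s, f i) = ∏ i ∈ s, qchar T (f i) := by
  simp only [qchar, legSym_prod]
  exact Finset.prod_comm

lemma qchar_sq_eq_one {T : Finset (MIrr q)} {f : Fqx q} (h : ∀ P ∈ T, ¬ P.1 ∣ f) :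
    qchar T f ^ 2 = 1 := by
  rw [qchar, ← Finset.prod_pow]
  exact Finset.prod_eq_one fun P hP => legSym_sq (h P hP)

end

noncomputable section

open scoped Classical

variable {q : ℕ} [Fact q.Prime]

/-- The polynomials of degree less than `n`. -/
def res (q : ℕ) [Fact q.Prime] (n : ℕ) : Finset (Fqx q) := Finset.univ.image (polyOf q n)

lemma polyOf_injective (n : ℕ) : Function.Injective (polyOf q n) := by
  intro c d h
  funext j
  rw [← coeff_polyOf n c j]
  exact (congrArg (fun f => f.coeff (j : ℕ)) h).trans (coeff_polyOf n d j)

lemma mem_res {n : ℕ} {f : Fqx q} : f ∈ res q n ↔ f.degree < n := by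
  constructor
  · intro h
    obtain ⟨c, -, rfl⟩ := Finset.mem_image.1 h
    exact degree_polyOf_lt n c
  · intro h
    refine Finset.mem_image.2 ⟨fun i => f.coeff i, Finset.mem_univ _, ?_⟩
    rw [polyOf, Fin.sum_univ_eq_sum_range (fun i => C (f.coeff i) * X ^ i) n]
    ext j
    simp only [finsetSum_coeff, coeff_C_mul_X_pow, Finset.sum_ite_eq, Finset.mem_range]
    split_ifs with hj
    · rfl
    · exact ((degree_lt_iff_coeff_zero f n).1 h j (not_lt.1 hj)).symm

lemma card_res (n : ℕ) : (res q n).card = q ^ n := by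
  rw [res, Finset.card_image_of_injective _ (polyOf_injective n)]
  simp [ZMod.card]

lemma add_mem_res {n : ℕ} {f g : Fqx q} (hf : f ∈ res q n) (hg : g ∈ res q n) :
    f + g ∈ res q n :=
  mem_res.2 ((degree_add_le f g).trans_lt (max_lt (mem_res.1 hf) (mem_res.1 hg)))

lemma neg_mem_res {n : ℕ} {f : Fqx q} (hf : f ∈ res q n) : -f ∈ res q n :=
  mem_res.2 (by rw [degree_neg]; exact mem_res.1 hf)

lemma C_mul_mem_res {n : ℕ} {f : Fqx q} (c : ZMod q) (hf : f ∈ res q n) : C c * f ∈ res q n := by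
  refine mem_res.2 (lt_of_le_of_lt ?_ (mem_res.1 hf))
  rw [C_mul']
  exact degree_smul_le c f

lemma sum_res_shift {R : Type*} [AddCommMonoid R] (n : ℕ) {l : Fqx q} (hl : l ∈ res q n)
    (F : Fqx q → R) : ∑ u ∈ res q n, F (u + l) = ∑ u ∈ res q n, F u :=
  Finset.sum_bij' (fun u _ => u + l) (fun u _ => u + -l)
    (fun u hu => add_mem_res hu hl) (fun u hu => add_mem_res hu (neg_mem_res hl))
    (fun u _ => by simp) (fun u _ => by simp) (fun _ _ => rfl)

lemma sum_res_succ {R : Type*} [AddCommMonoid R] (n : ℕ) (F : Fqx q → R) :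
    ∑ u ∈ res q (n + 1), F u = ∑ c : ZMod q, ∑ l ∈ res q n, F (C c * X ^ n + l) := by
  rw [← Finset.sum_product']
  symm
  refine Finset.sum_bij' (fun p _ => C p.1 * X ^ n + p.2)
    (fun u _ => (u.coeff n, u - C (u.coeff n) * X ^ n)) ?_ ?_ ?_ ?_ (fun _ _ => rfl)
  · rintro ⟨c, l⟩ h
    have hl := mem_res.1 (Finset.mem_product.1 h).2
    refine mem_res.2 ((degree_add_le _ _).trans_lt (max_lt ?_ (hl.trans ?_)))
    · exact (degree_C_mul_X_pow_le n c).trans_lt (by exact_mod_cast n.lt_succ_self)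
    · exact_mod_cast n.lt_succ_self
  · intro u hu
    have hu := (degree_lt_iff_coeff_zero u (n + 1)).1 (mem_res.1 hu)
    refine Finset.mem_product.2 ⟨Finset.mem_univ _, mem_res.2 ?_⟩
    rw [degree_lt_iff_coeff_zero]
    intro m hm
    rw [coeff_sub, coeff_C_mul_X_pow]
    split_ifs with h
    · simp [h]
    · rw [sub_zero]
      exact hu m (by omega)
  · rintro ⟨c, l⟩ h
    have hl := (degree_lt_iff_coeff_zero l n).1 (mem_res.1 (Finset.mem_product.1 h).2)
    have : (C c * X ^ n + l).coeff n = c := by simp [hl n le_rfl]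
    simp [this]
  · intro u _
    simp

lemma sum_mon_eq_sum_res {R : Type*} [AddCommMonoid R] (n : ℕ) (F : Fqx q → R) :
    ∑ u ∈ mon q n, F u = ∑ l ∈ res q n, F (X ^ n + l) := by
  rw [mon, res, Finset.sum_image (fun a _ b _ h => monicOf_injective n h),
    Finset.sum_image (fun a _ b _ h => polyOf_injective n h)]
  rfl

lemma sum_res_lead {R : Type*} [AddCommMonoid R] (n : ℕ) {c : ZMod q} (hc : c ≠ 0)
    (F : Fqx q → R) :
    ∑ l ∈ res q n, F (C c * X ^ n + l) = ∑ h ∈ mon q n, F (C c * h) := by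
  rw [sum_mon_eq_sum_res n fun h => F (C c * h)]
  refine Finset.sum_bij' (fun l _ => C c⁻¹ * l) (fun l _ => C c * l)
    (fun l hl => C_mul_mem_res _ hl) (fun l hl => C_mul_mem_res _ hl) ?_ ?_ ?_
  · intro l _
    rw [← mul_assoc, ← C_mul, mul_inv_cancel₀ hc, C_1, one_mul]
  · intro l _
    rw [← mul_assoc, ← C_mul, inv_mul_cancel₀ hc, C_1, one_mul]
  · intro l _
    rw [mul_add, ← mul_assoc, ← C_mul, mul_inv_cancel₀ hc, C_1, one_mul]

/-- The coefficient of `x ^ (deg f - 1)` in the remainder modulo `f`. -/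
def topc (f : Fqx q) : Fqx q →ₗ[ZMod q] ZMod q :=
  (lcoeff (ZMod q) (f.natDegree - 1)).comp (modByMonicHom f)

lemma topc_apply (f u : Fqx q) : topc f u = (u %ₘ f).coeff (f.natDegree - 1) := rfl

lemma topc_C_mul (f u : Fqx q) (c : ZMod q) : topc f (C c * u) = c * topc f u := by
  rw [C_mul', map_smul, smul_eq_mul]

lemma topc_of_mem {f u : Fqx q} (hf : f.Monic) (hu : u ∈ res q f.natDegree) :
    topc f u = u.coeff (f.natDegree - 1) := by
  rw [topc_apply, (modByMonic_eq_self_iff hf).2]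
  rw [degree_eq_natDegree hf.ne_zero]
  exact mem_res.1 hu

lemma topc_of_dvd {f u : Fqx q} (hf : f.Monic) (h : f ∣ u) : topc f u = 0 := by
  rw [topc_apply, (modByMonic_eq_zero_iff_dvd hf).2 h, coeff_zero]

lemma topc_mul_right {f R : Fqx q} (hf : f.Monic) (hR : R.Monic) (hn : 0 < f.natDegree)
    (u : Fqx q) : topc (f * R) (u * R) = topc f u := by
  have h1 : (u * R) %ₘ (f * R) = (u %ₘ f) * R := by
    refine (div_modByMonic_unique (u /ₘ f) ((u %ₘ f) * R) (hf.mul hR) ⟨?_, ?_⟩).2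
    · conv_rhs => rw [← modByMonic_add_div u f]
      ring
    · rw [degree_mul, degree_mul]
      exact WithBot.add_lt_add_right (by rw [Ne, degree_eq_bot]; exact hR.ne_zero)
        (degree_modByMonic_lt u hf)
  have h2 : (u %ₘ f).natDegree ≤ f.natDegree - 1 := by
    have := natDegree_modByMonic_lt u hf (by rintro rfl; simp at hn)
    omega
  rw [topc_apply, topc_apply, h1, hf.natDegree_mul hR,
    show f.natDegree + R.natDegree - 1 = (f.natDegree - 1) + R.natDegree by omega,
    coeff_mul_add_eq_of_natDegree_le h2 le_rfl, hR.coeff_natDegree, mul_one]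

/-- The standard additive character. -/
abbrev psi (q : ℕ) [Fact q.Prime] : AddChar (ZMod q) ℂ := ZMod.stdAddChar

lemma psi_ne_one : psi q ≠ 1 :=
  ne_of_eq_of_ne rfl fun h => by
    have := ZMod.isPrimitive_stdAddChar q (one_ne_zero (α := ZMod q))
    apply this
    rw [AddChar.mulShift_one]
    exact h

lemma sum_res_psi_eq_zero {n : ℕ} (L : Fqx q →ₗ[ZMod q] ZMod q) {u : Fqx q}
    (hu : u ∈ res q n) (h : L u ≠ 0) : ∑ v ∈ res q n, psi q (L v) = 0 := by
  have h1 : psi q 1 ≠ 1 := (AddChar.zmod_char_ne_one_iff q (psi q)).1 psi_ne_one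
  have h2 := sum_res_shift n (C_mul_mem_res (L u)⁻¹ hu) fun v => psi q (L v)
  have h3 : L (C (L u)⁻¹ * u) = 1 := by rw [C_mul', map_smul, smul_eq_mul, inv_mul_cancel₀ h]
  simp only [map_add, AddChar.map_add_eq_mul, h3] at h2
  rw [← Finset.sum_mul] at h2
  by_contra h4
  exact h1 (by simpa [h4] using h2)

lemma mul_mem_res {k l n : ℕ} {u v : Fqx q} (hu : u ∈ res q k) (hv : v ∈ res q l)
    (hn : k + l ≤ n + 1) : u * v ∈ res q n := by
  rw [mem_res] at *
  by_cases h0 : u = 0 ∨ v = 0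
  · rw [mul_eq_zero.2 h0, degree_zero]; exact WithBot.bot_lt_coe n
  · push Not at h0
    rw [← natDegree_lt_iff_degree_lt h0.1] at hu
    rw [← natDegree_lt_iff_degree_lt h0.2] at hv
    rw [← natDegree_lt_iff_degree_lt (mul_ne_zero h0.1 h0.2), natDegree_mul h0.1 h0.2]
    omega

lemma topc_eq_zero_of_mem {f u : Fqx q} (hf : f.Monic) (hu : u ∈ res q (f.natDegree - 1)) :
    topc f u = 0 := by
  have hu' := mem_res.1 hu
  rw [topc_of_mem hf]
  · exact (degree_lt_iff_coeff_zero _ _).1 hu' _ le_rfl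
  · exact mem_res.2 (hu'.trans_le (by exact_mod_cast Nat.sub_le _ _))

lemma sum_res_psi {f v : Fqx q} (hf : f.Monic) {k : ℕ} (hk : k ≤ f.natDegree)
    (hv : v ∈ res q f.natDegree) :
    ∑ u ∈ res q k, psi q (topc f (u * v)) =
      if v ∈ res q (f.natDegree - k) then (q : ℂ) ^ k else 0 := by
  split_ifs with h
  · rcases Nat.eq_zero_or_pos k with rfl | hk0
    · rw [Finset.sum_congr rfl (g := fun _ => (1 : ℂ)), Finset.sum_const, card_res]
      · simp
      · intro u hu
        have : u = 0 := by simpa [mem_res] using hu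
        simp [this]
    · rw [Finset.sum_congr rfl (g := fun _ => (1 : ℂ)), Finset.sum_const, card_res]
      · simp
      · intro u hu
        rw [topc_eq_zero_of_mem hf, AddChar.map_zero_eq_one]
        exact mul_mem_res hu h (by omega)
  · have hv0 : v ≠ 0 := by
      rintro rfl
      exact h (mem_res.2 (by rw [degree_zero]; exact WithBot.bot_lt_coe _))
    have hd : v.natDegree < f.natDegree := (natDegree_lt_iff_degree_lt hv0).2 (mem_res.1 hv)
    have hd2 : f.natDegree - k ≤ v.natDegree := by
      by_contra h'
      exact h (mem_res.2 ((natDegree_lt_iff_degree_lt hv0).1 (by omega)))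
    have hu : (X ^ (f.natDegree - 1 - v.natDegree) : Fqx q) ∈ res q k := by
      rw [mem_res, degree_X_pow]
      exact_mod_cast (by omega : f.natDegree - 1 - v.natDegree < k)
    have := sum_res_psi_eq_zero ((topc f).comp (LinearMap.mulRight (ZMod q) v)) hu ?_
    · simpa using this
    · simp only [LinearMap.comp_apply, LinearMap.mulRight_apply]
      have hdeg : (X ^ (f.natDegree - 1 - v.natDegree) * v).natDegree = f.natDegree - 1 := by
        rw [natDegree_mul (pow_ne_zero _ X_ne_zero) hv0, natDegree_X_pow]; omega
      have hc := coeff_X_pow_mul v (f.natDegree - 1 - v.natDegree) v.natDegree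
      rw [show v.natDegree + (f.natDegree - 1 - v.natDegree) = f.natDegree - 1 by omega] at hc
      rw [topc_of_mem hf, hc]
      · simp [hv0]
      · rw [mem_res, ← natDegree_lt_iff_degree_lt (mul_ne_zero (pow_ne_zero _ X_ne_zero) hv0)]
        omega

end

noncomputable section

open scoped Classical

/-- The quadratic character of a finite field with complex values. -/
def cquad (K : Type*) [Field K] [Fintype K] : MulChar K ℂ :=
  (quadraticChar K).ringHomComp (Int.castRingHom ℂ)

section FiniteField

variable {K : Type*} [Field K] [Fintype K]

lemma cquad_apply (a : K) : cquad K a = ((quadraticChar K a : ℤ) : ℂ) := rfl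

lemma cquad_sq {a : K} (ha : a ≠ 0) : cquad K a * cquad K a = 1 := by
  rw [cquad_apply, ← Int.cast_mul, ← pow_two, quadraticChar_sq_one ha, Int.cast_one]

lemma sum_cquad (hK : ringChar K ≠ 2) : ∑ a, cquad K a = 0 := by
  simp only [cquad_apply]
  rw [← Int.cast_sum, quadraticChar_sum_zero hK, Int.cast_zero]

lemma sum_cquad_mulShift (hK : ringChar K ≠ 2) (ψ : AddChar K ℂ) (a : K) :
    ∑ x, cquad K x * ψ (a * x) = cquad K a * gaussSum (cquad K) ψ := by
  by_cases ha : a = 0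
  · subst ha
    simp only [zero_mul, AddChar.map_zero_eq_one, mul_one, sum_cquad hK]
    rw [MulChar.map_zero, zero_mul]
  · have := gaussSum_mulShift (cquad K) ψ (Units.mk0 a ha)
    rw [Units.val_mk0] at this
    rw [← this, ← mul_assoc, cquad_sq ha, one_mul, gaussSum]
    rfl

lemma sum_psi_sq (hK : ringChar K ≠ 2) {ψ : AddChar K ℂ} (hψ : ψ ≠ 1) {a : K} (ha : a ≠ 0) :
    ∑ x, ψ (a * x ^ 2) = cquad K a * gaussSum (cquad K) ψ := by
  have h1 : ∑ x, ψ (a * x ^ 2) = ∑ y : K, (cquad K y + 1) * ψ (a * y) := by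
    rw [← Finset.sum_fiberwise (s := Finset.univ) (g := fun x : K => x ^ 2)]
    refine Finset.sum_congr rfl fun y _ => ?_
    rw [Finset.sum_congr rfl (g := fun _ => ψ (a * y))]
    · rw [Finset.sum_const, nsmul_eq_mul, cquad_apply]
      congr 1
      have := quadraticChar_card_sqrts hK y
      rw [Set.toFinset_ofPred] at this
      exact_mod_cast this
    · intro x hx
      rw [(Finset.mem_filter.1 hx).2]
  rw [h1]
  simp only [add_mul, one_mul, Finset.sum_add_distrib]
  rw [sum_cquad_mulShift hK, add_eq_left]
  have := AddChar.sum_mulShift a (AddChar.IsPrimitive.of_ne_one hψ)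
  rw [if_neg ha, Nat.cast_zero] at this
  rw [← this]
  exact Finset.sum_congr rfl fun x _ => by rw [mul_comm]

lemma cquad_ne_one (hK : ringChar K ≠ 2) : cquad K ≠ 1 := by
  intro h
  obtain ⟨a, ha⟩ := quadraticChar_exists_neg_one hK
  have h1 : cquad K a = (-1 : ℂ) := by rw [cquad_apply, ha]; simp
  have h0 : a ≠ 0 := by rintro rfl; simp at ha
  rw [h, MulChar.one_apply (Ne.isUnit h0)] at h1
  norm_num at h1

lemma cquad_isQuadratic : (cquad K).IsQuadratic :=
  (quadraticChar_isQuadratic K).comp (Int.castRingHom ℂ)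

lemma cquad_neg_one (hK : ringChar K ≠ 2) (h : Fintype.card K % 4 = 1) : cquad K (-1) = 1 := by
  rw [cquad_apply, quadraticChar_neg_one hK, ZMod.χ₄_nat_one_mod_four h, Int.cast_one]

end FiniteField

variable {q : ℕ} [Fact q.Prime]

/-- The quadratic Gauss sum of `ZMod q`. -/
def tau (q : ℕ) [Fact q.Prime] : ℂ := gaussSum (cquad (ZMod q)) (psi q)

lemma ringChar_ne_two (hq : q % 4 = 1) : ringChar (ZMod q) ≠ 2 := by
  rw [ZMod.ringChar_zmod_n]
  rintro rfl
  omega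

lemma tau_sq (hq : q % 4 = 1) : tau q ^ 2 = q := by
  rw [tau, gaussSum_sq (cquad_ne_one (ringChar_ne_two hq)) cquad_isQuadratic
    (ZMod.isPrimitive_stdAddChar q), ZMod.card,
    cquad_neg_one (ringChar_ne_two hq) (by rwa [ZMod.card]), one_mul]

lemma tau_ne_zero (hq : q % 4 = 1) : tau q ≠ 0 := by
  intro h
  have := tau_sq hq
  rw [h] at this
  have hq0 : (q : ℂ) ≠ 0 := Nat.cast_ne_zero.2 (Fact.out : q.Prime).ne_zero
  simp [hq0.symm] at this

/-- The quadratic Gauss sum with denominator `f` and numerator `a`. -/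
def gq (a f : Fqx q) : ℂ := ∑ u ∈ res q f.natDegree, psi q (topc f (a * u ^ 2))

lemma gq_reduce (hq : q % 4 = 1) {f : Fqx q} (hf : f.Monic) {c : ZMod q} (hc : c ≠ 0) {e : ℕ}
    (he : 2 * e ≤ f.natDegree) :
    gq (C c) f = ∑ u ∈ res q (f.natDegree - e), psi q (topc f (C c * u ^ 2)) := by
  have hq0 : (q : ℂ) ^ e ≠ 0 := pow_ne_zero _ (Nat.cast_ne_zero.2 (Fact.out : q.Prime).ne_zero)
  have h2 : (2 : ZMod q) ≠ 0 := Ring.two_ne_zero (ringChar_ne_two hq)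
  have hsub : res q e ⊆ res q f.natDegree := fun l hl =>
    mem_res.2 ((mem_res.1 hl).trans_le (by exact_mod_cast (by omega)))
  have h1 : ∀ l ∈ res q e, gq (C c) f = ∑ u ∈ res q f.natDegree,
      psi q (topc f (C c * u ^ 2)) * psi q (topc f (l * (C (c * 2) * u))) := by
    intro l hl
    rw [gq, ← sum_res_shift _ (hsub hl)]
    refine Finset.sum_congr rfl fun u _ => ?_
    have hl2 : topc f (C c * l ^ 2) = 0 := by
      rcases Nat.eq_zero_or_pos e with rfl | he0
      · have : l = 0 := by simpa [mem_res] using hl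
        simp [this]
      · refine topc_eq_zero_of_mem hf (C_mul_mem_res c ?_)
        rw [pow_two]
        exact mul_mem_res hl hl (by omega)
    have : C c * (u + l) ^ 2 = C c * u ^ 2 + l * (C (c * 2) * u) + C c * l ^ 2 := by
      have : (C (c * 2) : Fqx q) = C c * 2 := by rw [C_mul]; rfl
      rw [this]; ring
    rw [this, LinearMap.map_add, LinearMap.map_add, hl2, add_zero, AddChar.map_add_eq_mul]
  have h3 : (q : ℂ) ^ e * gq (C c) f = ∑ l ∈ res q e, gq (C c) f := by
    rw [Finset.sum_const, card_res, nsmul_eq_mul, Nat.cast_pow]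
  rw [Finset.sum_congr rfl h1, Finset.sum_comm] at h3
  simp only [← Finset.mul_sum] at h3
  have h4 : ∀ u ∈ res q f.natDegree, psi q (topc f (C c * u ^ 2)) *
      ∑ l ∈ res q e, psi q (topc f (l * (C (c * 2) * u))) =
      if u ∈ res q (f.natDegree - e) then (q : ℂ) ^ e * psi q (topc f (C c * u ^ 2)) else 0 := by
    intro u hu
    rw [sum_res_psi hf (by omega) (C_mul_mem_res _ hu)]
    have : C (c * 2) * u ∈ res q (f.natDegree - e) ↔ u ∈ res q (f.natDegree - e) := by
      refine ⟨fun h => ?_, fun h => C_mul_mem_res _ h⟩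
      have := C_mul_mem_res (c * 2)⁻¹ h
      rwa [← mul_assoc, ← C_mul, inv_mul_cancel₀ (mul_ne_zero hc h2), C_1, one_mul] at this
    simp only [this]
    split_ifs
    · ring
    · simp
  rw [Finset.sum_congr rfl h4, ← Finset.sum_filter, ← Finset.mul_sum] at h3
  rw [mul_left_cancel₀ hq0 h3]
  refine Finset.sum_congr ?_ fun _ _ => rfl
  ext u
  rw [Finset.mem_filter]
  exact ⟨fun h => h.2, fun h => ⟨mem_res.2 ((mem_res.1 h).trans_le
    (by exact_mod_cast Nat.sub_le _ _)), h⟩⟩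

lemma gq_C_even (hq : q % 4 = 1) {f : Fqx q} (hf : f.Monic) {c : ZMod q} (hc : c ≠ 0) {e : ℕ}
    (he : f.natDegree = 2 * e) : gq (C c) f = q ^ e := by
  rw [gq_reduce hq hf hc he.ge, Finset.sum_congr rfl (g := fun _ => (1 : ℂ)), Finset.sum_const,
    card_res, show f.natDegree - e = e by omega]
  · simp
  · intro u hu
    rw [show f.natDegree - e = e by omega] at hu
    have : topc f (C c * u ^ 2) = 0 := by
      rcases Nat.eq_zero_or_pos e with rfl | he0
      · have : u = 0 := by simpa [mem_res] using hu
        simp [this]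
      · refine topc_eq_zero_of_mem hf (C_mul_mem_res c ?_)
        rw [pow_two]
        exact mul_mem_res hu hu (by omega)
    rw [this, AddChar.map_zero_eq_one]

lemma gq_C_odd (hq : q % 4 = 1) {f : Fqx q} (hf : f.Monic) {c : ZMod q} (hc : c ≠ 0) {e : ℕ}
    (he : f.natDegree = 2 * e + 1) : gq (C c) f = q ^ e * (cquad (ZMod q) c * tau q) := by
  rw [gq_reduce hq hf hc (e := e) (by omega), show f.natDegree - e = e + 1 by omega,
    sum_res_succ]
  have : ∀ b : ZMod q, ∀ l ∈ res q e,
      psi q (topc f (C c * (C b * X ^ e + l) ^ 2)) = psi q (c * b ^ 2) := by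
    intro b l hl
    have hmem : C b * X ^ e + l ∈ res q (e + 1) := by
      refine mem_res.2 ((degree_add_le _ _).trans_lt (max_lt ?_ ((mem_res.1 hl).trans ?_)))
      · exact (degree_C_mul_X_pow_le e b).trans_lt (by exact_mod_cast e.lt_succ_self)
      · exact_mod_cast e.lt_succ_self
    have hnd : (C b * X ^ e + l).natDegree ≤ e := by
      rw [natDegree_le_iff_degree_le]
      exact Order.le_of_lt_succ (mem_res.1 hmem)
    have hl0 : l.coeff e = 0 := (degree_lt_iff_coeff_zero l e).1 (mem_res.1 hl) e le_rfl
    rw [topc_C_mul, topc_of_mem hf, show f.natDegree - 1 = e + e by omega, pow_two,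
      coeff_mul_add_eq_of_natDegree_le hnd hnd]
    · simp [hl0, pow_two]
    · rw [pow_two]
      exact mul_mem_res hmem hmem (by omega)
  rw [Finset.sum_congr rfl fun b _ => Finset.sum_congr rfl (this b)]
  simp only [Finset.sum_const, card_res, nsmul_eq_mul]
  rw [← Finset.mul_sum, sum_psi_sq (ringChar_ne_two hq) psi_ne_one hc, tau, Nat.cast_pow]

lemma gq_one (hq : q % 4 = 1) {f : Fqx q} (hf : f.Monic) : gq 1 f = tau q ^ f.natDegree := by
  rw [← C_1]
  rcases Nat.even_or_odd' f.natDegree with ⟨e, he | he⟩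
  · rw [gq_C_even hq hf one_ne_zero he, he, pow_mul, tau_sq hq]
  · rw [gq_C_odd hq hf one_ne_zero he, he, pow_succ, pow_mul, tau_sq hq]
    simp

end

noncomputable section

open scoped Classical

variable {q : ℕ} [Fact q.Prime]

lemma sum_res_mk {R : Type*} [AddCommMonoid R] (P : MIrr q) (F : resField P → R) :
    ∑ u ∈ res q P.1.natDegree, F (AdjoinRoot.mk P.1 u) = ∑ a, F a := by
  refine Finset.sum_bij' (fun u _ => AdjoinRoot.mk P.1 u)
    (fun a _ => AdjoinRoot.modByMonicHom P.2.1 a) (fun _ _ => Finset.mem_univ _) ?_ ?_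
    (fun a _ => AdjoinRoot.mk_leftInverse P.2.1 a) (fun _ _ => rfl)
  · intro a _
    obtain ⟨u, rfl⟩ := AdjoinRoot.mk_surjective a
    rw [AdjoinRoot.modByMonicHom_mk, mem_res, ← degree_eq_natDegree P.2.1.ne_zero]
    exact degree_modByMonic_lt _ P.2.1
  · intro u hu
    rw [AdjoinRoot.modByMonicHom_mk, (modByMonic_eq_self_iff P.2.1).2]
    rw [degree_eq_natDegree P.2.1.ne_zero]
    exact mem_res.1 hu

/-- The additive character of the residue field of `P` attached to the residue symbol at
infinity. -/
def psiP (P : MIrr q) : AddChar (resField P) ℂ :=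
  (psi q).compAddMonoidHom
    ((lcoeff (ZMod q) (P.1.natDegree - 1)).comp (AdjoinRoot.modByMonicHom P.2.1)).toAddMonoidHom

lemma psiP_mk (P : MIrr q) (u : Fqx q) : psiP P (AdjoinRoot.mk P.1 u) = psi q (topc P.1 u) := by
  change psi q ((AdjoinRoot.modByMonicHom P.2.1 (AdjoinRoot.mk P.1 u)).coeff _) = _
  rw [AdjoinRoot.modByMonicHom_mk, topc_apply]

lemma psiP_ne_one (P : MIrr q) : psiP P ≠ 1 := by
  intro h
  have hP := natDegree_pos_of_MIrr P
  have h1 := psiP_mk P (X ^ (P.1.natDegree - 1))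
  rw [h, AddChar.one_apply, topc_of_mem P.2.1, coeff_X_pow_self] at h1
  · exact (AddChar.zmod_char_ne_one_iff q (psi q)).1 psi_ne_one h1.symm
  · rw [mem_res, degree_X_pow]
    exact_mod_cast Nat.sub_lt hP one_pos

lemma ringChar_resField (hq : q % 4 = 1) (P : MIrr q) : ringChar (resField P) ≠ 2 := by
  rw [← Algebra.ringChar_eq (ZMod q) (resField P)]
  exact ringChar_ne_two hq

lemma cquad_mk (f : Fqx q) (P : MIrr q) :
    cquad (resField P) (AdjoinRoot.mk P.1 f) = (legSym q f P.1 : ℂ) := by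
  rw [cquad_apply, legSym_eq_quadraticChar]

lemma gq_prime' (hq : q % 4 = 1) {a : Fqx q} {P : MIrr q} (h : ¬ P.1 ∣ a) :
    gq a P.1 = (legSym q a P.1 : ℂ) * gaussSum (cquad (resField P)) (psiP P) := by
  rw [← cquad_mk, ← sum_psi_sq (ringChar_resField hq P) (psiP_ne_one P)
    (mt AdjoinRoot.mk_eq_zero.1 h), ← sum_res_mk, gq]
  refine Finset.sum_congr rfl fun u _ => ?_
  rw [← map_pow, ← map_mul, psiP_mk]

lemma not_dvd_one (P : MIrr q) : ¬ P.1 ∣ 1 := fun h => P.2.2.not_isUnit (isUnit_of_dvd_one h)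

lemma gaussSum_psiP (hq : q % 4 = 1) (P : MIrr q) :
    gaussSum (cquad (resField P)) (psiP P) = tau q ^ P.1.natDegree := by
  rw [← gq_one hq P.2.1, gq_prime' hq (not_dvd_one P), legSym_one, Int.cast_one, one_mul]

lemma gq_prime (hq : q % 4 = 1) {a : Fqx q} {P : MIrr q} (h : ¬ P.1 ∣ a) :
    gq a P.1 = (legSym q a P.1 : ℂ) * tau q ^ P.1.natDegree := by
  rw [gq_prime' hq h, gaussSum_psiP hq]

lemma sum_legSym_psi (hq : q % 4 = 1) (P : MIrr q) (v : Fqx q) :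
    ∑ u ∈ res q P.1.natDegree, (legSym q u P.1 : ℂ) * psi q (topc P.1 (u * v)) =
      legSym q v P.1 * tau q ^ P.1.natDegree := by
  rw [← gaussSum_psiP hq, ← cquad_mk, ← sum_cquad_mulShift (ringChar_resField hq P), ← sum_res_mk]
  refine Finset.sum_congr rfl fun u _ => ?_
  rw [← map_mul, psiP_mk, cquad_mk, mul_comm v u]

lemma not_dvd_C (P : MIrr q) {c : ZMod q} (hc : c ≠ 0) : ¬ P.1 ∣ C c := fun h =>
  P.2.2.not_isUnit (isUnit_of_dvd_unit h (isUnit_C.2 hc.isUnit))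

lemma legSym_C (hq : q % 4 = 1) (P : MIrr q) {c : ZMod q} (hc : c ≠ 0) :
    (legSym q (C c) P.1 : ℂ) = cquad (ZMod q) c ^ P.1.natDegree := by
  have ht : tau q ^ P.1.natDegree ≠ 0 := pow_ne_zero _ (tau_ne_zero hq)
  refine mul_right_cancel₀ ht ?_
  rw [← gq_prime hq (not_dvd_C P hc)]
  rcases Nat.even_or_odd' P.1.natDegree with ⟨e, he | he⟩
  · rw [gq_C_even hq P.2.1 hc he, he, pow_mul, pow_mul, tau_sq hq, pow_two, cquad_sq hc, one_pow,
      one_mul]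
  · rw [gq_C_odd hq P.2.1 hc he, he, pow_succ, pow_succ, pow_mul, pow_mul, tau_sq hq,
      pow_two (cquad _ _), cquad_sq hc, one_pow, one_mul]
    ring

lemma qchar_C (hq : q % 4 = 1) (T : Finset (MIrr q)) {c : ZMod q} (hc : c ≠ 0) :
    (qchar T (C c) : ℂ) = cquad (ZMod q) c ^ dg T := by
  rw [qchar, Int.cast_prod, dg, ← Finset.prod_pow_eq_pow_sum]
  exact Finset.prod_congr rfl fun P _ => legSym_C hq P hc

lemma sum_res_crt {R : Type*} [AddCommMonoid R] {f g : Fqx q} (hf : f.Monic) (hg : g.Monic)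
    (hc : IsCoprime f g) (F : Fqx q → R) :
    ∑ u ∈ res q (f * g).natDegree, F u =
      ∑ u ∈ res q f.natDegree, ∑ v ∈ res q g.natDegree, F (u * g + v * f) := by
  have key : ∀ {f g u u' v v' : Fqx q}, f.Monic → IsCoprime f g → u ∈ res q f.natDegree →
      u' ∈ res q f.natDegree → u * g + v * f = u' * g + v' * f → u = u' := by
    intro f g u u' v v' hf hc hu hu' h
    have h1 : f ∣ (u - u') * g := ⟨v' - v, by linear_combination h⟩
    have h2 := hc.dvd_of_dvd_mul_right h1
    have h3 : u - u' ∈ res q f.natDegree := by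
      rw [sub_eq_add_neg]; exact add_mem_res hu (neg_mem_res hu')
    rw [mem_res, ← degree_eq_natDegree hf.ne_zero] at h3
    exact sub_eq_zero.1 (eq_zero_of_dvd_of_degree_lt h2 h3)
  rw [← Finset.sum_product', ← Finset.sum_image (f := F)
    (g := fun p : Fqx q × Fqx q => p.1 * g + p.2 * f)]
  · congr 1
    symm
    have hinj : Set.InjOn (fun p : Fqx q × Fqx q => p.1 * g + p.2 * f)
        (res q f.natDegree ×ˢ res q g.natDegree : Finset _) := by
      rintro ⟨u, v⟩ h1 ⟨u', v'⟩ h2 h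
      simp only [Finset.coe_product, Set.mem_prod, Finset.mem_coe] at h1 h2 h
      rw [key hf hc h1.1 h2.1 h, key (v := u) (v' := u') hg hc.symm h1.2 h2.2
        (by linear_combination h)]
    refine Finset.eq_of_subset_of_card_le ?_ ?_
    · intro w hw
      obtain ⟨⟨u, v⟩, h, rfl⟩ := Finset.mem_image.1 hw
      rw [Finset.mem_product] at h
      have hu := mem_res.1 h.1
      have hv := mem_res.1 h.2
      rw [mem_res, ← degree_eq_natDegree (hf.mul hg).ne_zero]
      refine (degree_add_le _ _).trans_lt (max_lt ?_ ?_)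
      · rw [degree_mul, degree_mul, degree_eq_natDegree hf.ne_zero]
        exact WithBot.add_lt_add_right (degree_ne_bot.2 hg.ne_zero) hu
      · rw [degree_mul, degree_mul, add_comm f.degree, degree_eq_natDegree hg.ne_zero]
        exact WithBot.add_lt_add_right (degree_ne_bot.2 hf.ne_zero) hv
    · rw [Finset.card_image_of_injOn hinj, Finset.card_product, card_res, card_res, card_res,
        natDegree_mul hf.ne_zero hg.ne_zero, pow_add]
  · rintro ⟨u, v⟩ h1 ⟨u', v'⟩ h2 h
    simp only [Finset.coe_product, Set.mem_prod, Finset.mem_coe] at h1 h2 h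
    rw [key hf hc h1.1 h2.1 h, key (v := u) (v' := u') hg hc.symm h1.2 h2.2
      (by linear_combination h)]

lemma topc_mul_right' {f g : Fqx q} (hf : f.Monic) (hg : g.Monic) (u : Fqx q) :
    topc (f * g) (u * g) = topc f u := by
  rcases Nat.eq_zero_or_pos f.natDegree with h | h
  · rw [hf.natDegree_eq_zero.1 h, one_mul, topc_of_dvd hg (dvd_mul_left _ _),
      topc_of_dvd monic_one (one_dvd _)]
  · exact topc_mul_right hf hg h u

lemma gq_mul {f g : Fqx q} (hf : f.Monic) (hg : g.Monic) (hc : IsCoprime f g) :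
    gq 1 (f * g) = gq g f * gq f g := by
  rw [gq, sum_res_crt hf hg hc, gq, gq, Finset.sum_mul_sum]
  refine Finset.sum_congr rfl fun u _ => Finset.sum_congr rfl fun v _ => ?_
  have : (1 : Fqx q) * (u * g + v * f) ^ 2 = (g * u ^ 2) * g + (f * v ^ 2) * f +
      (f * g) * (2 * u * v) := by ring
  rw [this, LinearMap.map_add, LinearMap.map_add, topc_of_dvd (hf.mul hg) (dvd_mul_right _ _),
    add_zero, topc_mul_right' hf hg, AddChar.map_add_eq_mul]
  congr 2
  rw [mul_comm f g, topc_mul_right' hg hf]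

lemma legSym_reciprocity (hq : q % 4 = 1) {P R : MIrr q} (h : P ≠ R) :
    legSym q R.1 P.1 * legSym q P.1 R.1 = 1 := by
  have hPR : ∀ {P R : MIrr q}, P ≠ R → ¬ P.1 ∣ R.1 := fun {P R} h hd =>
    P.2.2.not_isUnit ((isCoprime_MIrr h).isUnit_of_dvd' dvd_rfl hd)
  have h1 := gq_mul P.2.1 R.2.1 (isCoprime_MIrr h)
  rw [gq_one hq (P.2.1.mul R.2.1), gq_prime hq (hPR h), gq_prime hq (hPR h.symm),
    natDegree_mul P.2.2.ne_zero R.2.2.ne_zero, pow_add] at h1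
  have ht : tau q ^ P.1.natDegree * tau q ^ R.1.natDegree ≠ 0 :=
    mul_ne_zero (pow_ne_zero _ (tau_ne_zero hq)) (pow_ne_zero _ (tau_ne_zero hq))
  have h2 : ((legSym q R.1 P.1 * legSym q P.1 R.1 : ℤ) : ℂ) = 1 := by
    refine mul_right_cancel₀ ht ?_
    push_cast
    rw [one_mul]
    linear_combination -h1
  exact_mod_cast h2

lemma legSym_comm (hq : q % 4 = 1) (P R : MIrr q) : legSym q R.1 P.1 = legSym q P.1 R.1 := by
  by_cases h : P = R
  · rw [h]
  · have h1 := legSym_reciprocity hq h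
    rcases Int.eq_one_or_neg_one_of_mul_eq_one' h1 with ⟨h2, h3⟩ | ⟨h2, h3⟩ <;> rw [h2, h3]

lemma sum_qchar_psi (hq : q % 4 = 1) (T : Finset (MIrr q)) (v : Fqx q) :
    ∑ u ∈ res q (dg T), (qchar T u : ℂ) * psi q (topc (pr T) (u * v)) =
      qchar T v * tau q ^ dg T := by
  induction T using Finset.induction_on generalizing v with
  | empty =>
    have : res q (dg (∅ : Finset (MIrr q))) = {0} := by
      ext u
      simp [mem_res, dg]
    rw [this]
    simp [dg, qchar]
  | insert P T hP ih =>
    have hpr : pr (insert P T) = P.1 * pr T := by rw [pr, Finset.prod_insert hP, pr]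
    have hcop : IsCoprime P.1 (pr T) :=
      (P.2.2.coprime_iff_not_dvd).2 (mt (prime_dvd_pr_iff T P).1 hP)
    have hdg : dg (insert P T) = P.1.natDegree + dg T := by rw [dg, Finset.sum_insert hP, dg]
    have hq1 : ∀ w : Fqx q, qchar (insert P T) w = legSym q w P.1 * qchar T w := fun w => by
      rw [qchar, Finset.prod_insert hP, qchar]
    have hrec : legSym q (pr T) P.1 * qchar T P.1 = 1 := by
      rw [pr, legSym_prod, qchar, ← Finset.prod_mul_distrib]
      refine Finset.prod_eq_one fun R hR => legSym_reciprocity hq ?_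
      rintro rfl
      exact hP hR
    have hrec' : (legSym q (pr T) P.1 : ℂ) * qchar T P.1 = 1 := by exact_mod_cast hrec
    have h1 := sum_res_crt P.2.1 (monic_pr T) hcop fun u =>
      (qchar (insert P T) u : ℂ) * psi q (topc (pr (insert P T)) (u * v))
    rw [natDegree_mul P.2.2.ne_zero (monic_pr T).ne_zero, natDegree_pr, ← hdg] at h1
    rw [h1, hq1, hdg, pow_add]
    have h2 : ∀ a b : Fqx q, (qchar (insert P T) (a * pr T + b * P.1) : ℂ) *
        psi q (topc (pr (insert P T)) ((a * pr T + b * P.1) * v)) =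
        ((legSym q a P.1 : ℂ) * psi q (topc P.1 (a * v))) *
          (qchar T b * psi q (topc (pr T) (b * v))) := by
      intro a b
      have e1 : legSym q (a * pr T + b * P.1) P.1 = legSym q a P.1 * legSym q (pr T) P.1 := by
        rw [← legSym_mul]
        exact legSym_congr P ⟨b, by ring⟩
      have e2 : qchar T (a * pr T + b * P.1) = qchar T b * qchar T P.1 := by
        rw [← qchar_mul]
        exact qchar_congr T ⟨a, by ring⟩
      have e3 : (a * pr T + b * P.1) * v = (a * v) * pr T + (b * v) * P.1 := by ring
      rw [hq1, e1, e2, e3, hpr, LinearMap.map_add, topc_mul_right' P.2.1 (monic_pr T),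
        mul_comm P.1 (pr T), topc_mul_right' (monic_pr T) P.2.1, AddChar.map_add_eq_mul]
      push_cast
      linear_combination ((legSym q a P.1 : ℂ) * psi q (topc P.1 (a * v)) *
          (qchar T b * psi q (topc (pr T) (b * v)))) * hrec'
    simp only [h2]
    rw [← Finset.sum_mul_sum, ih v, sum_legSym_psi hq]
    push_cast
    ring

lemma jacSym_eq_qchar (hq : q % 4 = 1) (D : Finset (MIrr q)) {f : Fqx q} (hf : f.Monic) :
    jacSym q (pr D) f = qchar D f := by
  induction hn : f.natDegree using Nat.strong_induction_on generalizing f with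
  | _ n ih =>
    by_cases h0 : f.natDegree = 0
    · rw [hf.natDegree_eq_zero.1 h0, jacSym_one_right, qchar_one]
    · obtain ⟨P, g, rfl⟩ := exists_prime_dvd h0
      have hg : g.Monic := P.2.1.of_mul_monic_left hf
      have hd := natDegree_mul P.2.2.ne_zero hg.ne_zero
      have hP := natDegree_pos_of_MIrr P
      rw [jacSym_mul_right _ P.2.2.ne_zero hg.ne_zero, qchar_mul, ih _ (by omega) hg rfl,
        jacSym_prime, pr, legSym_prod, qchar]
      congr 1
      exact Finset.prod_congr rfl fun R _ => legSym_comm hq _ _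

end

noncomputable section

open scoped Classical

variable {q : ℕ} [Fact q.Prime]

/-- The sum of the quadratic character modulo `pr T` over monic polynomials of degree `k`. -/
def charSum (T : Finset (MIrr q)) (k : ℕ) : ℤ := ∑ h ∈ mon q k, qchar T h

lemma qchar_zero {T : Finset (MIrr q)} (hT : T.Nonempty) : qchar T 0 = 0 := by
  obtain ⟨P, hP⟩ := hT
  exact Finset.prod_eq_zero hP (legSym_eq_zero (dvd_zero _))

lemma dg_pos {T : Finset (MIrr q)} (hT : T.Nonempty) : 0 < dg T :=
  Finset.sum_pos (fun P _ => natDegree_pos_of_MIrr P) hT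

lemma res_mono {a b : ℕ} (h : a ≤ b) {u : Fqx q} (hu : u ∈ res q a) : u ∈ res q b :=
  mem_res.2 ((mem_res.1 hu).trans_le (by exact_mod_cast h))

lemma charSum_eq_zero (hq : q % 4 = 1) {T : Finset (MIrr q)} (hT : T.Nonempty) {k : ℕ}
    (hk : dg T ≤ k) : charSum T k = 0 := by
  have h0 : ∑ u ∈ res q (dg T), (qchar T u : ℂ) = 0 := by
    have := sum_qchar_psi hq T 0
    simpa [qchar_zero hT] using this
  have h0' : ∑ u ∈ res q (dg T), qchar T u = 0 := by exact_mod_cast h0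
  have h1 : ∀ w : Fqx q, ∑ l ∈ res q (dg T), qchar T (w + l) = 0 := by
    intro w
    have hw : w %ₘ pr T ∈ res q (dg T) := by
      rw [mem_res, ← natDegree_pr, ← degree_eq_natDegree (monic_pr T).ne_zero]
      exact degree_modByMonic_lt _ (monic_pr T)
    rw [← h0', ← sum_res_shift _ hw (qchar T)]
    refine Finset.sum_congr rfl fun l _ => qchar_congr T ⟨w /ₘ pr T, ?_⟩
    linear_combination (modByMonic_add_div w (pr T)).symm
  have h2 : (q : ℤ) ^ dg T * charSum T k = 0 := by
    have : ∀ l ∈ res q (dg T), charSum T k = ∑ u ∈ res q k, qchar T (X ^ k + u + l) := by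
      intro l hl
      rw [charSum, sum_mon_eq_sum_res, ← sum_res_shift _ (res_mono hk hl)]
      simp only [add_assoc]
    have h3 := Finset.sum_congr rfl this
    rw [Finset.sum_comm, Finset.sum_const, card_res, nsmul_eq_mul, Nat.cast_pow] at h3
    rw [h3]
    exact Finset.sum_eq_zero fun u _ => h1 _
  exact (mul_eq_zero.1 h2).resolve_left
    (pow_ne_zero _ (Nat.cast_ne_zero.2 (Fact.out : q.Prime).ne_zero))

lemma tau_mul_charSum (hq : q % 4 = 1) (T : Finset (MIrr q)) {k : ℕ} (hk : k < dg T) :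
    tau q ^ dg T * charSum T k = q ^ k * ∑ u ∈ res q (dg T - 1 - k + 1),
      (qchar T u : ℂ) * psi q (u.coeff (dg T - 1 - k)) := by
  have h1 : tau q ^ dg T * charSum T k = ∑ h ∈ mon q k, ∑ u ∈ res q (dg T),
      (qchar T u : ℂ) * psi q (topc (pr T) (u * h)) := by
    rw [charSum, Int.cast_sum, Finset.mul_sum]
    exact Finset.sum_congr rfl fun h _ => by rw [sum_qchar_psi hq, mul_comm]
  rw [h1, sum_mon_eq_sum_res, Finset.sum_comm]
  have h2 : ∀ u ∈ res q (dg T), ∑ l ∈ res q k,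
      (qchar T u : ℂ) * psi q (topc (pr T) (u * (X ^ k + l))) =
      if u ∈ res q (dg T - k) then
        (q : ℂ) ^ k * ((qchar T u : ℂ) * psi q (topc (pr T) (u * X ^ k))) else 0 := by
    intro u hu
    have h3 := sum_res_psi (monic_pr T) (k := k) (v := u) (by rw [natDegree_pr]; omega)
      (by rwa [natDegree_pr])
    rw [natDegree_pr] at h3
    have : ∀ l ∈ res q k, (qchar T u : ℂ) * psi q (topc (pr T) (u * (X ^ k + l))) =
        (qchar T u : ℂ) * psi q (topc (pr T) (u * X ^ k)) * psi q (topc (pr T) (l * u)) := by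
      intro l _
      rw [mul_add, LinearMap.map_add, AddChar.map_add_eq_mul, mul_comm u l, mul_assoc]
    rw [Finset.sum_congr rfl this, ← Finset.mul_sum, h3]
    split_ifs
    · ring
    · simp
  rw [Finset.sum_congr rfl h2, ← Finset.sum_filter, Finset.mul_sum]
  refine Finset.sum_congr ?_ ?_
  · ext u
    rw [Finset.mem_filter, show dg T - 1 - k + 1 = dg T - k by omega]
    exact ⟨fun h => h.2, fun h => ⟨res_mono (Nat.sub_le _ _) h, h⟩⟩
  · intro u hu
    have hmem : u * X ^ k ∈ res q (dg T) :=
      mul_mem_res (l := k + 1) hu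
        (by rw [mem_res, degree_X_pow]; exact_mod_cast k.lt_succ_self) (by omega)
    rw [topc_of_mem (monic_pr T) (by rwa [natDegree_pr]), natDegree_pr,
      show dg T - 1 = (dg T - 1 - k) + k by omega, coeff_mul_X_pow]
    simp

lemma sum_qchar_coeff (hq : q % 4 = 1) (T : Finset (MIrr q)) (j : ℕ) (φ : ZMod q → ℂ) :
    ∑ u ∈ res q (j + 1), (qchar T u : ℂ) * φ (u.coeff j) =
      φ 0 * ∑ l ∈ res q j, (qchar T l : ℂ) +
        (∑ c ∈ Finset.univ.erase 0, φ c * cquad (ZMod q) c ^ dg T) * charSum T j := by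
  rw [sum_res_succ, ← Finset.add_sum_erase _ _ (Finset.mem_univ 0), Finset.sum_mul]
  have hc : ∀ c : ZMod q, ∀ l ∈ res q j, (C c * X ^ j + l).coeff j = c := by
    intro c l hl
    simp [(degree_lt_iff_coeff_zero l j).1 (mem_res.1 hl) j le_rfl]
  congr 1
  · rw [Finset.mul_sum]
    refine Finset.sum_congr rfl fun l hl => ?_
    rw [hc 0 l hl, C_0, zero_mul, zero_add, mul_comm]
  · refine Finset.sum_congr rfl fun c hc0 => ?_
    have hc0' := Finset.ne_of_mem_erase hc0
    have : ∀ l ∈ res q j, (qchar T (C c * X ^ j + l) : ℂ) * φ ((C c * X ^ j + l).coeff j) =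
        (qchar T (C c * X ^ j + l) : ℂ) * φ c := fun l hl => by rw [hc c l hl]
    rw [Finset.sum_congr rfl this, ← Finset.sum_mul,
      sum_res_lead j hc0' fun u => (qchar T u : ℂ), charSum, Int.cast_sum, mul_assoc,
      Finset.mul_sum, mul_comm (φ c)]
    congr 1
    refine Finset.sum_congr rfl fun h _ => ?_
    rw [qchar_mul, Int.cast_mul, qchar_C hq T hc0']

lemma sum_qchar_res (hq : q % 4 = 1) {T : Finset (MIrr q)} (hT : T.Nonempty) (j : ℕ) :
    ∑ l ∈ res q j, (qchar T l : ℂ) =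
      (∑ c ∈ Finset.univ.erase 0, cquad (ZMod q) c ^ dg T) *
        ∑ i ∈ Finset.range j, (charSum T i : ℂ) := by
  induction j with
  | zero =>
    have : res q 0 = {0} := by
      ext u
      simp [mem_res]
    rw [this, Finset.sum_singleton, qchar_zero hT]
    simp
  | succ j ih =>
    have := sum_qchar_coeff hq T j fun _ => 1
    simp only [mul_one, one_mul] at this
    rw [this, ih, Finset.sum_range_succ, mul_add]

lemma sum_cquad_pow_odd (φ : ZMod q → ℂ) (e : ℕ) :
    ∑ c ∈ Finset.univ.erase 0, φ c * cquad (ZMod q) c ^ (2 * e + 1) =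
      ∑ c, φ c * cquad (ZMod q) c := by
  rw [← Finset.add_sum_erase _ _ (Finset.mem_univ (0 : ZMod q)), MulChar.map_zero, mul_zero,
    zero_add]
  refine Finset.sum_congr rfl fun c hc => ?_
  rw [pow_succ, pow_mul, pow_two, cquad_sq (Finset.ne_of_mem_erase hc), one_pow, one_mul]

lemma sum_cquad_pow_even (φ : ZMod q → ℂ) (e : ℕ) :
    ∑ c ∈ Finset.univ.erase 0, φ c * cquad (ZMod q) c ^ (2 * e) = ∑ c, φ c - φ 0 := by
  rw [← Finset.add_sum_erase _ _ (Finset.mem_univ (0 : ZMod q)), add_sub_cancel_left]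
  refine Finset.sum_congr rfl fun c hc => ?_
  rw [pow_mul, pow_two, cquad_sq (Finset.ne_of_mem_erase hc), one_pow, mul_one]

lemma charSum_odd (hq : q % 4 = 1) (T : Finset (MIrr q)) {e : ℕ} (he : dg T = 2 * e + 1) {k : ℕ}
    (hk : k ≤ 2 * e) : (q : ℤ) ^ e * charSum T k = q ^ k * charSum T (2 * e - k) := by
  have hT : T.Nonempty := by
    rw [Finset.nonempty_iff_ne_empty]
    rintro rfl
    simp [dg] at he
  have h := tau_mul_charSum hq T (k := k) (by omega)
  rw [sum_qchar_coeff hq T, sum_qchar_res hq hT, he, sum_cquad_pow_odd] at h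
  have h0 := sum_cquad_pow_odd (q := q) (fun _ => (1 : ℂ)) e
  simp only [one_mul] at h0
  have h2 : ∑ c, psi q c * cquad (ZMod q) c = tau q := by
    rw [tau, gaussSum]
    exact Finset.sum_congr rfl fun c _ => mul_comm _ _
  rw [h0, sum_cquad (ringChar_ne_two hq), zero_mul, mul_zero, zero_add, h2, pow_succ, pow_mul,
    tau_sq hq, Nat.add_sub_cancel] at h
  have h3 : (q : ℂ) ^ e * charSum T k = q ^ k * charSum T (2 * e - k) :=
    mul_right_cancel₀ (tau_ne_zero hq) (by linear_combination h)
  exact_mod_cast h3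

lemma charSum_even (hq : q % 4 = 1) {T : Finset (MIrr q)} (hT : T.Nonempty) {e : ℕ}
    (he : dg T = 2 * e) {k : ℕ} (hk : k < 2 * e) :
    (q : ℤ) ^ e * charSum T k = q ^ k *
      ((q - 1) * ∑ i ∈ Finset.range (2 * e - 1 - k), charSum T i - charSum T (2 * e - 1 - k)) := by
  have h := tau_mul_charSum hq T (k := k) (by omega)
  rw [sum_qchar_coeff hq T, sum_qchar_res hq hT, he, sum_cquad_pow_even] at h
  have h0 := sum_cquad_pow_even (q := q) (fun _ => (1 : ℂ)) e
  simp only [one_mul] at h0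
  have h2 : ∑ c, psi q c = 0 := by
    have := AddChar.sum_eq_zero_of_ne_one (psi_ne_one (q := q))
    exact this
  rw [h0, h2, AddChar.map_zero_eq_one, pow_mul, tau_sq hq] at h
  simp only [Finset.sum_const, Finset.card_univ, ZMod.card, nsmul_eq_mul, mul_one, one_mul] at h
  have h3 : (q : ℂ) ^ e * charSum T k = q ^ k *
      ((q - 1) * ∑ i ∈ Finset.range (2 * e - 1 - k), (charSum T i : ℂ) -
        charSum T (2 * e - 1 - k)) := by linear_combination h
  exact_mod_cast h3

end

noncomputable section

open scoped Classical

variable {K : Type*} [Field K]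

lemma pow_dvd_hasseDeriv (f g : K[X]) (n k : ℕ) : f ^ (n - k) ∣ hasseDeriv k (f ^ n * g) := by
  induction n generalizing k with
  | zero => simp
  | succ n ih =>
    rw [pow_succ', mul_assoc, hasseDeriv_mul]
    refine Finset.dvd_sum fun p hp => ?_
    rw [Finset.HasAntidiagonal.mem_antidiagonal] at hp
    rcases Nat.eq_zero_or_pos p.1 with h | h
    · rw [h, hasseDeriv_zero', show p.2 = k by omega]
      refine (pow_dvd_pow f (show n + 1 - k ≤ 1 + (n - k) by omega)).trans ?_
      rw [pow_add, pow_one]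
      exact mul_dvd_mul_left _ (ih k)
    · exact Dvd.dvd.mul_left ((pow_dvd_pow f (by omega)).trans (ih p.2)) _

/-- A polynomial vanishing to order `l` on a set has degree at least `l` times its size. -/
lemma card_mul_le_natDegree {R : K[X]} (hR : R ≠ 0) (S : Finset K) (l : ℕ)
    (h : ∀ x ∈ S, (X - C x) ^ l ∣ R) : S.card * l ≤ R.natDegree := by
  have h1 : ∏ x ∈ S, (X - C x) ^ l ∣ R := by
    refine Finset.prod_dvd_of_coprime ?_ h
    intro x _ y _ hxy
    exact (pairwise_coprime_X_sub_C Function.injective_id hxy).pow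
  have h2 := natDegree_le_of_dvd h1 hR
  rw [natDegree_prod_of_monic _ _ fun x _ => (monic_X_sub_C x).pow l] at h2
  simpa [natDegree_pow] using h2

variable [Fintype K]

lemma X_pow_dvd_taylor {J l : ℕ} (hl : l ≤ Fintype.card K) (x : K) (A : Fin J → K[X]) :
    (X - C x) ^ l ∣ ∑ j, A j * X ^ (Fintype.card K * (j : ℕ)) ↔
      ∀ k < l, ∑ j, (hasseDeriv k (A j)).eval x * x ^ (j : ℕ) = 0 := by
  rw [X_sub_C_pow_dvd_iff, ← taylor_apply]
  have h1 : (X + C x : K[X]) ^ Fintype.card K = X ^ Fintype.card K + C x := by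
    rw [← FiniteField.expand_card]; simp
  have h2 : ∀ j : Fin J, X ^ l ∣ taylor x (A j * X ^ (Fintype.card K * (j : ℕ))) -
      taylor x (A j) * C (x ^ (j : ℕ)) := by
    intro j
    rw [taylor_mul, ← mul_sub, taylor_apply x (X ^ _), X_pow_comp, pow_mul, h1]
    refine Dvd.dvd.mul_left ?_ _
    have h3 := sub_dvd_pow_sub_pow (X ^ Fintype.card K + C x : K[X]) (C x) j
    rw [add_sub_cancel_right, ← C_pow] at h3
    exact (pow_dvd_pow X hl).trans h3
  have h4 : X ^ l ∣ taylor x (∑ j, A j * X ^ (Fintype.card K * (j : ℕ))) -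
      ∑ j, taylor x (A j) * C (x ^ (j : ℕ)) := by
    rw [map_sum, ← Finset.sum_sub_distrib]
    exact Finset.dvd_sum fun j _ => h2 j
  rw [dvd_iff_dvd_of_dvd_sub h4, X_pow_dvd_iff]
  refine forall₂_congr fun k _ => ?_
  rw [finsetSum_coeff]
  simp only [coeff_mul_C, taylor_coeff]

lemma eq_zero_of_X_pow_dvd {f : K[X]} (hf : f.Monic) (hs : ¬ IsSquare f) (h0 : f.coeff 0 ≠ 0)
    {c n : ℕ} (hc : Fintype.card K = 2 * c + 1) (hn : n + f.natDegree ≤ c) {r s : K[X]}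
    (hr : r ∈ degreeLT K n) (hs' : s ∈ degreeLT K n)
    (h : X ^ Fintype.card K ∣ r + s * f ^ c) : r = 0 ∧ s = 0 := by
  have e1 : X ^ Fintype.card K ∣ f ^ Fintype.card K - C (f.coeff 0) := by
    rw [← FiniteField.expand_card f]
    obtain ⟨g, hg⟩ := X_dvd_sub_C (p := f)
    rw [sub_eq_iff_eq_add] at hg
    refine ⟨expand K (Fintype.card K) g, ?_⟩
    conv_lhs => rw [hg]
    simp
  have e2 : X ^ Fintype.card K ∣ r ^ 2 * f - s ^ 2 * C (f.coeff 0) := by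
    have : r ^ 2 * f - s ^ 2 * C (f.coeff 0) = (r + s * f ^ c) * ((r - s * f ^ c) * f) +
        (f ^ Fintype.card K - C (f.coeff 0)) * s ^ 2 := by
      rw [hc]; ring
    rw [this]
    exact dvd_add (Dvd.dvd.mul_right h _) (Dvd.dvd.mul_right e1 _)
  rw [mem_degreeLT] at hr hs'
  have hfm : f.natDegree ≠ 0 := by
    intro h
    rw [hf.natDegree_eq_zero.1 h] at hs
    exact hs IsSquare.one
  have nd : ∀ {g : K[X]}, g.degree < n → g.natDegree ≤ n := fun hg =>
    natDegree_le_of_degree_le hg.le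
  have e3 : r ^ 2 * f = s ^ 2 * C (f.coeff 0) := by
    refine sub_eq_zero.1 (eq_zero_of_dvd_of_natDegree_lt e2 ?_)
    rw [natDegree_X_pow]
    refine (natDegree_sub_le _ _).trans_lt (max_lt ?_ ?_)
    · have h1 := natDegree_mul_le (p := r ^ 2) (q := f)
      have h2 := natDegree_pow_le (p := r) (n := 2)
      have h3 := nd hr
      omega
    · have h1 := natDegree_mul_C_le (s ^ 2) (f.coeff 0)
      have h2 := natDegree_pow_le (p := s) (n := 2)
      have h3 := nd hs'
      omega
  by_cases hr0 : r = 0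
  · refine ⟨hr0, ?_⟩
    rw [hr0] at e3
    simpa [h0] using e3.symm
  · exfalso
    have hsr : r ∣ s := by
      refine (IsIntegrallyClosed.pow_dvd_pow_iff two_ne_zero).1 ⟨f * C (f.coeff 0)⁻¹, ?_⟩
      rw [← mul_assoc, e3, mul_assoc, ← C_mul, mul_inv_cancel₀ h0, C_1, mul_one]
    obtain ⟨w, rfl⟩ := hsr
    have e4 : f = w ^ 2 * C (f.coeff 0) := by
      refine mul_left_cancel₀ (pow_ne_zero 2 hr0) ?_
      rw [e3]; ring
    have e5 := congrArg leadingCoeff e4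
    rw [hf.leadingCoeff, leadingCoeff_mul, leadingCoeff_pow, leadingCoeff_C] at e5
    have hw : w.leadingCoeff ≠ 0 := by
      intro hw
      rw [hw] at e5
      simp at e5
    apply hs
    refine ⟨w * C w.leadingCoeff⁻¹, ?_⟩
    have e6 : f.coeff 0 = w.leadingCoeff⁻¹ * w.leadingCoeff⁻¹ := by
      field_simp
      linear_combination -e5
    conv_lhs => rw [e4, e6, C_mul]
    ring

lemma eq_zero_of_sum_eq_zero {f : K[X]} (hf : f.Monic) (hs : ¬ IsSquare f) (h0 : f.coeff 0 ≠ 0)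
    {c n : ℕ} (hc : Fintype.card K = 2 * c + 1) (hn : n + f.natDegree ≤ c) {J : ℕ}
    (t : Fin J → degreeLT K n × degreeLT K n)
    (h : ∑ j, ((t j).1.1 + (t j).2.1 * f ^ c) * X ^ (Fintype.card K * (j : ℕ)) = 0) : t = 0 := by
  induction J with
  | zero => exact Subsingleton.elim _ _
  | succ J ih =>
    rw [Fin.sum_univ_succ] at h
    simp only [Fin.val_zero, mul_zero, pow_zero, mul_one, Fin.val_succ, mul_add, pow_add,
      ← mul_assoc] at h
    rw [← Finset.sum_mul] at h
    have h1 := eq_zero_of_X_pow_dvd hf hs h0 hc hn (t 0).1.2 (t 0).2.2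
      ⟨-∑ j : Fin J, ((t j.succ).1.1 + (t j.succ).2.1 * f ^ c) *
        X ^ (Fintype.card K * (j : ℕ)), by linear_combination h⟩
    rw [h1.1, h1.2, zero_mul, zero_add, zero_add, mul_eq_zero,
      or_iff_left (pow_ne_zero _ X_ne_zero)]
      at h
    have h2 := ih (fun j => t j.succ) h
    funext j
    refine Fin.cases ?_ (fun i => congrFun h2 i) j
    exact Prod.ext (Subtype.ext h1.1) (Subtype.ext h1.2)

end

noncomputable section

open scoped Classical

variable {K : Type*} [Field K]

/-- The `k`-th vanishing condition of the auxiliary polynomial. -/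
def auxCond (f : K[X]) (a : K) (c l n J k : ℕ) :
    (Fin J → degreeLT K n × degreeLT K n) →ₗ[K] K[X] where
  toFun t := ∑ j, (f ^ c * hasseDeriv k (f ^ l * (t j).1.1) +
    a • hasseDeriv k (f ^ (l + c) * (t j).2.1)) * X ^ (j : ℕ)
  map_add' t u := by
    rw [← Finset.sum_add_distrib]
    refine Finset.sum_congr rfl fun j _ => ?_
    simp only [Pi.add_apply, Prod.fst_add, Prod.snd_add, Submodule.coe_add, mul_add, map_add,
      smul_add]
    ring
  map_smul' b t := by
    rw [RingHom.id_apply, Finset.smul_sum]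
    refine Finset.sum_congr rfl fun j _ => ?_
    simp only [Pi.smul_apply, Prod.smul_fst, Prod.smul_snd, Submodule.coe_smul, mul_smul_comm,
      map_smul, smul_comm a b, ← smul_add, smul_mul_assoc]

lemma auxCond_apply (f : K[X]) (a : K) (c l n J k : ℕ)
    (t : Fin J → degreeLT K n × degreeLT K n) :
    auxCond f a c l n J k t = ∑ j, (f ^ c * hasseDeriv k (f ^ l * (t j).1.1) +
      a • hasseDeriv k (f ^ (l + c) * (t j).2.1)) * X ^ (j : ℕ) := rfl

lemma auxCond_mem {f : K[X]} (hf : f.Monic) (a : K) {c l n J k : ℕ} (hk : k < l)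
    (t : Fin J → degreeLT K n × degreeLT K n) :
    auxCond f a c l n J k t ∈ (degreeLT K (n + l * f.natDegree + J + 1)).map
      (LinearMap.mulLeft K (f ^ (l + c - k))) := by
  have h1 : f ^ (l + c - k) ∣ auxCond f a c l n J k t := by
    rw [auxCond_apply]
    refine Finset.dvd_sum fun j _ => Dvd.dvd.mul_right (dvd_add ?_ ?_) _
    · rw [show l + c - k = c + (l - k) by omega, pow_add]
      exact mul_dvd_mul_left _ (pow_dvd_hasseDeriv _ _ _ _)
    · exact dvd_smul_of_dvd _ (pow_dvd_hasseDeriv _ _ _ _)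
  obtain ⟨w, hw⟩ := h1
  rw [hw]
  refine ⟨w, ?_, rfl⟩
  rw [SetLike.mem_coe, mem_degreeLT]
  have nd : ∀ g : degreeLT K n, g.1.natDegree ≤ n := fun g =>
    natDegree_le_of_degree_le (mem_degreeLT.1 g.2).le
  have hn : ∀ (i : ℕ) (g : degreeLT K n),
      (hasseDeriv k (f ^ i * g.1)).natDegree ≤ i * f.natDegree + n := by
    intro i g
    have h2 := natDegree_hasseDeriv_le (f ^ i * g.1) k
    have h3 := natDegree_mul_le (p := f ^ i) (q := g.1)
    have h4 := natDegree_pow_le (p := f) (n := i)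
    have h5 := nd g
    omega
  have h2 : (auxCond f a c l n J k t).natDegree ≤ (l + c) * f.natDegree + n + J := by
    rw [auxCond_apply]
    refine natDegree_sum_le_of_forall_le _ _ fun j _ => ?_
    refine (natDegree_mul_le).trans (add_le_add ?_ ?_)
    · refine (natDegree_add_le _ _).trans (max_le ?_ ?_)
      · have h3 := natDegree_mul_le (p := f ^ c) (q := hasseDeriv k (f ^ l * (t j).1.1))
        have h4 := natDegree_pow_le (p := f) (n := c)
        have h5 := hn l (t j).1
        have h6 : (l + c) * f.natDegree = l * f.natDegree + c * f.natDegree := by ring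
        omega
      · exact (natDegree_smul_le _ _).trans (hn _ _)
    · rw [natDegree_X_pow]; exact j.2.le
  by_cases hw0 : w = 0
  · rw [hw0, degree_zero]; exact WithBot.bot_lt_coe _
  · rw [hw, (hf.pow _).natDegree_mul' hw0, hf.natDegree_pow] at h2
    rw [degree_eq_natDegree hw0]
    have h3 : (l + c) * f.natDegree ≤ (l + c - k) * f.natDegree + l * f.natDegree := by
      rw [← add_mul]
      exact Nat.mul_le_mul_right _ (by omega)
    exact_mod_cast (by omega : w.natDegree < n + l * f.natDegree + J + 1)

lemma finrank_degreeLT (n : ℕ) : Module.finrank K (degreeLT K n) = n := by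
  rw [(degreeLTEquiv K n).finrank_eq]; simp

instance (n : ℕ) : Module.Finite K (degreeLT K n) := Module.Finite.equiv (degreeLTEquiv K n).symm

lemma exists_auxCond {f : K[X]} (hf : f.Monic) (a : K) {c l n J : ℕ}
    (h : l * (n + l * f.natDegree + J + 1) < 2 * J * n) :
    ∃ t : Fin J → degreeLT K n × degreeLT K n, t ≠ 0 ∧
      ∀ k < l, auxCond f a c l n J k t = 0 := by
  let Φ := LinearMap.pi fun k : Fin l => (auxCond f a c l n J k).codRestrict
    ((degreeLT K (n + l * f.natDegree + J + 1)).map (LinearMap.mulLeft K (f ^ (l + c - (k : ℕ)))))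
    (auxCond_mem hf a k.2)
  have hker : Φ.ker ≠ ⊥ := by
    apply LinearMap.ker_ne_bot_of_finrank_lt
    rw [Module.finrank_pi_fintype, Module.finrank_pi_fintype]
    simp only [Module.finrank_prod, finrank_degreeLT, Finset.sum_const, Finset.card_univ,
      Fintype.card_fin, smul_eq_mul]
    calc _ ≤ ∑ _k : Fin l, (n + l * f.natDegree + J + 1) := Finset.sum_le_sum fun k _ =>
          (Submodule.finrank_map_le _ _).trans (finrank_degreeLT _).le
      _ = l * (n + l * f.natDegree + J + 1) := by simp
      _ < _ := h
      _ = _ := by ring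
  obtain ⟨t, ht, h0⟩ := Submodule.exists_mem_ne_zero_of_ne_bot hker
  refine ⟨t, h0, fun k hk => ?_⟩
  have := congrFun (LinearMap.mem_ker.1 ht) ⟨k, hk⟩
  exact congrArg Subtype.val this

variable [Fintype K]

lemma card_le_of_coeff_ne_zero {f : K[X]} (hf : f.Monic) (hs : ¬ IsSquare f) (h0 : f.coeff 0 ≠ 0)
    {a : K} (ha : a ≠ 0) {c l n J : ℕ} (hc : Fintype.card K = 2 * c + 1) (hn : n + f.natDegree ≤ c)
    (hl : l ≤ Fintype.card K) (h : l * (n + l * f.natDegree + J + 1) < 2 * J * n) :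
    (Finset.univ.filter fun x : K => f.eval x ^ c = a).card * l ≤
      (l + c) * f.natDegree + n + Fintype.card K * (J - 1) := by
  obtain ⟨t, ht, hΦ⟩ := exists_auxCond hf a (c := c) h
  set A : Fin J → K[X] := fun j => f ^ l * ((t j).1.1 + (t j).2.1 * f ^ c) with hA
  set R := ∑ j, A j * X ^ (Fintype.card K * (j : ℕ)) with hR
  have hR0 : R ≠ 0 := by
    intro hR0
    refine ht (eq_zero_of_sum_eq_zero hf hs h0 hc hn t ?_)
    have h1 : f ^ l * ∑ j, ((t j).1.1 + (t j).2.1 * f ^ c) *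
        X ^ (Fintype.card K * (j : ℕ)) = R := by
      rw [hR, Finset.mul_sum]
      exact Finset.sum_congr rfl fun j _ => by rw [hA]; ring
    rw [hR0] at h1
    exact (mul_eq_zero.1 h1).resolve_left (pow_ne_zero _ hf.ne_zero)
  refine (card_mul_le_natDegree hR0 _ l ?_).trans ?_
  · intro x hx
    have hx' : f.eval x ^ c = a := (Finset.mem_filter.1 hx).2
    rw [hR, X_pow_dvd_taylor hl]
    intro k hk
    refine (mul_eq_zero.1 ?_).resolve_left ha
    have h1 := congrArg (eval x) (hΦ k hk)
    rw [eval_zero] at h1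
    rw [← h1, auxCond_apply, eval_finsetSum, Finset.mul_sum]
    refine Finset.sum_congr rfl fun j _ => ?_
    have h2 : A j = f ^ l * (t j).1.1 + f ^ (l + c) * (t j).2.1 := by rw [hA]; ring
    rw [h2]
    simp only [map_add, eval_add, eval_mul, eval_pow, eval_smul, eval_X, smul_eq_mul, hx']
    ring
  · refine natDegree_sum_le_of_forall_le _ _ fun j _ => ?_
    refine natDegree_mul_le.trans ?_
    have nd : ∀ g : degreeLT K n, g.1.natDegree ≤ n := fun g =>
      natDegree_le_of_degree_le (mem_degreeLT.1 g.2).le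
    have h1 : (A j).natDegree ≤ (l + c) * f.natDegree + n := by
      refine natDegree_mul_le.trans ?_
      have h3 := natDegree_mul_le (p := (t j).2.1) (q := f ^ c)
      have h4 := natDegree_pow_le (p := f) (n := c)
      have h4' := natDegree_pow_le (p := f) (n := l)
      have h5 := nd (t j).1
      have h5' := nd (t j).2
      have h6 : (l + c) * f.natDegree = l * f.natDegree + c * f.natDegree := by ring
      have h7 := natDegree_add_le (t j).1.1 ((t j).2.1 * f ^ c)
      have h8 : max (t j).1.1.natDegree ((t j).2.1 * f ^ c).natDegree ≤ c * f.natDegree + n :=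
        max_le (by omega) (by omega)
      omega
    refine add_le_add h1 ?_
    rw [natDegree_X_pow]
    exact Nat.mul_le_mul_left _ (by omega)

end

noncomputable section

open scoped Classical

variable {K : Type*} [Field K] [Fintype K]

lemma stepanov_dim_lt {l m n Q c J : ℕ} (h3 : 8 * (m + 1) ≤ l) (h1 : l ^ 2 ≤ Q)
    (hc : Q = 2 * c + 1) (hn : n + m = c) (hJ1 : 2 * J ≤ l + 1 + 2 * m)
    (hJ2 : l + 2 * m ≤ 2 * J) :
    l * (n + l * m + (J + 1) + 1) < 2 * (J + 1) * n := by
  have e1 : (l + 2 * m + 2) * n ≤ 2 * (J + 1) * n := Nat.mul_le_mul_right _ (by omega)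
  refine lt_of_lt_of_le ?_ e1
  have e2 : l * (2 * J) ≤ l * (l + 1 + 2 * m) := Nat.mul_le_mul_left _ hJ1
  have e3 : 8 * (m + 1) * l ≤ l * l := Nat.mul_le_mul_right _ h3
  have e4 : l ^ 2 * (m + 1) ≤ (2 * n + 2 * m + 1) * (m + 1) :=
    Nat.mul_le_mul_right _ (by omega)
  have e5 : 8 * (m + 1) * (m + 1) ≤ l * (m + 1) := Nat.mul_le_mul_right _ h3
  ring_nf at *
  omega

lemma stepanov_degree_le {l m n Q c J S : ℕ} (h3 : 8 * (m + 1) ≤ l) (hm : 1 ≤ m)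
    (h2 : Q < (l + 1) ^ 2) (hc : Q = 2 * c + 1) (hn : n + m = c) (hJ1 : 2 * J ≤ l + 1 + 2 * m)
    (key : S * l ≤ (l + c) * m + n + Q * J) :
    2 * S * l ≤ (Q + 16 * m * l) * l := by
  have e1 : Q * (2 * J) ≤ Q * (l + 1 + 2 * m) := Nat.mul_le_mul_left _ hJ1
  have e2 : Q * (3 * m + 2) ≤ (l ^ 2 + 2 * l) * (3 * m + 2) :=
    Nat.mul_le_mul_right _ (by rw [add_sq] at h2; omega)
  have e4 : 8 * l ≤ l * l := Nat.mul_le_mul_right _ (by omega)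
  have e5 : 1 * (l * l) ≤ m * (l * l) := Nat.mul_le_mul_right _ hm
  have e6 : m * (8 * l) ≤ m * (l * l) := Nat.mul_le_mul_left _ e4
  have e7 : (2 * n + 2 * m + 1) * m = Q * m := by rw [hc, ← hn]; ring
  have e8 : 2 * c * m + m = Q * m := by rw [hc]; ring
  have e9 : Q = 2 * n + 2 * m + 1 := by omega
  have g1 : 2 * S * l = 2 * (S * l) := by ring
  have g2 : 2 * ((l + c) * m + n + Q * J) = 2 * (l * m) + 2 * c * m + 2 * n + Q * (2 * J) := by
    ring
  have g3 : Q * (l + 1 + 2 * m) + Q * m + Q = Q * l + Q * (3 * m + 2) := by ring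
  have g4 : (l ^ 2 + 2 * l) * (3 * m + 2) =
      3 * (m * (l * l)) + 2 * (l * l) + 6 * (l * m) + 4 * l := by
    ring
  have g5 : (Q + 16 * m * l) * l = Q * l + 16 * (m * (l * l)) := by ring
  have g6 : m * (8 * l) = 8 * (l * m) := by ring
  omega

lemma card_le_of_le_card {f : K[X]} (hf : f.Monic) (hs : ¬ IsSquare f) (h0 : f.coeff 0 ≠ 0)
    {a : K} (ha : a ≠ 0) {c m : ℕ} (hm : f.natDegree = m) (hm0 : 1 ≤ m)
    (hc : Fintype.card K = 2 * c + 1) (hQ : 64 * (m + 1) ^ 2 ≤ Fintype.card K) :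
    2 * ((Finset.univ.filter fun x : K => f.eval x ^ c = a).card : ℝ) ≤
      Fintype.card K + 16 * m * √(Fintype.card K) := by
  set Q := Fintype.card K with hQdef
  obtain ⟨l, hl⟩ : ∃ l, l = Nat.sqrt Q := ⟨_, rfl⟩
  have h1 : l ^ 2 ≤ Q := hl ▸ Nat.sqrt_le' Q
  have h2 : Q < (l + 1) ^ 2 := hl ▸ Nat.lt_succ_sqrt' Q
  have h3 : 8 * (m + 1) ≤ l := by
    by_contra h
    have : (l + 1) ^ 2 ≤ (8 * (m + 1)) ^ 2 := Nat.pow_le_pow_left (by omega) 2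
    nlinarith
  obtain ⟨n, hn⟩ : ∃ n, n + m = c := ⟨c - m, Nat.sub_add_cancel (by nlinarith)⟩
  obtain ⟨J, hJ⟩ : ∃ J, J = (l + 1) / 2 + m := ⟨_, rfl⟩
  have hJ1 : 2 * J ≤ l + 1 + 2 * m := by omega
  have hJ2 : l + 2 * m ≤ 2 * J := by omega
  have hdim := stepanov_dim_lt h3 h1 hc hn hJ1 hJ2
  have key := card_le_of_coeff_ne_zero hf hs h0 ha hc (n := n) (l := l) (J := J + 1)
    (by omega) (by nlinarith) (by rw [hm]; exact hdim)
  rw [hm, Nat.add_sub_cancel] at key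
  set S := (Finset.univ.filter fun x : K => f.eval x ^ c = a).card
  have hlr : (l : ℝ) ≤ √Q := Real.le_sqrt_of_sq_le (by exact_mod_cast h1)
  have hl0 : (0 : ℝ) < l := by exact_mod_cast (by omega : 0 < l)
  have key2 : 2 * S * l ≤ (Q + 16 * m * l) * l := stepanov_degree_le h3 hm0 h2 hc hn hJ1 key
  have key3 : (2 * S : ℝ) * l ≤ (Q + 16 * m * l) * l := by exact_mod_cast key2
  have key4 := le_of_mul_le_mul_right key3 hl0
  have : (16 * m * l : ℝ) ≤ 16 * m * √Q := mul_le_mul_of_nonneg_left hlr (by positivity)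
  linarith

lemma card_filter_pow_le {f : K[X]} (hf : f.Monic) (hs : ¬ IsSquare f)
    {a : K} (ha : a ≠ 0) {c : ℕ} (hc : Fintype.card K = 2 * c + 1) :
    2 * ((Finset.univ.filter fun x : K => f.eval x ^ c = a).card : ℝ) ≤
      Fintype.card K + 16 * f.natDegree * √(Fintype.card K) := by
  obtain ⟨m, hm⟩ : ∃ m, f.natDegree = m := ⟨_, rfl⟩
  have hm0 : 1 ≤ m := by
    rw [Nat.one_le_iff_ne_zero]
    rintro rfl
    rw [hf.natDegree_eq_zero.1 hm] at hs
    exact hs IsSquare.one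
  rw [hm]
  by_cases hQ : 64 * (m + 1) ^ 2 ≤ Fintype.card K
  · obtain ⟨b, hb⟩ : ∃ b, f.eval b ≠ 0 := by
      by_contra! h
      have := card_le_degree_of_subset_roots (p := f) (Z := (Finset.univ : Finset K))
        fun x _ => (mem_roots hf.ne_zero).2 (h x)
      rw [Finset.card_univ] at this
      nlinarith
    have hcomp : ∀ g : K[X], (g.comp (X + C b)).comp (X - C b) = g := fun g => by
      rw [comp_assoc]; simp
    have h1 := card_le_of_le_card (f := f.comp (X + C b)) (a := a) (c := c)
      (hf.comp (monic_X_add_C b) (by simp)) ?_ ?_ ha (m := m) (by rw [natDegree_comp, hm]; simp)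
      hm0 hc hQ
    · convert h1 using 3
      refine Finset.card_bij' (fun x _ => x - b) (fun x _ => x + b) ?_ ?_ ?_ ?_ <;> simp
    · rintro ⟨g, hg⟩
      apply hs
      refine ⟨g.comp (X - C b), ?_⟩
      rw [← mul_comp, ← hg, hcomp]
    · rw [coeff_zero_eq_eval_zero, eval_comp]
      simpa using hb
  · push Not at hQ
    have h1 : ((Finset.univ.filter fun x : K => f.eval x ^ c = a).card : ℝ) ≤ Fintype.card K := by
      exact_mod_cast Finset.card_filter_le _ _
    have h2 : √(Fintype.card K : ℝ) ≤ 16 * m := by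
      refine Real.sqrt_le_iff.2 ⟨by positivity, ?_⟩
      have : (Fintype.card K) ≤ (16 * m) ^ 2 := by nlinarith
      exact_mod_cast this
    have h3 : (Fintype.card K : ℝ) = √(Fintype.card K) * √(Fintype.card K) :=
      (Real.mul_self_sqrt (Nat.cast_nonneg _)).symm
    nlinarith [Real.sqrt_nonneg (Fintype.card K : ℝ)]

/-- The Weil bound for quadratic character sums, with a non-optimal constant. -/
lemma abs_sum_quadraticChar_le (hK : ringChar K ≠ 2) {f : K[X]} (hf : f.Monic)
    (hs : ¬ IsSquare f) :
    |∑ x : K, ((quadraticChar K (f.eval x) : ℤ) : ℝ)| ≤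
      17 * f.natDegree * √(Fintype.card K) := by
  obtain ⟨c, hc⟩ : ∃ c, Fintype.card K = 2 * c + 1 := by
    have := FiniteField.odd_card_of_char_ne_two hK
    exact ⟨Fintype.card K / 2, by omega⟩
  have hc2 : Fintype.card K / 2 = c := by omega
  set N₁ := Finset.univ.filter fun x : K => f.eval x ^ c = 1
  set N₂ := Finset.univ.filter fun x : K => f.eval x ^ c = -1
  set Z := Finset.univ.filter fun x : K => f.eval x = 0
  have hc0 : c ≠ 0 := by
    rintro rfl
    have := Fintype.one_lt_card (α := K)
    omega
  have h11 : (-1 : K) ≠ 1 := Ring.neg_one_ne_one_of_char_ne_two hK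
  have hχ : ∀ x : K, ((quadraticChar K (f.eval x) : ℤ) : ℝ) =
      (if f.eval x ^ c = 1 then 1 else 0) - (if f.eval x ^ c = -1 then 1 else 0) ∧
      (1 : ℝ) = (if f.eval x ^ c = 1 then 1 else 0) + (if f.eval x ^ c = -1 then 1 else 0) +
        (if f.eval x = 0 then 1 else 0) := by
    intro x
    by_cases h0 : f.eval x = 0
    · have : ∀ b : K, b ≠ 0 → ¬ (0 : K) ^ c = b := fun b hb h => hb (by rw [← h, zero_pow hc0])
      rw [h0, if_neg (this 1 one_ne_zero), if_neg (this (-1) (neg_ne_zero.2 one_ne_zero))]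
      simp
    · rw [quadraticChar_eq_pow_of_char_ne_two hK h0, hc2, if_neg h0]
      rcases FiniteField.pow_dichotomy hK h0 with h | h
      · rw [hc2] at h
        rw [h, if_pos rfl, if_pos rfl, if_neg h11.symm]
        norm_num
      · rw [hc2] at h
        rw [h, if_neg h11, if_neg h11, if_pos rfl]
        norm_num
  have e1 : ∑ x : K, ((quadraticChar K (f.eval x) : ℤ) : ℝ) = (N₁.card : ℝ) - N₂.card := by
    rw [Finset.sum_congr rfl fun x _ => (hχ x).1, Finset.sum_sub_distrib]
    simp [N₁, N₂]
  have e2 : (Fintype.card K : ℝ) = N₁.card + N₂.card + Z.card := by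
    have : (Fintype.card K : ℝ) = ∑ _x : K, (1 : ℝ) := by simp
    rw [this, Finset.sum_congr rfl fun x _ => (hχ x).2, Finset.sum_add_distrib,
      Finset.sum_add_distrib]
    simp [N₁, N₂, Z]
  have e3 : (Z.card : ℝ) ≤ f.natDegree := by
    have := card_le_degree_of_subset_roots (p := f) (Z := Z)
      fun x hx => (mem_roots hf.ne_zero).2 (Finset.mem_filter.1 hx).2
    exact_mod_cast this
  have e4 := card_filter_pow_le hf hs (one_ne_zero (α := K)) hc
  have e5 := card_filter_pow_le hf hs (neg_ne_zero.2 (one_ne_zero (α := K))) hc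
  have e6 : (1 : ℝ) ≤ √(Fintype.card K) :=
    Real.one_le_sqrt.2 (by exact_mod_cast Fintype.card_pos)
  have e7 : (f.natDegree : ℝ) * 1 ≤ f.natDegree * √(Fintype.card K) :=
    mul_le_mul_of_nonneg_left e6 (Nat.cast_nonneg _)
  rw [e1, abs_le]
  constructor
  · change 2 * (N₂.card : ℝ) ≤ _ at e5
    linarith
  · change 2 * (N₁.card : ℝ) ≤ _ at e4
    linarith

end

noncomputable section

open scoped Classical

variable {q : ℕ} [Fact q.Prime]

/-- The primes of degree `r`. -/
def primesDeg (q : ℕ) [Fact q.Prime] (r : ℕ) : Finset (MIrr q) :=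
  (primesLE q r).filter fun P => P.1.natDegree = r

lemma mem_primesDeg {r : ℕ} {P : MIrr q} : P ∈ primesDeg q r ↔ P.1.natDegree = r := by
  rw [primesDeg, Finset.mem_filter, mem_primesLE]
  exact ⟨fun h => h.2, fun h => ⟨h.le, h⟩⟩

lemma card_primesDeg_le (r : ℕ) : (primesDeg q r).card ≤ q ^ r := by
  rw [← card_mon]
  refine Finset.card_le_card_of_injOn (fun P => P.1) ?_ Subtype.val_injective.injOn
  intro P hP
  exact mem_mon.2 ⟨P.2.1, mem_primesDeg.1 hP⟩

lemma not_isSquare_map {K : Type*} [Field K] [Fintype K] [Algebra (ZMod q) K]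
    (hK : ringChar K ≠ 2) {V : Fqx q} (hV : V.Monic) (hs : ¬ IsSquare V) :
    ¬ IsSquare (V.map (algebraMap (ZMod q) K)) := by
  rintro ⟨W, hW⟩
  set i := algebraMap (ZMod q) K
  have hm : (V.map i).Monic := hV.map i
  have hl : W.leadingCoeff * W.leadingCoeff = 1 := by
    rw [← leadingCoeff_mul, ← hW]; exact hm
  have hl0 : W.leadingCoeff ≠ 0 := by rintro h; rw [h] at hl; simp at hl
  set U := C W.leadingCoeff * W with hU
  have hUm : U.Monic := by rw [hU, Monic, leadingCoeff_mul, leadingCoeff_C, hl]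
  have hU2 : V.map i = U * U := by
    rw [hW, hU]
    have : C W.leadingCoeff * W * (C W.leadingCoeff * W) =
      C (W.leadingCoeff * W.leadingCoeff) * (W * W) := by rw [C_mul]; ring
    rw [this, hl, C_1, one_mul]
  have hfix : ∀ (g : K ≃ₐ[ZMod q] K), U.map (g : K →+* K) = U := by
    intro g
    have h1 : U.map (g : K →+* K) * U.map (g : K →+* K) = U * U := by
      rw [← Polynomial.map_mul, ← hU2, Polynomial.map_map]
      congr 1
      ext a
      exact g.commutes a
    rcases mul_self_eq_mul_self_iff.1 h1 with h | h
    · exact h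
    · exfalso
      have h2 : (U.map (g : K →+* K)).Monic := hUm.map _
      rw [h, Monic, leadingCoeff_neg, hUm] at h2
      exact Ring.neg_one_ne_one_of_char_ne_two hK h2
  have : FiniteDimensional (ZMod q) K := Module.Finite.of_finite
  have hco : ∀ n, U.coeff n ∈ Set.range i := by
    intro n
    have : U.coeff n ∈ (⊥ : IntermediateField (ZMod q) K) := by
      rw [IsGalois.mem_bot_iff_fixed]
      intro g
      have := congrArg (fun p => p.coeff n) (hfix g)
      simpa [coeff_map] using this
    exact IntermediateField.mem_bot.1 this
  have : U ∈ Polynomial.lifts i := by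
    rw [Polynomial.lifts_iff_coeff_lifts]; exact hco
  obtain ⟨u, hu⟩ := (Polynomial.mem_lifts _).1 this
  apply hs
  refine ⟨u, Polynomial.map_injective i i.injective ?_⟩
  rw [hU2, Polynomial.map_mul, hu]

variable {r : ℕ}

lemma legSym_eq_quadraticChar_aeval {K : Type*} [Field K] [Fintype K] [Algebra (ZMod q) K]
    (V : Fqx q) (P : MIrr q) (x : K) (hx : aeval x P.1 = 0)
    (hd : P.1.natDegree = Module.finrank (ZMod q) K) :
    legSym q V P.1 = quadraticChar K (aeval x V) := by
  have : FiniteDimensional (ZMod q) K := Module.Finite.of_finite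
  have hmin : P.1 = minpoly (ZMod q) x := minpoly.eq_of_irreducible_of_monic P.2.2 hx P.2.1
  have hdvd : ∀ f : Fqx q, P.1 ∣ f ↔ aeval x f = 0 := fun f => by
    rw [hmin, minpoly.dvd_iff]
  have hsurj : ∀ y : K, ∃ g : Fqx q, aeval x g = y := by
    intro y
    have h1 : IntermediateField.adjoin (ZMod q) {x} = ⊤ := by
      rw [Field.primitive_element_iff_minpoly_natDegree_eq, ← hmin, hd]
    have h2 : y ∈ (IntermediateField.adjoin (ZMod q) {x}).toSubalgebra := by
      rw [h1]; exact Algebra.mem_top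
    rw [IntermediateField.adjoin_simple_toSubalgebra_of_isAlgebraic
      (IsAlgebraic.of_finite _ _), Algebra.adjoin_singleton_eq_range_aeval] at h2
    exact h2
  rw [legSym, quadraticChar_apply, quadraticCharFun]
  by_cases h : P.1 ∣ V
  · rw [if_pos h, if_pos ((hdvd V).1 h)]
  · rw [if_neg h, if_neg (mt (hdvd V).2 h)]
    have : (∃ g : Fqx q, P.1 ∣ (g ^ 2 - V)) ↔ IsSquare (aeval x V) := by
      constructor
      · rintro ⟨g, hg⟩
        refine ⟨aeval x g, ?_⟩
        rw [hdvd, map_sub, map_pow, sub_eq_zero] at hg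
        rw [← hg, sq]
      · rintro ⟨a, ha⟩
        obtain ⟨g, rfl⟩ := hsurj a
        refine ⟨g, ?_⟩
        rw [hdvd, map_sub, map_pow, ha, sq, sub_self]
    simp only [this]

lemma card_roots_prime {K : Type*} [Field K] [Fintype K] [Algebra (ZMod q) K] (P : MIrr q)
    (hd : P.1.natDegree = Module.finrank (ZMod q) K) :
    (Finset.univ.filter fun x : K => aeval x P.1 = 0).card = P.1.natDegree := by
  have : FiniteDimensional (ZMod q) K := Module.Finite.of_finite
  have hsp : (P.1.map (algebraMap (ZMod q) K)).Splits := by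
    have h1 : P.1 ∣ X ^ Nat.card (ZMod q) ^ Module.finrank (ZMod q) K - X :=
      (P.2.2.natDegree_dvd_iff_dvd_X_pow_card_pow_sub_X).1 (dvd_of_eq hd)
    have h2 : Nat.card (ZMod q) ^ Module.finrank (ZMod q) K = Fintype.card K := by
      rw [Nat.card_eq_fintype_card, ← Module.card_eq_pow_finrank]
    rw [h2] at h1
    have h3 := (FiniteField.isSplittingField_sub K (ZMod q)).splits'
    refine h3.of_dvd ?_ (Polynomial.map_dvd _ h1)
    rw [Polynomial.map_ne_zero_iff (algebraMap (ZMod q) K).injective]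
    exact FiniteField.X_pow_card_sub_X_ne_zero _ Fintype.one_lt_card
  have h := card_rootSet_eq_natDegree (K := K) (PerfectField.separable_of_irreducible P.2.2) hsp
  rw [← h, ← Set.toFinset_card]
  congr 1
  ext x
  simp [mem_rootSet, P.2.1.ne_zero]

lemma card_small_degree_le {K : Type*} [Field K] [Fintype K] [Algebra (ZMod q) K] :
    (Finset.univ.filter fun x : K =>
      (minpoly (ZMod q) x).natDegree ≠ Module.finrank (ZMod q) K).card ≤
      2 * q ^ (Module.finrank (ZMod q) K / 2) := by
  have : FiniteDimensional (ZMod q) K := Module.Finite.of_finite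
  set r := Module.finrank (ZMod q) K
  have hr : 0 < r := Module.finrank_pos
  have hcover : (Finset.univ.filter fun x : K => (minpoly (ZMod q) x).natDegree ≠ r) ⊆
      (Finset.Icc 1 (r / 2)).biUnion fun d =>
        Finset.univ.filter fun x : K => x ^ q ^ d - x = 0 := by
    intro x hx
    have hint : IsIntegral (ZMod q) x := IsIntegral.of_finite _ _
    have hdiv : (minpoly (ZMod q) x).natDegree ∣ r := minpoly.degree_dvd hint
    obtain ⟨c, hc⟩ := hdiv
    have hne := (Finset.mem_filter.1 hx).2
    have hpos := minpoly.natDegree_pos hint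
    refine Finset.mem_biUnion.2 ⟨(minpoly (ZMod q) x).natDegree, Finset.mem_Icc.2 ⟨hpos, ?_⟩, ?_⟩
    · rw [Nat.le_div_iff_mul_le two_pos, hc]
      refine Nat.mul_le_mul_left _ ?_
      by_contra hlt
      interval_cases c <;> omega
    · rw [Finset.mem_filter]
      refine ⟨Finset.mem_univ _, ?_⟩
      have h1 := ((minpoly.irreducible hint).natDegree_dvd_iff_dvd_X_pow_card_pow_sub_X
        (n := (minpoly (ZMod q) x).natDegree)).1 dvd_rfl
      rw [minpoly.dvd_iff] at h1
      simpa using h1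
  have hcard : ∀ d ∈ Finset.Icc 1 (r / 2),
      (Finset.univ.filter fun x : K => x ^ q ^ d - x = 0).card ≤ q ^ d := by
    intro d hd
    have hq : 1 < q ^ d := Nat.one_lt_pow (by have := Finset.mem_Icc.1 hd; omega)
      (Fact.out : q.Prime).one_lt
    have h0 : (X ^ q ^ d - X : K[X]) ≠ 0 := FiniteField.X_pow_card_sub_X_ne_zero _ hq
    have := card_le_degree_of_subset_roots (p := (X ^ q ^ d - X : K[X]))
      (Z := Finset.univ.filter fun x : K => x ^ q ^ d - x = 0) fun x hx => by
        rw [mem_roots h0]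
        simpa using (Finset.mem_filter.1 hx).2
    rwa [FiniteField.X_pow_card_sub_X_natDegree_eq _ hq] at this
  have hgeom : ∀ n : ℕ, ∑ d ∈ Finset.Icc 1 n, q ^ d ≤ 2 * q ^ n := by
    intro n
    induction n with
    | zero => simp
    | succ n ih =>
      rw [Finset.sum_Icc_succ_top (by omega), pow_succ]
      have := (Fact.out : q.Prime).two_le
      nlinarith [pow_pos (Fact.out : q.Prime).pos n]
  calc _ ≤ _ := Finset.card_le_card hcover
    _ ≤ ∑ d ∈ Finset.Icc 1 (r / 2), _ := Finset.card_biUnion_le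
    _ ≤ ∑ d ∈ Finset.Icc 1 (r / 2), q ^ d := Finset.sum_le_sum hcard
    _ ≤ _ := hgeom _

/-- The Riemann hypothesis bound for quadratic characters summed over primes of degree `r`. -/
lemma abs_sum_legSym_le (hq : q ≠ 2) {V : Fqx q} (hV : V.Monic) (hs : ¬ IsSquare V) (r : ℕ)
    (hr : r ≠ 0) :
    r * |∑ P ∈ primesDeg q r, (legSym q V P.1 : ℝ)| ≤ 19 * V.natDegree * √((q : ℝ) ^ r) := by
  let K := GaloisField q r
  let _ : Fintype K := Fintype.ofFinite K
  have : FiniteDimensional (ZMod q) K := Module.Finite.of_finite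
  have hfr : Module.finrank (ZMod q) K = r := GaloisField.finrank q hr
  have hcard : Fintype.card K = q ^ r := by
    rw [← Nat.card_eq_fintype_card]; exact GaloisField.card q r hr
  have hchar : ringChar K ≠ 2 := by rw [ringChar.eq K q]; exact hq
  have hdV : 1 ≤ V.natDegree := by
    rw [Nat.one_le_iff_ne_zero]
    intro h
    rw [hV.natDegree_eq_zero.1 h] at hs
    exact hs IsSquare.one
  have hmain := abs_sum_quadraticChar_le hchar (hV.map (algebraMap (ZMod q) K))
    (not_isSquare_map hchar hV hs)
  rw [hV.natDegree_map] at hmain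
  simp only [eval_map_algebraMap] at hmain
  set χ : K → ℝ := fun x => ((quadraticChar K (aeval x V) : ℤ) : ℝ) with hχ
  change |∑ x, χ x| ≤ _ at hmain
  rw [hcard, Nat.cast_pow] at hmain
  have hsplit := Finset.sum_filter_add_sum_filter_not Finset.univ
    (fun x : K => (minpoly (ZMod q) x).natDegree = Module.finrank (ZMod q) K) χ
  have hbig : ∑ x ∈ Finset.univ.filter
      (fun x : K => (minpoly (ZMod q) x).natDegree = Module.finrank (ZMod q) K), χ x =
      r * ∑ P ∈ primesDeg q r, (legSym q V P.1 : ℝ) := by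
    let mp : K → MIrr q := fun x => ⟨minpoly (ZMod q) x, minpoly.monic (IsIntegral.of_finite _ _),
      minpoly.irreducible (IsIntegral.of_finite _ _)⟩
    rw [← Finset.sum_fiberwise_of_maps_to (t := primesDeg q r) (g := mp), Finset.mul_sum]
    · refine Finset.sum_congr rfl fun P hP => ?_
      have hPr := mem_primesDeg.1 hP
      have hset : (Finset.univ.filter
          (fun x : K => (minpoly (ZMod q) x).natDegree = Module.finrank (ZMod q) K)).filter
          (fun x => mp x = P) = Finset.univ.filter fun x : K => aeval x P.1 = 0 := by
        ext x
        simp only [Finset.mem_filter, Finset.mem_univ, true_and]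
        constructor
        · rintro ⟨-, h⟩
          rw [← h]; exact minpoly.aeval _ _
        · intro h
          have h1 := minpoly.eq_of_irreducible_of_monic P.2.2 h P.2.1
          exact ⟨by rw [← h1, hPr, hfr], Subtype.ext h1.symm⟩
      rw [hset, Finset.sum_congr rfl (g := fun _ => (legSym q V P.1 : ℝ)), Finset.sum_const,
        card_roots_prime P (hPr.trans hfr.symm), hPr, nsmul_eq_mul]
      intro x hx
      rw [hχ, legSym_eq_quadraticChar_aeval V P x (Finset.mem_filter.1 hx).2 (hPr.trans hfr.symm)]
    · intro x hx
      rw [mem_primesDeg]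
      exact (Finset.mem_filter.1 hx).2.trans hfr
  have hsmall : |∑ x ∈ Finset.univ.filter
      (fun x : K => ¬ (minpoly (ZMod q) x).natDegree = Module.finrank (ZMod q) K), χ x| ≤
      2 * √((q : ℝ) ^ r) := by
    have h1 : ∀ x, |χ x| ≤ 1 := fun x => by
      rw [hχ]
      have : |quadraticChar K (aeval x V)| ≤ 1 := by
        by_cases h : aeval x V = 0
        · rw [h]; simp
        · rcases quadraticChar_dichotomy h with h | h <;> rw [h] <;> simp
      change |((quadraticChar K (aeval x V) : ℤ) : ℝ)| ≤ 1
      exact_mod_cast this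
    refine (Finset.abs_sum_le_sum_abs _ _).trans ((Finset.sum_le_sum fun x _ => h1 x).trans ?_)
    rw [Finset.sum_const, nsmul_eq_mul, mul_one]
    have h2 := card_small_degree_le (q := q) (K := K)
    rw [hfr] at h2
    have h3 : (q : ℝ) ^ (r / 2) ≤ √((q : ℝ) ^ r) := by
      refine Real.le_sqrt_of_sq_le ?_
      rw [← pow_mul]
      exact pow_le_pow_right₀ (by exact_mod_cast (Fact.out : q.Prime).one_lt.le)
        (Nat.div_mul_le_self r 2)
    have h4 : ((Finset.univ.filter (fun x : K =>
        ¬ (minpoly (ZMod q) x).natDegree = Module.finrank (ZMod q) K)).card : ℝ) ≤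
        2 * (q : ℝ) ^ (r / 2) := by
      rw [hfr]
      exact_mod_cast h2
    linarith
  have hr0 : (0 : ℝ) ≤ r := Nat.cast_nonneg r
  rw [← abs_of_nonneg hr0, ← abs_mul, ← hbig]
  have h5 : (1 : ℝ) ≤ V.natDegree := by exact_mod_cast hdV
  have h6 := mul_le_mul_of_nonneg_right h5 (Real.sqrt_nonneg ((q : ℝ) ^ r))
  rw [← hsplit] at hmain
  have h7 := abs_sub_abs_le_abs_sub (∑ x ∈ Finset.univ.filter
      (fun x : K => (minpoly (ZMod q) x).natDegree = Module.finrank (ZMod q) K), χ x)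
      (-∑ x ∈ Finset.univ.filter
      (fun x : K => ¬ (minpoly (ZMod q) x).natDegree = Module.finrank (ZMod q) K), χ x)
  rw [sub_neg_eq_add, abs_neg] at h7
  linarith

end

noncomputable section

open scoped Classical ENNReal

/-- A submultiplicative seminorm with values in `[0, ∞]`. -/
structure SubNorm (A : Type*) [CommRing A] where
  toFun : A → ℝ≥0∞
  zero' : toFun 0 = 0
  add_le' : ∀ a b, toFun (a + b) ≤ toFun a + toFun b
  mul_le' : ∀ a b, toFun (a * b) ≤ toFun a * toFun b
  one_le' : toFun 1 ≤ 1
  neg' : ∀ a, toFun (-a) = toFun a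

namespace SubNorm

instance {A : Type*} [CommRing A] : CoeFun (SubNorm A) fun _ => A → ℝ≥0∞ := ⟨SubNorm.toFun⟩

/-- The absolute value on `ℝ`. -/
def real : SubNorm ℝ where
  toFun a := ‖a‖ₑ
  zero' := enorm_zero
  add_le' := enorm_add_le
  mul_le' a b := (enorm_mul a b).le
  one_le' := by simp
  neg' := enorm_neg

variable {A : Type*} [CommRing A] (N : SubNorm A)

lemma sub_le (a b : A) : N (a - b) ≤ N a + N b := by
  rw [sub_eq_add_neg, ← N.neg' b]
  exact N.add_le' _ _

lemma sum_le {ι : Type*} (s : Finset ι) (f : ι → A) : N (∑ i ∈ s, f i) ≤ ∑ i ∈ s, N (f i) := by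
  induction s using Finset.induction_on with
  | empty => simp [N.zero']
  | insert a s ha ih =>
    rw [Finset.sum_insert ha, Finset.sum_insert ha]
    exact (N.add_le' _ _).trans (by gcongr)

lemma prod_le {ι : Type*} (s : Finset ι) (f : ι → A) : N (∏ i ∈ s, f i) ≤ ∏ i ∈ s, N (f i) := by
  induction s using Finset.induction_on with
  | empty => simpa using N.one_le'
  | insert a s ha ih =>
    rw [Finset.prod_insert ha, Finset.prod_insert ha]
    exact (N.mul_le' _ _).trans (by gcongr)

lemma pow_le (a : A) (n : ℕ) : N (a ^ n) ≤ N a ^ n := by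
  simpa using N.prod_le (Finset.range n) fun _ => a

/-- The extension to power series giving the variable the weight `w`. -/
def ext (w : ℝ≥0∞) : SubNorm (PowerSeries A) where
  toFun F := ∑' n, N (PowerSeries.coeff n F) * w ^ n
  zero' := by simp [N.zero']
  add_le' F G := by
    rw [← ENNReal.tsum_add]
    refine ENNReal.tsum_le_tsum fun n => ?_
    rw [← add_mul, map_add]
    gcongr
    exact N.add_le' _ _
  mul_le' F G := by
    rw [← ENNReal.tsum_mul_right]
    simp_rw [← ENNReal.tsum_mul_left]
    rw [← ENNReal.tsum_prod (f := fun a b => N (PowerSeries.coeff a F) * w ^ a *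
      (N (PowerSeries.coeff b G) * w ^ b)),
    ← Equiv.tsum_eq (Finset.HasAntidiagonal.sigmaAntidiagonalEquivProd (A := ℕ)),
      ENNReal.tsum_sigma']
    refine ENNReal.tsum_le_tsum fun n => ?_
    rw [tsum_fintype, PowerSeries.coeff_mul]
    refine (mul_le_mul_left (N.sum_le _ _) _).trans ?_
    rw [Finset.sum_mul, ← Finset.sum_coe_sort]
    refine Finset.sum_le_sum fun p _ => ?_
    have hp : p.1.1 + p.1.2 = n := Finset.HasAntidiagonal.mem_antidiagonal.1 p.2
    simp only [Finset.HasAntidiagonal.sigmaAntidiagonalEquivProd_apply]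
    calc _ ≤ N (PowerSeries.coeff p.1.1 F) * N (PowerSeries.coeff p.1.2 G) * w ^ n := by
          gcongr; exact N.mul_le' _ _
      _ = _ := by rw [congrArg (w ^ ·) hp.symm, pow_add]; ring
  one_le' := by
    rw [tsum_eq_single 0]
    · simpa using N.one_le'
    · intro n hn
      rw [PowerSeries.coeff_one, if_neg hn, N.zero', zero_mul]
  neg' F := by simp [N.neg']

variable {w : ℝ≥0∞}

lemma ext_apply (F : PowerSeries A) : N.ext w F = ∑' n, N (PowerSeries.coeff n F) * w ^ n := rfl

lemma coeff_le (F : PowerSeries A) (n : ℕ) : N (PowerSeries.coeff n F) * w ^ n ≤ N.ext w F :=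
  ENNReal.le_tsum n

lemma ext_C_mul_X_pow (a : A) (n : ℕ) :
    N.ext w (PowerSeries.C a * PowerSeries.X ^ n) = N a * w ^ n := by
  rw [ext_apply, tsum_eq_single n]
  · simp [PowerSeries.coeff_X_pow]
  · intro k hk
    rw [PowerSeries.coeff_C_mul, PowerSeries.coeff_X_pow, if_neg hk, mul_zero, N.zero', zero_mul]

lemma ext_C (a : A) : N.ext w (PowerSeries.C a) = N a := by
  simpa using N.ext_C_mul_X_pow (w := w) a 0

lemma ext_X_pow_le (n : ℕ) : N.ext w (PowerSeries.X ^ n) ≤ w ^ n := by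
  have := N.ext_C_mul_X_pow (w := w) 1 n
  rw [map_one, one_mul] at this
  rw [this]
  exact (mul_le_mul_left N.one_le' _).trans (one_mul _).le

lemma ext_le_of_coeff_eq {F : PowerSeries A} {K : ℝ≥0∞}
    (h : ∀ n : ℕ, ∃ G : PowerSeries A, N.ext w G ≤ K ∧
      ∀ k ≤ n, PowerSeries.coeff k F = PowerSeries.coeff k G) : N.ext w F ≤ K := by
  rw [ext_apply, ENNReal.tsum_eq_iSup_nat]
  refine iSup_le fun n => ?_
  obtain ⟨G, hG, hc⟩ := h n
  refine le_trans ?_ hG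
  rw [Finset.sum_congr rfl fun k hk => by rw [hc k (Finset.mem_range.1 hk).le]]
  exact ENNReal.sum_le_tsum _

lemma ext_inv_le {F : PowerSeries A} {c : A} {d : ℕ} (hd : d ≠ 0)
    (hF : F = 1 + PowerSeries.C c * PowerSeries.X ^ d * F) :
    N.ext w F ≤ (1 - N c * w ^ d)⁻¹ := by
  refine N.ext_le_of_coeff_eq fun n =>
    ⟨∑ i ∈ Finset.range (n + 1), (PowerSeries.C c * PowerSeries.X ^ d) ^ i, ?_, ?_⟩
  · refine (sum_le _ _ _).trans ?_
    rw [← ENNReal.tsum_geometric, ← N.ext_C_mul_X_pow (w := w)]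
    refine le_trans (Finset.sum_le_sum fun i _ => pow_le _ _ _) (ENNReal.sum_le_tsum _)
  · have h : ∀ K : ℕ, F = ∑ i ∈ Finset.range K, (PowerSeries.C c * PowerSeries.X ^ d) ^ i +
        (PowerSeries.C c * PowerSeries.X ^ d) ^ K * F := by
      intro K
      induction K with
      | zero => simp
      | succ K ih =>
        rw [Finset.sum_range_succ]
        nth_rewrite 1 [ih]
        nth_rewrite 1 [hF]
        ring
    intro k hk
    have h1 := h (n + 1)
    nth_rewrite 1 [h1]
    rw [map_add, mul_pow, ← pow_mul, mul_comm (_ ^ (n + 1)), mul_assoc,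
      PowerSeries.coeff_X_pow_mul', if_neg, add_zero]
    have : n + 1 ≤ d * (n + 1) := Nat.le_mul_of_pos_left _ (Nat.pos_of_ne_zero hd)
    omega

end SubNorm

end

noncomputable section

open scoped Classical ENNReal

variable {q : ℕ} [Fact q.Prime]

/-- The Möbius inversion formula behind the Euler product, for a completely multiplicative
function vanishing on polynomials of large degree. -/
lemma euler_inverse {R : Type*} [CommRing R] {F : Fqx q → R} (h1 : F 1 = 1)
    (hmul : ∀ f g : Fqx q, F (f * g) = F f * F g) {N : ℕ}
    (h0 : ∀ f : Fqx q, f.Monic → N < f.natDegree → F f = 0) :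
    (∑ h ∈ monLE q N, F h) * ∏ P ∈ primesLE q N, (1 - F P.1) = 1 := by
  have hpr : ∀ T : Finset (MIrr q), F (pr T) = ∏ P ∈ T, F P.1 := by
    intro T
    induction T using Finset.induction_on with
    | empty => simp [pr, h1]
    | insert a s ha ih =>
      rw [pr, Finset.prod_insert ha, Finset.prod_insert ha, hmul, ← ih, pr]
  have e1 : ∏ P ∈ primesLE q N, (1 - F P.1) =
      ∑ T ∈ (primesLE q N).powerset, (-1) ^ T.card * F (pr T) := by
    simp only [sub_eq_add_neg]
    rw [Finset.prod_one_add]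
    refine Finset.sum_congr rfl fun T _ => ?_
    rw [hpr, Finset.prod_neg]
  rw [e1, Finset.sum_mul_sum, ← Finset.sum_product']
  have e2 : ∀ p : Fqx q × Finset (MIrr q), F p.1 * ((-1) ^ p.2.card * F (pr p.2)) =
      (-1) ^ p.2.card * F (p.1 * pr p.2) := fun p => by rw [hmul]; ring
  rw [Finset.sum_congr rfl fun p _ => e2 p]
  rw [← Finset.sum_filter_add_sum_filter_not _ (fun p : Fqx q × Finset (MIrr q) =>
    p.1 * pr p.2 ∈ monLE q N)]
  have e3 : ∑ p ∈ (monLE q N ×ˢ (primesLE q N).powerset).filter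
      (fun p : Fqx q × Finset (MIrr q) => ¬ p.1 * pr p.2 ∈ monLE q N),
      (-1) ^ p.2.card * F (p.1 * pr p.2) = 0 := by
    refine Finset.sum_eq_zero fun p hp => ?_
    rw [Finset.mem_filter, Finset.mem_product, mem_monLE, mem_monLE] at hp
    have hm : (p.1 * pr p.2).Monic := hp.1.1.1.mul (monic_pr _)
    rw [h0 _ hm, mul_zero]
    by_contra hlt
    exact hp.2 ⟨hm, not_lt.1 hlt⟩
  rw [e3, add_zero, ← Finset.sum_fiberwise_of_maps_to (t := monLE q N)
    (g := fun p : Fqx q × Finset (MIrr q) => p.1 * pr p.2)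
    (fun p hp => (Finset.mem_filter.1 hp).2)]
  have e4 : ∀ f ∈ monLE q N, ∑ p ∈ ((monLE q N ×ˢ (primesLE q N).powerset).filter
      (fun p : Fqx q × Finset (MIrr q) => p.1 * pr p.2 ∈ monLE q N)).filter
      (fun p => p.1 * pr p.2 = f), (-1) ^ p.2.card * F (p.1 * pr p.2) =
      (∑ T ∈ (primeSet f).powerset, (-1 : ℤ) ^ T.card : ℤ) * F f := by
    intro f hf
    have hf' := mem_monLE.1 hf
    push_cast
    rw [Finset.sum_mul]
    refine Finset.sum_bij' (fun p _ => p.2) (fun T _ => (f /ₘ pr T, T)) ?_ ?_ ?_ ?_ ?_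
    · intro p hp
      rw [Finset.mem_powerset]
      intro P hP
      rw [mem_primeSet hf'.1.ne_zero, ← (Finset.mem_filter.1 hp).2]
      exact ((prime_dvd_pr_iff _ _).2 hP).trans (dvd_mul_left _ _)
    · intro T hT
      have hd : pr T ∣ f := (pr_dvd_iff T f).2 fun P hP =>
        (mem_primeSet hf'.1.ne_zero).1 (Finset.mem_powerset.1 hT hP)
      obtain ⟨g, rfl⟩ := hd
      have hg : g.Monic := (monic_pr T).of_mul_monic_left hf'.1
      have hd2 := hf'.2
      rw [(monic_pr T).natDegree_mul hg] at hd2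
      have hdiv : pr T * g /ₘ pr T = g := mul_divByMonic_cancel_left _ (monic_pr T)
      simp only [hdiv, Finset.mem_filter, Finset.mem_product, mem_monLE, Finset.mem_powerset]
      refine ⟨⟨⟨⟨hg, by omega⟩, ?_⟩, ?_⟩, mul_comm _ _⟩
      · refine subset_primesLE ?_
        rw [← natDegree_pr]; omega
      · rw [mul_comm]; exact hf'
    · intro p hp
      have := (Finset.mem_filter.1 hp).2
      rw [← this, mul_comm, mul_divByMonic_cancel_left _ (monic_pr p.2)]
    · intro T hT
      rfl
    · intro p hp
      rw [(Finset.mem_filter.1 hp).2]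
  rw [Finset.sum_congr rfl e4]
  simp only [Finset.sum_powerset_neg_one_pow_card]
  rw [Finset.sum_eq_single_of_mem 1 (mem_monLE.2 ⟨monic_one, by simp⟩)]
  · rw [if_pos]
    · simp [h1]
    · ext P
      simp only [mem_primeSet one_ne_zero, Finset.notMem_empty, iff_false]
      exact fun h => P.2.2.not_isUnit (isUnit_of_dvd_one h)
  · intro f hf hne
    rw [if_neg]
    · simp
    · intro h
      have hf' := mem_monLE.1 hf
      by_cases hd : f.natDegree = 0
      · exact hne (hf'.1.natDegree_eq_zero.1 hd)
      · obtain ⟨P, hP⟩ := exists_prime_dvd hd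
        have := (mem_primeSet hf'.1.ne_zero).2 hP
        rw [h] at this
        simp at this

/-- The Euler product of `1 - q z`. -/
lemma prod_one_sub_pow {R : Type*} [CommRing R] {z : R} {N : ℕ} (hz : z ^ (N + 1) = 0) :
    ∏ P ∈ primesLE q N, (1 - z ^ P.1.natDegree) = 1 - q * z := by
  have h := euler_inverse (q := q) (F := fun f : Fqx q => if f = 0 then 0 else z ^ f.natDegree)
    (N := N) (by simp) (fun f g => by
      by_cases hf : f = 0
      · simp [hf]
      by_cases hg : g = 0
      · simp [hg]
      simp [hf, hg, natDegree_mul, pow_add])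
    (fun f hf hN => by
      rw [if_neg hf.ne_zero]
      exact pow_eq_zero_of_le hN hz)
  have e1 : ∑ h ∈ monLE q N, (if h = 0 then 0 else z ^ h.natDegree : R) =
      ∑ k ∈ Finset.range (N + 1), (q * z) ^ k := by
    rw [sum_monLE]
    refine Finset.sum_congr rfl fun k _ => ?_
    rw [Finset.sum_congr rfl (g := fun _ => z ^ k), Finset.sum_const, card_mon, nsmul_eq_mul,
      mul_pow, Nat.cast_pow]
    intro f hf
    obtain ⟨h1, h2⟩ := mem_mon.1 hf
    rw [if_neg h1.ne_zero, h2]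
  have e2 : ∏ P ∈ primesLE q N, (1 - (if P.1 = 0 then 0 else z ^ P.1.natDegree : R)) =
      ∏ P ∈ primesLE q N, (1 - z ^ P.1.natDegree) :=
    Finset.prod_congr rfl fun P _ => by rw [if_neg P.2.1.ne_zero]
  rw [e1, e2] at h
  have h3 := geom_sum_mul (q * z : R) (N + 1)
  rw [mul_pow, hz, mul_zero] at h3
  calc _ = -((∑ k ∈ Finset.range (N + 1), (q * z : R) ^ k) * (q * z - 1)) *
        ∏ P ∈ primesLE q N, (1 - z ^ P.1.natDegree) := by rw [h3]; ring
    _ = (1 - q * z) * ((∑ k ∈ Finset.range (N + 1), (q * z : R) ^ k) *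
        ∏ P ∈ primesLE q N, (1 - z ^ P.1.natDegree)) := by ring
    _ = _ := by rw [h, mul_one]

variable {A : Type*} [CommRing A]

/-- Truncation of power series modulo `X ^ (N + 1)`. -/
abbrev tq (A : Type*) [CommRing A] (N : ℕ) :
    PowerSeries A →+* PowerSeries A ⧸ Ideal.span {(PowerSeries.X : PowerSeries A) ^ (N + 1)} :=
  Ideal.Quotient.mk _

lemma tq_eq_iff {N : ℕ} {F G : PowerSeries A} :
    tq A N F = tq A N G ↔ ∀ k ≤ N, PowerSeries.coeff k F = PowerSeries.coeff k G := by
  rw [Ideal.Quotient.mk_eq_mk_iff_sub_mem, Ideal.mem_span_singleton, PowerSeries.X_pow_dvd_iff]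
  simp only [map_sub, sub_eq_zero, Nat.lt_succ_iff]

lemma tq_X_pow {N k : ℕ} (h : N < k) : tq A N (PowerSeries.X ^ k) = 0 := by
  rw [Ideal.Quotient.eq_zero_iff_mem, Ideal.mem_span_singleton]
  exact pow_dvd_pow _ h

/-- The formal Euler product `∏ (1 + f(P) X ^ deg P)`. -/
def eprod (f : MIrr q → A) : PowerSeries A :=
  PowerSeries.mk fun n => ∑ D ∈ sqf q n, ∏ P ∈ D, f P

lemma coeff_eprod (f : MIrr q → A) (n : ℕ) :
    PowerSeries.coeff n (eprod f) = ∑ D ∈ sqf q n, ∏ P ∈ D, f P := PowerSeries.coeff_mk _ _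

lemma prod_one_add_C_mul_X_pow (s : Finset (MIrr q)) (f : MIrr q → A) :
    ∏ P ∈ s, (1 + PowerSeries.C (f P) * PowerSeries.X ^ P.1.natDegree) =
      ∑ D ∈ s.powerset, PowerSeries.C (∏ P ∈ D, f P) * PowerSeries.X ^ dg D := by
  rw [Finset.prod_one_add]
  refine Finset.sum_congr rfl fun D _ => ?_
  rw [Finset.prod_mul_distrib, map_prod, Finset.prod_pow_eq_pow_sum, dg]

lemma tq_eprod (f : MIrr q → A) (N : ℕ) : tq A N (eprod f) =
    tq A N (∏ P ∈ primesLE q N, (1 + PowerSeries.C (f P) * PowerSeries.X ^ P.1.natDegree)) := by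
  rw [tq_eq_iff, prod_one_add_C_mul_X_pow]
  intro k hk
  rw [coeff_eprod, map_sum]
  simp only [PowerSeries.coeff_C_mul, PowerSeries.coeff_X_pow, mul_ite, mul_one, mul_zero]
  rw [← Finset.sum_filter]
  refine Finset.sum_congr ?_ fun _ _ => rfl
  ext D
  rw [mem_sqf, Finset.mem_filter, Finset.mem_powerset]
  exact ⟨fun h => ⟨subset_primesLE (h.le.trans hk), h.symm⟩, fun h => h.2.symm⟩

/-- The formal `L`-series of a function on polynomials. -/
def lser (A : Type*) [CommRing A] (c : Fqx q → ℤ) : PowerSeries A :=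
  PowerSeries.mk fun n => ((∑ h ∈ mon q n, c h : ℤ) : A)

lemma tq_lser_mul_prod {c : Fqx q → ℤ} (h1 : c 1 = 1) (hmul : ∀ f g, c (f * g) = c f * c g)
    (N : ℕ) :
    tq A N (lser A c * ∏ P ∈ primesLE q N,
      (1 - PowerSeries.C (c P.1 : A) * PowerSeries.X ^ P.1.natDegree)) = 1 := by
  have h := euler_inverse (q := q) (F := fun f : Fqx q => if f = 0 then 0 else
      tq A N (PowerSeries.C (c f : A) * PowerSeries.X ^ f.natDegree))
    (N := N) (by simp [h1]) (fun f g => by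
      by_cases hf : f = 0
      · simp [hf]
      by_cases hg : g = 0
      · simp [hg]
      rw [if_neg hf, if_neg hg, if_neg (mul_ne_zero hf hg), ← map_mul, natDegree_mul hf hg, hmul]
      congr 1
      push_cast
      rw [map_mul, pow_add]
      ring)
    (fun f hf hN => by
      rw [if_neg hf.ne_zero, map_mul, tq_X_pow hN, mul_zero])
  rw [← h, map_mul, map_prod]
  congr 1
  · rw [Finset.sum_congr rfl (g := fun f => tq A N (PowerSeries.C (c f : A) *
      PowerSeries.X ^ f.natDegree)) fun f hf => if_neg (mem_monLE.1 hf).1.ne_zero, ← map_sum,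
      tq_eq_iff]
    intro k hk
    rw [lser, PowerSeries.coeff_mk, map_sum]
    simp only [PowerSeries.coeff_C_mul, PowerSeries.coeff_X_pow, mul_ite, mul_one, mul_zero]
    rw [← Finset.sum_filter, Int.cast_sum]
    refine Finset.sum_congr ?_ fun _ _ => rfl
    ext f
    rw [mem_mon, Finset.mem_filter, mem_monLE]
    exact ⟨fun h => ⟨⟨h.1, h.2.le.trans hk⟩, h.2.symm⟩, fun h => ⟨h.1.1, h.2.symm⟩⟩
  · refine Finset.prod_congr rfl fun P _ => ?_
    rw [if_neg P.2.1.ne_zero, map_sub, map_one]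

lemma tq_prod_one_sub (N : ℕ) {d : ℕ} (hd : d ≠ 0) :
    tq A N (∏ P ∈ primesLE q N, (1 - PowerSeries.X ^ (d * P.1.natDegree))) =
      tq A N (1 - (q : PowerSeries A) * PowerSeries.X ^ d) := by
  rw [map_prod]
  have := prod_one_sub_pow (q := q) (z := tq A N (PowerSeries.X ^ d)) (N := N)
    (by rw [← map_pow, ← pow_mul]; exact tq_X_pow (by
          have : N + 1 ≤ d * (N + 1) := Nat.le_mul_of_pos_left _ (Nat.pos_of_ne_zero hd)
          omega))
  simp only [map_sub, map_one, map_mul, map_natCast]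
  rw [← this]
  exact Finset.prod_congr rfl fun P _ => by rw [← map_pow, pow_mul]

variable (N : SubNorm A) {w : ℝ≥0∞}

lemma ext_pow_mul_eprod_le (f : MIrr q → A) (κ : ℕ) {K : ℝ≥0∞}
    (h : ∀ n : ℕ, ∏ P ∈ primesLE q n, N.ext w ((1 - PowerSeries.X ^ P.1.natDegree) ^ κ *
      (1 + PowerSeries.C (f P) * PowerSeries.X ^ P.1.natDegree)) ≤ K) :
    N.ext w ((1 - (q : PowerSeries A) * PowerSeries.X) ^ κ * eprod f) ≤ K := by
  refine N.ext_le_of_coeff_eq fun n => ⟨_, (SubNorm.prod_le _ _ _).trans (h n), ?_⟩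
  rw [← tq_eq_iff, Finset.prod_mul_distrib, Finset.prod_pow, map_mul, map_mul, map_pow, map_pow,
    tq_eprod]
  have := tq_prod_one_sub (q := q) (A := A) n one_ne_zero
  rw [pow_one] at this
  rw [← this]
  simp only [one_mul]

end

noncomputable section

open scoped Classical ENNReal

variable {q : ℕ} [Fact q.Prime]

/-- Power series in `x`. -/
abbrev A1 := PowerSeries ℝ

/-- Power series in `u` over `A1`. -/
abbrev A2 := PowerSeries A1

/-- Power series in `y` over `A2`. -/
abbrev A3 := PowerSeries A2

/-- `(1 + x ^ (2 r))⁻¹`. -/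
def iX (r : ℕ) : A1 := PowerSeries.invOfUnit (1 + PowerSeries.X ^ (2 * r)) 1

/-- `(1 - u ^ (2 r))⁻¹`. -/
def iV (r : ℕ) : A2 := PowerSeries.invOfUnit (1 - PowerSeries.X ^ (2 * r)) 1

lemma mul_iX {r : ℕ} (hr : r ≠ 0) : (1 + PowerSeries.X ^ (2 * r)) * iX r = 1 :=
  PowerSeries.mul_invOfUnit _ _ (by simp [hr])

lemma mul_iV {r : ℕ} (hr : r ≠ 0) : (1 - PowerSeries.X ^ (2 * r)) * iV r = 1 :=
  PowerSeries.mul_invOfUnit _ _ (by simp [hr])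

/-- The local factor at a prime dividing `D`. -/
def thetaS (r : ℕ) : A1 := (1 - PowerSeries.X ^ (2 * r)) ^ 2 * iX r

/-- The local factor at a prime dividing `T`. -/
def ellS (r : ℕ) : A2 := PowerSeries.C (2 * iX r) * iV r

/-- The quotient `(1 - θ) / (1 - u ^ (2 r))`. -/
def etaS (r : ℕ) : A2 :=
  PowerSeries.C ((3 * PowerSeries.X ^ (2 * r) - PowerSeries.X ^ (4 * r)) * iX r) * iV r

/-- `(1 - q x²)⁻³ (1 - q x⁴)`. -/
def LamS (q : ℕ) : A1 := (1 - (q : A1) * PowerSeries.X ^ 4) *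
  PowerSeries.invOfUnit (1 - (q : A1) * PowerSeries.X ^ 2) 1 ^ 3

lemma mul_LamS : (1 - (q : A1) * PowerSeries.X ^ 2) ^ 3 * LamS q =
    1 - (q : A1) * PowerSeries.X ^ 4 := by
  have : (1 - (q : A1) * PowerSeries.X ^ 2) *
      PowerSeries.invOfUnit (1 - (q : A1) * PowerSeries.X ^ 2) 1 = 1 :=
    PowerSeries.mul_invOfUnit _ _ (by simp)
  rw [LamS, mul_left_comm, ← mul_pow, this, one_pow, mul_one]

lemma one_sub_thetaS {r : ℕ} (hr : r ≠ 0) :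
    1 - thetaS r = (3 * PowerSeries.X ^ (2 * r) - PowerSeries.X ^ (4 * r)) * iX r := by
  have h := mul_iX hr
  have e : (PowerSeries.X : A1) ^ (4 * r) = (PowerSeries.X ^ (2 * r)) ^ 2 := by
    rw [← pow_mul]; congr 1; ring
  rw [thetaS, e]
  nth_rewrite 1 [← h]
  ring

lemma ellS_sub_two {r : ℕ} (hr : r ≠ 0) : ellS r - 2 = (2 * PowerSeries.X ^ (2 * r) *
    (1 + PowerSeries.C (PowerSeries.X ^ (2 * r))) -
    2 * PowerSeries.C (PowerSeries.X ^ (2 * r))) * (PowerSeries.C (iX r) * iV r) := by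
  have h1 := congrArg (PowerSeries.C (R := A1)) (mul_iX hr)
  have h2 := mul_iV hr
  rw [map_mul, map_add, map_one] at h1
  rw [ellS, map_mul, map_ofNat]
  calc _ = 2 * PowerSeries.C (iX r) * iV r -
        2 * (((1 + PowerSeries.C (PowerSeries.X ^ (2 * r))) * PowerSeries.C (iX r)) *
        ((1 - PowerSeries.X ^ (2 * r)) * iV r)) := by rw [h1, h2]; ring
    _ = _ := by ring

section Norms

variable {wx wu wy : ℝ≥0∞}

/-- The norm on `A1` with weight `wx`. -/
abbrev N1 (wx : ℝ≥0∞) : SubNorm A1 := SubNorm.real.ext wx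

/-- The norm on `A2` with weights `wx` and `wu`. -/
abbrev N2 (wx wu : ℝ≥0∞) : SubNorm A2 := (N1 wx).ext wu

/-- The norm on `A3` with weights `wx`, `wu` and `wy`. -/
abbrev N3 (wx wu wy : ℝ≥0∞) : SubNorm A3 := (N2 wx wu).ext wy

lemma SubNorm.natCast_le {A : Type*} [CommRing A] (N : SubNorm A) (n : ℕ) : N n ≤ n := by
  induction n with
  | zero => simp [N.zero']
  | succ n ih =>
    push_cast
    exact (N.add_le' _ _).trans (add_le_add ih N.one_le')

lemma SubNorm.ofNat_le {A : Type*} [CommRing A] (N : SubNorm A) (n : ℕ) [n.AtLeastTwo] :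
    N (ofNat(n) : A) ≤ (ofNat(n) : ℝ≥0∞) := by
  have := N.natCast_le (OfNat.ofNat n)
  rwa [Nat.cast_ofNat, Nat.cast_ofNat] at this

lemma pow_le_sq {w : ℝ≥0∞} (hw : w ≤ 1) {r : ℕ} (hr : r ≠ 0) : w ^ (2 * r) ≤ w ^ 2 :=
  pow_le_pow_right_of_le_one' hw (by omega)

lemma N1_iX_le (hx : wx ≤ 1) {r : ℕ} (hr : r ≠ 0) : N1 wx (iX r) ≤ (1 - wx ^ 2)⁻¹ := by
  refine (SubNorm.ext_inv_le SubNorm.real (c := -1) (d := 2 * r) (by omega) ?_).trans ?_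
  · rw [map_neg, map_one]
    linear_combination mul_iX hr
  · rw [SubNorm.neg']
    refine ENNReal.inv_le_inv.2 (tsub_le_tsub_left ?_ _)
    exact (mul_le_mul' SubNorm.real.one_le' (pow_le_sq hx hr)).trans (one_mul _).le

lemma N2_iV_le (hu : wu ≤ 1) {r : ℕ} (hr : r ≠ 0) : N2 wx wu (iV r) ≤ (1 - wu ^ 2)⁻¹ := by
  refine (SubNorm.ext_inv_le (N1 wx) (c := 1) (d := 2 * r) (by omega) ?_).trans ?_
  · rw [map_one]
    linear_combination mul_iV hr
  · refine ENNReal.inv_le_inv.2 (tsub_le_tsub_left ?_ _)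
    exact (mul_le_mul' (N1 wx).one_le' (pow_le_sq hu hr)).trans (one_mul _).le

lemma N1_thetaS_le (hx : wx ≤ 1) {r : ℕ} (hr : r ≠ 0) :
    N1 wx (thetaS r) ≤ 4 * (1 - wx ^ 2)⁻¹ := by
  refine ((N1 wx).mul_le' _ _).trans (mul_le_mul' ?_ (N1_iX_le hx hr))
  refine ((N1 wx).pow_le _ _).trans ?_
  have h : N1 wx (1 - PowerSeries.X ^ (2 * r)) ≤ 2 :=
    calc _ ≤ N1 wx 1 + N1 wx (PowerSeries.X ^ (2 * r)) := (N1 wx).sub_le _ _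
      _ ≤ 1 + 1 := add_le_add (N1 wx).one_le'
          ((SubNorm.real.ext_X_pow_le _).trans (pow_le_one' hx _))
      _ = 2 := one_add_one_eq_two
  exact (pow_le_pow_left' h 2).trans (by norm_num)

lemma N1_one_sub_thetaS_le (hx : wx ≤ 1) {r : ℕ} (hr : r ≠ 0) :
    N1 wx ((3 * PowerSeries.X ^ (2 * r) - PowerSeries.X ^ (4 * r)) * iX r) ≤
      4 * wx ^ (2 * r) * (1 - wx ^ 2)⁻¹ := by
  refine ((N1 wx).mul_le' _ _).trans (mul_le_mul' ?_ (N1_iX_le hx hr))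
  calc _ ≤ N1 wx (3 * PowerSeries.X ^ (2 * r)) + N1 wx (PowerSeries.X ^ (4 * r)) :=
        (N1 wx).sub_le _ _
    _ ≤ 3 * wx ^ (2 * r) + wx ^ (2 * r) := by
        refine add_le_add (((N1 wx).mul_le' _ _).trans (mul_le_mul' ((N1 wx).ofNat_le 3)
          (SubNorm.real.ext_X_pow_le _))) ((SubNorm.real.ext_X_pow_le _).trans ?_)
        exact pow_le_pow_right_of_le_one' hx (by omega)
    _ = _ := by ring

lemma N2_ellS_le (hx : wx ≤ 1) (hu : wu ≤ 1) {r : ℕ} (hr : r ≠ 0) :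
    N2 wx wu (ellS r) ≤ 2 * (1 - wx ^ 2)⁻¹ * (1 - wu ^ 2)⁻¹ := by
  refine ((N2 wx wu).mul_le' _ _).trans (mul_le_mul' ?_ (N2_iV_le hu hr))
  rw [SubNorm.ext_C]
  exact ((N1 wx).mul_le' _ _).trans (mul_le_mul' ((N1 wx).ofNat_le 2) (N1_iX_le hx hr))

lemma N2_etaS_le (hx : wx ≤ 1) (hu : wu ≤ 1) {r : ℕ} (hr : r ≠ 0) :
    N2 wx wu (etaS r) ≤ 4 * wx ^ (2 * r) * (1 - wx ^ 2)⁻¹ * (1 - wu ^ 2)⁻¹ := by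
  refine ((N2 wx wu).mul_le' _ _).trans (mul_le_mul' ?_ (N2_iV_le hu hr))
  rw [SubNorm.ext_C]
  exact N1_one_sub_thetaS_le hx hr

lemma N2_ellS_sub_two_le (hx : wx ≤ 1) (hu : wu ≤ 1) {r : ℕ} (hr : r ≠ 0) :
    N2 wx wu (ellS r - 2) ≤
      (4 * wu ^ (2 * r) + 2 * wx ^ (2 * r)) * ((1 - wx ^ 2)⁻¹ * (1 - wu ^ 2)⁻¹) := by
  have hX : N2 wx wu (PowerSeries.C (PowerSeries.X ^ (2 * r))) ≤ wx ^ (2 * r) := by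
    rw [SubNorm.ext_C]
    exact SubNorm.real.ext_X_pow_le _
  rw [ellS_sub_two hr]
  refine ((N2 wx wu).mul_le' _ _).trans (mul_le_mul' ?_ ?_)
  · refine ((N2 wx wu).sub_le _ _).trans (add_le_add ?_ ?_)
    · refine ((N2 wx wu).mul_le' _ _).trans ?_
      calc _ ≤ (2 * wu ^ (2 * r)) * (1 + 1) := by
            refine mul_le_mul' (((N2 wx wu).mul_le' _ _).trans (mul_le_mul'
              ((N2 wx wu).ofNat_le 2) ((N1 wx).ext_X_pow_le _)))
              (((N2 wx wu).add_le' _ _).trans (add_le_add (N2 wx wu).one_le' (hX.trans ?_)))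
            exact pow_le_one' hx _
        _ = _ := by ring
    · exact ((N2 wx wu).mul_le' _ _).trans (mul_le_mul' ((N2 wx wu).ofNat_le 2) hX)
  · refine ((N2 wx wu).mul_le' _ _).trans (mul_le_mul' ?_ (N2_iV_le hu hr))
    rw [SubNorm.ext_C]
    exact N1_iX_le hx hr

lemma N1_LamS_le : N1 wx (LamS q) ≤ (1 + q * wx ^ 4) * (1 - q * wx ^ 2)⁻¹ ^ 3 := by
  refine ((N1 wx).mul_le' _ _).trans (mul_le_mul' ?_ ?_)
  · exact ((N1 wx).sub_le _ _).trans (add_le_add (N1 wx).one_le'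
      (((N1 wx).mul_le' _ _).trans (mul_le_mul' ((N1 wx).natCast_le q)
      (SubNorm.real.ext_X_pow_le _))))
  · refine ((N1 wx).pow_le _ _).trans (pow_le_pow_left' ?_ 3)
    refine (SubNorm.ext_inv_le SubNorm.real (c := (q : ℝ)) (d := 2) (by omega) ?_).trans ?_
    · have : (1 - (q : A1) * PowerSeries.X ^ 2) *
          PowerSeries.invOfUnit (1 - (q : A1) * PowerSeries.X ^ 2) 1 = 1 :=
        PowerSeries.mul_invOfUnit _ _ (by simp)
      rw [map_natCast]
      linear_combination this
    · refine ENNReal.inv_le_inv.2 (tsub_le_tsub_left ?_ _)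
      exact mul_le_mul_left (SubNorm.real.natCast_le q) _

end Norms

section Parity

/-- The power series in `A2` that are even in `x` and in `u`. -/
def evenS : Subring A2 :=
  RingHom.eqLocus (PowerSeries.map (PowerSeries.rescale (-1 : ℝ))) (RingHom.id A2) ⊓
    RingHom.eqLocus (PowerSeries.rescale (-1 : A1)) (RingHom.id A2)

lemma mem_evenS {F : A2} : F ∈ evenS ↔ PowerSeries.map (PowerSeries.rescale (-1 : ℝ)) F = F ∧
    PowerSeries.rescale (-1 : A1) F = F := Iff.rfl

lemma evenS_inv {F G : A2} (h : F * G = 1) (hF : F ∈ evenS) : G ∈ evenS := by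
  have key : ∀ σ : A2 →+* A2, σ F = F → σ G = G := fun σ hσ => by
    have h1 := congrArg σ h
    rw [map_mul, hσ, map_one] at h1
    calc σ G = σ G * (F * G) := by rw [h, mul_one]
      _ = F * σ G * G := by ring
      _ = G := by rw [h1, one_mul]
  exact ⟨key _ hF.1, key _ hF.2⟩

lemma X_pow_mem_evenS {n : ℕ} (hn : Even n) : (PowerSeries.X : A2) ^ n ∈ evenS := by
  refine mem_evenS.2 ⟨by simp, ?_⟩
  rw [map_pow, PowerSeries.rescale_X, mul_pow, ← map_pow, hn.neg_one_pow, map_one, one_mul]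

lemma C_X_pow_mem_evenS {n : ℕ} (hn : Even n) :
    (PowerSeries.C (PowerSeries.X ^ n : A1) : A2) ∈ evenS := by
  refine mem_evenS.2 ⟨?_, ?_⟩
  swap
  · ext1 k
    rw [PowerSeries.coeff_rescale, PowerSeries.coeff_C]
    split_ifs with h <;> simp [h]
  rw [PowerSeries.map_C, map_pow, PowerSeries.rescale_X, mul_pow, ← map_pow, hn.neg_one_pow,
    map_one, one_mul]

lemma iV_mem_evenS {r : ℕ} (hr : r ≠ 0) : iV r ∈ evenS :=
  evenS_inv (mul_iV hr) (sub_mem (one_mem _) (X_pow_mem_evenS (even_two_mul r)))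

lemma C_iX_mem_evenS {r : ℕ} (hr : r ≠ 0) : PowerSeries.C (iX r) ∈ evenS := by
  refine evenS_inv (F := PowerSeries.C (1 + PowerSeries.X ^ (2 * r))) ?_ ?_
  · rw [← map_mul, mul_iX hr, map_one]
  · rw [map_add, map_one]
    exact add_mem (one_mem _) (C_X_pow_mem_evenS (even_two_mul r))

lemma ellS_mem_evenS {r : ℕ} (hr : r ≠ 0) : ellS r ∈ evenS := by
  rw [ellS, map_mul, map_ofNat]
  exact mul_mem (mul_mem (ofNat_mem _ 2) (C_iX_mem_evenS hr)) (iV_mem_evenS hr)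

lemma etaS_mem_evenS {r : ℕ} (hr : r ≠ 0) : etaS r ∈ evenS := by
  rw [etaS, map_mul, map_sub, map_mul, map_ofNat]
  refine mul_mem (mul_mem (sub_mem (mul_mem (ofNat_mem _ 3) ?_) ?_) (C_iX_mem_evenS hr))
    (iV_mem_evenS hr)
  · exact C_X_pow_mem_evenS (even_two_mul r)
  · exact C_X_pow_mem_evenS ⟨2 * r, by ring⟩

lemma C_LamS_mem_evenS : PowerSeries.C (LamS q) ∈ evenS := by
  have h : (1 - (q : A1) * PowerSeries.X ^ 2) *
      PowerSeries.invOfUnit (1 - (q : A1) * PowerSeries.X ^ 2) 1 = 1 :=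
    PowerSeries.mul_invOfUnit _ _ (by simp)
  have h2 := congrArg (PowerSeries.C (R := A1)) h
  rw [map_mul, map_one] at h2
  rw [LamS, map_mul, map_pow, map_sub, map_mul, map_natCast, map_one]
  refine mul_mem (sub_mem (one_mem _) (mul_mem (natCast_mem _ q) (C_X_pow_mem_evenS (by decide))))
    (pow_mem (evenS_inv h2 ?_) 3)
  rw [map_sub, map_mul, map_natCast, map_one]
  exact sub_mem (one_mem _) (mul_mem (natCast_mem _ q) (C_X_pow_mem_evenS (by decide)))

lemma coeff_evenS_x {F : A2} (hF : F ∈ evenS) {n : ℕ} (hn : Odd n) (k : ℕ) :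
    PowerSeries.coeff n (PowerSeries.coeff k F) = 0 := by
  have h := congrArg (fun G => PowerSeries.coeff n (PowerSeries.coeff k G)) (mem_evenS.1 hF).1
  simp only [PowerSeries.coeff_map, PowerSeries.coeff_rescale, hn.neg_one_pow] at h
  linarith

lemma coeff_evenS_u {F : A2} (hF : F ∈ evenS) {k : ℕ} (hk : Odd k) :
    PowerSeries.coeff k F = 0 := by
  have h := congrArg (PowerSeries.coeff k) (mem_evenS.1 hF).2
  rw [PowerSeries.coeff_rescale, hk.neg_one_pow, neg_one_mul] at h
  ext n
  have h2 := congrArg (PowerSeries.coeff n) h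
  rw [map_neg] at h2
  rw [map_zero]
  linarith

end Parity

end

noncomputable section

open scoped Classical ENNReal

variable {q : ℕ} [Fact q.Prime]

lemma natDegree_ne_zero_of_MIrr (P : MIrr q) : P.1.natDegree ≠ 0 := (natDegree_pos_of_MIrr P).ne'

lemma qchar_prime_of_mem {D : Finset (MIrr q)} {P : MIrr q} (h : P ∈ D) : qchar D P.1 = 0 :=
  Finset.prod_eq_zero h (legSym_eq_zero dvd_rfl)

lemma qchar_prime_sq {D : Finset (MIrr q)} {P : MIrr q} (h : P ∉ D) : qchar D P.1 ^ 2 = 1 := by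
  refine qchar_sq_eq_one fun R hR hdvd => h ?_
  by_contra
  have hne : R ≠ P := by rintro rfl; exact h hR
  exact R.2.2.not_isUnit ((isCoprime_MIrr hne).isUnit_of_dvd' dvd_rfl hdvd)

lemma local_square_identity (D : Finset (MIrr q)) (P : MIrr q) :
    (1 - (PowerSeries.X : A1) ^ (4 * P.1.natDegree)) *
      ((if P ∈ D then thetaS P.1.natDegree else 1) *
      (1 + PowerSeries.C (qchar D P.1 : ℝ) * (2 * iX P.1.natDegree) *
        PowerSeries.X ^ P.1.natDegree) *
      (1 - PowerSeries.C ((qchar D P.1 : ℤ) : ℝ) * PowerSeries.X ^ P.1.natDegree) ^ 2) =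
      (1 - PowerSeries.X ^ (2 * P.1.natDegree)) ^ 3 := by
  have h := mul_iX (natDegree_ne_zero_of_MIrr P)
  have e2 : (PowerSeries.X : A1) ^ (2 * P.1.natDegree) = (PowerSeries.X ^ P.1.natDegree) ^ 2 := by
    rw [← pow_mul]; congr 1; ring
  have e4 : (PowerSeries.X : A1) ^ (4 * P.1.natDegree) = (PowerSeries.X ^ P.1.natDegree) ^ 4 := by
    rw [← pow_mul]; congr 1; ring
  by_cases hP : P ∈ D
  · rw [if_pos hP, qchar_prime_of_mem hP, thetaS]
    simp only [Int.cast_zero, map_zero, zero_mul, add_zero, mul_one, sub_zero, one_pow]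
    rw [e2] at h ⊢
    rw [e4]
    linear_combination (1 - (PowerSeries.X ^ P.1.natDegree : A1) ^ 2) ^ 3 * h
  · have hc : (PowerSeries.C ((qchar D P.1 : ℤ) : ℝ) : A1) ^ 2 = 1 := by
      rw [← map_pow, ← Int.cast_pow, qchar_prime_sq hP, Int.cast_one, map_one]
    rw [if_neg hP]
    rw [e2] at h ⊢
    rw [e4]
    generalize (PowerSeries.C ((qchar D P.1 : ℤ) : ℝ) : A1) = c at *
    generalize (PowerSeries.X ^ P.1.natDegree : A1) = X at *
    generalize iX P.1.natDegree = J at *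
    linear_combination (1 - X ^ 2) * (2 * c * X) * (1 - c * X) ^ 2 * h +
      (1 - X ^ 2) * (-3 * X ^ 2 + 2 * c * X ^ 3 + X ^ 4) * hc

lemma tq_lser_sq (D : Finset (MIrr q)) {N : ℕ} (hD : dg D ≤ N) :
    tq ℝ N (lser ℝ (qchar D) ^ 2) = tq ℝ N (LamS q * (∏ P ∈ D, thetaS P.1.natDegree) *
      ∏ P ∈ primesLE q N, (1 + PowerSeries.C (qchar D P.1 : ℝ) * (2 * iX P.1.natDegree) *
        PowerSeries.X ^ P.1.natDegree)) := by
  set Pr : A1 := ∏ P ∈ primesLE q N,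
    (1 - PowerSeries.C ((qchar D P.1 : ℤ) : ℝ) * PowerSeries.X ^ P.1.natDegree) with hPr
  set Y : A1 := (∏ P ∈ D, thetaS P.1.natDegree) *
      ∏ P ∈ primesLE q N, (1 + PowerSeries.C (qchar D P.1 : ℝ) * (2 * iX P.1.natDegree) *
        PowerSeries.X ^ P.1.natDegree) with hY
  have h1 : tq ℝ N (lser ℝ (qchar D) ^ 2 * Pr ^ 2) = 1 := by
    rw [← mul_pow, map_pow, tq_lser_mul_prod (qchar_one D) (qchar_mul D), one_pow]
  have h2 : (∏ P ∈ primesLE q N, (1 - (PowerSeries.X : A1) ^ (4 * P.1.natDegree))) *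
      (Y * Pr ^ 2) = (∏ P ∈ primesLE q N, (1 - PowerSeries.X ^ (2 * P.1.natDegree))) ^ 3 := by
    rw [hPr, hY, ← Finset.prod_pow, ← Finset.prod_pow]
    have : ∏ P ∈ D, thetaS P.1.natDegree =
        ∏ P ∈ primesLE q N, if P ∈ D then thetaS P.1.natDegree else 1 := by
      rw [Finset.prod_ite_mem, Finset.inter_eq_right.2 (subset_primesLE hD)]
    rw [this, ← Finset.prod_mul_distrib, ← Finset.prod_mul_distrib, ← Finset.prod_mul_distrib]
    exact Finset.prod_congr rfl fun P _ => local_square_identity D P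
  have h3 := congrArg (tq ℝ N) h2
  rw [map_mul, map_pow, tq_prod_one_sub N (by decide : (4 : ℕ) ≠ 0),
    tq_prod_one_sub N (by decide : (2 : ℕ) ≠ 0), ← mul_LamS, ← map_pow, ← map_mul] at h3
  have hu : (1 - (q : A1) * PowerSeries.X ^ 2) *
      PowerSeries.invOfUnit (1 - (q : A1) * PowerSeries.X ^ 2) 1 = 1 :=
    PowerSeries.mul_invOfUnit _ _ (by simp)
  set I := PowerSeries.invOfUnit (1 - (q : A1) * PowerSeries.X ^ 2) 1
  have h4 : tq ℝ N (LamS q * Y * Pr ^ 2) = 1 := by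
    have h5 := congrArg (tq ℝ N (I ^ 3) * ·) h3
    simp only [← map_mul] at h5
    have hI : I ^ 3 * (1 - (q : A1) * PowerSeries.X ^ 2) ^ 3 = 1 := by
      rw [← mul_pow, mul_comm I, hu, one_pow]
    rw [hI, map_one] at h5
    rw [← h5]
    congr 1
    linear_combination -(LamS q * Y * Pr ^ 2) * hI
  rw [mul_assoc, ← hY]
  calc _ = tq ℝ N (lser ℝ (qchar D) ^ 2) * tq ℝ N (LamS q * Y * Pr ^ 2) := by rw [h4, mul_one]
    _ = tq ℝ N (LamS q * Y) * tq ℝ N (lser ℝ (qchar D) ^ 2 * Pr ^ 2) := by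
        rw [← map_mul, ← map_mul]; congr 1; ring
    _ = _ := by rw [h1, mul_one]

lemma coeff_lser_sq (D : Finset (MIrr q)) (n : ℕ) :
    PowerSeries.coeff n (lser ℝ (qchar D) ^ 2) = ∑ d ∈ Finset.range (n + 1), ∑ T ∈ sqf q d,
      (∏ P ∈ T, (qchar D P.1 : ℝ)) * PowerSeries.coeff (n - d)
        (LamS q * (∏ P ∈ T, 2 * iX P.1.natDegree) * ∏ P ∈ D, thetaS P.1.natDegree) := by
  have h := tq_eq_iff.1 (tq_lser_sq D (le_max_left (dg D) n)) n (le_max_right _ _)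
  rw [h, Finset.prod_one_add, Finset.mul_sum, map_sum]
  have e : ∀ T : Finset (MIrr q), PowerSeries.coeff n (LamS q * (∏ P ∈ D, thetaS P.1.natDegree) *
      ∏ P ∈ T, PowerSeries.C (qchar D P.1 : ℝ) * (2 * iX P.1.natDegree) *
        PowerSeries.X ^ P.1.natDegree) = if dg T ≤ n then
      (∏ P ∈ T, (qchar D P.1 : ℝ)) * PowerSeries.coeff (n - dg T)
        (LamS q * (∏ P ∈ T, 2 * iX P.1.natDegree) * ∏ P ∈ D, thetaS P.1.natDegree) else 0 := by
    intro T
    rw [Finset.prod_mul_distrib, Finset.prod_mul_distrib, Finset.prod_pow_eq_pow_sum, ← map_prod,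
      ← PowerSeries.coeff_C_mul, ← PowerSeries.coeff_mul_X_pow']
    congr 1
    rw [dg]
    ring
  rw [Finset.sum_congr rfl fun T _ => e T, ← Finset.sum_filter,
    ← Finset.sum_fiberwise_of_maps_to (t := Finset.range (n + 1)) (g := dg)]
  · refine Finset.sum_congr rfl fun d hd => ?_
    have hd' : d ≤ n := Nat.lt_succ_iff.1 (Finset.mem_range.1 hd)
    refine Finset.sum_congr ?_ fun T hT => ?_
    · ext T
      rw [mem_sqf, Finset.mem_filter, Finset.mem_filter, Finset.mem_powerset]
      refine ⟨fun h => h.2, fun h => ⟨⟨?_, by omega⟩, h⟩⟩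
      exact subset_primesLE (by rw [h]; exact hd'.trans (le_max_right _ _))
    · rw [mem_sqf.1 hT]
  · intro T hT
    exact Finset.mem_range.2 (Nat.lt_succ_of_le (Finset.mem_filter.1 hT).2)

/-- The sum of the `n`-th coefficients of the squared `L`-series over `H_m`. -/
def E (q : ℕ) [Fact q.Prime] (n m : ℕ) : ℝ :=
  ∑ D ∈ sqf q m, PowerSeries.coeff n (lser ℝ (qchar D) ^ 2)

lemma E_eq (hq : q % 4 = 1) (n m : ℕ) : E q n m = ∑ d ∈ Finset.range (n + 1), ∑ T ∈ sqf q d,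
    PowerSeries.coeff (n - d) (LamS q * (∏ P ∈ T, 2 * iX P.1.natDegree) *
      PowerSeries.coeff m (eprod fun P : MIrr q =>
        PowerSeries.C (qchar T P.1 : ℝ) * thetaS P.1.natDegree)) := by
  rw [E, Finset.sum_congr rfl fun D _ => coeff_lser_sq D n, Finset.sum_comm]
  refine Finset.sum_congr rfl fun d _ => ?_
  rw [Finset.sum_comm]
  refine Finset.sum_congr rfl fun T _ => ?_
  rw [coeff_eprod, Finset.mul_sum, map_sum]
  refine Finset.sum_congr rfl fun D _ => ?_
  rw [← PowerSeries.coeff_C_mul, Finset.prod_mul_distrib (s := D)]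
  have : ∏ P ∈ T, (qchar D P.1 : ℝ) = ∏ P ∈ D, (qchar T P.1 : ℝ) := by
    simp only [qchar, Int.cast_prod]
    rw [Finset.prod_comm]
    exact Finset.prod_congr rfl fun P _ => Finset.prod_congr rfl fun R _ => by
      rw [legSym_comm hq]
  rw [this, map_prod]
  congr 1
  ring

lemma local_twist_identity {R : Type*} [CommRing R] {θ u v η c iv : R} (hc : c ^ 2 = 1)
    (hv : v = u ^ 2) (hη : η = (1 - θ) * iv) (hi : (1 - v) * iv = 1) :
    (1 + c * θ * u) * (1 - c * u) = (1 - v) * (1 + η * (v - c * u)) := by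
  subst hv hη
  linear_combination (-(θ * u ^ 2)) * hc - (1 - θ) * (u ^ 2 - c * u) * hi

/-- The summand of the expansion of `E` indexed by `A ⊆ B`, without the factors from `T`. -/
def ZS (A B : Finset (MIrr q)) : A2 :=
  PowerSeries.C (LamS q) * (1 - (q : A2) * PowerSeries.X ^ 2) * (∏ P ∈ B, etaS P.1.natDegree) *
    ((∏ P ∈ A, -PowerSeries.X ^ P.1.natDegree) * ∏ P ∈ B \ A, PowerSeries.X ^ (2 * P.1.natDegree))

lemma tq_eprod_twist (T : Finset (MIrr q)) {N : ℕ} (hT : dg T ≤ N) :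
    tq A1 N (eprod fun P : MIrr q => PowerSeries.C (qchar T P.1 : ℝ) * thetaS P.1.natDegree) =
    tq A1 N (lser A1 (qchar T) * ((1 - (q : A2) * PowerSeries.X ^ 2) *
      (∏ P ∈ T, iV P.1.natDegree) * ∏ P ∈ primesLE q N \ T, (1 + etaS P.1.natDegree *
        (PowerSeries.X ^ (2 * P.1.natDegree) -
          PowerSeries.C ((qchar T P.1 : ℤ) : A1) * PowerSeries.X ^ P.1.natDegree)))) := by
  set Pr : A2 := ∏ P ∈ primesLE q N,
    (1 - PowerSeries.C ((qchar T P.1 : ℤ) : A1) * PowerSeries.X ^ P.1.natDegree) with hPr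
  set W : A2 := ∏ P ∈ primesLE q N \ T, (1 + etaS P.1.natDegree *
        (PowerSeries.X ^ (2 * P.1.natDegree) -
          PowerSeries.C ((qchar T P.1 : ℤ) : A1) * PowerSeries.X ^ P.1.natDegree)) with hW
  have hL : tq A1 N (lser A1 (qchar T)) * tq A1 N Pr = 1 := by
    rw [← map_mul]; exact tq_lser_mul_prod (qchar_one T) (qchar_mul T) N
  have hTN := subset_primesLE hT
  have h1 : (∏ P ∈ primesLE q N, (1 + PowerSeries.C (PowerSeries.C (qchar T P.1 : ℝ) *
      thetaS P.1.natDegree) * PowerSeries.X ^ P.1.natDegree)) * Pr =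
      (∏ P ∈ primesLE q N, (1 - (PowerSeries.X : A2) ^ (2 * P.1.natDegree))) *
        (∏ P ∈ T, iV P.1.natDegree) * W := by
    rw [hPr, ← Finset.prod_mul_distrib, ← Finset.prod_sdiff hTN,
      ← Finset.prod_sdiff (f := fun P : MIrr q => (1 - (PowerSeries.X : A2) ^ (2 * P.1.natDegree)))
      hTN, hW]
    have e1 : ∏ P ∈ T, (1 + PowerSeries.C (PowerSeries.C (qchar T P.1 : ℝ) *
      thetaS P.1.natDegree) * PowerSeries.X ^ P.1.natDegree) * (1 -
        PowerSeries.C ((qchar T P.1 : ℤ) : A1) * PowerSeries.X ^ P.1.natDegree) = 1 := by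
      refine Finset.prod_eq_one fun P hP => ?_
      rw [qchar_prime_of_mem hP]
      simp
    have e2 : (∏ P ∈ T, (1 - (PowerSeries.X : A2) ^ (2 * P.1.natDegree))) *
        (∏ P ∈ T, iV P.1.natDegree) = 1 := by
      rw [← Finset.prod_mul_distrib]
      exact Finset.prod_eq_one fun P hP => mul_iV (natDegree_ne_zero_of_MIrr P)
    rw [e1, mul_one, mul_assoc (∏ P ∈ primesLE q N \ T, _), e2, mul_one, ← Finset.prod_mul_distrib]
    refine Finset.prod_congr rfl fun P hP => ?_
    have hP' := (Finset.mem_sdiff.1 hP).2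
    rw [map_mul]
    have e : (PowerSeries.C (PowerSeries.C (qchar T P.1 : ℝ) : A1) : A2) =
        PowerSeries.C ((qchar T P.1 : ℤ) : A1) := by
      rw [map_intCast (PowerSeries.C (R := ℝ))]
    rw [e]
    refine local_twist_identity (u := (PowerSeries.X : A2) ^ P.1.natDegree)
      (θ := PowerSeries.C (thetaS P.1.natDegree)) (iv := iV P.1.natDegree)
      (c := PowerSeries.C ((qchar T P.1 : ℤ) : A1)) ?_ ?_ ?_
      (mul_iV (natDegree_ne_zero_of_MIrr P))
    · rw [← map_pow, ← Int.cast_pow, qchar_prime_sq hP', Int.cast_one, map_one]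
    · rw [← pow_mul, mul_comm]
    · rw [etaS, ← one_sub_thetaS (natDegree_ne_zero_of_MIrr P), map_sub, map_one]
  have h2 := congrArg (tq A1 N) h1
  rw [map_mul, ← tq_eprod, map_mul, map_mul, tq_prod_one_sub N two_ne_zero] at h2
  simp only [map_mul]
  calc _ = tq A1 N (lser A1 (qchar T)) * (tq A1 N (eprod fun P : MIrr q =>
        PowerSeries.C (qchar T P.1 : ℝ) * thetaS P.1.natDegree) * tq A1 N Pr) := by
        linear_combination -tq A1 N (eprod fun P : MIrr q =>
          PowerSeries.C (qchar T P.1 : ℝ) * thetaS P.1.natDegree) * hL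
    _ = _ := by rw [h2]

end

noncomputable section

open scoped Classical ENNReal

variable {q : ℕ} [Fact q.Prime]

/-- The coefficients of the functional equation of `charSum T` for `dg T = d`. -/
def gam (q d k i : ℕ) : ℝ := (q : ℝ) ^ k / q ^ (d / 2) *
  if Even d then (if i + k + 1 < d then (q : ℝ) - 1 else if i + k + 1 = d then -1 else 0)
  else if i + k + 1 = d then 1 else 0

lemma charSum_flip (hq : q % 4 = 1) {T : Finset (MIrr q)} (hT : T.Nonempty) (k : ℕ) :
    (charSum T k : ℝ) = ∑ i ∈ Finset.range (dg T), gam q (dg T) k i * charSum T i := by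
  have hq0 : (q : ℝ) ≠ 0 := Nat.cast_ne_zero.2 (Fact.out : q.Prime).ne_zero
  by_cases hk : dg T ≤ k
  · rw [charSum_eq_zero hq hT hk, Int.cast_zero]
    refine (Finset.sum_eq_zero fun i _ => ?_).symm
    rw [gam]
    split_ifs <;> first | omega | simp
  rw [not_le] at hk
  simp only [gam, mul_assoc, ← Finset.mul_sum]
  rw [div_mul_eq_mul_div, eq_div_iff (pow_ne_zero _ hq0), mul_comm]
  rcases Nat.even_or_odd' (dg T) with ⟨e, he | he⟩
  · have h := charSum_even hq hT he (k := k) (by omega)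
    have he' : dg T / 2 = e := by omega
    have hev : Even (dg T) := ⟨e, by omega⟩
    rw [he', ← Int.cast_natCast (R := ℝ), ← Int.cast_pow, ← Int.cast_mul, h]
    push_cast
    congr 1
    obtain ⟨j, hj⟩ : ∃ j, dg T = (j + 1) + k := ⟨dg T - k - 1, by omega⟩
    have hj' : 2 * e - 1 - k = j := by omega
    rw [hj', hj, Finset.sum_range_add, Finset.sum_range_succ]
    rw [← hj]
    simp only [if_pos hev]
    have e1 : ∑ i ∈ Finset.range j, (if i + k + 1 < dg T then (q : ℝ) - 1 else
        if i + k + 1 = dg T then -1 else 0) * (charSum T i : ℝ) =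
        (q - 1) * ∑ i ∈ Finset.range j, (charSum T i : ℝ) := by
      rw [Finset.mul_sum]
      refine Finset.sum_congr rfl fun i hi => ?_
      rw [if_pos (by have := Finset.mem_range.1 hi; omega)]
    have e2 : ∑ i ∈ Finset.range k, (if j + 1 + i + k + 1 < dg T then (q : ℝ) - 1 else
        if j + 1 + i + k + 1 = dg T then -1 else 0) * (charSum T (j + 1 + i) : ℝ) = 0 := by
      refine Finset.sum_eq_zero fun i hi => ?_
      rw [if_neg (by omega), if_neg (by omega), zero_mul]
    rw [e1, e2, if_neg (by omega), if_pos (by omega)]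
    ring
  · have h := charSum_odd hq T he (k := k) (by omega)
    have he' : dg T / 2 = e := by omega
    have hev : ¬ Even (dg T) := by rw [Nat.not_even_iff_odd]; exact ⟨e, by omega⟩
    rw [he', ← Int.cast_natCast (R := ℝ), ← Int.cast_pow, ← Int.cast_mul, h]
    push_cast
    congr 1
    rw [Finset.sum_eq_single (2 * e - k)]
    · rw [if_neg hev, if_pos (by omega), one_mul]
    · intro i _ hi
      rw [if_neg hev, if_neg (by omega), zero_mul]
    · intro hi
      exact absurd (Finset.mem_range.2 (by omega)) hi

/-- The generating series of the sums over `T` disjoint from `B`. -/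
def FS (B : Finset (MIrr q)) (V : Fqx q) : A3 :=
  eprod fun P : MIrr q => if P ∈ B then 0 else legSym q V P.1 • ellS P.1.natDegree

lemma coeff_FS (B : Finset (MIrr q)) (V : Fqx q) (d : ℕ) : PowerSeries.coeff d (FS B V) =
    ∑ T ∈ (sqf q d).filter fun T => Disjoint T B,
      qchar T V • ∏ P ∈ T, ellS P.1.natDegree := by
  rw [FS, coeff_eprod, Finset.sum_filter]
  refine Finset.sum_congr rfl fun T _ => ?_
  split_ifs with h
  · rw [qchar, zsmul_eq_mul, Int.cast_prod, ← Finset.prod_mul_distrib]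
    refine Finset.prod_congr rfl fun P hP => ?_
    rw [if_neg (Finset.disjoint_left.1 h hP), zsmul_eq_mul]
  · obtain ⟨P, hP, hB⟩ := Finset.not_disjoint_iff.1 h
    exact Finset.prod_eq_zero hP (if_pos hB)

lemma coeff_eprod_twist (T : Finset (MIrr q)) {m : ℕ} (hT : dg T ≤ m) :
    LamS q * (∏ P ∈ T, 2 * iX P.1.natDegree) * PowerSeries.coeff m (eprod fun P : MIrr q =>
      PowerSeries.C (qchar T P.1 : ℝ) * thetaS P.1.natDegree) =
    ∑ k ∈ Finset.range (m + 1), charSum T k • PowerSeries.coeff (m - k)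
      (∑ B ∈ (primesLE q m \ T).powerset, ∑ A ∈ B.powerset,
        qchar T (pr A) • (ZS A B * ∏ P ∈ T, ellS P.1.natDegree)) := by
  have h := tq_eq_iff.1 (tq_eprod_twist T hT) m le_rfl
  rw [h, ← PowerSeries.coeff_C_mul]
  have e1 : ∏ P ∈ primesLE q m \ T, (1 + etaS P.1.natDegree * ((PowerSeries.X : A2) ^
      (2 * P.1.natDegree) - PowerSeries.C ((qchar T P.1 : ℤ) : A1) *
        PowerSeries.X ^ P.1.natDegree)) = ∑ B ∈ (primesLE q m \ T).powerset, ∑ A ∈ B.powerset,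
      (qchar T (pr A) : A2) * ((∏ P ∈ B, etaS P.1.natDegree) *
    ((∏ P ∈ A, -PowerSeries.X ^ P.1.natDegree) *
      ∏ P ∈ B \ A, PowerSeries.X ^ (2 * P.1.natDegree))) := by
    rw [Finset.prod_one_add]
    refine Finset.sum_congr rfl fun B _ => ?_
    rw [Finset.prod_mul_distrib]
    have : ∀ P : MIrr q, (PowerSeries.X : A2) ^
      (2 * P.1.natDegree) - PowerSeries.C ((qchar T P.1 : ℤ) : A1) *
        PowerSeries.X ^ P.1.natDegree = (qchar T P.1 : A2) * -PowerSeries.X ^ P.1.natDegree +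
          PowerSeries.X ^ (2 * P.1.natDegree) := by
      intro P
      rw [map_intCast]
      ring
    simp only [this]
    rw [Finset.prod_add, Finset.mul_sum]
    refine Finset.sum_congr rfl fun A _ => ?_
    rw [Finset.prod_mul_distrib, pr, qchar_prod, Int.cast_prod]
    ring
  have e2 : PowerSeries.C (LamS q * ∏ P ∈ T, 2 * iX P.1.natDegree) *
      (lser A1 (qchar T) * ((1 - (q : A2) * PowerSeries.X ^ 2) * (∏ P ∈ T, iV P.1.natDegree) *
        ∏ P ∈ primesLE q m \ T, (1 + etaS P.1.natDegree * ((PowerSeries.X : A2) ^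
      (2 * P.1.natDegree) - PowerSeries.C ((qchar T P.1 : ℤ) : A1) *
        PowerSeries.X ^ P.1.natDegree)))) =
      lser A1 (qchar T) * ∑ B ∈ (primesLE q m \ T).powerset, ∑ A ∈ B.powerset,
        qchar T (pr A) • (ZS A B * ∏ P ∈ T, ellS P.1.natDegree) := by
    rw [e1]
    simp only [Finset.mul_sum]
    refine Finset.sum_congr rfl fun B _ => Finset.sum_congr rfl fun A _ => ?_
    rw [zsmul_eq_mul, ZS, map_mul, map_prod]
    simp only [ellS]
    rw [Finset.prod_mul_distrib]
    ring
  rw [e2, PowerSeries.coeff_mul, Finset.Nat.sum_antidiagonal_eq_sum_range_succ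
    (fun i j => PowerSeries.coeff i (lser A1 (qchar T)) * PowerSeries.coeff j _)]
  refine Finset.sum_congr rfl fun k _ => ?_
  rw [lser, PowerSeries.coeff_mk, zsmul_eq_mul, charSum]

lemma E_expand (hq : q % 4 = 1) {n m : ℕ} (hnm : n ≤ m) : E q n m =
    PowerSeries.coeff n (LamS q * PowerSeries.coeff m (eprod fun P : MIrr q =>
      thetaS P.1.natDegree)) + ∑ d ∈ Finset.Icc 1 n, ∑ B ∈ (primesLE q m).powerset,
      ∑ A ∈ B.powerset, ∑ k ∈ Finset.range (m + 1), ∑ i ∈ Finset.range d, gam q d k i *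
        ∑ h ∈ mon q i, PowerSeries.coeff (n - d) (PowerSeries.coeff (m - k)
          (ZS A B * PowerSeries.coeff d (FS B (pr A * h)))) := by
  rw [E_eq hq, Finset.sum_range_eq_add_Ico _ (Nat.succ_pos n)]
  refine congrArg₂ (· + ·) ?_ ?_
  · have : sqf q 0 = {∅} := by
      ext T
      rw [mem_sqf, Finset.mem_singleton]
      refine ⟨fun h => ?_, fun h => by rw [h]; rfl⟩
      by_contra hne
      have := dg_pos (Finset.nonempty_iff_ne_empty.2 hne)
      omega
    rw [this, Finset.sum_singleton]
    simp [qchar]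
  refine Finset.sum_congr rfl fun d hd => ?_
  rw [Finset.mem_Icc] at hd
  have hT : ∀ T ∈ sqf q d, PowerSeries.coeff (n - d) (LamS q *
      (∏ P ∈ T, 2 * iX P.1.natDegree) * PowerSeries.coeff m (eprod fun P : MIrr q =>
      PowerSeries.C (qchar T P.1 : ℝ) * thetaS P.1.natDegree)) =
      ∑ B ∈ (primesLE q m \ T).powerset, ∑ A ∈ B.powerset, ∑ k ∈ Finset.range (m + 1),
      ∑ i ∈ Finset.range d, gam q d k i * ∑ h ∈ mon q i, PowerSeries.coeff (n - d)
        (PowerSeries.coeff (m - k)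
          (ZS A B * (qchar T (pr A * h) • ∏ P ∈ T, ellS P.1.natDegree))) := by
    intro T hT
    rw [mem_sqf] at hT
    have hne : T.Nonempty := by
      rw [Finset.nonempty_iff_ne_empty]
      rintro rfl
      rw [dg, Finset.sum_empty] at hT
      omega
    rw [coeff_eprod_twist T (by omega), map_sum]
    simp only [map_zsmul, map_sum, Finset.smul_sum]
    rw [Finset.sum_comm]
    refine Finset.sum_congr rfl fun B _ => ?_
    rw [Finset.sum_comm]
    refine Finset.sum_congr rfl fun A _ => Finset.sum_congr rfl fun k _ => ?_
    rw [zsmul_eq_mul, charSum_flip hq hne, hT, Finset.sum_mul]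
    refine Finset.sum_congr rfl fun i _ => ?_
    rw [mul_assoc]
    congr 1
    rw [charSum, Int.cast_sum, Finset.sum_mul]
    refine Finset.sum_congr rfl fun h _ => ?_
    simp only [mul_smul_comm, map_zsmul]
    rw [zsmul_eq_mul, zsmul_eq_mul, qchar_mul, Int.cast_mul]
    ring
  rw [Finset.sum_congr rfl hT]
  have hB : ∀ T : Finset (MIrr q), (primesLE q m \ T).powerset =
      (primesLE q m).powerset.filter fun B => Disjoint T B := by
    intro T
    ext B
    rw [Finset.mem_powerset, Finset.mem_filter, Finset.mem_powerset, Finset.subset_sdiff,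
      disjoint_comm]
  simp only [hB, Finset.sum_filter]
  rw [Finset.sum_comm]
  refine Finset.sum_congr rfl fun B _ => ?_
  rw [← Finset.sum_filter, Finset.sum_comm]
  refine Finset.sum_congr rfl fun A _ => ?_
  rw [Finset.sum_comm]
  refine Finset.sum_congr rfl fun k _ => ?_
  rw [Finset.sum_comm]
  refine Finset.sum_congr rfl fun i _ => ?_
  rw [← Finset.mul_sum, Finset.sum_comm]
  congr 1
  refine Finset.sum_congr rfl fun h _ => ?_
  rw [coeff_FS, Finset.mul_sum, map_sum, map_sum]

end

noncomputable section

open scoped Classical ENNReal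

variable {q : ℕ} [Fact q.Prime]

/-- The extended nonnegative real `q ^ a`. -/
def qp (q : ℕ) (a : ℝ) : ℝ≥0∞ := (q : ℝ≥0∞) ^ a

lemma one_lt_q : (1 : ℝ≥0∞) < q := by exact_mod_cast (Fact.out : q.Prime).one_lt

lemma qp_zero : qp q 0 = 1 := ENNReal.rpow_zero

lemma qp_one : qp q 1 = q := ENNReal.rpow_one _

lemma qp_add (a b : ℝ) : qp q (a + b) = qp q a * qp q b :=
  ENNReal.rpow_add _ _ (zero_lt_one.trans one_lt_q).ne' (ENNReal.natCast_ne_top q)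

lemma qp_pow (a : ℝ) (n : ℕ) : qp q a ^ n = qp q (a * n) := by
  rw [qp, qp, ENNReal.rpow_mul, ENNReal.rpow_natCast]

lemma qp_ne_top (a : ℝ) : qp q a ≠ ⊤ :=
  ENNReal.rpow_ne_top_of_ne_zero (zero_lt_one.trans one_lt_q).ne' (ENNReal.natCast_ne_top q)

lemma qp_mono {a b : ℝ} (h : a ≤ b) : qp q a ≤ qp q b :=
  ENNReal.rpow_le_rpow_of_exponent_le one_lt_q.le h

lemma qp_strictMono {a b : ℝ} (h : a < b) : qp q a < qp q b :=
  ENNReal.rpow_lt_rpow_of_exponent_lt one_lt_q (ENNReal.natCast_ne_top q) h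

lemma qp_le_one {a : ℝ} (h : a ≤ 0) : qp q a ≤ 1 := qp_zero (q := q) ▸ qp_mono h

lemma qp_lt_one {a : ℝ} (h : a < 0) : qp q a < 1 := qp_zero (q := q) ▸ qp_strictMono h

lemma one_le_qp {a : ℝ} (h : 0 ≤ a) : 1 ≤ qp q a := qp_zero (q := q) ▸ qp_mono h

lemma qp_nat (n : ℕ) : qp q n = (q : ℝ≥0∞) ^ n := ENNReal.rpow_natCast _ _

lemma q_mul_qp (a : ℝ) : q * qp q a = qp q (1 + a) := by rw [qp_add, qp_one]

lemma qp_toReal (a : ℝ) : (qp q a).toReal = (q : ℝ) ^ a := by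
  rw [qp, ← ENNReal.toReal_rpow, ENNReal.toReal_natCast]

lemma ofReal_q_rpow (a : ℝ) : ENNReal.ofReal ((q : ℝ) ^ a) = qp q a := by
  rw [← qp_toReal, ENNReal.ofReal_toReal (qp_ne_top a)]

lemma inv_one_sub_ne_top {x : ℝ≥0∞} (h : x < 1) : (1 - x)⁻¹ ≠ ⊤ :=
  ENNReal.inv_ne_top.2 (tsub_pos_of_lt h).ne'

lemma tsum_geometric_ne_top {x : ℝ≥0∞} (h : x < 1) : ∑' n, x ^ n ≠ ⊤ := by
  rw [ENNReal.tsum_geometric]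
  exact inv_one_sub_ne_top h

lemma exists_pow_bound (k : ℕ) {ε : ℝ} (hε : 0 < ε) :
    ∃ C : ℝ≥0∞, C ≠ ⊤ ∧ ∀ n : ℕ, (1 + n : ℝ≥0∞) ^ k ≤ C * qp q ε ^ n := by
  have hq : (1 : ℝ) < q := by exact_mod_cast (Fact.out : q.Prime).one_lt
  have hr : |(q : ℝ) ^ (-ε)| < 1 := by
    rw [abs_of_pos (Real.rpow_pos_of_pos (by linarith) _)]
    exact Real.rpow_lt_one_of_one_lt_of_neg hq (by linarith)
  have hs := (summable_pow_mul_geometric_of_norm_lt_one (R := ℝ) k hr)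
  have h1 : Filter.Tendsto (fun n : ℕ => ((n + 1 : ℕ) : ℝ) ^ k * ((q : ℝ) ^ (-ε)) ^ (n + 1))
      Filter.atTop (nhds 0) := (Filter.tendsto_add_atTop_iff_nat 1).2 hs.tendsto_atTop_zero
  obtain ⟨C, hC⟩ := h1.bddAbove_range
  refine ⟨ENNReal.ofReal (C * q ^ ε), ENNReal.ofReal_ne_top, fun n => ?_⟩
  have hn := hC ⟨n, rfl⟩
  have hp : 0 < ((q : ℝ) ^ ε) ^ (n + 1) := pow_pos (Real.rpow_pos_of_pos (by linarith) _) _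
  have hn' : (1 + n : ℝ) ^ k ≤ C * q ^ ε * ((q : ℝ) ^ ε) ^ n := by
    simp only [Real.rpow_neg (by linarith : (0 : ℝ) ≤ q), inv_pow] at hn
    rw [← div_eq_mul_inv, div_le_iff₀ hp] at hn
    push_cast at hn
    rw [pow_succ] at hn
    rw [add_comm]
    linarith
  have hC0 : 0 ≤ C * (q : ℝ) ^ ε := by
    have h0 : (0 : ℝ) < (1 + n : ℝ) ^ k := by positivity
    have h2 : (0 : ℝ) < ((q : ℝ) ^ ε) ^ n := pow_pos (Real.rpow_pos_of_pos (by linarith) _) _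
    by_contra hneg
    rw [not_le] at hneg
    nlinarith
  calc (1 + n : ℝ≥0∞) ^ k = ENNReal.ofReal ((1 + n : ℝ) ^ k) := by
        rw [ENNReal.ofReal_pow (by positivity), ENNReal.ofReal_add one_pos.le (by positivity)]
        simp
    _ ≤ ENNReal.ofReal (C * q ^ ε * ((q : ℝ) ^ ε) ^ n) := ENNReal.ofReal_le_ofReal hn'
    _ = _ := by
        rw [ENNReal.ofReal_mul hC0, ENNReal.ofReal_pow (by positivity), ofReal_q_rpow]

lemma sum_prime_pow_le (S : Finset (MIrr q)) (ρ : ℝ≥0∞) :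
    ∑ P ∈ S, ρ ^ P.1.natDegree ≤ (1 - q * ρ)⁻¹ := by
  rw [← ENNReal.tsum_geometric]
  have hS : ∀ P ∈ S, P.1.natDegree ∈ S.image fun P : MIrr q => P.1.natDegree := fun P hP =>
    Finset.mem_image_of_mem _ hP
  rw [← Finset.sum_fiberwise_of_maps_to hS]
  refine le_trans (Finset.sum_le_sum fun r hr => ?_)
    (ENNReal.sum_le_tsum (S.image fun P : MIrr q => P.1.natDegree))
  obtain ⟨P0, hP0, hr0⟩ := Finset.mem_image.1 hr
  have hr' : r ≠ 0 := by rw [← hr0]; exact natDegree_ne_zero_of_MIrr P0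
  have h1 : ∑ P ∈ S with P.1.natDegree = r, ρ ^ P.1.natDegree =
      ((S.filter fun P : MIrr q => P.1.natDegree = r).card : ℝ≥0∞) * ρ ^ r := by
    rw [← nsmul_eq_mul, ← Finset.sum_const]
    exact Finset.sum_congr rfl fun P hP => by rw [(Finset.mem_filter.1 hP).2]
  rw [h1, mul_pow]
  gcongr
  have h2 : (S.filter fun P : MIrr q => P.1.natDegree = r).card ≤ q ^ r := by
    refine le_trans (Finset.card_le_card fun P hP => ?_) (card_primesDeg_le r)
    exact mem_primesDeg.2 (Finset.mem_filter.1 hP).2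
  exact_mod_cast h2

lemma exists_prime_prod_bound {C ρ : ℝ≥0∞} (hC : C ≠ ⊤) (hρ : q * ρ < 1) :
    ∃ K : ℝ≥0∞, K ≠ ⊤ ∧ ∀ S : Finset (MIrr q), ∏ P ∈ S, (1 + C * ρ ^ P.1.natDegree) ≤ K := by
  have hρ' : ρ ≠ ⊤ := by
    rintro rfl
    rw [ENNReal.mul_top (zero_lt_one.trans one_lt_q).ne'] at hρ
    exact absurd hρ (by simp)
  have hB : C * (1 - q * ρ)⁻¹ ≠ ⊤ := ENNReal.mul_ne_top hC (inv_one_sub_ne_top hρ)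
  refine ⟨ENNReal.ofReal (Real.exp (C * (1 - q * ρ)⁻¹).toReal), ENNReal.ofReal_ne_top,
    fun S => ?_⟩
  have hs : (∑ P ∈ S, C * ρ ^ P.1.natDegree).toReal ≤ (C * (1 - q * ρ)⁻¹).toReal := by
    refine ENNReal.toReal_mono hB ?_
    rw [← Finset.mul_sum]
    gcongr
    exact sum_prime_pow_le S ρ
  have ht : ∀ P ∈ S, C * ρ ^ P.1.natDegree ≠ ⊤ := fun P _ =>
    ENNReal.mul_ne_top hC (ENNReal.pow_ne_top hρ')
  calc ∏ P ∈ S, (1 + C * ρ ^ P.1.natDegree)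
      ≤ ∏ P ∈ S, ENNReal.ofReal (Real.exp (C * ρ ^ P.1.natDegree).toReal) := by
        refine Finset.prod_le_prod' fun P hP => ?_
        rw [ENNReal.le_ofReal_iff_toReal_le (ENNReal.add_ne_top.2 ⟨ENNReal.one_ne_top, ht P hP⟩)
          (Real.exp_pos _).le, ENNReal.toReal_add ENNReal.one_ne_top (ht P hP),
          ENNReal.toReal_one, add_comm]
        exact Real.add_one_le_exp _
    _ = ENNReal.ofReal (Real.exp (∑ P ∈ S, C * ρ ^ P.1.natDegree).toReal) := by
        rw [← ENNReal.ofReal_prod_of_nonneg fun _ _ => (Real.exp_pos _).le, ← Real.exp_sum,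
          ENNReal.toReal_sum ht]
    _ ≤ _ := ENNReal.ofReal_le_ofReal (Real.exp_le_exp.2 hs)

lemma sum_powerset_prod_le {S : Finset (MIrr q)} (f : MIrr q → ℝ≥0∞) :
    ∑ B ∈ S.powerset, ∏ P ∈ B, f P = ∏ P ∈ S, (1 + f P) := (Finset.prod_one_add _).symm

lemma exists_const_prod_bound {K : ℝ≥0∞} (hK : K ≠ ⊤) {ε : ℝ} (hε : 0 < ε) :
    ∃ C : ℝ≥0∞, C ≠ ⊤ ∧ ∀ T : Finset (MIrr q), ∏ _P ∈ T, K ≤ C * qp q ε ^ dg T := by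
  obtain ⟨L, hL⟩ : ∃ L : ℕ, K ≤ qp q ε ^ L := by
    have h := ENNReal.tendsto_pow_atTop_nhds_top_iff.2
      (qp_zero (q := q) ▸ qp_strictMono hε : 1 < qp q ε)
    exact ((h.eventually (lt_mem_nhds (lt_top_iff_ne_top.2 hK))).exists).imp fun _ h => h.le
  obtain ⟨C, hC, h⟩ := exists_prime_prod_bound (q := q) (C := K * qp q 2 ^ L) (ρ := qp q (-2))
    (ENNReal.mul_ne_top hK (ENNReal.pow_ne_top (qp_ne_top _)))
    (by rw [q_mul_qp]; exact qp_lt_one (by norm_num))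
  refine ⟨C, hC, fun T => le_trans ?_ (mul_le_mul_left (h T) _)⟩
  rw [dg, ← Finset.prod_pow_eq_pow_sum, ← Finset.prod_mul_distrib]
  refine Finset.prod_le_prod' fun P _ => ?_
  rcases le_total L P.1.natDegree with hr | hr
  · refine hL.trans ((pow_le_pow_right₀ (one_le_qp hε.le) hr).trans ?_)
    exact le_mul_of_one_le_left' le_self_add
  · refine le_trans ?_ (le_mul_of_one_le_right' (one_le_pow₀ (one_le_qp hε.le)))
    refine le_trans ?_ le_add_self
    rw [mul_assoc]
    refine le_mul_of_one_le_right' ?_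
    rw [qp_pow, qp_pow, ← qp_add]
    refine one_le_qp ?_
    have : (P.1.natDegree : ℝ) ≤ L := by exact_mod_cast hr
    linarith

/-- Rankin's trick for comparing finite sums with the complete series. -/
lemma abs_sum_sub_tsum_le {ι : Type*} {w : ι → ℝ} {h : ι → ℕ} {σ : ℝ} (hσ : 1 ≤ σ)
    (hs : Summable fun τ => |w τ| * σ ^ h τ) (Φ : Finset ι) (m : ℕ)
    (hΦ : ∀ τ ∉ Φ, w τ = 0 ∨ m < h τ) :
    |∑ τ ∈ Φ, w τ - ∑' τ, w τ| ≤ (∑' τ, |w τ| * σ ^ h τ) * (σ ^ m)⁻¹ := by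
  have hσ0 : 0 < σ := zero_lt_one.trans_le hσ
  have hw : Summable w := by
    refine Summable.of_norm_bounded hs fun τ => ?_
    rw [Real.norm_eq_abs]
    exact le_mul_of_one_le_right (abs_nonneg _) (one_le_pow₀ hσ)
  rw [← hw.sum_add_tsum_compl (s := Φ), sub_add_cancel_left, abs_neg, ← div_eq_mul_inv,
    le_div_iff₀ (pow_pos hσ0 m)]
  have hs' := hs.subtype ((Φ : Set ι)ᶜ)
  have hn : Summable fun τ : ((Φ : Set ι)ᶜ : Set ι) => ‖w τ‖ := hw.abs.subtype _
  calc |∑' τ : ((Φ : Set ι)ᶜ : Set ι), w τ| * σ ^ m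
      ≤ (∑' τ : ((Φ : Set ι)ᶜ : Set ι), |w τ|) * σ ^ m := by
        gcongr
        exact norm_tsum_le_tsum_norm hn
    _ = ∑' τ : ((Φ : Set ι)ᶜ : Set ι), |w τ| * σ ^ m := tsum_mul_right.symm
    _ ≤ ∑' τ : ((Φ : Set ι)ᶜ : Set ι), |w τ| * σ ^ h τ := by
        refine Summable.tsum_le_tsum (fun τ => ?_) (hn.mul_right _) hs'
        rcases hΦ τ (fun h => τ.2 (Finset.mem_coe.2 h)) with h0 | hlt
        · rw [h0]; simp
        · gcongr
    _ ≤ ∑' τ, |w τ| * σ ^ h τ :=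
        Summable.tsum_subtype_le _ _ (fun τ => by positivity) hs

lemma summable_of_enorm {ι : Type*} {w : ι → ℝ} {h : ι → ℕ} {a : ℝ}
    (hs : ∑' τ, ‖w τ‖ₑ * qp q a ^ h τ ≠ ⊤) : Summable fun τ => |w τ| * ((q : ℝ) ^ a) ^ h τ := by
  have := ENNReal.summable_toReal hs
  refine this.congr fun τ => ?_
  rw [ENNReal.toReal_mul, toReal_enorm, ENNReal.toReal_pow, qp_toReal, Real.norm_eq_abs]

end

noncomputable section

open scoped Classical ENNReal

variable {q : ℕ} [Fact q.Prime]

/-- Functions of `g` that are `O(q ^ (g * (1 + ε)))` for every `ε > 0`. -/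
def Negl (q : ℕ) (F : ℕ → ℝ) : Prop :=
  ∀ ε : ℝ, 0 < ε → ∃ K : ℝ, ∀ g : ℕ, |F g| ≤ K * (q : ℝ) ^ ((g : ℝ) * (1 + ε))

lemma Negl.add {F G : ℕ → ℝ} (hF : Negl q F) (hG : Negl q G) :
    Negl q fun g => F g + G g := by
  intro ε hε
  obtain ⟨K, hK⟩ := hF ε hε
  obtain ⟨L, hL⟩ := hG ε hε
  refine ⟨K + L, fun g => (abs_add_le _ _).trans ?_⟩
  rw [add_mul]
  exact add_le_add (hK g) (hL g)

lemma q_real_pos : (0 : ℝ) < q := Nat.cast_pos.2 (Fact.out : q.Prime).pos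

lemma one_lt_q_real : (1 : ℝ) < q := by exact_mod_cast (Fact.out : q.Prime).one_lt

lemma exists_pow_bound_real (k : ℕ) {ε : ℝ} (hε : 0 < ε) :
    ∃ C : ℝ, 0 ≤ C ∧ ∀ n : ℕ, (1 + n : ℝ) ^ k ≤ C * (q : ℝ) ^ (ε * n) := by
  obtain ⟨C, hC, h⟩ := exists_pow_bound (q := q) k hε
  refine ⟨C.toReal, ENNReal.toReal_nonneg, fun n => ?_⟩
  have := ENNReal.toReal_mono (ENNReal.mul_ne_top hC (ENNReal.pow_ne_top (qp_ne_top _))) (h n)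
  rw [ENNReal.toReal_mul, qp_pow, qp_toReal, ENNReal.toReal_pow,
    ENNReal.toReal_add ENNReal.one_ne_top (by simp)] at this
  simpa using this

/-- The standard shape of an error term. -/
lemma negl_of_le (k : ℕ) {F : ℕ → ℝ}
    (h : ∀ ε : ℝ, 0 < ε → ε < 1 / 2 → ∃ K : ℝ, 0 ≤ K ∧ ∀ g : ℕ,
      |F g| ≤ K * (1 + (2 * g + 1 : ℕ) : ℝ) ^ k * (q : ℝ) ^ ((1 / 2 + ε) * (2 * g + 1))) :
    Negl q F := by
  intro ε hε
  obtain ⟨δ, hδ, hδ1, hδ2⟩ : ∃ δ : ℝ, 0 < δ ∧ δ < 1 / 2 ∧ 4 * δ ≤ ε :=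
    ⟨min (ε / 4) (1 / 4), lt_min (by linarith) (by norm_num),
      (min_le_right _ _).trans_lt (by norm_num), by linarith [min_le_left (ε / 4) (1 / 4 : ℝ)]⟩
  obtain ⟨K, hK0, hK⟩ := h δ hδ hδ1
  obtain ⟨C, hC0, hC⟩ := exists_pow_bound_real (q := q) k hδ
  refine ⟨K * C * (q : ℝ) ^ (2 : ℝ), fun g => (hK g).trans ?_⟩
  calc K * (1 + (2 * g + 1 : ℕ) : ℝ) ^ k * (q : ℝ) ^ ((1 / 2 + δ) * (2 * g + 1))
      ≤ K * (C * (q : ℝ) ^ (δ * (2 * g + 1 : ℕ))) * (q : ℝ) ^ ((1 / 2 + δ) * (2 * g + 1)) := by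
        gcongr
        exact hC _
    _ = K * C * (q : ℝ) ^ (δ * (2 * g + 1 : ℕ) + (1 / 2 + δ) * (2 * g + 1)) := by
        rw [Real.rpow_add q_real_pos]; ring
    _ ≤ K * C * (q : ℝ) ^ (2 + (g : ℝ) * (1 + ε)) := by
        refine mul_le_mul_of_nonneg_left
          (Real.rpow_le_rpow_of_exponent_le one_lt_q_real.le ?_) (mul_nonneg hK0 hC0)
        push_cast
        have : (0 : ℝ) ≤ g := Nat.cast_nonneg g
        nlinarith
    _ = _ := by rw [Real.rpow_add q_real_pos]; ring

lemma negl_of_rankin {ι : Type*} {w : ι → ℝ} {h : ι → ℕ}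
    (hs : ∀ ε : ℝ, 0 < ε → ε < 1 / 2 → ∑' τ, ‖w τ‖ₑ * qp q (1 / 2 - ε) ^ h τ ≠ ⊤)
    (Φ : ℕ → Finset ι) (hΦ : ∀ g, ∀ τ ∉ Φ g, w τ = 0 ∨ 2 * g + 1 < h τ) (i : ℕ) :
    Negl q fun g => (q : ℝ) ^ (2 * g + 1) *
      ((2 * g + 1) ^ i * (∑ τ ∈ Φ g, w τ - ∑' τ, w τ)) := by
  refine negl_of_le i fun ε hε hε2 => ?_
  have hs' := summable_of_enorm (hs ε hε hε2)
  have hσ : 1 ≤ (q : ℝ) ^ (1 / 2 - ε) := Real.one_le_rpow one_lt_q_real.le (by linarith)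
  refine ⟨∑' τ, |w τ| * ((q : ℝ) ^ (1 / 2 - ε)) ^ h τ,
    tsum_nonneg fun τ => mul_nonneg (abs_nonneg _)
    (pow_nonneg (zero_le_one.trans hσ) _), fun g => ?_⟩
  have h1 := abs_sum_sub_tsum_le hσ hs' (Φ g) (2 * g + 1) (hΦ g)
  have hT : 0 ≤ ∑' τ, |w τ| * ((q : ℝ) ^ (1 / 2 - ε)) ^ h τ :=
    tsum_nonneg fun τ => mul_nonneg (abs_nonneg _) (pow_nonneg (zero_le_one.trans hσ) _)
  set T := ∑' τ, |w τ| * ((q : ℝ) ^ (1 / 2 - ε)) ^ h τ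
  rw [abs_mul, abs_mul, abs_of_pos (pow_pos q_real_pos _),
    abs_of_nonneg (by positivity : (0 : ℝ) ≤ (2 * g + 1) ^ i)]
  calc (q : ℝ) ^ (2 * g + 1) * ((2 * g + 1) ^ i * |∑ τ ∈ Φ g, w τ - ∑' τ, w τ|)
      ≤ (q : ℝ) ^ (2 * g + 1) * ((1 + (2 * g + 1 : ℕ)) ^ i *
        (T * (((q : ℝ) ^ (1 / 2 - ε)) ^ (2 * g + 1))⁻¹)) := by
        have h2 : ((2 * g + 1 : ℝ)) ^ i ≤ (1 + (2 * g + 1 : ℕ)) ^ i :=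
          pow_le_pow_left₀ (by positivity) (by push_cast; linarith) i
        exact mul_le_mul_of_nonneg_left (mul_le_mul h2 h1 (abs_nonneg _) (by positivity))
          (pow_nonneg q_real_pos.le _)
    _ = _ := by
        have e : (q : ℝ) ^ (2 * g + 1) * (((q : ℝ) ^ (1 / 2 - ε)) ^ (2 * g + 1))⁻¹ =
            (q : ℝ) ^ ((1 / 2 + ε) * (2 * g + 1)) := by
          rw [← Real.rpow_natCast, ← Real.rpow_natCast, ← Real.rpow_mul q_real_pos.le,
            ← Real.rpow_neg q_real_pos.le, ← Real.rpow_add q_real_pos]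
          congr 1
          push_cast
          ring
        rw [← e]
        ring

end

noncomputable section

open scoped Classical ENNReal

variable {q : ℕ} [Fact q.Prime]

/-- The generating series of the part of the moment in which no character survives. -/
def QS (q : ℕ) [Fact q.Prime] : A2 :=
  PowerSeries.C (1 - (q : A1) * PowerSeries.X ^ 4) *
    ((1 - (q : A2) * PowerSeries.X) * eprod fun P : MIrr q => thetaS P.1.natDegree)

lemma N2_theta_factor_le {wx wu ρ : ℝ≥0∞} (hx : wx ≤ 1) (h1 : wx ^ 2 * wu ≤ ρ)
    (h2 : wu ^ 2 ≤ ρ) {r : ℕ} (hr : r ≠ 0) :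
    N2 wx wu ((1 - PowerSeries.X ^ r) ^ 1 * (1 + PowerSeries.C (thetaS r) * PowerSeries.X ^ r)) ≤
      1 + 8 * (1 - wx ^ 2)⁻¹ * ρ ^ r := by
  have e : ((1 - PowerSeries.X ^ r) ^ 1 *
      (1 + PowerSeries.C (thetaS r) * PowerSeries.X ^ r) : A2) =
      1 - PowerSeries.C ((3 * PowerSeries.X ^ (2 * r) - PowerSeries.X ^ (4 * r)) * iX r) *
        PowerSeries.X ^ r - PowerSeries.C (thetaS r) * PowerSeries.X ^ (2 * r) := by
    rw [← one_sub_thetaS hr, map_sub, map_one]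
    ring
  rw [e]
  refine (SubNorm.sub_le _ _ _).trans ((add_le_add_left (SubNorm.sub_le _ _ _) _).trans ?_)
  rw [SubNorm.ext_C_mul_X_pow, SubNorm.ext_C_mul_X_pow]
  have b1 : wx ^ (2 * r) * wu ^ r ≤ ρ ^ r := by
    rw [pow_mul, ← mul_pow]; exact pow_le_pow_left' h1 r
  have b2 : wu ^ (2 * r) ≤ ρ ^ r := by
    rw [pow_mul]; exact pow_le_pow_left' h2 r
  calc _ ≤ 1 + 4 * wx ^ (2 * r) * (1 - wx ^ 2)⁻¹ * wu ^ r +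
        4 * (1 - wx ^ 2)⁻¹ * wu ^ (2 * r) :=
        add_le_add (add_le_add (SubNorm.one_le' _) (mul_le_mul_left (N1_one_sub_thetaS_le hx hr) _))
          (mul_le_mul_left (N1_thetaS_le hx hr) _)
    _ = 1 + 4 * (1 - wx ^ 2)⁻¹ * (wx ^ (2 * r) * wu ^ r) +
        4 * (1 - wx ^ 2)⁻¹ * wu ^ (2 * r) := by ring
    _ ≤ 1 + 4 * (1 - wx ^ 2)⁻¹ * ρ ^ r + 4 * (1 - wx ^ 2)⁻¹ * ρ ^ r := by gcongr
    _ = _ := by ring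

lemma N2_QS_ne_top {a b : ℝ} (ha : 0 < a) (hab : 1 < 2 * a + b) (hb : 1 < 2 * b) :
    N2 (qp q (-a)) (qp q (-b)) (QS q) ≠ ⊤ := by
  have hx : qp q (-a) ^ 2 < 1 := by
    rw [qp_pow]; exact qp_lt_one (by push_cast; linarith)
  have hx1 : qp q (-a) ≤ 1 := qp_le_one (by linarith)
  set c : ℝ := min (2 * a + b) (2 * b)
  have hc : 1 < c := lt_min hab hb
  obtain ⟨K, hK, h⟩ := exists_prime_prod_bound (q := q)
    (C := 8 * (1 - qp q (-a) ^ 2)⁻¹) (ρ := qp q (-c))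
    (ENNReal.mul_ne_top (by simp) (inv_one_sub_ne_top hx))
    (by rw [q_mul_qp]; exact qp_lt_one (by linarith))
  have hH : N2 (qp q (-a)) (qp q (-b)) ((1 - (q : A2) * PowerSeries.X) ^ 1 *
      eprod fun P : MIrr q => thetaS P.1.natDegree) ≤ K := by
    refine ext_pow_mul_eprod_le _ _ _ fun n => le_trans ?_ (h (primesLE q n))
    refine Finset.prod_le_prod' fun P _ => N2_theta_factor_le hx1 ?_ ?_
      (natDegree_ne_zero_of_MIrr P)
    · rw [qp_pow, ← qp_add]
      exact qp_mono (by push_cast; linarith [min_le_left (2 * a + b) (2 * b)])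
    · rw [qp_pow]
      exact qp_mono (by push_cast; linarith [min_le_right (2 * a + b) (2 * b)])
  rw [pow_one] at hH
  refine ne_top_of_le_ne_top (b := (1 + q * 1) * K)
    (ENNReal.mul_ne_top (by simp) hK) ?_
  refine (SubNorm.mul_le' _ _ _).trans (mul_le_mul' ?_ hH)
  rw [SubNorm.ext_C]
  refine (SubNorm.sub_le _ _ _).trans (add_le_add (SubNorm.one_le' _) ?_)
  refine (SubNorm.mul_le' _ _ _).trans (mul_le_mul' (SubNorm.natCast_le _ _) ?_)
  exact (SubNorm.ext_X_pow_le _ _).trans (pow_le_one' hx1 _)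

/-- The coefficient of `u ^ i x ^ s` in `QS`. -/
def Qc (q : ℕ) [Fact q.Prime] (s i : ℕ) : ℝ := PowerSeries.coeff s (PowerSeries.coeff i (QS q))

lemma Qc_tsum_ne_top {a b : ℝ} (ha : 0 < a) (hab : 1 < 2 * a + b) (hb : 1 < 2 * b) :
    ∑' τ : ℕ × ℕ, ‖Qc q τ.1 τ.2‖ₑ * qp q (-a) ^ τ.1 * qp q (-b) ^ τ.2 ≠ ⊤ := by
  have := N2_QS_ne_top (q := q) ha hab hb
  rw [SubNorm.ext_apply] at this
  convert this using 1
  rw [ENNReal.tsum_prod', ENNReal.tsum_comm]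
  refine tsum_congr fun i => ?_
  dsimp only
  rw [ENNReal.tsum_mul_right]
  rfl

lemma Qc_tsum_pow_ne_top {a b : ℝ} (ha : 0 < a) (hab : 1 < 2 * a + b) (hb : 1 < 2 * b) (k : ℕ) :
    ∑' τ : ℕ × ℕ, ‖Qc q τ.1 τ.2‖ₑ * (1 + τ.1) ^ k * qp q (-a) ^ τ.1 * qp q (-b) ^ τ.2 ≠ ⊤ := by
  obtain ⟨δ, hδ, hδa, hδb⟩ : ∃ δ : ℝ, 0 < δ ∧ δ < a ∧ 1 < 2 * (a - δ) + b :=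
    ⟨min (a / 2) ((2 * a + b - 1) / 4), lt_min (by linarith) (by linarith),
      (min_le_left _ _).trans_lt (by linarith),
      by linarith [min_le_right (a / 2) ((2 * a + b - 1) / 4)]⟩
  obtain ⟨C, hC, h⟩ := exists_pow_bound (q := q) k hδ
  refine ne_top_of_le_ne_top (ENNReal.mul_ne_top hC
    (Qc_tsum_ne_top (q := q) (sub_pos.2 hδa) hδb hb)) ?_
  rw [← ENNReal.tsum_mul_left]
  refine ENNReal.tsum_le_tsum fun τ => ?_
  calc _ ≤ ‖Qc q τ.1 τ.2‖ₑ * (C * qp q δ ^ τ.1) * qp q (-a) ^ τ.1 * qp q (-b) ^ τ.2 := by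
        gcongr; exact h _
    _ = C * (‖Qc q τ.1 τ.2‖ₑ * (qp q δ * qp q (-a)) ^ τ.1 * qp q (-b) ^ τ.2) := by
        rw [mul_pow]; ring
    _ = _ := by rw [← qp_add, show δ + -a = -(a - δ) by ring]

lemma rpow_max_le {σ : ℝ≥0∞} (s i : ℕ) : σ ^ max s i ≤ σ ^ s + σ ^ i := by
  rcases le_total s i with h | h
  · rw [max_eq_right h]; exact le_add_self
  · rw [max_eq_left h]; exact le_self_add

lemma Qc_weight_ne_top (k : ℕ) {ε : ℝ} (hε : 0 < ε) (hε2 : ε < 1 / 2) :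
    ∑' τ : ℕ × ℕ, ‖Qc q τ.1 τ.2‖ₑ * (1 + τ.1) ^ k * qp q (-(1 / 2)) ^ τ.1 * qp q (-1) ^ τ.2 *
      qp q (1 / 2 - ε) ^ max τ.1 τ.2 ≠ ⊤ := by
  have h1 := Qc_tsum_pow_ne_top (q := q) (a := ε) (b := 1) hε (by linarith) (by norm_num) k
  have h2 := Qc_tsum_pow_ne_top (q := q) (a := 1 / 2) (b := 1 / 2 + ε) (by norm_num)
    (by linarith) (by linarith) k
  refine ne_top_of_le_ne_top (ENNReal.add_ne_top.2 ⟨h1, h2⟩) ?_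
  rw [← ENNReal.tsum_add]
  refine ENNReal.tsum_le_tsum fun τ => (mul_le_mul_right (rpow_max_le _ _) _).trans (le_of_eq ?_)
  rw [show -ε = -(1 / 2) + (1 / 2 - ε) by ring, show -(1 / 2 + ε) = -1 + (1 / 2 - ε) by ring,
    qp_add (-(1 / 2)), qp_add (-1), mul_pow, mul_pow]
  ring

end

noncomputable section

open scoped Classical ENNReal

variable {q : ℕ} [Fact q.Prime]

/-- The series `(1 - X)⁻¹ (1 - X ^ 2)^(-k)`. -/
def TS (k : ℕ) : A1 := PowerSeries.mk fun j => ((j / 2 + k).choose k : ℝ)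

lemma one_sub_mul_TS_zero : (1 - PowerSeries.X) * TS 0 = 1 := by
  ext j
  rw [sub_mul, one_mul, map_sub]
  cases j with
  | zero => simp [TS]
  | succ j => simp [TS, PowerSeries.coeff_succ_X_mul, PowerSeries.coeff_one]

lemma one_sub_sq_mul_TS (k : ℕ) : (1 - PowerSeries.X ^ 2) * TS (k + 1) = TS k := by
  ext j
  rw [sub_mul, one_mul, map_sub, PowerSeries.coeff_X_pow_mul']
  rcases j with _ | _ | j
  · simp [TS]
  · simp [TS]
  · rw [if_pos (by omega)]
    simp only [TS, PowerSeries.coeff_mk]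
    rw [show (j + 1 + 1) / 2 + (k + 1) = (j / 2 + k + 1) + 1 by omega,
      show (j + 1 + 1) / 2 + k = j / 2 + k + 1 by omega,
      show (j + 1 + 1 - 2) / 2 + (k + 1) = j / 2 + k + 1 by omega, Nat.choose_succ_succ]
    push_cast
    ring

lemma one_sub_mul_TS_three : (1 - PowerSeries.X) * ((1 - PowerSeries.X ^ 2) ^ 3 * TS 3) = 1 := by
  rw [pow_succ, pow_succ, pow_one, mul_assoc, one_sub_sq_mul_TS, mul_assoc, one_sub_sq_mul_TS,
    one_sub_sq_mul_TS, one_sub_mul_TS_zero]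

lemma coeff_one_add_mul_TS (t : ℕ) : PowerSeries.coeff (2 * t) ((1 + PowerSeries.X) * TS 3) =
    ((2 * t : ℝ) + 2) * (2 * t + 3) * (2 * t + 4) / 24 := by
  have e (n : ℕ) : ((n + 3).choose 3 : ℝ) = (n + 1) * (n + 2) * (n + 3) / 6 := by
    rw [Nat.cast_choose_eq_ascPochhammer_div]
    simp [ascPochhammer_succ_eval, Nat.factorial]
    ring
  rw [add_mul, one_mul, map_add]
  rcases t with _ | t
  · simp [TS]; norm_num
  · rw [show 2 * (t + 1) = 2 * t + 1 + 1 by ring, PowerSeries.coeff_succ_X_mul]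
    simp only [TS, PowerSeries.coeff_mk]
    rw [show (2 * t + 1 + 1) / 2 = t + 1 by omega, show (2 * t + 1) / 2 = t by omega, e, e]
    push_cast
    ring

lemma sum_range_pow_mul_coeff (c : ℝ) (F : A1) (N : ℕ) :
    ∑ n ∈ Finset.range (N + 1), c ^ n * PowerSeries.coeff n F =
      PowerSeries.coeff N (TS 0 * PowerSeries.rescale c F) := by
  rw [PowerSeries.coeff_mul, Finset.Nat.sum_antidiagonal_eq_sum_range_succ_mk,
    ← Finset.sum_range_reflect]
  refine Finset.sum_congr rfl fun n hn => ?_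
  rw [Finset.mem_range] at hn
  simp only [PowerSeries.coeff_rescale, TS, PowerSeries.coeff_mk]
  rw [show N + 1 - 1 - n = N - n by omega]
  simp

/-- The two partial sums of the approximate functional equation, together. -/
lemma sum_range_add_sum_range (c : ℝ) (F : A1) (g : ℕ) :
    ∑ n ∈ Finset.range (2 * g + 1), c ^ n * PowerSeries.coeff n F +
      ∑ n ∈ Finset.range (2 * g), c ^ n * PowerSeries.coeff n F =
    PowerSeries.coeff (2 * g) ((1 + PowerSeries.X) * (TS 0 * PowerSeries.rescale c F)) := by
  rw [add_mul, one_mul, map_add, sum_range_pow_mul_coeff]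
  rcases g with _ | g
  · simp
  · rw [show 2 * (g + 1) = 2 * g + 1 + 1 by ring, PowerSeries.coeff_succ_X_mul,
      sum_range_pow_mul_coeff]

lemma TS_zero_mul_rescale_LamS {c : ℝ} (hc : c ^ 2 * q = 1) (f : A1) :
    TS 0 * PowerSeries.rescale c (LamS q * f) =
      TS 3 * PowerSeries.rescale c ((1 - (q : A1) * PowerSeries.X ^ 4) * f) := by
  have h1 := congrArg (PowerSeries.rescale c) (mul_LamS (q := q))
  rw [map_mul, map_pow, map_sub, map_mul, map_pow, PowerSeries.rescale_X, map_one, map_natCast,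
    mul_pow, ← mul_assoc, ← map_pow, ← map_natCast (PowerSeries.C (R := ℝ)), ← map_mul,
    mul_comm _ (c ^ 2), hc, map_one, one_mul, map_natCast] at h1
  have h0 := one_sub_mul_TS_zero
  have h3 := one_sub_mul_TS_three
  have h03 : TS 0 = (1 - PowerSeries.X ^ 2) ^ 3 * TS 3 := by
    linear_combination ((1 - PowerSeries.X ^ 2) ^ 3 * TS 3) * h0 - (TS 0) * h3
  rw [map_mul, map_mul _ (1 - _), ← h1, h03]
  ring

lemma coeff_eq_sum_of_one_sub_mul {A : Type*} [CommRing A] {a : A} {F G : PowerSeries A}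
    (h : (1 - PowerSeries.C a * PowerSeries.X) * F = G) (m : ℕ) :
    PowerSeries.coeff m F =
      ∑ i ∈ Finset.range (m + 1), a ^ (m - i) * PowerSeries.coeff i G := by
  have hF : F = G + PowerSeries.C a * (PowerSeries.X * F) := by rw [← h]; ring
  induction m with
  | zero => rw [hF]; simp
  | succ m ih =>
    rw [Finset.sum_range_succ, hF, map_add, PowerSeries.coeff_C_mul, PowerSeries.coeff_succ_X_mul,
      ih, Finset.mul_sum, add_comm, Nat.sub_self, pow_zero, one_mul]
    congr 1
    refine Finset.sum_congr rfl fun i hi => ?_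
    rw [Finset.mem_range] at hi
    rw [show m + 1 - i = m - i + 1 by omega, pow_succ]
    ring

lemma coeff_eprod_theta (m : ℕ) : (1 - (q : A1) * PowerSeries.X ^ 4) *
    PowerSeries.coeff m (eprod fun P : MIrr q => thetaS P.1.natDegree) =
      ∑ i ∈ Finset.range (m + 1), (q : A1) ^ (m - i) * PowerSeries.coeff i (QS q) := by
  rw [← PowerSeries.coeff_C_mul]
  refine coeff_eq_sum_of_one_sub_mul ?_ m
  rw [QS, map_natCast]
  ring

lemma Qc_odd {s : ℕ} (hs : Odd s) (i : ℕ) : Qc q s i = 0 := by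
  have h : (PowerSeries.C (PowerSeries.coeff i (QS q)) : A2) ∈ evenS := by
    have hE (i : ℕ) : (PowerSeries.C (PowerSeries.coeff i
        (eprod fun P : MIrr q => thetaS P.1.natDegree)) : A2) ∈ evenS := by
      rw [coeff_eprod, map_sum]
      refine sum_mem fun D _ => ?_
      rw [map_prod]
      refine prod_mem fun P _ => ?_
      rw [thetaS, map_mul, map_pow, map_sub, map_one]
      exact mul_mem (pow_mem (sub_mem (one_mem _) (C_X_pow_mem_evenS (even_two_mul _))) _)
        (C_iX_mem_evenS (natDegree_ne_zero_of_MIrr P))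
    have h2 : (PowerSeries.C (PowerSeries.coeff i ((1 - (q : A2) * PowerSeries.X) *
        eprod fun P : MIrr q => thetaS P.1.natDegree)) : A2) ∈ evenS := by
      rw [← map_natCast (PowerSeries.C (R := A1)), sub_mul, one_mul, mul_assoc, map_sub,
        PowerSeries.coeff_C_mul, map_sub, map_mul (PowerSeries.C (R := A1)) (q : A1), map_natCast]
      refine sub_mem (hE i) (mul_mem (natCast_mem _ _) ?_)
      rcases i with _ | i
      · simp
      · rw [PowerSeries.coeff_succ_X_mul]; exact hE i
    rw [QS, PowerSeries.coeff_C_mul, map_mul, map_sub, map_mul, map_one, map_natCast]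
    exact mul_mem (sub_mem (one_mem _) (mul_mem (natCast_mem _ _)
      (C_X_pow_mem_evenS (by decide)))) h2
  simpa [Qc] using coeff_evenS_x h hs 0

/-- The contribution of the trivial character to the two partial sums. -/
lemma main_sum_eq {c : ℝ} (hc : c ^ 2 * q = 1) (g : ℕ) :
    ∑ n ∈ Finset.range (2 * g + 1), c ^ n * PowerSeries.coeff n (LamS q *
        PowerSeries.coeff (2 * g + 1) (eprod fun P : MIrr q => thetaS P.1.natDegree)) +
      ∑ n ∈ Finset.range (2 * g), c ^ n * PowerSeries.coeff n (LamS q *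
        PowerSeries.coeff (2 * g + 1) (eprod fun P : MIrr q => thetaS P.1.natDegree)) =
    (q : ℝ) ^ (2 * g + 1) * ∑ τ ∈ Finset.range (2 * g + 1) ×ˢ Finset.range (2 * g + 2),
      Qc q τ.1 τ.2 * c ^ τ.1 * (q : ℝ)⁻¹ ^ τ.2 *
        (((2 * g + 1 : ℝ) - τ.1 + 1) * ((2 * g + 1 : ℝ) - τ.1 + 2) *
          ((2 * g + 1 : ℝ) - τ.1 + 3) / 24) := by
  rw [sum_range_add_sum_range, TS_zero_mul_rescale_LamS hc, coeff_eprod_theta, ← mul_assoc,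
    mul_comm (_ * TS 3), PowerSeries.coeff_mul, Finset.Nat.sum_antidiagonal_eq_sum_range_succ_mk,
    Finset.sum_product, Finset.mul_sum]
  refine Finset.sum_congr rfl fun s hs => ?_
  rw [Finset.mem_range] at hs
  dsimp only
  rw [PowerSeries.coeff_rescale, map_sum, Finset.mul_sum, Finset.sum_mul, Finset.mul_sum]
  refine Finset.sum_congr rfl fun i hi => ?_
  rw [Finset.mem_range] at hi
  have e1 : PowerSeries.coeff s ((q : A1) ^ (2 * g + 1 - i) * PowerSeries.coeff i (QS q)) =
      (q : ℝ) ^ (2 * g + 1 - i) * Qc q s i := by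
    rw [← map_natCast (PowerSeries.C (R := ℝ)), ← map_pow, PowerSeries.coeff_C_mul, Qc]
  rw [e1]
  rcases Nat.even_or_odd s with h | h
  · obtain ⟨t, rfl⟩ := h
    rw [show 2 * g - (t + t) = 2 * (g - t) by omega, coeff_one_add_mul_TS,
      Nat.cast_sub (by omega : t ≤ g), pow_sub₀ _ q_real_pos.ne' (by omega : i ≤ 2 * g + 1),
      inv_pow]
    push_cast
    ring
  · rw [Qc_odd h]; ring

end

noncomputable section

open scoped Classical ENNReal

variable {q : ℕ} [Fact q.Prime]

/-- `q ^ (-1/2)`. -/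
def rq (q : ℕ) : ℝ := (q : ℝ) ^ (-(1 / 2) : ℝ)

lemma rq_pos : 0 < rq q := Real.rpow_pos_of_pos q_real_pos _

lemma rq_sq : rq q ^ 2 * q = 1 := by
  rw [rq, ← Real.rpow_natCast, ← Real.rpow_mul q_real_pos.le, ← Real.rpow_add_one q_real_pos.ne']
  norm_num

lemma enorm_rq : ‖rq q‖ₑ = qp q (-(1 / 2)) := by
  rw [Real.enorm_of_nonneg rq_pos.le, rq, ofReal_q_rpow]

lemma enorm_q_inv : ‖(q : ℝ)⁻¹‖ₑ = qp q (-1) := by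
  rw [Real.enorm_of_nonneg (inv_nonneg.2 q_real_pos.le), ← Real.rpow_neg_one, ofReal_q_rpow]

/-- The coefficients of `(m - s + 1) (m - s + 2) (m - s + 3)` as a polynomial in `m`. -/
def cubicCoeff (s : ℝ) : ℕ → ℝ
  | 0 => -s ^ 3 + 6 * s ^ 2 - 11 * s + 6
  | 1 => 3 * s ^ 2 - 12 * s + 11
  | 2 => 6 - 3 * s
  | _ => 1

lemma sum_cubicCoeff (s m : ℝ) : ∑ b ∈ Finset.range 4, cubicCoeff s b * m ^ b =
    (m - s + 1) * (m - s + 2) * (m - s + 3) := by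
  simp only [Finset.sum_range_succ, Finset.sum_range_zero, cubicCoeff]
  ring

lemma abs_cubicCoeff_le (s b : ℕ) : |cubicCoeff s b / 24| ≤ (1 + s : ℝ) ^ 3 := by
  have hs : (0 : ℝ) ≤ s := Nat.cast_nonneg s
  have h2 := mul_nonneg hs hs
  have h3 := mul_nonneg h2 hs
  rw [abs_le]
  rcases b with _ | _ | _ | b <;> simp only [cubicCoeff] <;> constructor <;> nlinarith

/-- The weights in the contribution of the trivial character. -/
def mainW (q : ℕ) [Fact q.Prime] (τ : ℕ × ℕ) : ℝ := Qc q τ.1 τ.2 * rq q ^ τ.1 * (q : ℝ)⁻¹ ^ τ.2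

lemma mainW_tsum_ne_top (b : ℕ) {ε : ℝ} (hε : 0 < ε) (hε2 : ε < 1 / 2) :
    ∑' τ : ℕ × ℕ, ‖mainW q τ * (cubicCoeff τ.1 b / 24)‖ₑ * qp q (1 / 2 - ε) ^ max τ.1 τ.2 ≠ ⊤ := by
  refine ne_top_of_le_ne_top (Qc_weight_ne_top (q := q) 3 hε hε2) (ENNReal.tsum_le_tsum fun τ => ?_)
  gcongr
  rw [mainW, enorm_mul, enorm_mul, enorm_mul, enorm_pow, enorm_pow, enorm_rq, enorm_q_inv]
  have : ‖cubicCoeff τ.1 b / 24‖ₑ ≤ (1 + τ.1 : ℝ≥0∞) ^ 3 := by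
    rw [Real.enorm_eq_ofReal_abs]
    refine (ENNReal.ofReal_le_ofReal (abs_cubicCoeff_le _ _)).trans (le_of_eq ?_)
    rw [ENNReal.ofReal_pow (by positivity), ENNReal.ofReal_add one_pos.le (Nat.cast_nonneg _),
      ENNReal.ofReal_one, ENNReal.ofReal_natCast]
  calc _ ≤ ‖Qc q τ.1 τ.2‖ₑ * qp q (-(1 / 2)) ^ τ.1 * qp q (-1) ^ τ.2 *
        (1 + τ.1 : ℝ≥0∞) ^ 3 := by gcongr
    _ = _ := by ring

/-- The contribution of the trivial character to the moment. -/
def mainS (q : ℕ) [Fact q.Prime] (g : ℕ) : ℝ :=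
  ∑ n ∈ Finset.range (2 * g + 1), rq q ^ n * PowerSeries.coeff n (LamS q *
      PowerSeries.coeff (2 * g + 1) (eprod fun P : MIrr q => thetaS P.1.natDegree)) +
    ∑ n ∈ Finset.range (2 * g), rq q ^ n * PowerSeries.coeff n (LamS q *
      PowerSeries.coeff (2 * g + 1) (eprod fun P : MIrr q => thetaS P.1.natDegree))

lemma main_contribution : ∃ R : ℝ[X], R.natDegree ≤ 3 ∧ R.coeff 3 = (∑' τ, mainW q τ) / 24 ∧
    Negl q fun g => mainS q g - (q : ℝ) ^ (2 * g + 1) * R.eval (2 * g + 1 : ℝ) := by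
  set T : ℕ → ℝ := fun b => ∑' τ : ℕ × ℕ, mainW q τ * (cubicCoeff τ.1 b / 24) with hT
  have hN (b : ℕ) := negl_of_rankin (q := q)
    (w := fun τ : ℕ × ℕ => mainW q τ * (cubicCoeff τ.1 b / 24))
    (h := fun τ => max τ.1 τ.2) (fun ε => mainW_tsum_ne_top b)
    (fun g => Finset.range (2 * g + 1) ×ˢ Finset.range (2 * g + 2)) (fun g τ hτ => by
      rw [Finset.mem_product, Finset.mem_range, Finset.mem_range, not_and_or] at hτ
      rcases hτ with h | h
      · rcases eq_or_lt_of_le (not_lt.1 h) with h | h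
        · left; rw [mainW, Qc_odd ⟨g, h.symm⟩]; ring
        · right; exact lt_max_of_lt_left h
      · right; exact lt_max_of_lt_right (by omega)) b
  refine ⟨∑ b ∈ Finset.range 4, C (T b) * X ^ b, ?_, ?_, ?_⟩
  · refine natDegree_sum_le_of_forall_le _ _ fun b hb => ?_
    rw [Finset.mem_range] at hb
    exact (natDegree_C_mul_X_pow_le _ _).trans (by omega)
  · rw [finsetSum_coeff]
    simp only [coeff_C_mul_X_pow]
    rw [Finset.sum_ite_eq, if_pos (by simp), hT]
    simp only [cubicCoeff, tsum_mul_right]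
    ring
  · have := (((hN 0).add (hN 1)).add (hN 2)).add (hN 3)
    convert this using 2 with g
    rw [mainS, main_sum_eq rq_sq, eval_finsetSum]
    simp only [eval_mul, eval_C, eval_pow, eval_X, Finset.sum_range_succ, Finset.sum_range_zero]
    have e (τ : ℕ × ℕ) := sum_cubicCoeff τ.1 (2 * g + 1)
    simp only [← e, Finset.sum_range_succ, Finset.sum_range_zero, zero_add]
    have e2 : ∑ τ ∈ Finset.range (2 * g + 1) ×ˢ Finset.range (2 * g + 2),
        Qc q τ.1 τ.2 * rq q ^ τ.1 * (q : ℝ)⁻¹ ^ τ.2 * ((cubicCoeff τ.1 0 * (2 * g + 1) ^ 0 +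
          cubicCoeff τ.1 1 * (2 * g + 1) ^ 1 + cubicCoeff τ.1 2 * (2 * g + 1) ^ 2 +
          cubicCoeff τ.1 3 * (2 * g + 1) ^ 3) / 24) =
        ∑ τ ∈ Finset.range (2 * g + 1) ×ˢ Finset.range (2 * g + 2),
          ((2 * g + 1) ^ 0 * (mainW q τ * (cubicCoeff τ.1 0 / 24)) +
          (2 * g + 1) ^ 1 * (mainW q τ * (cubicCoeff τ.1 1 / 24)) +
          (2 * g + 1) ^ 2 * (mainW q τ * (cubicCoeff τ.1 2 / 24)) +
          (2 * g + 1) ^ 3 * (mainW q τ * (cubicCoeff τ.1 3 / 24))) :=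
      Finset.sum_congr rfl fun τ _ => by rw [mainW]; ring
    rw [e2]
    simp only [Finset.sum_add_distrib, ← Finset.mul_sum, hT]
    ring

end

noncomputable section

open scoped Classical ENNReal

variable {q : ℕ} [Fact q.Prime]

/-- The value at `c` of a real power series. -/
def ev (c : ℝ) (F : A1) : ℝ := ∑' n, PowerSeries.coeff n F * c ^ n

section Ev

variable {c : ℝ} {F G : A1}

lemma summable_norm_ev (hF : N1 ‖c‖ₑ F ≠ ⊤) :
    Summable fun n => ‖PowerSeries.coeff n F * c ^ n‖ := by
  have h : (fun n => ‖PowerSeries.coeff n F * c ^ n‖) =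
      fun n => (‖PowerSeries.coeff n F‖ₑ * ‖c‖ₑ ^ n).toReal := by
    funext n
    rw [← enorm_pow, ← enorm_mul, toReal_enorm]
  rw [h]
  exact ENNReal.summable_toReal hF

lemma ev_mul (hF : N1 ‖c‖ₑ F ≠ ⊤) (hG : N1 ‖c‖ₑ G ≠ ⊤) : ev c (F * G) = ev c F * ev c G := by
  rw [ev, ev, ev, tsum_mul_tsum_eq_tsum_sum_antidiagonal_of_summable_norm (summable_norm_ev hF)
    (summable_norm_ev hG)]
  refine tsum_congr fun n => ?_
  rw [PowerSeries.coeff_mul, Finset.sum_mul]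
  refine Finset.sum_congr rfl fun p hp => ?_
  rw [← Finset.HasAntidiagonal.mem_antidiagonal.1 hp, pow_add]
  ring

lemma ev_add (hF : N1 ‖c‖ₑ F ≠ ⊤) (hG : N1 ‖c‖ₑ G ≠ ⊤) : ev c (F + G) = ev c F + ev c G := by
  rw [ev, ev, ev, ← (summable_norm_ev hF).of_norm.tsum_add (summable_norm_ev hG).of_norm]
  exact tsum_congr fun n => by rw [map_add, add_mul]

lemma ev_C_mul (a : ℝ) : ev c (PowerSeries.C a * F) = a * ev c F := by
  rw [ev, ev, ← tsum_mul_left]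
  exact tsum_congr fun n => by rw [PowerSeries.coeff_C_mul, mul_assoc]

lemma ev_X_pow (n : ℕ) : ev c (PowerSeries.X ^ n) = c ^ n := by
  rw [ev, tsum_eq_single n fun k hk => by rw [PowerSeries.coeff_X_pow, if_neg hk, zero_mul],
    PowerSeries.coeff_X_pow_self, one_mul]

lemma ev_one : ev c 1 = 1 := by simpa using ev_X_pow (c := c) 0

lemma N1_ne_top_C_mul_X_pow (a : ℝ) (n : ℕ) :
    N1 ‖c‖ₑ (PowerSeries.C a * PowerSeries.X ^ n) ≠ ⊤ := by
  rw [SubNorm.ext_C_mul_X_pow]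
  exact ENNReal.mul_ne_top enorm_ne_top (ENNReal.pow_ne_top enorm_ne_top)

lemma N1_one_ne_top : N1 ‖c‖ₑ 1 ≠ ⊤ := ne_top_of_le_ne_top ENNReal.one_ne_top (SubNorm.one_le' _)

lemma N1_ne_top_add (hF : N1 ‖c‖ₑ F ≠ ⊤) (hG : N1 ‖c‖ₑ G ≠ ⊤) : N1 ‖c‖ₑ (F + G) ≠ ⊤ :=
  ne_top_of_le_ne_top (ENNReal.add_ne_top.2 ⟨hF, hG⟩) (SubNorm.add_le' _ _ _)

lemma N1_ne_top_mul (hF : N1 ‖c‖ₑ F ≠ ⊤) (hG : N1 ‖c‖ₑ G ≠ ⊤) : N1 ‖c‖ₑ (F * G) ≠ ⊤ :=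
  ne_top_of_le_ne_top (ENNReal.mul_ne_top hF hG) (SubNorm.mul_le' _ _ _)

lemma ev_binomial (a : ℝ) (n : ℕ) : ev c (1 + PowerSeries.C a * PowerSeries.X ^ n) =
    1 + a * c ^ n := by
  rw [ev_add N1_one_ne_top (N1_ne_top_C_mul_X_pow a n), ev_one, ev_C_mul, ev_X_pow]

lemma N1_binomial_ne_top (a : ℝ) (n : ℕ) :
    N1 ‖c‖ₑ (1 + PowerSeries.C a * PowerSeries.X ^ n) ≠ ⊤ :=
  N1_ne_top_add N1_one_ne_top (N1_ne_top_C_mul_X_pow a n)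

lemma ev_prod {ι : Type*} (s : Finset ι) (f : ι → A1) (hf : ∀ i ∈ s, N1 ‖c‖ₑ (f i) ≠ ⊤) :
    ev c (∏ i ∈ s, f i) = ∏ i ∈ s, ev c (f i) ∧ N1 ‖c‖ₑ (∏ i ∈ s, f i) ≠ ⊤ := by
  induction s using Finset.induction_on with
  | empty => exact ⟨ev_one, N1_one_ne_top⟩
  | insert a s ha ih =>
    obtain ⟨h1, h2⟩ := ih fun i hi => hf i (Finset.mem_insert_of_mem hi)
    have h3 := hf a (Finset.mem_insert_self a s)
    rw [Finset.prod_insert ha, Finset.prod_insert ha, ev_mul h3 h2, h1]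
    exact ⟨rfl, N1_ne_top_mul h3 h2⟩

lemma ev_sum {ι : Type*} (s : Finset ι) (f : ι → A1) (hf : ∀ i ∈ s, N1 ‖c‖ₑ (f i) ≠ ⊤) :
    ev c (∑ i ∈ s, f i) = ∑ i ∈ s, ev c (f i) ∧ N1 ‖c‖ₑ (∑ i ∈ s, f i) ≠ ⊤ := by
  induction s using Finset.induction_on with
  | empty => simp [ev, SubNorm.zero']
  | insert a s ha ih =>
    obtain ⟨h1, h2⟩ := ih fun i hi => hf i (Finset.mem_insert_of_mem hi)
    have h3 := hf a (Finset.mem_insert_self a s)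
    rw [Finset.sum_insert ha, Finset.sum_insert ha, ev_add h3 h2, h1]
    exact ⟨rfl, N1_ne_top_add h3 h2⟩

lemma tendsto_ev {G : ℕ → A1} {w K : ℝ≥0∞} (hc : ‖c‖ₑ < w) (hw : w ≠ ⊤) (hK : K ≠ ⊤)
    (hG : ∀ N, N1 w (G N) ≤ K)
    (hFG : ∀ N, ∀ k ≤ N, PowerSeries.coeff k F = PowerSeries.coeff k (G N)) :
    Filter.Tendsto (fun N => ev c (G N)) Filter.atTop (nhds (ev c F)) := by
  have hw0 : w ≠ 0 := (pos_of_gt hc).ne'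
  have hr : ‖c‖ₑ / w < 1 := by rwa [ENNReal.div_lt_iff (Or.inl hw0) (Or.inl hw), one_mul]
  refine tendsto_tsum_of_dominated_convergence
    (bound := fun n => (K * (‖c‖ₑ / w) ^ n).toReal) ?_ ?_ ?_
  · refine ENNReal.summable_toReal ?_
    rw [ENNReal.tsum_mul_left]
    exact ENNReal.mul_ne_top hK (tsum_geometric_ne_top hr)
  · intro k
    refine tendsto_const_nhds.congr' ?_
    filter_upwards [Filter.eventually_ge_atTop k] with N hN
    rw [hFG N k hN]
  · refine Filter.Eventually.of_forall fun N k => ?_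
    rw [← toReal_enorm]
    refine ENNReal.toReal_mono (ENNReal.mul_ne_top hK (ENNReal.pow_ne_top hr.ne_top)) ?_
    rw [enorm_mul, enorm_pow]
    calc ‖PowerSeries.coeff k (G N)‖ₑ * ‖c‖ₑ ^ k
        = ‖PowerSeries.coeff k (G N)‖ₑ * w ^ k * (‖c‖ₑ / w) ^ k := by
          rw [mul_assoc, ← mul_pow, ENNReal.mul_div_cancel hw0 hw]
      _ ≤ K * (‖c‖ₑ / w) ^ k :=
          mul_le_mul_left ((SubNorm.coeff_le _ _ _).trans (hG N)) _

end Ev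

lemma tendsto_primesLE : Filter.Tendsto (primesLE q) Filter.atTop Filter.atTop :=
  Filter.tendsto_atTop_finset_of_monotone
    (fun _ _ h _ hP => mem_primesLE.2 ((mem_primesLE.1 hP).trans h))
    fun P => ⟨P.1.natDegree, mem_primesLE.2 le_rfl⟩

lemma q_inv_enorm_lt : ‖(q : ℝ)⁻¹‖ₑ < qp q (-(3 / 4)) := by
  rw [enorm_q_inv]; exact qp_strictMono (by norm_num)

lemma tendsto_prod_one_sub_sq : Filter.Tendsto
    (fun N => ∏ P ∈ primesLE q N, (1 - ((q : ℝ)⁻¹ ^ P.1.natDegree) ^ 2)) Filter.atTop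
    (nhds (1 - (q : ℝ)⁻¹)) := by
  obtain ⟨K, hK, h⟩ := exists_prime_prod_bound (q := q) (C := 1) (ρ := qp q (-(3 / 2)))
    ENNReal.one_ne_top (by rw [q_mul_qp]; exact qp_lt_one (by norm_num))
  have := tendsto_ev (c := (q : ℝ)⁻¹) (F := 1 + PowerSeries.C (-(q : ℝ)) * PowerSeries.X ^ 2)
    (G := fun N => ∏ P ∈ primesLE q N,
      (1 + PowerSeries.C (-1 : ℝ) * PowerSeries.X ^ (2 * P.1.natDegree)))
    q_inv_enorm_lt (qp_ne_top _) hK (fun N => ?_) (fun N => ?_)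
  · rw [ev_binomial] at this
    convert this using 2 with N
    · rw [(ev_prod _ _ fun P _ => N1_binomial_ne_top _ _).1]
      refine Finset.prod_congr rfl fun P _ => ?_
      rw [ev_binomial]
      ring
    · have := (q_real_pos (q := q)).ne'
      field_simp
      ring
  · refine (SubNorm.prod_le _ _ _).trans (le_trans ?_ (h (primesLE q N)))
    refine Finset.prod_le_prod' fun P _ => ?_
    refine (SubNorm.add_le' _ _ _).trans (add_le_add (SubNorm.one_le' _) ?_)
    rw [SubNorm.ext_C_mul_X_pow, pow_mul, qp_pow]
    refine mul_le_mul' (by simp [SubNorm.real]) (le_of_eq ?_)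
    norm_num
  · have := tq_prod_one_sub (q := q) (A := ℝ) N two_ne_zero
    rw [tq_eq_iff] at this
    intro k hk
    have := (this k hk).symm
    simpa [sub_eq_add_neg] using this

end

noncomputable section

open scoped Classical ENNReal

variable {q : ℕ} [Fact q.Prime]

lemma q_inv_pow_pos (r : ℕ) : 0 < (q : ℝ)⁻¹ ^ r := pow_pos (inv_pos.2 q_real_pos) r

lemma q_inv_pow_lt_one {r : ℕ} (hr : r ≠ 0) : (q : ℝ)⁻¹ ^ r < 1 :=
  pow_lt_one₀ (inv_nonneg.2 q_real_pos.le) (inv_lt_one_of_one_lt₀ one_lt_q_real) hr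

lemma rq_sq_eq : rq q ^ 2 = (q : ℝ)⁻¹ := eq_inv_of_mul_eq_one_left rq_sq

lemma N1_rq_iX_ne_top {r : ℕ} (hr : r ≠ 0) : N1 ‖rq q‖ₑ (iX r) ≠ ⊤ := by
  refine ne_top_of_le_ne_top (inv_one_sub_ne_top ?_) (N1_iX_le ?_ hr)
  · rw [enorm_rq, qp_pow]; exact qp_lt_one (by norm_num)
  · rw [enorm_rq]; exact qp_le_one (by norm_num)

lemma ev_thetaS {r : ℕ} (hr : r ≠ 0) : ev (rq q) (thetaS r) =
    (1 - (q : ℝ)⁻¹ ^ r) ^ 2 / (1 + (q : ℝ)⁻¹ ^ r) ∧ N1 ‖rq q‖ₑ (thetaS r) ≠ ⊤ := by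
  have e : thetaS r = ((1 + PowerSeries.C (-1 : ℝ) * PowerSeries.X ^ (2 * r)) *
      (1 + PowerSeries.C (-1 : ℝ) * PowerSeries.X ^ (2 * r))) * iX r := by
    rw [thetaS, map_neg, map_one]; ring
  have h1 := N1_binomial_ne_top (c := rq q) (-1) (2 * r)
  have h2 := N1_rq_iX_ne_top (q := q) hr
  have h3 : (1 + (q : ℝ)⁻¹ ^ r) * ev (rq q) (iX r) = 1 := by
    have h0 : (1 + PowerSeries.X ^ (2 * r) : A1) =
      1 + PowerSeries.C (1 : ℝ) * PowerSeries.X ^ (2 * r) := by rw [map_one, one_mul]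
    have h' := congrArg (ev (rq q)) (mul_iX hr)
    rwa [h0, ev_mul (N1_binomial_ne_top 1 (2 * r)) h2, ev_binomial, ev_one, pow_mul, rq_sq_eq,
      one_mul] at h'
  refine ⟨?_, by rw [e]; exact N1_ne_top_mul (N1_ne_top_mul h1 h1) h2⟩
  rw [e, ev_mul (N1_ne_top_mul h1 h1) h2, ev_mul h1 h1, ev_binomial, pow_mul, rq_sq_eq,
    eq_div_iff (by have := q_inv_pow_pos (q := q) r; positivity)]
  linear_combination (1 - (q : ℝ)⁻¹ ^ r) ^ 2 * h3

/-- The value of `θ_P` at `x = q ^ (-1/2)`. -/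
def thetaVal (q : ℕ) (r : ℕ) : ℝ := (1 - (q : ℝ)⁻¹ ^ r) ^ 2 / (1 + (q : ℝ)⁻¹ ^ r)

/-- The Euler factor of `B(1/q)`. -/
def bVal (q : ℕ) (r : ℕ) : ℝ :=
  1 + (q : ℝ)⁻¹ ^ r * ((q : ℝ)⁻¹ ^ r - 3) / (((q : ℝ) ^ r + 1) * (1 + (q : ℝ)⁻¹ ^ r))

lemma local_factor_eq {r : ℕ} : (1 - (q : ℝ)⁻¹ ^ r) * (1 + thetaVal q r * (q : ℝ)⁻¹ ^ r) =
    (1 - ((q : ℝ)⁻¹ ^ r) ^ 2) * bVal q r := by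
  have hp := q_inv_pow_pos (q := q) r
  have e : (q : ℝ) ^ r = ((q : ℝ)⁻¹ ^ r)⁻¹ := by rw [inv_pow, inv_inv]
  rw [thetaVal, bVal, e]
  set p := (q : ℝ)⁻¹ ^ r
  have h1 : 1 + p ≠ 0 := by positivity
  field_simp
  ring

lemma ev_coeff_eprod_theta (i : ℕ) :
    ev (rq q) (PowerSeries.coeff i (eprod fun P : MIrr q => thetaS P.1.natDegree)) =
      PowerSeries.coeff i (eprod fun P : MIrr q => thetaVal q P.1.natDegree) ∧
    N1 ‖rq q‖ₑ (PowerSeries.coeff i (eprod fun P : MIrr q => thetaS P.1.natDegree)) ≠ ⊤ := by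
  have h (D : Finset (MIrr q)) := ev_prod (c := rq q) D (fun P => thetaS P.1.natDegree)
    fun P _ => (ev_thetaS (natDegree_ne_zero_of_MIrr P)).2
  have h2 := ev_sum (c := rq q) (sqf q i) (fun D => ∏ P ∈ D, thetaS P.1.natDegree)
    fun D _ => (h D).2
  rw [coeff_eprod, coeff_eprod]
  refine ⟨h2.1.trans (Finset.sum_congr rfl fun D _ => (h D).1.trans
    (Finset.prod_congr rfl fun P _ => (ev_thetaS (natDegree_ne_zero_of_MIrr P)).1)), h2.2⟩

/-- The series `(1 - qu) ∏ (1 + θ_P u ^ d(P))` at `x = q ^ (-1/2)`. -/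
def QV (q : ℕ) [Fact q.Prime] : A1 := (1 - (q : A1) * PowerSeries.X) ^ 1 *
  eprod fun P : MIrr q => thetaVal q P.1.natDegree

lemma ev_coeff_QS (i : ℕ) : ev (rq q) (PowerSeries.coeff i (QS q)) =
    (1 - (q : ℝ)⁻¹) * PowerSeries.coeff i (QV q) := by
  have hE := ev_coeff_eprod_theta (q := q)
  have h2 : ev (rq q) (PowerSeries.coeff i ((1 - (q : A2) * PowerSeries.X) *
        eprod fun P : MIrr q => thetaS P.1.natDegree)) = PowerSeries.coeff i (QV q) ∧
      N1 ‖rq q‖ₑ (PowerSeries.coeff i ((1 - (q : A2) * PowerSeries.X) *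
        eprod fun P : MIrr q => thetaS P.1.natDegree)) ≠ ⊤ := by
    rw [QV, pow_one]
    rcases i with _ | i
    · rw [sub_mul, one_mul, sub_mul, one_mul, map_sub, map_sub, mul_assoc, mul_assoc,
        ← map_natCast (PowerSeries.C (R := A1)), PowerSeries.coeff_C_mul,
        ← map_natCast (PowerSeries.C (R := ℝ)), PowerSeries.coeff_C_mul,
        PowerSeries.coeff_zero_X_mul, PowerSeries.coeff_zero_X_mul, mul_zero, mul_zero, sub_zero,
        sub_zero]
      exact hE 0
    · have e : PowerSeries.coeff (i + 1) ((1 - (q : A2) * PowerSeries.X) *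
          eprod fun P : MIrr q => thetaS P.1.natDegree) =
          PowerSeries.coeff (i + 1) (eprod fun P : MIrr q => thetaS P.1.natDegree) +
          PowerSeries.C (-(q : ℝ)) *
            PowerSeries.coeff i (eprod fun P : MIrr q => thetaS P.1.natDegree) := by
        rw [sub_mul, one_mul, map_sub, mul_assoc, ← map_natCast (PowerSeries.C (R := A1)),
          PowerSeries.coeff_C_mul, PowerSeries.coeff_succ_X_mul, map_neg, map_natCast]
        ring
      have h3 : N1 ‖rq q‖ₑ (PowerSeries.C (-(q : ℝ)) *
            PowerSeries.coeff i (eprod fun P : MIrr q => thetaS P.1.natDegree)) ≠ ⊤ := by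
        refine N1_ne_top_mul ?_ (hE i).2
        rw [SubNorm.ext_C]
        exact enorm_ne_top
      rw [e, ev_add (hE (i + 1)).2 h3, ev_C_mul, (hE _).1, (hE _).1, sub_mul, one_mul, map_sub,
        mul_assoc, ← map_natCast (PowerSeries.C (R := ℝ)), PowerSeries.coeff_C_mul,
        PowerSeries.coeff_succ_X_mul]
      exact ⟨by ring, N1_ne_top_add (hE _).2 h3⟩
  have e : (1 - (q : A1) * PowerSeries.X ^ 4) =
      1 + PowerSeries.C (-(q : ℝ)) * PowerSeries.X ^ 4 := by
    rw [map_neg, map_natCast]; ring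
  rw [QS, PowerSeries.coeff_C_mul, e, ev_mul (N1_binomial_ne_top _ _) h2.2, ev_binomial, h2.1,
    show 4 = 2 * 2 from rfl, pow_mul, rq_sq_eq]
  have := (q_real_pos (q := q)).ne'
  field_simp
  ring

lemma enorm_thetaVal_le {r : ℕ} (hr : r ≠ 0) : ‖thetaVal q r‖ₑ ≤ 1 := by
  have h0 := q_inv_pow_pos (q := q) r
  have h1 := q_inv_pow_lt_one (q := q) hr
  rw [thetaVal, Real.enorm_of_nonneg (by positivity), ENNReal.ofReal_le_one,
    div_le_one (by positivity)]
  nlinarith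

lemma enorm_one_sub_thetaVal_le {r : ℕ} (hr : r ≠ 0) : ‖1 - thetaVal q r‖ₑ ≤ 3 * qp q (-1) ^ r := by
  have h0 := q_inv_pow_pos (q := q) r
  have h1 := q_inv_pow_lt_one (q := q) hr
  rw [← enorm_q_inv, ← enorm_pow, Real.enorm_of_nonneg h0.le, thetaVal]
  set p := (q : ℝ)⁻¹ ^ r
  have e : 1 - (1 - p) ^ 2 / (1 + p) = p * (3 - p) / (1 + p) := by
    field_simp
    ring
  rw [e, Real.enorm_of_nonneg (div_nonneg (mul_nonneg h0.le (by linarith)) (by linarith)),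
    ← ENNReal.ofReal_ofNat, ← ENNReal.ofReal_mul (by norm_num)]
  refine ENNReal.ofReal_le_ofReal ?_
  rw [div_le_iff₀ (by linarith)]
  nlinarith

lemma ev_binomials {c : ℝ} (N : ℕ) (t : MIrr q → ℝ) :
    ev c (∏ P ∈ primesLE q N, ((1 - PowerSeries.X ^ P.1.natDegree) ^ 1 *
      (1 + PowerSeries.C (t P) * PowerSeries.X ^ P.1.natDegree))) =
    ∏ P ∈ primesLE q N, ((1 - c ^ P.1.natDegree) * (1 + t P * c ^ P.1.natDegree)) := by
  have e (r : ℕ) : ((1 - PowerSeries.X ^ r) ^ 1 : A1) =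
      1 + PowerSeries.C (-1 : ℝ) * PowerSeries.X ^ r := by
    rw [map_neg, map_one]; ring
  simp only [e]
  rw [(ev_prod _ _ fun P _ => N1_ne_top_mul (N1_binomial_ne_top _ _) (N1_binomial_ne_top _ _)).1]
  refine Finset.prod_congr rfl fun P _ => ?_
  rw [ev_mul (N1_binomial_ne_top _ _) (N1_binomial_ne_top _ _), ev_binomial, ev_binomial]
  ring

lemma tendsto_prod_QV : Filter.Tendsto (fun N => ∏ P ∈ primesLE q N,
    ((1 - ((q : ℝ)⁻¹ ^ P.1.natDegree) ^ 2) * bVal q P.1.natDegree)) Filter.atTop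
    (nhds (ev (q : ℝ)⁻¹ (QV q))) := by
  obtain ⟨K, hK, h⟩ := exists_prime_prod_bound (q := q) (C := 4) (ρ := qp q (-(3 / 2)))
    (by norm_num) (by rw [q_mul_qp]; exact qp_lt_one (by norm_num))
  have := tendsto_ev (c := (q : ℝ)⁻¹) (F := QV q)
    (G := fun N => ∏ P ∈ primesLE q N, ((1 - PowerSeries.X ^ P.1.natDegree) ^ 1 *
      (1 + PowerSeries.C (thetaVal q P.1.natDegree) * PowerSeries.X ^ P.1.natDegree)))
    q_inv_enorm_lt (qp_ne_top _) hK (fun N => ?_) (fun N => ?_)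
  · simpa only [ev_binomials, local_factor_eq] using this
  · refine (SubNorm.prod_le _ _ _).trans (le_trans ?_ (h (primesLE q N)))
    refine Finset.prod_le_prod' fun P _ => ?_
    have hr := natDegree_ne_zero_of_MIrr P
    set r := P.1.natDegree
    have e : ((1 - PowerSeries.X ^ r) ^ 1 *
        (1 + PowerSeries.C (thetaVal q r) * PowerSeries.X ^ r) : A1) =
        1 - PowerSeries.C (1 - thetaVal q r) * PowerSeries.X ^ r -
          PowerSeries.C (thetaVal q r) * PowerSeries.X ^ (2 * r) := by
      rw [map_sub, map_one]
      ring
    rw [e]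
    refine (SubNorm.sub_le _ _ _).trans ((add_le_add_left (SubNorm.sub_le _ _ _) _).trans ?_)
    rw [SubNorm.ext_C_mul_X_pow, SubNorm.ext_C_mul_X_pow]
    calc _ ≤ 1 + 3 * qp q (-1) ^ r * qp q (-(3 / 4)) ^ r + 1 * qp q (-(3 / 4)) ^ (2 * r) :=
          add_le_add (add_le_add (SubNorm.one_le' _)
            (mul_le_mul_left (enorm_one_sub_thetaVal_le hr) _))
            (mul_le_mul_left (enorm_thetaVal_le hr) _)
      _ ≤ 1 + 3 * qp q (-(3 / 2)) ^ r + 1 * qp q (-(3 / 2)) ^ r := by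
          rw [mul_assoc, ← mul_pow, ← qp_add, pow_mul, qp_pow _ 2]
          gcongr <;> exact qp_mono (by norm_num)
      _ = _ := by ring
  · rw [← tq_eq_iff, Finset.prod_mul_distrib, Finset.prod_pow, map_mul, map_pow, QV, map_mul,
      map_pow, tq_eprod]
    have := tq_prod_one_sub (q := q) (A := ℝ) N one_ne_zero
    rw [pow_one] at this
    rw [← this]
    simp only [one_mul]

lemma summable_bVal : Summable fun P : MIrr q => ‖((bVal q P.1.natDegree : ℝ) : ℂ) - 1‖ := by
  have h : ∑' P : MIrr q, 3 * qp q (-2) ^ P.1.natDegree ≠ ⊤ := by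
    rw [ENNReal.tsum_mul_left]
    refine ENNReal.mul_ne_top (by norm_num) (ne_top_of_le_ne_top (b := (1 - q * qp q (-2))⁻¹)
      (inv_one_sub_ne_top (by rw [q_mul_qp]; exact qp_lt_one (by norm_num))) ?_)
    rw [ENNReal.tsum_eq_iSup_sum]
    exact iSup_le fun S => sum_prime_pow_le S _
  refine (ENNReal.summable_toReal h).of_nonneg_of_le (fun _ => norm_nonneg _) fun P => ?_
  have hr := natDegree_ne_zero_of_MIrr P
  set r := P.1.natDegree
  have h0 := q_inv_pow_pos (q := q) r
  have h1 := q_inv_pow_lt_one (q := q) hr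
  have e : (qp q (-2) ^ r).toReal = ((q : ℝ)⁻¹ ^ r) ^ 2 := by
    rw [ENNReal.toReal_pow, qp_toReal, ← pow_mul, mul_comm r, pow_mul]
    norm_num
  rw [← Complex.ofReal_one, ← Complex.ofReal_sub, Complex.norm_real, ENNReal.toReal_mul, e, bVal,
    add_sub_cancel_left, show (q : ℝ) ^ r = ((q : ℝ)⁻¹ ^ r)⁻¹ by rw [inv_pow, inv_inv]]
  set p := (q : ℝ)⁻¹ ^ r
  have e2 : p * (p - 3) / ((p⁻¹ + 1) * (1 + p)) = -(p ^ 2 * (3 - p) / (1 + p) ^ 2) := by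
    field_simp
    ring
  have h2 : 0 ≤ p ^ 2 * (3 - p) := mul_nonneg (by positivity) (by linarith)
  rw [e2, norm_neg, Real.norm_of_nonneg (by positivity), div_le_iff₀ (by positivity)]
  norm_num
  nlinarith [mul_nonneg h0.le (sq_nonneg p), mul_nonneg (sq_nonneg p) (sq_nonneg p)]

lemma bVal_ne_zero {r : ℕ} (hr : r ≠ 0) : bVal q r ≠ 0 := by
  have h0 := q_inv_pow_pos (q := q) r
  have h1 := q_inv_pow_lt_one (q := q) hr
  rw [bVal, show (q : ℝ) ^ r = ((q : ℝ)⁻¹ ^ r)⁻¹ by rw [inv_pow, inv_inv]]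
  set p := (q : ℝ)⁻¹ ^ r
  have e2 : 1 + p * (p - 3) / ((p⁻¹ + 1) * (1 + p)) =
      (1 + 2 * p - 2 * p ^ 2 + p ^ 3) / (1 + p) ^ 2 := by
    field_simp
    ring
  rw [e2]
  have : 0 < 1 + 2 * p - 2 * p ^ 2 + p ^ 3 := by nlinarith [pow_pos h0 3]
  positivity

lemma Bfun_eq : Bfun q (1 / q) = ∏' P : MIrr q, (1 + (((bVal q P.1.natDegree : ℝ) : ℂ) - 1)) := by
  refine tprod_congr fun P => ?_
  rw [bVal, nm]
  push_cast
  rw [one_div]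
  ring

lemma Bfun_ne_zero : Bfun q (1 / q) ≠ 0 := by
  rw [Bfun_eq]
  refine tprod_one_add_ne_zero_of_summable (fun P => ?_) summable_bVal
  rw [add_sub_cancel]
  exact Complex.ofReal_ne_zero.2 (bVal_ne_zero (natDegree_ne_zero_of_MIrr P))

lemma ev_QV : ((ev (q : ℝ)⁻¹ (QV q) : ℝ) : ℂ) = (1 - (q : ℂ)⁻¹) * Bfun q (1 / q) := by
  have h1 := (Complex.continuous_ofReal.tendsto _).comp (tendsto_prod_QV (q := q))
  have h2 := (Complex.continuous_ofReal.tendsto _).comp (tendsto_prod_one_sub_sq (q := q))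
  have h3 := (multipliable_one_add_of_summable (summable_bVal (q := q))).hasProd.comp
    (tendsto_primesLE (q := q))
  refine tendsto_nhds_unique h1 ?_
  convert h2.mul h3 using 1
  · funext N
    simp [Finset.prod_mul_distrib]
  · rw [Bfun_eq]
    push_cast
    rfl

lemma tsum_mainW : (((∑' τ, mainW q τ : ℝ)) : ℂ) = (1 - (q : ℂ)⁻¹) ^ 2 * Bfun q (1 / q) := by
  have hs : Summable (mainW q) := by
    have h := Qc_tsum_ne_top (q := q) (a := 1 / 2) (b := 1) (by norm_num) (by norm_num)
      (by norm_num)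
    refine Summable.of_norm ((ENNReal.summable_toReal h).congr fun τ => ?_)
    rw [mainW, ← toReal_enorm, enorm_mul, enorm_mul, enorm_pow, enorm_pow, enorm_rq, enorm_q_inv]
  have e : ∑' τ, mainW q τ = ∑' i, ∑' s, mainW q (s, i) := by
    rw [hs.tsum_prod]
    exact (Summable.tsum_comm (f := fun s i => mainW q (s, i)) hs).symm
  have e2 (i : ℕ) : ∑' s, mainW q (s, i) =
      (1 - (q : ℝ)⁻¹) * (PowerSeries.coeff i (QV q) * (q : ℝ)⁻¹ ^ i) := by
    rw [← mul_assoc, ← ev_coeff_QS, ev, ← tsum_mul_right]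
    rfl
  rw [e, tsum_congr e2, tsum_mul_left, ← ev, Complex.ofReal_mul, ev_QV]
  push_cast
  ring

end

noncomputable section

open scoped Classical ENNReal

variable {q : ℕ} [Fact q.Prime]

section SignedProduct

variable {A : Type*} [CommRing A] (N : SubNorm A)

lemma SubNorm.pow_mul_pow_le (Y : A) (a b : ℕ) (h : b ≤ a) :
    N ((1 + Y) ^ a * (1 - Y) ^ b) ≤ (1 + N Y ^ 2) ^ b * (1 + N Y) ^ (a - b) := by
  have e : (1 + Y) ^ a * (1 - Y) ^ b = (1 - Y ^ 2) ^ b * (1 + Y) ^ (a - b) := by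
    rw [show 1 - Y ^ 2 = (1 + Y) * (1 - Y) by ring, mul_pow]
    conv_lhs => rw [← Nat.sub_add_cancel h, pow_add]
    ring
  rw [e]
  refine (N.mul_le' _ _).trans (mul_le_mul' ((N.pow_le _ _).trans ?_) ((N.pow_le _ _).trans ?_))
  · exact pow_le_pow_left' ((N.sub_le _ _).trans (add_le_add N.one_le' (N.pow_le _ _))) _
  · exact pow_le_pow_left' ((N.add_le' _ _).trans (add_le_add_left N.one_le' _)) _

lemma SubNorm.signed_prod_le {ι : Type*} (S : Finset ι) (ε : ι → ℤ)
    (hε : ∀ i, ε i = 0 ∨ ε i = 1 ∨ ε i = -1) (Y : A) :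
    N (∏ i ∈ S, (1 + ε i • Y)) ≤ (1 + N Y ^ 2) ^ S.card * (1 + N Y) ^ (∑ i ∈ S, ε i).natAbs := by
  set S1 := S.filter fun i => ε i = 1 with hS1
  set S2 := S.filter fun i => ε i = -1 with hS2
  have hprod : ∏ i ∈ S, (1 + ε i • Y) = (1 + Y) ^ S1.card * (1 - Y) ^ S2.card := by
    have h (i : ι) : 1 + ε i • Y = (if ε i = 1 then 1 + Y else 1) *
        (if ε i = -1 then 1 - Y else 1) := by
      rcases hε i with h | h | h <;> simp [h, sub_eq_add_neg]
    rw [Finset.prod_congr rfl fun i _ => h i, Finset.prod_mul_distrib, Finset.prod_ite,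
      Finset.prod_ite]
    simp [hS1, hS2]
  have hsum : ∑ i ∈ S, ε i = (S1.card : ℤ) - S2.card := by
    have h (i : ι) : ε i = (if ε i = 1 then 1 else 0) - (if ε i = -1 then 1 else 0) := by
      rcases hε i with h | h | h <;> simp [h]
    rw [Finset.sum_congr rfl fun i _ => h i, Finset.sum_sub_distrib, Finset.sum_ite,
      Finset.sum_ite]
    simp [hS1, hS2]
  have h1 : S1.card ≤ S.card := Finset.card_filter_le _ _
  have h2 : S2.card ≤ S.card := Finset.card_filter_le _ _
  have hY : 1 ≤ 1 + N Y ^ 2 := le_self_add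
  rw [hprod, hsum]
  rcases le_total S2.card S1.card with h | h
  · refine (N.pow_mul_pow_le Y _ _ h).trans ?_
    rw [show ((S1.card : ℤ) - S2.card).natAbs = S1.card - S2.card by omega]
    exact mul_le_mul_left (pow_le_pow_right₀ hY h2) _
  · have := N.pow_mul_pow_le (-Y) _ _ h
    rw [N.neg', sub_neg_eq_add, ← sub_eq_add_neg] at this
    rw [show ((S1.card : ℤ) - S2.card).natAbs = S2.card - S1.card by omega, mul_comm]
    exact this.trans (mul_le_mul_left (pow_le_pow_right₀ hY h1) _)

end SignedProduct

lemma one_add_le_qp {x : ℝ} (hx : 0 ≤ x) : 1 + ENNReal.ofReal x ≤ qp q (2 * x) := by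
  rw [← ENNReal.ofReal_one, ← ENNReal.ofReal_add one_pos.le hx, ← ofReal_q_rpow]
  refine ENNReal.ofReal_le_ofReal ?_
  rw [Real.rpow_def_of_pos q_real_pos]
  refine (add_comm 1 x ▸ Real.add_one_le_exp x).trans (Real.exp_le_exp.2 ?_)
  have h2 : (2 : ℝ) ≤ q := by exact_mod_cast (Fact.out : q.Prime).two_le
  have := Real.log_le_log (by norm_num) h2
  have := Real.log_two_gt_d9
  nlinarith

lemma one_add_pow_le_qp {x y : ℝ} (hx : 0 ≤ x) {n : ℕ} (h : x * n ≤ y) :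
    (1 + ENNReal.ofReal x) ^ n ≤ qp q (2 * y) := by
  refine (pow_le_pow_left' (one_add_le_qp (q := q) hx) n).trans ?_
  rw [qp_pow]
  exact qp_mono (by linarith)

lemma prod_primesLE_eq {M : Type*} [CommMonoid M] (N : ℕ) (f : MIrr q → M) :
    ∏ P ∈ primesLE q N, f P = ∏ r ∈ Finset.range (N + 1), ∏ P ∈ primesDeg q r, f P := by
  rw [← Finset.prod_fiberwise_of_maps_to (s := primesLE q N) (t := Finset.range (N + 1))
    (g := fun P => P.1.natDegree)
    (fun P hP => Finset.mem_range.2 (Nat.lt_succ_of_le (mem_primesLE.1 hP)))]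
  refine Finset.prod_congr rfl fun r hr => Finset.prod_congr ?_ fun _ _ => rfl
  ext P
  rw [Finset.mem_filter, mem_primesLE, mem_primesDeg]
  rw [Finset.mem_range] at hr
  constructor
  · exact fun h => h.2
  · exact fun h => ⟨by omega, h⟩

/-- The sign attached to `P` in `FS B V`. -/
def sgn (B : Finset (MIrr q)) (V : Fqx q) (P : MIrr q) : ℤ :=
  if P ∈ B then 0 else legSym q V P.1

lemma sgn_cases (B : Finset (MIrr q)) (V : Fqx q) (P : MIrr q) :
    sgn B V P = 0 ∨ sgn B V P = 1 ∨ sgn B V P = -1 := by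
  unfold sgn
  split_ifs
  · exact Or.inl rfl
  · by_cases h : P.1 ∣ V
    · exact Or.inl (legSym_eq_zero h)
    · exact Or.inr (legSym_eq_or h)

lemma natAbs_sum_sgn_le (B : Finset (MIrr q)) (V : Fqx q) (r : ℕ) :
    (∑ P ∈ primesDeg q r, sgn B V P).natAbs ≤
      (∑ P ∈ primesDeg q r, legSym q V P.1).natAbs + (primesDeg q r ∩ B).card := by
  have h : ∑ P ∈ primesDeg q r, sgn B V P =
      ∑ P ∈ primesDeg q r, legSym q V P.1 - ∑ P ∈ primesDeg q r ∩ B, legSym q V P.1 := by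
    rw [← Finset.filter_mem_eq_inter, Finset.sum_filter, ← Finset.sum_sub_distrib]
    refine Finset.sum_congr rfl fun P _ => ?_
    unfold sgn
    split_ifs <;> simp
  have h2 : (∑ P ∈ primesDeg q r ∩ B, legSym q V P.1).natAbs ≤ (primesDeg q r ∩ B).card := by
    rw [← Int.ofNat_le, Int.natCast_natAbs]
    refine (Finset.abs_sum_le_sum_abs _ _).trans ?_
    refine (Finset.sum_le_sum fun P _ => abs_legSym_le V P).trans (by simp)
  rw [h]
  omega

lemma qp_sum {ι : Type*} (s : Finset ι) (f : ι → ℝ) :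
    ∏ i ∈ s, qp q (f i) = qp q (∑ i ∈ s, f i) := by
  induction s using Finset.induction_on with
  | empty => simp [qp_zero]
  | insert a s ha ih => rw [Finset.prod_insert ha, Finset.sum_insert ha, ih, qp_add]

/-- The part of degree `r` of the truncated Euler product of `FS B V`. -/
lemma N3_block_le {wx wu wy : ℝ≥0∞} (B : Finset (MIrr q)) (V : Fqx q) (r : ℕ) {x : ℝ}
    (hx : 0 ≤ x) (h : N2 wx wu (ellS r) * wy ^ r ≤ ENNReal.ofReal x) :
    N3 wx wu wy (∏ P ∈ primesDeg q r, (1 + PowerSeries.C (if P ∈ B then 0 else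
      legSym q V P.1 • ellS P.1.natDegree) * PowerSeries.X ^ P.1.natDegree)) ≤
    qp q (2 * (x ^ 2 * (q : ℝ) ^ r)) *
      (qp q (2 * (x * (∑ P ∈ primesDeg q r, legSym q V P.1).natAbs)) *
        (1 + ENNReal.ofReal x) ^ (primesDeg q r ∩ B).card) := by
  set Y : A3 := PowerSeries.C (ellS r) * PowerSeries.X ^ r
  have hY : N3 wx wu wy Y ≤ ENNReal.ofReal x := by rwa [N3, SubNorm.ext_C_mul_X_pow]
  have e : ∏ P ∈ primesDeg q r, (1 + PowerSeries.C (if P ∈ B then 0 else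
      legSym q V P.1 • ellS P.1.natDegree) * PowerSeries.X ^ P.1.natDegree) =
      ∏ P ∈ primesDeg q r, (1 + sgn B V P • Y) := by
    refine Finset.prod_congr rfl fun P hP => ?_
    rw [mem_primesDeg.1 hP, sgn]
    split_ifs
    · simp
    · rw [map_zsmul, smul_mul_assoc]
  rw [e]
  refine ((N3 wx wu wy).signed_prod_le _ _ (sgn_cases B V) Y).trans (mul_le_mul' ?_ ?_)
  · refine (pow_le_pow_left' (add_le_add_right (pow_le_pow_left' hY 2) 1) _).trans ?_
    rw [← ENNReal.ofReal_pow hx]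
    refine one_add_pow_le_qp (sq_nonneg x) (mul_le_mul_of_nonneg_left ?_ (sq_nonneg x))
    exact_mod_cast card_primesDeg_le r
  · refine (pow_le_pow_left' (add_le_add_right hY 1) _).trans ?_
    refine (pow_le_pow_right₀ le_self_add (natAbs_sum_sgn_le B V r)).trans ?_
    rw [pow_add]
    exact mul_le_mul_left (one_add_pow_le_qp hx le_rfl) _

end

noncomputable section

open scoped Classical ENNReal

variable {q : ℕ} [Fact q.Prime]

lemma primesDeg_zero : primesDeg q 0 = ∅ :=
  Finset.eq_empty_of_forall_notMem fun P hP =>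
    natDegree_ne_zero_of_MIrr P (mem_primesDeg.1 hP)

lemma natAbs_sum_legSym_le_pow (V : Fqx q) (r : ℕ) :
    ((∑ P ∈ primesDeg q r, legSym q V P.1).natAbs : ℝ) ≤ (q : ℝ) ^ r := by
  have h : (∑ P ∈ primesDeg q r, legSym q V P.1).natAbs ≤ (primesDeg q r).card := by
    rw [← Int.ofNat_le, Int.natCast_natAbs]
    refine (Finset.abs_sum_le_sum_abs _ _).trans ?_
    exact (Finset.sum_le_sum fun P _ => abs_legSym_le V P).trans (by simp)
  exact_mod_cast h.trans (card_primesDeg_le r)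

lemma natAbs_sum_legSym_le_sqrt (hq : q ≠ 2) {V : Fqx q} (hV : V.Monic) (hs : ¬ IsSquare V)
    {r : ℕ} (hr : r ≠ 0) :
    ((∑ P ∈ primesDeg q r, legSym q V P.1).natAbs : ℝ) ≤
      19 * V.natDegree * (q : ℝ) ^ (r / 2 : ℝ) := by
  have h := abs_sum_legSym_le hq hV hs r hr
  have e : √((q : ℝ) ^ r) = (q : ℝ) ^ (r / 2 : ℝ) := by
    rw [Real.sqrt_eq_rpow, ← Real.rpow_natCast, ← Real.rpow_mul q_real_pos.le]
    ring_nf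
  rw [e] at h
  have h1 : (1 : ℝ) ≤ r := by exact_mod_cast Nat.one_le_iff_ne_zero.2 hr
  rw [Nat.cast_natAbs, Int.cast_abs, Int.cast_sum]
  nlinarith [abs_nonneg (∑ P ∈ primesDeg q r, (legSym q V P.1 : ℝ))]

lemma sum_card_primesDeg_inter_le (B : Finset (MIrr q)) (n : ℕ) :
    ∑ r ∈ Finset.range n, (primesDeg q r ∩ B).card ≤ B.card := by
  have h (r : ℕ) : primesDeg q r ∩ B = B.filter fun P => P.1.natDegree = r := by
    ext P
    simp [mem_primesDeg, and_comm]
  simp only [h]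
  rw [Finset.sum_card_fiberwise_eq_card_filter]
  exact Finset.card_filter_le _ _

lemma exists_N3_FS_le (hq : q ≠ 2) {δ : ℝ} (hδ : 0 < δ) {wx wu : ℝ≥0∞} (hx : wx < 1)
    (hu : wu < 1) : ∃ K : ℝ≥0∞, K ≠ ⊤ ∧ ∀ (B : Finset (MIrr q)) (V : Fqx q), V.Monic →
      ¬ IsSquare V → N3 wx wu (qp q (-(1 / 2 + δ))) (FS B V) ≤
        K * (K ^ B.card * qp q (δ * V.natDegree)) := by
  set c' : ℝ≥0∞ := 2 * (1 - wx ^ 2)⁻¹ * (1 - wu ^ 2)⁻¹ with hc'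
  have hc't : c' ≠ ⊤ := ENNReal.mul_ne_top (ENNReal.mul_ne_top (by simp)
    (inv_one_sub_ne_top (pow_lt_one₀ zero_le hx two_ne_zero)))
    (inv_one_sub_ne_top (pow_lt_one₀ zero_le hu two_ne_zero))
  set c : ℝ := c'.toReal with hc
  have hc0 : 0 ≤ c := ENNReal.toReal_nonneg
  have hcc : ENNReal.ofReal c = c' := ENNReal.ofReal_toReal hc't
  set ρ : ℝ := (q : ℝ) ^ (-δ) with hρ
  have hρ0 : 0 < ρ := Real.rpow_pos_of_pos q_real_pos _
  have hρ1 : ρ < 1 := Real.rpow_lt_one_of_one_lt_of_neg one_lt_q_real (neg_lt_zero.2 hδ)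
  have hgeom {t : ℝ} (h0 : 0 ≤ t) (h1 : t < 1) (n : ℕ) :
      ∑ r ∈ Finset.range n, t ^ r ≤ (1 - t)⁻¹ := by
    rw [← tsum_geometric_of_lt_one h0 h1]
    exact (summable_geometric_of_lt_one h0 h1).sum_le_tsum _ fun _ _ => by positivity
  obtain ⟨R, hR⟩ : ∃ R : ℕ, 38 * c * (1 - ρ)⁻¹ * ρ ^ R ≤ δ := by
    have h := (tendsto_pow_atTop_nhds_zero_of_lt_one hρ0.le hρ1).const_mul (38 * c * (1 - ρ)⁻¹)
    rw [mul_zero] at h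
    exact (h.eventually (ge_mem_nhds hδ)).exists
  set T : ℝ := 2 * (c ^ 2 * (1 - ρ ^ 2)⁻¹) + 2 * ((R + 1) * (c * (q : ℝ) ^ R)) with hT
  refine ⟨max (qp q T) (1 + c'), by simp [qp_ne_top, hc't], fun B V hV hs => ?_⟩
  refine SubNorm.ext_le_of_coeff_eq _ fun n => ⟨_, ?_, tq_eq_iff.1 (tq_eprod _ n)⟩
  rw [prod_primesLE_eq]
  refine ((N3 wx wu _).prod_le _ _).trans ?_
  set y : ℕ → ℝ := fun r => if r ≤ R then c * (q : ℝ) ^ R else 19 * c * V.natDegree * ρ ^ r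
    with hy
  have hy0 (r : ℕ) : 0 ≤ y r := by
    rw [hy]; dsimp only; split_ifs <;> positivity
  have hblock : ∀ r ∈ Finset.range (n + 1), N3 wx wu (qp q (-(1 / 2 + δ)))
      (∏ P ∈ primesDeg q r, (1 + PowerSeries.C (if P ∈ B then 0 else
        legSym q V P.1 • ellS P.1.natDegree) * PowerSeries.X ^ P.1.natDegree)) ≤
      qp q (2 * (c ^ 2 * (ρ ^ 2) ^ r)) * (qp q (2 * y r) *
        (1 + c') ^ (primesDeg q r ∩ B).card) := by
    intro r _
    rcases eq_or_ne r 0 with rfl | hr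
    · simp only [primesDeg_zero, Finset.prod_empty, Finset.empty_inter, Finset.card_empty,
        pow_zero, mul_one]
      refine (N3 wx wu _).one_le'.trans ?_
      exact one_le_mul (one_le_qp (by positivity)) (one_le_qp (by linarith [hy0 0]))
    have hxr : N2 wx wu (ellS r) * qp q (-(1 / 2 + δ)) ^ r ≤
        ENNReal.ofReal (c * (q : ℝ) ^ (-(1 / 2 + δ) * r)) := by
      rw [ENNReal.ofReal_mul hc0, hcc, ofReal_q_rpow, qp_pow]
      exact mul_le_mul_left (N2_ellS_le hx.le hu.le hr) _
    have hxle : (q : ℝ) ^ (-(1 / 2 + δ) * r) ≤ 1 :=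
      Real.rpow_le_one_of_one_le_of_nonpos one_lt_q_real.le
        (mul_nonpos_of_nonpos_of_nonneg (by linarith) r.cast_nonneg)
    have hx0 : 0 < (q : ℝ) ^ (-(1 / 2 + δ) * r) := Real.rpow_pos_of_pos q_real_pos _
    have hρr : ρ ^ r = (q : ℝ) ^ (-δ * r) := by
      rw [hρ, ← Real.rpow_mul_natCast q_real_pos.le]
    refine (N3_block_le B V r (by positivity) hxr).trans
      (mul_le_mul' (qp_mono (le_of_eq ?_)) (mul_le_mul' (qp_mono ?_) (pow_le_pow_left' ?_ _)))
    · rw [← pow_mul, mul_comm 2 r, pow_mul, hρr, mul_pow, ← Real.rpow_natCast _ r, mul_assoc,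
        ← Real.rpow_mul_natCast q_real_pos.le, ← Real.rpow_mul_natCast q_real_pos.le,
        ← Real.rpow_add q_real_pos]
      push_cast
      ring_nf
    · refine mul_le_mul_of_nonneg_left ?_ two_pos.le
      rw [hy]
      dsimp only
      split_ifs with h
      · rw [mul_assoc]
        refine mul_le_mul_of_nonneg_left ?_ hc0
        refine (mul_le_mul hxle (natAbs_sum_legSym_le_pow V r) (by positivity) one_pos.le).trans ?_
        rw [one_mul]
        exact pow_le_pow_right₀ one_lt_q_real.le h
      · refine (mul_le_mul_of_nonneg_left (natAbs_sum_legSym_le_sqrt hq hV hs hr)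
          (by positivity)).trans (le_of_eq ?_)
        have : (q : ℝ) ^ (-(1 / 2 + δ) * r) * (q : ℝ) ^ (r / 2 : ℝ) = ρ ^ r := by
          rw [hρr, ← Real.rpow_add q_real_pos]
          ring_nf
        rw [← this]
        ring
    · rw [← hcc]
      exact add_le_add_right (ENNReal.ofReal_le_ofReal (mul_le_of_le_one_right hc0 hxle)) 1
  refine (Finset.prod_le_prod' hblock).trans ?_
  rw [Finset.prod_mul_distrib, Finset.prod_mul_distrib, qp_sum, qp_sum,
    Finset.prod_pow_eq_pow_sum, ← mul_assoc, ← qp_add, mul_comm (_ ^ B.card), ← mul_assoc]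
  refine mul_le_mul' ?_ ?_
  · refine le_trans ?_ (mul_le_mul_left (le_max_left (qp q T) _) _)
    rw [← qp_add]
    refine qp_mono ?_
    rw [← Finset.mul_sum, ← Finset.mul_sum, ← Finset.mul_sum]
    have h1 := mul_le_mul_of_nonneg_left (hgeom (sq_nonneg ρ)
      (pow_lt_one₀ hρ0.le hρ1 two_ne_zero) (n + 1)) (sq_nonneg c)
    have h2 : ∑ r ∈ Finset.range (n + 1), y r ≤ (R + 1) * (c * (q : ℝ) ^ R) +
        19 * c * V.natDegree * (ρ ^ R * (1 - ρ)⁻¹) := by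
      have hle (r : ℕ) (h : ¬ r ≤ R) : ρ ^ r ≤ ρ ^ R * ρ ^ (r - R) := by
        rw [← pow_add]
        exact le_of_eq (by congr 1; omega)
      rw [hy, Finset.sum_ite]
      refine add_le_add ?_ ?_
      · rw [Finset.sum_const, nsmul_eq_mul]
        refine mul_le_mul_of_nonneg_right ?_ (by positivity)
        have : ((Finset.range (n + 1)).filter fun r => r ≤ R).card ≤ R + 1 := by
          rw [← Finset.card_range (R + 1)]
          refine Finset.card_le_card fun r hr => ?_
          rw [Finset.mem_filter] at hr
          exact Finset.mem_range.2 (by omega)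
        exact_mod_cast this
      · rw [← Finset.mul_sum]
        refine mul_le_mul_of_nonneg_left ?_ (by positivity)
        refine (Finset.sum_le_sum fun r hr => hle r (Finset.mem_filter.1 hr).2).trans ?_
        rw [← Finset.mul_sum]
        refine mul_le_mul_of_nonneg_left ?_ (by positivity)
        rw [← Finset.sum_image (s := (Finset.range (n + 1)).filter fun r => ¬ r ≤ R)
          (g := fun r => r - R) (f := fun k => ρ ^ k)]
        · rw [← tsum_geometric_of_lt_one hρ0.le hρ1]
          exact (summable_geometric_of_lt_one hρ0.le hρ1).sum_le_tsum _
            fun _ _ => by positivity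
        · intro a ha b hb hab
          simp only [Finset.coe_filter, Set.mem_ofPred_eq, not_le] at ha hb
          dsimp only at hab
          omega
    have h3 := mul_le_mul_of_nonneg_right hR (Nat.cast_nonneg V.natDegree (α := ℝ))
    rw [hT]
    nlinarith
  · exact (pow_le_pow_right₀ le_self_add (sum_card_primesDeg_inter_le B _)).trans
      (pow_le_pow_left' (le_max_right _ _) _)

end

noncomputable section

open scoped Classical ENNReal

variable {q : ℕ} [Fact q.Prime]

/-- The contribution to the terms with `d ≥ 1` of those `h` for which `pr A * h` satisfies `p`. -/
def twisted (q : ℕ) [Fact q.Prime] (p : Fqx q → Prop) (n m : ℕ) : ℝ :=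
  ∑ d ∈ Finset.Icc 1 n, ∑ B ∈ (primesLE q m).powerset, ∑ A ∈ B.powerset,
    ∑ k ∈ Finset.range (m + 1), ∑ i ∈ Finset.range d, gam q d k i *
      ∑ h ∈ (mon q i).filter fun h => p (pr A * h), PowerSeries.coeff (n - d)
        (PowerSeries.coeff (m - k) (ZS A B * PowerSeries.coeff d (FS B (pr A * h))))

lemma E_split (hq : q % 4 = 1) {n m : ℕ} (hnm : n ≤ m) :
    E q n m = PowerSeries.coeff n (LamS q * PowerSeries.coeff m
      (eprod fun P : MIrr q => thetaS P.1.natDegree)) +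
      (twisted q IsSquare n m + twisted q (fun V => ¬ IsSquare V) n m) := by
  rw [E_expand hq hnm, twisted, twisted]
  simp only [← Finset.sum_add_distrib, ← mul_add, Finset.sum_filter_add_sum_filter_not]

lemma enorm_gam_mul_le (d k i : ℕ) :
    ‖gam q d k i‖ₑ * (q : ℝ≥0∞) ^ i ≤ qp q (d / 2 + 1 / 2) := by
  by_cases h : i + k + 1 ≤ d
  · have h1 : |gam q d k i| ≤ (q : ℝ) ^ (k + 1) / (q : ℝ) ^ (d / 2) := by
      rw [gam, abs_mul, abs_of_nonneg (div_nonneg (pow_nonneg q_real_pos.le _)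
        (pow_nonneg q_real_pos.le _)), pow_succ, mul_div_right_comm]
      refine mul_le_mul_of_nonneg_left ?_ (div_nonneg (pow_nonneg q_real_pos.le _)
        (pow_nonneg q_real_pos.le _))
      have := one_lt_q_real (q := q)
      split_ifs <;> first
        | (rw [abs_of_nonneg (by linarith)]; linarith)
        | (rw [abs_neg, abs_one]; exact this.le)
    have h2 : (q : ℝ) ^ (k + 1) / (q : ℝ) ^ (d / 2) * (q : ℝ) ^ i ≤
        (q : ℝ) ^ ((d : ℝ) / 2 + 1 / 2) := by
      rw [← Real.rpow_natCast, ← Real.rpow_natCast, ← Real.rpow_natCast,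
        ← Real.rpow_sub q_real_pos, ← Real.rpow_add q_real_pos]
      refine Real.rpow_le_rpow_of_exponent_le one_lt_q_real.le ?_
      have e1 : (i : ℝ) + k + 1 ≤ d := by exact_mod_cast h
      have e2 : (d : ℝ) ≤ 2 * (d / 2 : ℕ) + 1 := by
        have : d ≤ 2 * (d / 2) + 1 := by omega
        exact_mod_cast this
      push_cast
      linarith
    rw [← ofReal_q_rpow, Real.enorm_eq_ofReal_abs, ← ENNReal.ofReal_natCast q,
      ← ENNReal.ofReal_pow q_real_pos.le, ← ENNReal.ofReal_mul (abs_nonneg _)]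
    refine ENNReal.ofReal_le_ofReal (le_trans ?_ h2)
    exact mul_le_mul_of_nonneg_right h1 (pow_nonneg q_real_pos.le _)
  · have : gam q d k i = 0 := by
      rw [gam]
      split_ifs <;> first | omega | simp
    simp [this]

lemma N2_ZS_le {wx wu : ℝ≥0∞} (hx : wx ≤ 1) (hu : wu ≤ 1) {A B : Finset (MIrr q)} :
    N2 wx wu (ZS A B) ≤ ((1 + q * wx ^ 4) * (1 - q * wx ^ 2)⁻¹ ^ 3 * (1 + q * wu ^ 2)) *
      ((∏ P ∈ B, 4 * wx ^ (2 * P.1.natDegree) * (1 - wx ^ 2)⁻¹ * (1 - wu ^ 2)⁻¹) *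
        (wu ^ dg A * wu ^ (2 * dg (B \ A)))) := by
  rw [ZS]
  refine ((N2 wx wu).mul_le' _ _).trans ?_
  rw [← mul_assoc]
  refine mul_le_mul' ?_ ?_
  · refine ((N2 wx wu).mul_le' _ _).trans (mul_le_mul' ?_ ?_)
    · refine ((N2 wx wu).mul_le' _ _).trans (mul_le_mul' ?_ ?_)
      · rw [N2, SubNorm.ext_C]
        exact N1_LamS_le
      · refine ((N2 wx wu).sub_le _ _).trans (add_le_add (N2 wx wu).one_le' ?_)
        refine ((N2 wx wu).mul_le' _ _).trans (mul_le_mul' ((N2 wx wu).natCast_le q) ?_)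
        exact SubNorm.ext_X_pow_le _ _
    · refine ((N2 wx wu).prod_le _ _).trans (Finset.prod_le_prod' fun P _ => ?_)
      exact N2_etaS_le hx hu (natDegree_ne_zero_of_MIrr P)
  · refine ((N2 wx wu).mul_le' _ _).trans (mul_le_mul' ?_ ?_)
    · refine ((N2 wx wu).prod_le _ _).trans ?_
      rw [dg, ← Finset.prod_pow_eq_pow_sum]
      refine Finset.prod_le_prod' fun P _ => ?_
      rw [(N2 wx wu).neg']
      exact SubNorm.ext_X_pow_le _ _
    · refine ((N2 wx wu).prod_le _ _).trans ?_
      rw [dg, Finset.mul_sum, ← Finset.prod_pow_eq_pow_sum]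
      exact Finset.prod_le_prod' fun P _ => SubNorm.ext_X_pow_le _ _

lemma enorm_coeff3_mul_le {wx wu wy : ℝ≥0∞} (F : A3) (a b c : ℕ) :
    ‖PowerSeries.coeff a (PowerSeries.coeff b (PowerSeries.coeff c F))‖ₑ *
      (wx ^ a * wu ^ b * wy ^ c) ≤ N3 wx wu wy F := by
  refine le_trans ?_ (SubNorm.coeff_le _ F c)
  rw [← mul_assoc]
  refine mul_le_mul_left ?_ _
  refine le_trans ?_ (SubNorm.coeff_le _ _ b)
  rw [← mul_assoc]
  exact mul_le_mul_left (SubNorm.coeff_le SubNorm.real _ a) _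

lemma sum_powerset_powerset_prod {S : Finset (MIrr q)} (f a : MIrr q → ℝ≥0∞) :
    ∑ B ∈ S.powerset, ∑ A ∈ B.powerset, (∏ P ∈ B, f P) * ∏ P ∈ A, a P =
      ∏ P ∈ S, (1 + f P * (1 + a P)) := by
  rw [← sum_powerset_prod_le]
  refine Finset.sum_congr rfl fun B _ => ?_
  rw [← Finset.mul_sum, sum_powerset_prod_le, Finset.prod_mul_distrib]

lemma qp_mul_cancel (a : ℝ) : qp q (-a) * qp q a = 1 := by rw [← qp_add, neg_add_cancel, qp_zero]

lemma exists_enorm_twisted_le (hq : q ≠ 2) {δ : ℝ} (hδ : 0 < δ) :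
    ∃ K : ℝ≥0∞, K ≠ ⊤ ∧ ∀ n m : ℕ, n ≤ m → ‖twisted q (fun V => ¬ IsSquare V) n m‖ₑ ≤
      K * (1 + m) ^ 3 * qp q ((n : ℝ) / 2 + (1 / 2 + 3 * δ) * m) := by
  set wx := qp q (-(1 / 2 + δ)) with hwx
  set wu := qp q (-δ) with hwu
  have hx : wx < 1 := qp_lt_one (by linarith)
  have hu : wu < 1 := qp_lt_one (by linarith)
  obtain ⟨K, hK, hFS⟩ := exists_N3_FS_le hq hδ hx hu
  rw [← hwx] at hFS
  set Z := (1 + q * wx ^ 4) * (1 - q * wx ^ 2)⁻¹ ^ 3 * (1 + q * wu ^ 2) with hZ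
  set c := 4 * (1 - wx ^ 2)⁻¹ * (1 - wu ^ 2)⁻¹ with hc
  have hxt : wx ≠ ⊤ := qp_ne_top _
  have hut : wu ≠ ⊤ := qp_ne_top _
  have hqx : q * wx ^ 2 < 1 := by
    rw [hwx, qp_pow, q_mul_qp]
    exact qp_lt_one (by push_cast; linarith)
  have hZt : Z ≠ ⊤ := ENNReal.mul_ne_top (ENNReal.mul_ne_top
    (by simp [ENNReal.mul_eq_top, hxt]) (ENNReal.pow_ne_top (inv_one_sub_ne_top hqx)))
    (by simp [ENNReal.mul_eq_top, hut])
  have hct : c ≠ ⊤ := ENNReal.mul_ne_top (ENNReal.mul_ne_top (by simp)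
    (inv_one_sub_ne_top (pow_lt_one₀ zero_le hx two_ne_zero)))
    (inv_one_sub_ne_top (pow_lt_one₀ zero_le hu two_ne_zero))
  obtain ⟨M, hM, hMle⟩ := exists_prime_prod_bound (q := q) (C := 2 * (c * K))
    (ρ := qp q (-(1 + δ))) (ENNReal.mul_ne_top (by simp) (ENNReal.mul_ne_top hct hK))
    (by rw [q_mul_qp]; exact qp_lt_one (by linarith))
  refine ⟨Z * K * qp q (1 / 2) * M, ENNReal.mul_ne_top (ENNReal.mul_ne_top
    (ENNReal.mul_ne_top hZt hK) (qp_ne_top _)) hM, fun n m hnm => ?_⟩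
  set Y := qp q ((n : ℝ) / 2 + (1 / 2 + 3 * δ) * m) with hY
  have hterm : ∀ d ∈ Finset.Icc 1 n, ∀ B A : Finset (MIrr q), ∀ k i : ℕ, i < d →
      ‖gam q d k i * ∑ h ∈ (mon q i).filter fun h => ¬ IsSquare (pr A * h),
        PowerSeries.coeff (n - d) (PowerSeries.coeff (m - k)
          (ZS A B * PowerSeries.coeff d (FS B (pr A * h))))‖ₑ ≤
      Z * K * qp q (1 / 2) * Y * ((∏ P ∈ B, c * K * (wx ^ 2) ^ P.1.natDegree) *
        ∏ P ∈ A, qp q δ ^ P.1.natDegree) := by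
    intro d hd B A k i hi
    rw [Finset.mem_Icc] at hd
    set W := Z * ((∏ P ∈ B, c * (wx ^ 2) ^ P.1.natDegree) *
      (K * (K ^ B.card * qp q (δ * (dg A + i : ℕ))))) * qp q ((1 / 2 + δ) * n + δ * m)
    have hh : ∀ h ∈ (mon q i).filter fun h => ¬ IsSquare (pr A * h),
        ‖PowerSeries.coeff (n - d) (PowerSeries.coeff (m - k)
          (ZS A B * PowerSeries.coeff d (FS B (pr A * h))))‖ₑ ≤ W := by
      intro h hh
      rw [Finset.mem_filter, mem_mon] at hh
      have hdeg : (pr A * h).natDegree = dg A + i := by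
        rw [(monic_pr A).natDegree_mul hh.1.1, natDegree_pr, hh.1.2]
      have h1 := hFS B _ ((monic_pr A).mul hh.1.1) hh.2
      rw [hdeg] at h1
      have h2 := enorm_coeff3_mul_le (wx := wx) (wu := wu) (wy := wx)
        (PowerSeries.C (ZS A B) * FS B (pr A * h)) (n - d) (m - k) d
      rw [PowerSeries.coeff_C_mul] at h2
      have h3 : qp q (-((1 / 2 + δ) * n + δ * m)) ≤ wx ^ (n - d) * wu ^ (m - k) * wx ^ d := by
        rw [mul_right_comm, ← pow_add, Nat.sub_add_cancel hd.2, hwx, hwu, qp_pow, qp_pow,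
          ← qp_add]
        refine qp_mono ?_
        have : ((m - k : ℕ) : ℝ) ≤ m := by exact_mod_cast Nat.sub_le m k
        nlinarith
      have h4 : N3 wx wu wx (PowerSeries.C (ZS A B) * FS B (pr A * h)) ≤
          Z * ((∏ P ∈ B, c * (wx ^ 2) ^ P.1.natDegree) *
            (K * (K ^ B.card * qp q (δ * (dg A + i : ℕ))))) := by
        refine ((N3 wx wu wx).mul_le' _ _).trans ?_
        rw [← mul_assoc]
        refine mul_le_mul' ?_ h1
        rw [N3, SubNorm.ext_C]
        refine (N2_ZS_le hx.le hu.le).trans (mul_le_mul_right ?_ Z)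
        refine (mul_le_of_le_one_right' (mul_le_one' (pow_le_one₀ zero_le hu.le)
          (pow_le_one₀ zero_le hu.le))).trans (le_of_eq ?_)
        refine Finset.prod_congr rfl fun P _ => ?_
        rw [hc, pow_mul]
        ring
      refine le_trans ?_ (mul_le_mul_left (h2.trans h4) _)
      refine le_trans ?_ (mul_le_mul_left (mul_le_mul_right h3 _) _)
      rw [mul_assoc, qp_mul_cancel, mul_one]
    rw [enorm_mul]
    have hsum : ‖∑ h ∈ (mon q i).filter fun h => ¬ IsSquare (pr A * h),
        PowerSeries.coeff (n - d) (PowerSeries.coeff (m - k)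
          (ZS A B * PowerSeries.coeff d (FS B (pr A * h))))‖ₑ ≤ (q : ℝ≥0∞) ^ i * W := by
      refine (enorm_sum_le _ _).trans ((Finset.sum_le_card_nsmul _ _ _ hh).trans ?_)
      rw [nsmul_eq_mul]
      refine mul_le_mul_left ?_ W
      have := (Finset.card_filter_le (mon q i) fun h => ¬ IsSquare (pr A * h)).trans_eq
        (card_mon i)
      exact_mod_cast this
    refine (mul_le_mul_right hsum _).trans ?_
    rw [← mul_assoc]
    refine (mul_le_mul_left (enorm_gam_mul_le d k i) W).trans ?_
    have e1 : (∏ P ∈ B, c * K * (wx ^ 2) ^ P.1.natDegree) =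
        (∏ P ∈ B, c * (wx ^ 2) ^ P.1.natDegree) * K ^ B.card := by
      rw [← Finset.prod_const, ← Finset.prod_mul_distrib]
      exact Finset.prod_congr rfl fun P _ => by ring
    have e2 : (∏ P ∈ A, qp q δ ^ P.1.natDegree) = qp q (δ * dg A) := by
      rw [Finset.prod_pow_eq_pow_sum, qp_pow, dg]
    rw [e1, e2]
    have e3 : qp q ((d : ℝ) / 2 + 1 / 2) * qp q (δ * (dg A + i : ℕ)) *
        qp q ((1 / 2 + δ) * n + δ * m) ≤ qp q (1 / 2) * Y * qp q (δ * dg A) := by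
      rw [hY, ← qp_add, ← qp_add, ← qp_add, ← qp_add]
      refine qp_mono ?_
      have i1 : (d : ℝ) ≤ n := by exact_mod_cast hd.2
      have i2 : (n : ℝ) ≤ m := by exact_mod_cast hnm
      have i3 : (i : ℝ) ≤ d := by exact_mod_cast hi.le
      push_cast
      nlinarith
    calc _ = Z * K * ((∏ P ∈ B, c * (wx ^ 2) ^ P.1.natDegree) * K ^ B.card) *
        (qp q ((d : ℝ) / 2 + 1 / 2) * qp q (δ * (dg A + i : ℕ)) *
        qp q ((1 / 2 + δ) * n + δ * m)) := by ring
      _ ≤ _ := mul_le_mul_right e3 _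
      _ = _ := by ring
  rw [twisted]
  have hAB : ∑ B ∈ (primesLE q m).powerset, ∑ A ∈ B.powerset,
      ((∏ P ∈ B, c * K * (wx ^ 2) ^ P.1.natDegree) * ∏ P ∈ A, qp q δ ^ P.1.natDegree) ≤ M := by
    rw [sum_powerset_powerset_prod]
    refine le_trans (Finset.prod_le_prod' fun P _ => ?_) (hMle (primesLE q m))
    refine add_le_add_right ?_ 1
    have h1 : 1 + qp q δ ^ P.1.natDegree ≤ 2 * qp q δ ^ P.1.natDegree := by
      rw [two_mul]
      exact add_le_add_left (one_le_pow₀ (one_le_qp hδ.le)) _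
    have h2 : wx ^ 2 * qp q δ = qp q (-(1 + δ)) := by
      rw [hwx, qp_pow, ← qp_add]
      congr 1
      push_cast
      ring
    refine (mul_le_mul_right h1 _).trans (le_of_eq ?_)
    rw [← h2, mul_pow]
    ring
  calc _ ≤ ∑ d ∈ Finset.Icc 1 n, ∑ B ∈ (primesLE q m).powerset, ∑ A ∈ B.powerset,
      ∑ k ∈ Finset.range (m + 1), ∑ i ∈ Finset.range d, Z * K * qp q (1 / 2) * Y *
        ((∏ P ∈ B, c * K * (wx ^ 2) ^ P.1.natDegree) * ∏ P ∈ A, qp q δ ^ P.1.natDegree) := by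
        refine (enorm_sum_le _ _).trans (Finset.sum_le_sum fun d hd => ?_)
        refine (enorm_sum_le _ _).trans (Finset.sum_le_sum fun B _ => ?_)
        refine (enorm_sum_le _ _).trans (Finset.sum_le_sum fun A _ => ?_)
        refine (enorm_sum_le _ _).trans (Finset.sum_le_sum fun k _ => ?_)
        refine (enorm_sum_le _ _).trans (Finset.sum_le_sum fun i hi => ?_)
        refine le_of_eq_of_le ?_ (hterm d hd B A k i (Finset.mem_range.1 hi))
        congr!
    _ ≤ ∑ d ∈ Finset.Icc 1 n, ((m + 1 : ℕ) : ℝ≥0∞) * ((m + 1 : ℕ) : ℝ≥0∞) *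
        (Z * K * qp q (1 / 2) * Y * M) := by
        refine Finset.sum_le_sum fun d hd => ?_
        rw [Finset.mem_Icc] at hd
        have e (X w : ℝ≥0∞) : ∑ k ∈ Finset.range (m + 1), ∑ i ∈ Finset.range d, X * w =
            ((m + 1 : ℕ) * d * X) * w := by
          simp only [Finset.sum_const, Finset.card_range, nsmul_eq_mul, mul_assoc]
        simp only [e]
        simp only [← Finset.mul_sum] at hAB ⊢
        rw [mul_assoc ((m + 1 : ℕ) * (d : ℝ≥0∞))]
        refine mul_le_mul' (mul_le_mul_right ?_ _) (mul_le_mul_right hAB _)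
        exact_mod_cast (hd.2.trans (hnm.trans (Nat.le_succ m)))
    _ ≤ _ := by
        rw [Finset.sum_const, nsmul_eq_mul, Nat.card_Icc, Nat.add_sub_cancel]
        have : (n : ℝ≥0∞) ≤ 1 + m := by
          exact_mod_cast (hnm.trans (Nat.le_add_left m 1))
        refine (mul_le_mul_left this _).trans (le_of_eq ?_)
        push_cast
        ring

/-- The central values weighted by the coefficients of degree at most `2g`. -/
def halfSum (q : ℕ) (F : ℕ → ℕ → ℝ) (g : ℕ) : ℝ :=
  ∑ n ∈ Finset.range (2 * g + 1), rq q ^ n * F n (2 * g + 1) +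
    ∑ n ∈ Finset.range (2 * g), rq q ^ n * F n (2 * g + 1)

lemma negl_halfSum_nonsquare (hq : q ≠ 2) :
    Negl q (halfSum q (twisted q fun V => ¬ IsSquare V)) := by
  refine negl_of_le 4 fun ε hε _ => ?_
  obtain ⟨K, hK, h⟩ := exists_enorm_twisted_le hq (δ := ε / 3) (by positivity)
  have key (n m : ℕ) (hnm : n ≤ m) : |rq q ^ n * twisted q (fun V => ¬ IsSquare V) n m| ≤
      K.toReal * (1 + m : ℝ) ^ 3 * (q : ℝ) ^ ((1 / 2 + ε) * m) := by
    have ht : K * (1 + (m : ℝ≥0∞)) ^ 3 *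
        qp q ((n : ℝ) / 2 + (1 / 2 + 3 * (ε / 3)) * m) ≠ ⊤ :=
      ENNReal.mul_ne_top (ENNReal.mul_ne_top hK (ENNReal.pow_ne_top (by finiteness)))
        (qp_ne_top _)
    have h1 := ENNReal.toReal_mono ht (h n m hnm)
    rw [toReal_enorm, Real.norm_eq_abs, ENNReal.toReal_mul, ENNReal.toReal_mul, qp_toReal,
      ENNReal.toReal_pow, ENNReal.toReal_add (by simp) (by simp), ENNReal.toReal_one,
      ENNReal.toReal_natCast] at h1
    rw [abs_mul, abs_of_pos (pow_pos rq_pos n)]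
    refine (mul_le_mul_of_nonneg_left h1 (pow_nonneg rq_pos.le n)).trans (le_of_eq ?_)
    have e : rq q ^ n * (q : ℝ) ^ ((n : ℝ) / 2 + (1 / 2 + 3 * (ε / 3)) * m) =
        (q : ℝ) ^ ((1 / 2 + ε) * m) := by
      rw [rq, ← Real.rpow_mul_natCast q_real_pos.le, ← Real.rpow_add q_real_pos]
      ring_nf
    rw [← e]
    ring
  refine ⟨2 * K.toReal, by positivity, fun g => ?_⟩
  have hs (N : ℕ) (hN : N ≤ 2 * g + 1) : |∑ n ∈ Finset.range N,
      rq q ^ n * twisted q (fun V => ¬ IsSquare V) n (2 * g + 1)| ≤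
      K.toReal * (1 + (2 * g + 1 : ℕ) : ℝ) ^ 4 * (q : ℝ) ^ ((1 / 2 + ε) * (2 * g + 1)) := by
    refine (Finset.abs_sum_le_sum_abs _ _).trans ((Finset.sum_le_card_nsmul _ _ _ fun n hn =>
      key n (2 * g + 1) ((Finset.mem_range.1 hn).le.trans hN)).trans ?_)
    rw [Finset.card_range, nsmul_eq_mul]
    have hN' : (N : ℝ) ≤ 1 + (2 * g + 1 : ℕ) := by exact_mod_cast (by omega : N ≤ 1 + (2 * g + 1))
    have hq0 : (0 : ℝ) ≤ (q : ℝ) ^ ((1 / 2 + ε) * (2 * g + 1 : ℕ)) :=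
      Real.rpow_nonneg q_real_pos.le _
    refine (mul_le_mul_of_nonneg_right hN' (by positivity)).trans (le_of_eq ?_)
    push_cast
    ring
  refine (abs_add_le _ _).trans ((add_le_add (hs _ le_rfl) (hs _ (by omega))).trans
    (le_of_eq (by ring)))

end

noncomputable section

open scoped Classical ENNReal

variable {q : ℕ} [Fact q.Prime]

lemma isSquare_pr_mul_iff (A : Finset (MIrr q)) {h : Fqx q} (hh : h.Monic) :
    IsSquare (pr A * h) ↔ ∃ g : Fqx q, g.Monic ∧ h = pr A * g ^ 2 := by
  constructor
  · rintro ⟨s, hs⟩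
    have hpr : pr A ≠ 0 := (monic_pr A).ne_zero
    have hd : pr A ∣ s := ((squarefree_pr A).dvd_pow_iff_dvd two_ne_zero).1
      ⟨h, by rw [pow_two, ← hs]⟩
    obtain ⟨g, rfl⟩ := hd
    have e : h = pr A * g ^ 2 := mul_left_cancel₀ hpr (by rw [hs]; ring)
    have hl : g.leadingCoeff ^ 2 = 1 := by
      have := congrArg leadingCoeff e
      rwa [hh.leadingCoeff, leadingCoeff_mul, (monic_pr A).leadingCoeff, one_mul,
        leadingCoeff_pow, eq_comm] at this
    refine ⟨C g.leadingCoeff * g, ?_, ?_⟩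
    · rw [Monic, leadingCoeff_mul, leadingCoeff_C, ← pow_two, hl]
    · rw [mul_pow, ← C_pow, hl, C_1, one_mul, ← e]
  · rintro ⟨g, -, rfl⟩
    exact ⟨pr A * g, by ring⟩

lemma coeff_of_one_sub_sq_mul {R : Type*} [CommRing R] {a : R} {F G : PowerSeries R}
    (h : (1 - PowerSeries.C a * PowerSeries.X) ^ 2 * F = G) (n : ℕ) :
    PowerSeries.coeff n F = ∑ t ∈ Finset.range (n + 1),
      ((n - t : ℕ) + 1 : R) * a ^ (n - t) * PowerSeries.coeff t G := by
  have h1 : (PowerSeries.mk fun n => ((n : R) + 1) * a ^ n) *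
      (1 - PowerSeries.C a * PowerSeries.X) = PowerSeries.mk fun n => a ^ n := by
    ext n
    rw [mul_sub, mul_one, mul_left_comm, map_sub, PowerSeries.coeff_C_mul]
    cases n with
    | zero => simp
    | succ n =>
      rw [PowerSeries.coeff_succ_mul_X]
      simp only [PowerSeries.coeff_mk]
      push_cast
      ring
  have h2 : (PowerSeries.mk fun n => a ^ n) * (1 - PowerSeries.C a * PowerSeries.X) = 1 := by
    ext n
    rw [mul_sub, mul_one, mul_left_comm, map_sub, PowerSeries.coeff_C_mul]
    cases n with
    | zero => simp
    | succ n =>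
      rw [PowerSeries.coeff_succ_mul_X]
      simp only [PowerSeries.coeff_mk, PowerSeries.coeff_one]
      rw [if_neg (by omega)]
      ring
  have hF : F = G * PowerSeries.mk fun n => ((n : R) + 1) * a ^ n := by
    rw [← h, mul_comm, ← mul_assoc, pow_two, ← mul_assoc, h1, h2, one_mul]
  rw [hF, PowerSeries.coeff_mul, Finset.Nat.sum_antidiagonal_eq_sum_range_succ_mk]
  refine Finset.sum_congr rfl fun t _ => ?_
  rw [PowerSeries.coeff_mk]
  ring

/-- The generating series of the principal character outside `R`. -/
def ES (R : Finset (MIrr q)) : A3 := eprod fun P => if P ∈ R then 0 else ellS P.1.natDegree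

/-- `ES R` with its pole removed. -/
def GS (R : Finset (MIrr q)) : A3 := (1 - (q : A3) * PowerSeries.X) ^ 2 * ES R

lemma FS_square {A B : Finset (MIrr q)} (hAB : A ⊆ B) {g : Fqx q} (hg : g.Monic) :
    FS B (pr A * (pr A * g ^ 2)) = ES (B ∪ primeSet g) := by
  rw [FS, ES]
  congr 1
  funext P
  by_cases hB : P ∈ B
  · simp [hB]
  by_cases hP : P.1 ∣ g
  · rw [if_neg hB, if_pos (Finset.mem_union_right _ ((mem_primeSet hg.ne_zero).2 hP)),
      legSym_eq_zero ((dvd_pow hP two_ne_zero).mul_left _ |>.mul_left _), zero_smul]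
  · have hA : ¬ P.1 ∣ pr A * g := fun h => (P.2.2.prime.dvd_or_dvd h).elim
      (fun h => hB (hAB ((prime_dvd_pr_iff A P).1 h))) hP
    rw [if_neg hB, if_neg (by simp [hB, mem_primeSet hg.ne_zero, hP]),
      show pr A * (pr A * g ^ 2) = (pr A * g) * (pr A * g) by ring, legSym_mul, ← pow_two,
      legSym_sq hA, one_smul]

lemma coeff_ES (R : Finset (MIrr q)) (d : ℕ) : PowerSeries.coeff d (ES R) =
    ∑ t ∈ Finset.range (d + 1), ((d - t + 1) * q ^ (d - t) : ℕ) • PowerSeries.coeff t (GS R) := by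
  rw [coeff_of_one_sub_sq_mul (a := (q : A2)) (F := ES R) (G := GS R) (by rw [GS]; simp)]
  refine Finset.sum_congr rfl fun t _ => ?_
  rw [nsmul_eq_mul]
  push_cast
  rfl

lemma coeff_ES_mem_evenS (R : Finset (MIrr q)) (d : ℕ) : PowerSeries.coeff d (ES R) ∈ evenS := by
  rw [ES, coeff_eprod]
  refine sum_mem fun D _ => prod_mem fun P _ => ?_
  split_ifs
  · exact zero_mem _
  · exact ellS_mem_evenS (natDegree_ne_zero_of_MIrr P)

lemma exists_ZS_eq (A B : Finset (MIrr q)) :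
    ∃ F ∈ evenS, ZS A B = PowerSeries.X ^ dg A * F := by
  refine ⟨(-1) ^ A.card * (PowerSeries.C (LamS q) * (1 - (q : A2) * PowerSeries.X ^ 2) *
    (∏ P ∈ B, etaS P.1.natDegree) * ∏ P ∈ B \ A, PowerSeries.X ^ (2 * P.1.natDegree)), ?_, ?_⟩
  · refine mul_mem (pow_mem (neg_mem (one_mem _)) _) (mul_mem (mul_mem (mul_mem C_LamS_mem_evenS
      (sub_mem (one_mem _) (mul_mem (natCast_mem _ q) (X_pow_mem_evenS (by decide)))))
      (prod_mem fun P _ => etaS_mem_evenS (natDegree_ne_zero_of_MIrr P)))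
      (prod_mem fun P _ => X_pow_mem_evenS (even_two_mul _)))
  · rw [ZS, Finset.prod_neg, Finset.prod_pow_eq_pow_sum, dg]
    ring

lemma coeff_ZS_mul_eq_zero_of_odd_x (A B : Finset (MIrr q)) {F : A2} (hF : F ∈ evenS) {a : ℕ}
    (ha : Odd a) (b : ℕ) : PowerSeries.coeff a (PowerSeries.coeff b (ZS A B * F)) = 0 := by
  obtain ⟨G, hG, e⟩ := exists_ZS_eq A B
  rw [e, mul_assoc, PowerSeries.coeff_X_pow_mul']
  split_ifs
  · exact coeff_evenS_x (mul_mem hG hF) ha _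
  · simp

lemma coeff_ZS_mul_eq_zero_of_odd_u (A B : Finset (MIrr q)) {F : A2} (hF : F ∈ evenS) {b : ℕ}
    (hb : Odd (b + dg A)) : PowerSeries.coeff b (ZS A B * F) = 0 := by
  obtain ⟨G, hG, e⟩ := exists_ZS_eq A B
  rw [e, mul_assoc, PowerSeries.coeff_X_pow_mul']
  split_ifs with h
  · refine coeff_evenS_u (mul_mem hG hF) ?_
    rw [Nat.odd_iff] at hb ⊢
    omega
  · rfl

lemma coeff_ZS_mul_eq_zero_of_lt {A B : Finset (MIrr q)} (hAB : A ⊆ B) (F : A2) {b : ℕ}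
    (hb : b < dg B) : PowerSeries.coeff b (ZS A B * F) = 0 := by
  have h : (PowerSeries.X : A2) ^ dg B ∣ ZS A B * F := by
    refine Dvd.dvd.mul_right (Dvd.dvd.mul_left ?_ _) _
    rw [dg, ← Finset.prod_pow_eq_pow_sum, ← Finset.prod_sdiff hAB, mul_comm (∏ P ∈ A, _)]
    refine mul_dvd_mul (Finset.prod_dvd_prod_of_dvd _ _ fun P _ => pow_dvd_pow _ (by omega))
      (Finset.prod_dvd_prod_of_dvd _ _ fun P _ => (dvd_neg.2 dvd_rfl))
  exact PowerSeries.X_pow_dvd_iff.1 h b hb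

/-- The coefficient coming from reflecting the sums over `h`. -/
def brk (q κ i : ℕ) : ℝ := if i < κ then q - 1 else if i = κ then -1 else 0

/-- The contribution of `A`, `B` and the polynomials of degree `e` with prime set in `R`. -/
def sqTerm (j s κ t : ℕ) (A B R : Finset (MIrr q)) (e : ℕ) : ℝ :=
  (q : ℝ)⁻¹ ^ κ * rq q ^ s * (q : ℝ)⁻¹ ^ t * brk q κ (dg A + 2 * e + j + s + 1) *
    PowerSeries.coeff s (PowerSeries.coeff κ (ZS A B * PowerSeries.coeff t (GS R)))

lemma rq_pow_mul_gam {m n d k i t : ℕ} (hd : d ≤ n) (hn : n ≤ m) (hk : k ≤ m) (hev : Even d)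
    (ht : t ≤ d) :
    rq q ^ n * (gam q d k i * (q : ℝ) ^ (d - t)) = (q : ℝ) ^ m * ((q : ℝ)⁻¹ ^ (m - k) *
      rq q ^ (n - d) * (q : ℝ)⁻¹ ^ t * brk q (m - k) (i + (m - n) + (n - d) + 1)) := by
  obtain ⟨c, rfl⟩ := hev
  have hq0 : (q : ℝ) ≠ 0 := q_real_pos.ne'
  have hinv : (q : ℝ)⁻¹ = rq q ^ 2 := (eq_inv_of_mul_eq_one_left rq_sq).symm
  have h1 : rq q ^ n = rq q ^ (n - (c + c)) * (q : ℝ)⁻¹ ^ c := by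
    rw [hinv, ← pow_mul, ← pow_add]
    congr 1
    omega
  have h2 (a b : ℕ) (hab : b ≤ a) : (q : ℝ) ^ (a - b) = (q : ℝ) ^ a * (q : ℝ)⁻¹ ^ b := by
    rw [inv_pow, ← div_eq_mul_inv, eq_div_iff (pow_ne_zero _ hq0), ← pow_add]
    congr 1
    omega
  have h2' : (q : ℝ) ^ k = (q : ℝ) ^ m * (q : ℝ)⁻¹ ^ (m - k) := by
    rw [← h2 _ _ (Nat.sub_le m k), Nat.sub_sub_self hk]
  have h3 : (if i + k + 1 < c + c then (q : ℝ) - 1 else if i + k + 1 = c + c then -1 else 0) =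
      brk q (m - k) (i + (m - n) + (n - (c + c)) + 1) := by
    rw [brk]
    split_ifs <;> first | rfl | omega
  rw [gam, if_pos ⟨c, rfl⟩, h3, h1, h2', h2 _ _ ht, show (c + c) / 2 = c by omega, inv_pow _ c,
    pow_add]
  field_simp

end

noncomputable section

open scoped Classical ENNReal

variable {q : ℕ} [Fact q.Prime]

lemma coeff_GS_mem_evenS (R : Finset (MIrr q)) (d : ℕ) : PowerSeries.coeff d (GS R) ∈ evenS := by
  have h : (1 - (q : A3) * PowerSeries.X) ^ 2 = 1 - PowerSeries.C (2 * q : A2) * PowerSeries.X ^ 1 +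
      PowerSeries.C (q ^ 2 : A2) * PowerSeries.X ^ 2 := by
    simp only [map_mul, map_pow, map_natCast, map_ofNat]
    ring
  rw [GS, h, add_mul, sub_mul, one_mul, map_add, map_sub, mul_assoc, mul_assoc,
    PowerSeries.coeff_C_mul, PowerSeries.coeff_C_mul, PowerSeries.coeff_X_pow_mul',
    PowerSeries.coeff_X_pow_mul']
  have hq : (q : A2) ∈ evenS := natCast_mem _ q
  refine add_mem (sub_mem (coeff_ES_mem_evenS R d) (mul_mem (mul_mem (ofNat_mem _ 2) hq) ?_))
    (mul_mem (pow_mem hq 2) ?_)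
  all_goals
    split_ifs
    · exact coeff_ES_mem_evenS R _
    · exact zero_mem _

lemma rq_pow_mul_square_term {m n d k : ℕ} (hm : Odd m) (hd : d ≤ n) (hn : n ≤ m) (hk : k ≤ m)
    (A B R : Finset (MIrr q)) (e : ℕ) :
    rq q ^ n * (gam q d k (dg A + 2 * e) * PowerSeries.coeff (n - d) (PowerSeries.coeff (m - k)
      (ZS A B * PowerSeries.coeff d (ES R)))) =
    if Odd (m - n) ∧ Even (n - d) then (q : ℝ) ^ m * ∑ t ∈ Finset.range (d + 1),
      sqTerm (m - n) (n - d) (m - k) t A B R e * ((m : ℝ) + 1 - (m - n + (n - d) + t : ℕ))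
    else 0 := by
  by_cases hs : Odd (n - d)
  · rw [coeff_ZS_mul_eq_zero_of_odd_x A B (coeff_ES_mem_evenS R d) hs,
      if_neg (fun h => Nat.not_even_iff_odd.2 hs h.2), mul_zero, mul_zero]
  by_cases hκ : Odd (m - k + dg A)
  · rw [coeff_ZS_mul_eq_zero_of_odd_u A B (coeff_ES_mem_evenS R d) hκ, map_zero, mul_zero, mul_zero]
    split_ifs
    · rw [Finset.sum_eq_zero, mul_zero]
      intro t _
      rw [sqTerm, coeff_ZS_mul_eq_zero_of_odd_u A B (coeff_GS_mem_evenS R t) hκ, map_zero, mul_zero,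
        zero_mul]
    · rfl
  rw [Nat.odd_iff] at hm hs hκ
  by_cases hev : Even d
  · have hev' := Nat.even_iff.1 hev
    rw [if_pos ⟨Nat.odd_iff.2 (by omega), Nat.even_iff.2 (by omega)⟩, coeff_ES, Finset.mul_sum,
      map_sum, map_sum, Finset.mul_sum, Finset.mul_sum, Finset.mul_sum]
    refine Finset.sum_congr rfl fun t ht => ?_
    have ht' : t ≤ d := Nat.lt_succ_iff.1 (Finset.mem_range.1 ht)
    have h := rq_pow_mul_gam (q := q) (i := dg A + 2 * e) hd hn hk hev ht'
    have hl : (m : ℝ) + 1 - (m - n + (n - d) + t : ℕ) = ((d - t + 1 : ℕ) : ℝ) := by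
      rw [sub_eq_iff_eq_add]
      exact_mod_cast (by omega : m + 1 = d - t + 1 + (m - n + (n - d) + t))
    rw [mul_smul_comm, map_nsmul, map_nsmul, nsmul_eq_mul, hl, sqTerm, Nat.cast_mul, Nat.cast_pow]
    linear_combination ((d - t + 1 : ℕ) : ℝ) * PowerSeries.coeff (n - d) (PowerSeries.coeff (m - k)
      (ZS A B * PowerSeries.coeff t (GS R))) * h
  · rw [Nat.even_iff] at hev
    rw [if_neg (by rw [Nat.odd_iff]; omega), gam, if_neg (by rwa [Nat.even_iff]), if_neg (by omega)]
    simp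

lemma gam_eq_zero {d k i : ℕ} (h : d ≤ i) : gam q d k i = 0 := by
  rw [gam]
  split_ifs <;> first | omega | simp

lemma sum_gam_square (A : Finset (MIrr q)) {d k m : ℕ} (hd : d ≤ m) (f : Fqx q → ℝ) :
    ∑ i ∈ Finset.range d, gam q d k i *
        ∑ h ∈ (mon q i).filter (fun h => IsSquare (pr A * h)), f h =
      ∑ e ∈ Finset.range m, ∑ g ∈ mon q e, gam q d k (dg A + 2 * e) * f (pr A * g ^ 2) := by
  have hr : ∑ e ∈ Finset.range m, ∑ g ∈ mon q e, gam q d k (dg A + 2 * e) * f (pr A * g ^ 2) =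
      ∑ e ∈ (Finset.range m).filter (fun e => dg A + 2 * e < d), ∑ g ∈ mon q e,
        gam q d k (dg A + 2 * e) * f (pr A * g ^ 2) := by
    rw [Finset.sum_filter_of_ne]
    intro e _ he
    by_contra hlt
    exact he (Finset.sum_eq_zero fun g _ => by rw [gam_eq_zero (not_lt.1 hlt), zero_mul])
  rw [hr]
  simp only [Finset.mul_sum]
  rw [Finset.sum_sigma', Finset.sum_sigma']
  have hdeg {e : ℕ} {g : Fqx q} (hg : g ∈ mon q e) : pr A * g ^ 2 ∈ mon q (dg A + 2 * e) := by
    rw [mem_mon] at hg ⊢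
    refine ⟨(monic_pr A).mul (hg.1.pow 2), ?_⟩
    rw [(monic_pr A).natDegree_mul (hg.1.pow 2), hg.1.natDegree_pow, natDegree_pr, hg.2]
  symm
  refine Finset.sum_nbij (fun x => ⟨dg A + 2 * x.1, pr A * x.2 ^ 2⟩) ?_ ?_ ?_ ?_
  · rintro ⟨e, g⟩ h
    simp only [Finset.mem_sigma, Finset.mem_filter, Finset.mem_range] at h ⊢
    exact ⟨h.1.2, hdeg h.2, pr A * g, by ring⟩
  · rintro ⟨e, g⟩ h ⟨e', g'⟩ h' he
    simp only [Finset.coe_sigma, Set.mem_sigma_iff, Finset.mem_coe] at h h'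
    have hg := mem_mon.1 h.2
    have hg' := mem_mon.1 h'.2
    have h1 : pr A * g ^ 2 = pr A * g' ^ 2 := by
      have := congrArg Sigma.snd he
      exact this
    have h2 : g = g' := by
      rcases sq_eq_sq_iff_eq_or_eq_neg.1 (mul_left_cancel₀ (monic_pr A).ne_zero h1) with h2 | h2
      · exact h2
      · have h3 : (1 : ZMod q) = -1 := by
          have := congrArg leadingCoeff h2
          rwa [leadingCoeff_neg, hg.1.leadingCoeff, hg'.1.leadingCoeff] at this
        rw [h2, neg_eq_neg_one_mul, ← C_1, ← C_neg, ← h3, C_1, one_mul]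
    obtain rfl := h2
    obtain rfl := hg.2.symm.trans hg'.2
    rfl
  · rintro ⟨i, h⟩ hh
    simp only [Finset.coe_sigma, Set.mem_sigma_iff, Finset.mem_coe, Finset.mem_filter,
      Finset.mem_range] at hh
    obtain ⟨g, hg, rfl⟩ := (isSquare_pr_mul_iff A (mem_mon.1 hh.2.1).1).1 hh.2.2
    have hg' : g ∈ mon q g.natDegree := mem_mon.2 ⟨hg, rfl⟩
    have hi : i = dg A + 2 * g.natDegree :=
      (mem_mon.1 hh.2.1).2.symm.trans (mem_mon.1 (hdeg hg')).2
    subst hi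
    refine ⟨⟨g.natDegree, g⟩, ?_, rfl⟩
    simp only [Finset.coe_sigma, Set.mem_sigma_iff, Finset.mem_coe, Finset.mem_filter,
      Finset.mem_range]
    exact ⟨⟨by omega, hh.1⟩, hg'⟩
  · rintro ⟨e, g⟩ _
    rfl

/-- The total contribution of the squares for fixed values of the remaining parameters. -/
def sqSum (q : ℕ) [Fact q.Prime] (j s κ t : ℕ) : ℝ :=
  ∑ B ∈ (primesLE q κ).powerset, ∑ A ∈ B.powerset, ∑ e ∈ Finset.range κ, ∑ g ∈ mon q e,
    sqTerm j s κ t A B (B ∪ primeSet g) e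

lemma sqTerm_eq_zero_of_brk {j s κ t e : ℕ} (A B R : Finset (MIrr q))
    (h : κ < dg A + 2 * e + j + s + 1) : sqTerm j s κ t A B R e = 0 := by
  rw [sqTerm, brk, if_neg (by omega), if_neg (by omega)]
  simp

lemma sqTerm_eq_zero_of_lt {j s κ t e : ℕ} {A B : Finset (MIrr q)} (hAB : A ⊆ B)
    (R : Finset (MIrr q)) (h : κ < dg B) : sqTerm j s κ t A B R e = 0 := by
  rw [sqTerm, coeff_ZS_mul_eq_zero_of_lt hAB _ h, map_zero, mul_zero]

lemma sqSum_eq_zero {j s κ t : ℕ} (h : κ ≤ j + s) : sqSum q j s κ t = 0 :=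
  Finset.sum_eq_zero fun _ _ => Finset.sum_eq_zero fun _ _ => Finset.sum_eq_zero fun _ _ =>
    Finset.sum_eq_zero fun _ _ => sqTerm_eq_zero_of_brk _ _ _ (by omega)

lemma sum_sqTerm_eq_sqSum {κ m : ℕ} (hκ : κ ≤ m) (j s t : ℕ) :
    ∑ B ∈ (primesLE q m).powerset, ∑ A ∈ B.powerset, ∑ e ∈ Finset.range m, ∑ g ∈ mon q e,
      sqTerm j s κ t A B (B ∪ primeSet g) e = sqSum q j s κ t := by
  have hsub : (primesLE q κ).powerset ⊆ (primesLE q m).powerset :=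
    Finset.powerset_mono.2 fun P hP => mem_primesLE.2 ((mem_primesLE.1 hP).trans hκ)
  rw [sqSum, Finset.sum_subset hsub]
  · refine Finset.sum_congr rfl fun B _ => Finset.sum_congr rfl fun A _ => ?_
    rw [Finset.sum_subset (Finset.range_subset_range.2 hκ)]
    intro e _ he
    rw [Finset.mem_range, not_lt] at he
    exact Finset.sum_eq_zero fun g _ => sqTerm_eq_zero_of_brk _ _ _ (by omega)
  · intro B _ hB
    rw [Finset.mem_powerset, Finset.not_subset] at hB
    obtain ⟨P, hP, hPκ⟩ := hB
    have hdg : κ < dg B := (not_le.1 fun h => hPκ (mem_primesLE.2 h)).trans_le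
      (Finset.single_le_sum (f := fun P : MIrr q => P.1.natDegree) (fun _ _ => Nat.zero_le _) hP)
    exact Finset.sum_eq_zero fun A hA => Finset.sum_eq_zero fun _ _ => Finset.sum_eq_zero fun _ _ =>
      sqTerm_eq_zero_of_lt (Finset.mem_powerset.1 hA) _ hdg

/-- The coefficients of the secondary term; `j₀` records which half of the sum is considered. -/
def sqW (q : ℕ) [Fact q.Prime] (j₀ : ℕ) (τ : ℕ × ℕ × ℕ × ℕ) : ℝ :=
  if j₀ ≤ τ.1 ∧ Odd τ.1 ∧ Even τ.2.1 then sqSum q τ.1 τ.2.1 τ.2.2.1 τ.2.2.2 else 0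

lemma rq_pow_mul_twisted_isSquare {n m : ℕ} (hm : Odd m) (hn : n ≤ m) :
    rq q ^ n * twisted q IsSquare n m = ∑ d ∈ Finset.Icc 1 n, ∑ k ∈ Finset.range (m + 1),
      ∑ t ∈ Finset.range (d + 1), (q : ℝ) ^ m * (if Odd (m - n) ∧ Even (n - d) then
        sqSum q (m - n) (n - d) (m - k) t * ((m : ℝ) + 1 - (m - n + (n - d) + t : ℕ)) else 0) := by
  rw [twisted, Finset.mul_sum]
  refine Finset.sum_congr rfl fun d hd => ?_
  rw [Finset.mem_Icc] at hd
  have h1 (B) (_ : B ∈ (primesLE q m).powerset) (A) (hA : A ∈ B.powerset) (k : ℕ)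
      (hk : k ∈ Finset.range (m + 1)) :
      rq q ^ n * ∑ i ∈ Finset.range d, gam q d k i *
        ∑ h ∈ (mon q i).filter fun h => IsSquare (pr A * h), PowerSeries.coeff (n - d)
          (PowerSeries.coeff (m - k) (ZS A B * PowerSeries.coeff d (FS B (pr A * h)))) =
      ∑ t ∈ Finset.range (d + 1), ∑ e ∈ Finset.range m, ∑ g ∈ mon q e,
        if Odd (m - n) ∧ Even (n - d) then (q : ℝ) ^ m *
          (sqTerm (m - n) (n - d) (m - k) t A B (B ∪ primeSet g) e *
            ((m : ℝ) + 1 - (m - n + (n - d) + t : ℕ))) else 0 := by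
    have h2 := sum_gam_square (k := k) A (hd.2.trans hn) fun h => PowerSeries.coeff (n - d)
          (PowerSeries.coeff (m - k) (ZS A B * PowerSeries.coeff d (FS B (pr A * h))))
    rw [Finset.sum_comm]
    refine (congrArg (rq q ^ n * ·) (Eq.trans (by congr!) h2)).trans ?_
    simp only [Finset.mul_sum]
    refine Finset.sum_congr rfl fun e _ => ?_
    rw [Finset.sum_comm]
    refine Finset.sum_congr rfl fun g hg => ?_
    rw [FS_square (Finset.mem_powerset.1 hA) (mem_mon.1 hg).1,
      rq_pow_mul_square_term hm hd.2 hn (Nat.lt_succ_iff.1 (Finset.mem_range.1 hk)), Finset.mul_sum]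
    split_ifs
    · rfl
    · simp
  have hswap (N : ℕ) (F : Finset (MIrr q) → Finset (MIrr q) → ℕ → ℝ) :
      ∑ B ∈ (primesLE q m).powerset, ∑ A ∈ B.powerset, ∑ k ∈ Finset.range N, F B A k =
      ∑ k ∈ Finset.range N, ∑ B ∈ (primesLE q m).powerset, ∑ A ∈ B.powerset, F B A k := by
    rw [Finset.sum_comm]
    exact Finset.sum_congr rfl fun B _ => Finset.sum_comm
  rw [hswap, Finset.mul_sum]
  refine Finset.sum_congr rfl fun k hk => ?_
  rw [Finset.mul_sum, Finset.sum_congr rfl fun B hB => (Finset.mul_sum _ _ _).trans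
    (Finset.sum_congr rfl fun A hA => h1 B hB A hA k hk), hswap]
  refine Finset.sum_congr rfl fun t _ => ?_
  split_ifs
  · rw [← sum_sqTerm_eq_sqSum (Nat.sub_le m k)]
    simp only [Finset.sum_mul, Finset.mul_sum]
  · simp

end

noncomputable section

open scoped Classical ENNReal

variable {q : ℕ} [Fact q.Prime]

/-- The parameters of the secondary term that occur for the discriminants of degree `m`. -/
def sqIdx (m : ℕ) : Finset (ℕ × ℕ × ℕ × ℕ) :=
  (Finset.range (m + 1) ×ˢ Finset.range (m + 1) ×ˢ Finset.range (m + 1) ×ˢ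
    Finset.range (m + 1)).filter fun τ => τ.1 + τ.2.1 + τ.2.2.2 ≤ m

lemma sum_twisted_isSquare {m N j₀ : ℕ} (hm : Odd m) (hN : N + j₀ = m + 1) (hj : 1 ≤ j₀) :
    ∑ n ∈ Finset.range N, rq q ^ n * twisted q IsSquare n m = (q : ℝ) ^ m *
      ∑ τ ∈ sqIdx m, sqW q j₀ τ * ((m : ℝ) + 1 - (τ.1 + τ.2.1 + τ.2.2.2 : ℕ)) := by
  have hr : ∑ τ ∈ sqIdx m, sqW q j₀ τ * ((m : ℝ) + 1 - (τ.1 + τ.2.1 + τ.2.2.2 : ℕ)) =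
      ∑ τ ∈ (sqIdx m).filter (fun τ => j₀ ≤ τ.1 ∧ τ.1 + τ.2.1 < m),
        sqW q j₀ τ * ((m : ℝ) + 1 - (τ.1 + τ.2.1 + τ.2.2.2 : ℕ)) := by
    rw [Finset.sum_filter_of_ne]
    intro τ hτ h
    have hw := left_ne_zero_of_mul h
    simp only [sqIdx, Finset.mem_filter, Finset.mem_product, Finset.mem_range] at hτ
    rw [sqW] at hw
    have hc : j₀ ≤ τ.1 ∧ Odd τ.1 ∧ Even τ.2.1 := by
      by_contra hc
      exact hw (if_neg hc)
    rw [if_pos hc] at hw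
    refine ⟨hc.1, ?_⟩
    by_contra hlt
    exact hw (sqSum_eq_zero (by omega))
  rw [hr, Finset.mul_sum, Finset.sum_congr rfl fun n hn => rq_pow_mul_twisted_isSquare hm
    (by rw [Finset.mem_range] at hn; omega)]
  rw [Finset.sum_sigma', Finset.sum_sigma', Finset.sum_sigma']
  refine Finset.sum_nbij' (fun x => (m - x.1.1.1, x.1.1.1 - x.1.1.2, m - x.1.2, x.2))
    (fun τ => ⟨⟨⟨m - τ.1, m - τ.1 - τ.2.1⟩, m - τ.2.2.1⟩, τ.2.2.2⟩) ?_ ?_ ?_ ?_ ?_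
  · rintro ⟨⟨⟨n, d⟩, k⟩, t⟩ h
    simp only [sqIdx, Finset.mem_sigma, Finset.mem_filter, Finset.mem_product, Finset.mem_range,
      Finset.mem_Icc] at h ⊢
    omega
  · rintro ⟨j, s, κ, t⟩ h
    simp only [sqIdx, Finset.mem_sigma, Finset.mem_filter, Finset.mem_product, Finset.mem_range,
      Finset.mem_Icc] at h ⊢
    omega
  · rintro ⟨⟨⟨n, d⟩, k⟩, t⟩ h
    simp only [Finset.mem_sigma, Finset.mem_range, Finset.mem_Icc] at h
    have h1 : m - (m - n) = n := by omega
    have h2 : n - (n - d) = d := by omega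
    have h3 : m - (m - k) = k := by omega
    simp only [h1, h2, h3]
  · rintro ⟨j, s, κ, t⟩ h
    simp only [sqIdx, Finset.mem_filter, Finset.mem_product, Finset.mem_range] at h
    have h1 : m - (m - j) = j := by omega
    have h2 : m - j - (m - j - s) = s := by omega
    have h3 : m - (m - κ) = κ := by omega
    simp only [h1, h2, h3]
  · rintro ⟨⟨⟨n, d⟩, k⟩, t⟩ h
    simp only [Finset.mem_sigma, Finset.mem_range, Finset.mem_Icc] at h
    simp only [sqW]
    have hc : (j₀ ≤ m - n ∧ Odd (m - n) ∧ Even (n - d)) ↔ (Odd (m - n) ∧ Even (n - d)) :=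
      and_iff_right (by omega)
    simp only [hc]
    rw [ite_mul, zero_mul]

lemma halfSum_twisted_isSquare (g : ℕ) : halfSum q (twisted q IsSquare) g =
    (q : ℝ) ^ (2 * g + 1) * ∑ τ ∈ sqIdx (2 * g + 1), (sqW q 1 τ + sqW q 2 τ) *
      ((2 * g + 1 : ℝ) + 1 - (τ.1 + τ.2.1 + τ.2.2.2 : ℕ)) := by
  have hm : Odd (2 * g + 1) := ⟨g, rfl⟩
  rw [halfSum, sum_twisted_isSquare (j₀ := 1) hm rfl le_rfl,
    sum_twisted_isSquare (j₀ := 2) hm (by omega) one_le_two, ← mul_add, ← Finset.sum_add_distrib]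
  simp only [← add_mul]
  push_cast
  rfl

/-- The height of an index of the secondary term. -/
def sqHt (τ : ℕ × ℕ × ℕ × ℕ) : ℕ := max τ.2.2.1 (τ.1 + τ.2.1 + τ.2.2.2)

lemma square_contribution (hs : ∀ ε : ℝ, 0 < ε → ε < 1 / 2 →
    ∑' τ : ℕ × ℕ × ℕ × ℕ, ‖sqSum q τ.1 τ.2.1 τ.2.2.1 τ.2.2.2‖ₑ *
      (1 + (τ.1 + τ.2.1 + τ.2.2.2 : ℕ)) * qp q (1 / 2 - ε) ^ sqHt τ ≠ ⊤) :
    ∃ a b : ℝ, Negl q fun g => halfSum q (twisted q IsSquare) g -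
      (q : ℝ) ^ (2 * g + 1) * (a * (2 * g + 1) + b) := by
  have hΦ (w : ℕ × ℕ × ℕ × ℕ → ℝ) (g : ℕ) (τ) (hτ : τ ∉ sqIdx (2 * g + 1)) :
      w τ = 0 ∨ 2 * g + 1 < sqHt τ := by
    right
    simp only [sqIdx, Finset.mem_filter, Finset.mem_product, Finset.mem_range] at hτ
    rw [sqHt, lt_max_iff]
    omega
  have hb (j₀ : ℕ) (τ : ℕ × ℕ × ℕ × ℕ) :
      ‖sqW q j₀ τ‖ₑ ≤ ‖sqSum q τ.1 τ.2.1 τ.2.2.1 τ.2.2.2‖ₑ := by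
    rw [sqW]
    split_ifs
    · rfl
    · simp
  have hb2 (τ : ℕ × ℕ × ℕ × ℕ) : ‖sqW q 1 τ + sqW q 2 τ‖ₑ ≤
      2 * ‖sqSum q τ.1 τ.2.1 τ.2.2.1 τ.2.2.2‖ₑ := by
    rw [two_mul]
    exact (enorm_add_le _ _).trans (add_le_add (hb 1 τ) (hb 2 τ))
  have hfin {w : ℕ × ℕ × ℕ × ℕ → ℝ} (hw : ∀ τ, ‖w τ‖ₑ ≤ 2 *
      (‖sqSum q τ.1 τ.2.1 τ.2.2.1 τ.2.2.2‖ₑ * (1 + (τ.1 + τ.2.1 + τ.2.2.2 : ℕ)))) (ε : ℝ)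
      (hε : 0 < ε) (hε2 : ε < 1 / 2) : ∑' τ, ‖w τ‖ₑ * qp q (1 / 2 - ε) ^ sqHt τ ≠ ⊤ := by
    refine ne_top_of_le_ne_top (ENNReal.mul_ne_top (by simp : (2 : ℝ≥0∞) ≠ ⊤) (hs ε hε hε2)) ?_
    rw [← ENNReal.tsum_mul_left]
    refine ENNReal.tsum_le_tsum fun τ => ?_
    rw [← mul_assoc]
    gcongr
    exact hw τ
  have h0 := fun ε => hfin (w := fun τ => sqW q 1 τ + sqW q 2 τ) (fun τ => (hb2 τ).trans
    (mul_le_mul_right (le_mul_of_one_le_right' le_self_add) _)) ε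
  have h1 := fun ε => hfin
    (w := fun τ => (sqW q 1 τ + sqW q 2 τ) * (1 - (τ.1 + τ.2.1 + τ.2.2.2 : ℕ))) (fun τ => by
      rw [enorm_mul, ← mul_assoc]
      refine mul_le_mul' (hb2 τ) ?_
      refine enorm_sub_le.trans (le_of_eq ?_)
      generalize τ.1 + τ.2.1 + τ.2.2.2 = l
      simp) ε
  refine ⟨∑' τ, (sqW q 1 τ + sqW q 2 τ),
    ∑' τ, (sqW q 1 τ + sqW q 2 τ) * (1 - (τ.1 + τ.2.1 + τ.2.2.2 : ℕ)), ?_⟩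
  have := (negl_of_rankin h0 (fun g => sqIdx (2 * g + 1)) (hΦ _) 1).add
    (negl_of_rankin h1 (fun g => sqIdx (2 * g + 1)) (hΦ _) 0)
  convert this using 2 with g
  rw [halfSum_twisted_isSquare]
  have e : ∑ τ ∈ sqIdx (2 * g + 1), (sqW q 1 τ + sqW q 2 τ) *
      ((2 * g + 1 : ℝ) + 1 - (τ.1 + τ.2.1 + τ.2.2.2 : ℕ)) =
      (2 * g + 1) * ∑ τ ∈ sqIdx (2 * g + 1), (sqW q 1 τ + sqW q 2 τ) +
      ∑ τ ∈ sqIdx (2 * g + 1), (sqW q 1 τ + sqW q 2 τ) *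
        (1 - (τ.1 + τ.2.1 + τ.2.2.2 : ℕ)) := by
    rw [Finset.mul_sum, ← Finset.sum_add_distrib]
    exact Finset.sum_congr rfl fun _ _ => by ring
  rw [e]
  ring

end

noncomputable section

open scoped Classical ENNReal

variable {q : ℕ} [Fact q.Prime]

lemma N3_local_factor_le {wx wu wy ρ : ℝ≥0∞} (hx : wx ≤ 1) (hu : wu ≤ 1) (hy : wy ≤ 1) {r : ℕ}
    (hr : r ≠ 0) (h1 : wu ^ (2 * r) * wy ^ r ≤ ρ) (h2 : wx ^ (2 * r) * wy ^ r ≤ ρ)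
    (h3 : wy ^ (2 * r) ≤ ρ) :
    N3 wx wu wy ((1 - PowerSeries.X ^ r) ^ 2 * (1 + PowerSeries.C (ellS r) * PowerSeries.X ^ r)) ≤
      1 + (1 + 12 * ((1 - wx ^ 2)⁻¹ * (1 - wu ^ 2)⁻¹)) * ρ := by
  set c := (1 - wx ^ 2)⁻¹ * (1 - wu ^ 2)⁻¹ with hc
  have e : (1 - PowerSeries.X ^ r) ^ 2 * (1 + PowerSeries.C (ellS r) * PowerSeries.X ^ r) =
      (1 : A3) + (PowerSeries.C (ellS r - 2) * PowerSeries.X ^ r +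
        (PowerSeries.C (1 - 2 * ellS r) * PowerSeries.X ^ (2 * r) +
          PowerSeries.C (ellS r) * PowerSeries.X ^ (3 * r))) := by
    simp only [map_sub, map_mul, map_one, map_ofNat]
    ring
  have hl : N2 wx wu (ellS r) ≤ 2 * c := by
    rw [hc, ← mul_assoc]
    exact N2_ellS_le hx hu hr
  have hl2 : N2 wx wu (1 - 2 * ellS r) ≤ 1 + 4 * c := by
    refine ((N2 wx wu).sub_le _ _).trans (add_le_add (N2 wx wu).one_le' ?_)
    refine ((N2 wx wu).mul_le' _ _).trans ((mul_le_mul' ((N2 wx wu).ofNat_le 2) hl).trans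
      (le_of_eq (by ring)))
  rw [e]
  refine ((N3 wx wu wy).add_le' _ _).trans (add_le_add (N3 wx wu wy).one_le' ?_)
  have k1 : N3 wx wu wy (PowerSeries.C (ellS r - 2) * PowerSeries.X ^ r) ≤ 6 * c * ρ := by
    rw [N3, SubNorm.ext_C_mul_X_pow]
    refine (mul_le_mul_left (N2_ellS_sub_two_le hx hu hr) _).trans ?_
    calc _ = 4 * c * (wu ^ (2 * r) * wy ^ r) + 2 * c * (wx ^ (2 * r) * wy ^ r) := by ring
      _ ≤ 4 * c * ρ + 2 * c * ρ := by gcongr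
      _ = _ := by ring
  have k2 : N3 wx wu wy (PowerSeries.C (1 - 2 * ellS r) * PowerSeries.X ^ (2 * r)) ≤
      (1 + 4 * c) * ρ := by
    rw [N3, SubNorm.ext_C_mul_X_pow]
    exact mul_le_mul' hl2 h3
  have k3 : N3 wx wu wy (PowerSeries.C (ellS r) * PowerSeries.X ^ (3 * r)) ≤ 2 * c * ρ := by
    rw [N3, SubNorm.ext_C_mul_X_pow]
    exact mul_le_mul' hl ((pow_le_pow_right_of_le_one' hy (by omega)).trans h3)
  refine ((N3 wx wu wy).add_le' _ _).trans ((add_le_add k1 (((N3 wx wu wy).add_le' _ _).trans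
    (add_le_add k2 k3))).trans (le_of_eq (by ring)))

lemma exists_N3_GS_le {a b c η : ℝ} (hη : 0 < η) (ha : 0 < a) (hb : 0 < b) (hc : 1 + η ≤ 2 * c)
    (hbc : 1 + η ≤ 2 * b + c) (hac : 1 + η ≤ 2 * a + c) :
    ∃ K : ℝ≥0∞, K ≠ ⊤ ∧ ∀ R : Finset (MIrr q),
      N3 (qp q (-a)) (qp q (-b)) (qp q (-c)) (GS R) ≤ K * 4 ^ R.card := by
  have hx : qp q (-a) < 1 := qp_lt_one (by linarith)
  have hu : qp q (-b) < 1 := qp_lt_one (by linarith)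
  have hy : qp q (-c) ≤ 1 := qp_le_one (by linarith)
  set C := 1 + 12 * ((1 - qp q (-a) ^ 2)⁻¹ * (1 - qp q (-b) ^ 2)⁻¹) with hC
  have hCt : C ≠ ⊤ := by
    refine ENNReal.add_ne_top.2 ⟨by simp, ENNReal.mul_ne_top (by simp) (ENNReal.mul_ne_top ?_ ?_)⟩
    · exact inv_one_sub_ne_top (pow_lt_one₀ zero_le hx two_ne_zero)
    · exact inv_one_sub_ne_top (pow_lt_one₀ zero_le hu two_ne_zero)
  obtain ⟨K, hK, hKle⟩ := exists_prime_prod_bound (q := q) (C := C) (ρ := qp q (-(1 + η))) hCt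
    (by rw [q_mul_qp]; exact qp_lt_one (by linarith))
  refine ⟨K, hK, fun R => ?_⟩
  refine ext_pow_mul_eprod_le _ _ 2 fun n => ?_
  have hfac (P : MIrr q) : N3 (qp q (-a)) (qp q (-b)) (qp q (-c))
      ((1 - PowerSeries.X ^ P.1.natDegree) ^ 2 * (1 + PowerSeries.C (if P ∈ R then 0 else
        ellS P.1.natDegree) * PowerSeries.X ^ P.1.natDegree)) ≤
      (1 + C * qp q (-(1 + η)) ^ P.1.natDegree) * (if P ∈ R then 4 else 1) := by
    have hr := natDegree_ne_zero_of_MIrr P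
    split_ifs with hP
    · rw [map_zero, zero_mul, add_zero, mul_one]
      refine ((SubNorm.pow_le _ _ _).trans (pow_le_pow_left' ((SubNorm.sub_le _ _ _).trans
        (add_le_add (SubNorm.one_le' _) ((SubNorm.ext_X_pow_le _ _).trans
          (pow_le_one₀ zero_le hy)))) 2)).trans ?_
      refine le_trans (le_of_eq (by norm_num)) (le_mul_of_one_le_left' le_self_add)
    · rw [mul_one]
      have hpow {x y : ℝ} (i : ℕ) (h : 1 + η ≤ i * x + y) (r : ℕ) :
          qp q (-x) ^ (i * r) * qp q (-y) ^ r ≤ qp q (-(1 + η)) ^ r := by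
        rw [pow_mul, ← mul_pow, qp_pow, ← qp_add]
        exact pow_le_pow_left' (qp_mono (by linarith)) r
      refine N3_local_factor_le hx.le hu.le hy hr (hpow 2 (by exact_mod_cast hbc) _)
        (hpow 2 (by exact_mod_cast hac) _) ?_
      have := hpow (x := c) (y := 0) 2 (by push_cast; linarith) P.1.natDegree
      rwa [neg_zero, qp_zero, one_pow, mul_one] at this
  refine (Finset.prod_le_prod' fun P _ => hfac P).trans ?_
  rw [Finset.prod_mul_distrib]
  refine mul_le_mul' (hKle _) ?_
  rw [Finset.prod_ite, Finset.prod_const, Finset.prod_const_one, mul_one]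
  refine pow_le_pow_right₀ (by norm_num) (Finset.card_le_card fun P hP => ?_)
  exact (Finset.mem_filter.1 hP).2

lemma dg_primeSet_le {g : Fqx q} (hg : g ≠ 0) : dg (primeSet g) ≤ g.natDegree := by
  rw [← natDegree_pr]
  exact natDegree_le_of_dvd ((pr_dvd_iff _ _).2 fun P hP => (mem_primeSet hg).1 hP) hg

lemma exists_sum_N3_GS_le {a b c η : ℝ} (hη : 0 < η) (ha : 1 + η ≤ 2 * a) (hb : 0 < b)
    (hc : 1 + η ≤ 2 * c) (hbc : 1 + η ≤ 2 * b + c) (hac : 1 + η ≤ 2 * a + c) :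
    ∃ M : ℝ≥0∞, M ≠ ⊤ ∧ ∀ (S : Finset (MIrr q)) (N : ℕ),
      ∑ B ∈ S.powerset, ∑ A ∈ B.powerset, ∑ e ∈ Finset.range N, ∑ g ∈ mon q e,
        N2 (qp q (-a)) (qp q (-b)) (ZS A B) *
          N3 (qp q (-a)) (qp q (-b)) (qp q (-c)) (GS (B ∪ primeSet g)) *
          qp q (-(1 / 2 + η) * (dg A + 2 * e : ℕ)) ≤ M := by
  have ha0 : 0 < a := by linarith
  have hx : qp q (-a) < 1 := qp_lt_one (by linarith)
  have hu : qp q (-b) < 1 := qp_lt_one (by linarith)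
  have hqx : (q : ℝ≥0∞) * qp q (-a) ^ 2 < 1 := by
    rw [qp_pow, q_mul_qp]
    exact qp_lt_one (by push_cast; linarith)
  obtain ⟨K, hK, hKle⟩ := exists_N3_GS_le (q := q) hη ha0 hb hc hbc hac
  obtain ⟨F, hF, hFle⟩ := exists_const_prod_bound (q := q) (K := 4) (by simp) hη
  set Z := (1 + q * qp q (-a) ^ 4) * (1 - q * qp q (-a) ^ 2)⁻¹ ^ 3 * (1 + q * qp q (-b) ^ 2) with hZ
  have hZt : Z ≠ ⊤ := ENNReal.mul_ne_top (ENNReal.mul_ne_top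
    (by simp [ENNReal.mul_eq_top, qp_ne_top]) (ENNReal.pow_ne_top (inv_one_sub_ne_top hqx)))
    (by simp [ENNReal.mul_eq_top, qp_ne_top])
  set d := 4 * ((1 - qp q (-a) ^ 2)⁻¹ * (1 - qp q (-b) ^ 2)⁻¹) with hd
  have hdt : d ≠ ⊤ := ENNReal.mul_ne_top (by simp) (ENNReal.mul_ne_top
    (inv_one_sub_ne_top (pow_lt_one₀ zero_le hx two_ne_zero))
    (inv_one_sub_ne_top (pow_lt_one₀ zero_le hu two_ne_zero)))
  obtain ⟨L, hL, hLle⟩ := exists_prime_prod_bound (q := q) (C := d * 4 * (1 + 1))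
    (ρ := qp q (-(1 + η))) (ENNReal.mul_ne_top (ENNReal.mul_ne_top hdt (by simp)) (by simp))
    (by rw [q_mul_qp]; exact qp_lt_one (by linarith))
  set G := ∑' n, qp q (-η) ^ n with hG
  have hGt : G ≠ ⊤ := tsum_geometric_ne_top (qp_lt_one (by linarith))
  refine ⟨Z * K * F * G * L, by finiteness, fun S N => ?_⟩
  have hterm (B A : Finset (MIrr q)) (e : ℕ) (g : Fqx q) (hg : g ∈ mon q e) :
      N2 (qp q (-a)) (qp q (-b)) (ZS A B) *
          N3 (qp q (-a)) (qp q (-b)) (qp q (-c)) (GS (B ∪ primeSet g)) *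
          qp q (-(1 / 2 + η) * (dg A + 2 * e : ℕ)) ≤
      Z * K * F * ((∏ P ∈ B, d * 4 * qp q (-(1 + η)) ^ P.1.natDegree) * ∏ _P ∈ A, 1) *
        qp q (-(1 + η) * e) := by
    have h1 : N2 (qp q (-a)) (qp q (-b)) (ZS A B) ≤
        Z * ∏ P ∈ B, d * qp q (-(1 + η)) ^ P.1.natDegree := by
      refine (N2_ZS_le hx.le hu.le).trans (mul_le_mul_right ?_ Z)
      refine (mul_le_of_le_one_right' (mul_le_one' (pow_le_one₀ zero_le hu.le)
        (pow_le_one₀ zero_le hu.le))).trans (Finset.prod_le_prod' fun P _ => ?_)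
      have : qp q (-a) ^ (2 * P.1.natDegree) ≤ qp q (-(1 + η)) ^ P.1.natDegree := by
        rw [pow_mul, qp_pow]
        exact pow_le_pow_left' (qp_mono (by push_cast; linarith)) _
      calc _ = d * qp q (-a) ^ (2 * P.1.natDegree) := by rw [hd]; ring
        _ ≤ _ := by gcongr
    have h2 : N3 (qp q (-a)) (qp q (-b)) (qp q (-c)) (GS (B ∪ primeSet g)) ≤
        K * ((∏ _P ∈ B, 4) * (F * qp q (η * e))) := by
      have hg' := mem_mon.1 hg
      refine (hKle _).trans (mul_le_mul_right ?_ K)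
      refine (pow_le_pow_right₀ (by norm_num) (Finset.card_union_le _ _)).trans ?_
      rw [pow_add, Finset.prod_const]
      refine mul_le_mul_right ?_ _
      rw [← Finset.prod_const]
      refine (hFle _).trans (mul_le_mul_right ?_ F)
      rw [qp_pow]
      refine qp_mono (mul_le_mul_of_nonneg_left ?_ hη.le)
      exact_mod_cast (dg_primeSet_le hg'.1.ne_zero).trans_eq hg'.2
    have h3 : qp q (-(1 / 2 + η) * (dg A + 2 * e : ℕ)) ≤ qp q (-(1 + 2 * η) * e) := by
      refine qp_mono ?_
      push_cast
      nlinarith [(dg A).cast_nonneg (α := ℝ)]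
    refine (mul_le_mul' (mul_le_mul' h1 h2) h3).trans (le_of_eq ?_)
    have e1 : qp q (η * e) * qp q (-(1 + 2 * η) * e) = qp q (-(1 + η) * e) := by
      rw [← qp_add]
      ring_nf
    rw [← e1, Finset.prod_const_one, mul_one]
    have e2 : ∏ P ∈ B, d * 4 * qp q (-(1 + η)) ^ P.1.natDegree =
        (∏ P ∈ B, d * qp q (-(1 + η)) ^ P.1.natDegree) * ∏ _P ∈ B, 4 := by
      rw [← Finset.prod_mul_distrib]
      exact Finset.prod_congr rfl fun _ _ => by ring
    rw [e2]
    ring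
  have hinner (B A : Finset (MIrr q)) : ∑ e ∈ Finset.range N, ∑ g ∈ mon q e,
        N2 (qp q (-a)) (qp q (-b)) (ZS A B) *
          N3 (qp q (-a)) (qp q (-b)) (qp q (-c)) (GS (B ∪ primeSet g)) *
          qp q (-(1 / 2 + η) * (dg A + 2 * e : ℕ)) ≤
      Z * K * F * G * ((∏ P ∈ B, d * 4 * qp q (-(1 + η)) ^ P.1.natDegree) * ∏ _P ∈ A, 1) := by
    have ht := hterm B A
    generalize (∏ P ∈ B, d * 4 * qp q (-(1 + η)) ^ P.1.natDegree) * ∏ _P ∈ A, 1 = Y at ht ⊢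
    refine (Finset.sum_le_sum (g := fun e => Z * K * F * Y * qp q (-η) ^ e) fun e _ =>
      (Finset.sum_le_card_nsmul _ _ _ (ht e)).trans_eq ?_).trans ?_
    · rw [card_mon, nsmul_eq_mul, Nat.cast_pow, ← qp_nat, mul_left_comm, ← qp_add, qp_pow]
      ring_nf
    · rw [← Finset.mul_sum]
      refine (mul_le_mul_right (ENNReal.sum_le_tsum _) _).trans (le_of_eq ?_)
      rw [← hG]
      ring
  refine (Finset.sum_le_sum fun B _ => Finset.sum_le_sum fun A _ => hinner B A).trans ?_
  simp only [← Finset.mul_sum]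
  refine mul_le_mul_right ?_ _
  have := sum_powerset_powerset_prod (S := S)
    (fun P => d * 4 * qp q (-(1 + η)) ^ P.1.natDegree) fun _ => 1
  simp only [Finset.mul_sum] at this ⊢
  rw [this]
  refine le_trans (le_of_eq (Finset.prod_congr rfl fun P _ => ?_)) (hLle S)
  ring

end

noncomputable section

open scoped Classical ENNReal

variable {q : ℕ} [Fact q.Prime]

lemma enorm_brk_le (κ i : ℕ) : ‖brk q κ i‖ₑ ≤ q := by
  have h1 : (1 : ℝ) < q := one_lt_q_real
  have h : |brk q κ i| ≤ q := by
    rw [brk]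
    split_ifs
    · rw [abs_of_nonneg] <;> linarith
    · rw [abs_neg, abs_one]; exact h1.le
    · rw [abs_zero]; linarith
  rw [← Real.enorm_abs, Real.enorm_of_nonneg (abs_nonneg _), ← ENNReal.ofReal_natCast]
  exact ENNReal.ofReal_le_ofReal h

lemma enorm_sqTerm_mul_le {a b c v V η : ℝ} {j s κ t e : ℕ} (A B R : Finset (MIrr q))
    (h : ∀ i : ℕ, i + j + s ≤ κ →
      -(κ : ℝ) - s / 2 - t + a * s + b * κ + c * t + v ≤ -(1 / 2 + η) * i + V) :
    ‖sqTerm j s κ t A B R e‖ₑ * qp q v ≤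
      N2 (qp q (-a)) (qp q (-b)) (ZS A B) * N3 (qp q (-a)) (qp q (-b)) (qp q (-c)) (GS R) *
        qp q (-(1 / 2 + η) * (dg A + 2 * e : ℕ)) * (q * qp q V) := by
  rcases lt_or_ge κ (dg A + 2 * e + j + s) with hlt | hle
  · rw [sqTerm_eq_zero_of_brk A B R (by omega), enorm_zero, zero_mul]
    exact zero_le
  set X := PowerSeries.coeff s (PowerSeries.coeff κ (ZS A B * PowerSeries.coeff t (GS R))) with hX
  have h1 : ‖X‖ₑ * qp q (-(a * s + b * κ + c * t)) ≤
      N2 (qp q (-a)) (qp q (-b)) (ZS A B) *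
        N3 (qp q (-a)) (qp q (-b)) (qp q (-c)) (GS R) := by
    have h2 := enorm_coeff3_mul_le (wx := qp q (-a)) (wu := qp q (-b)) (wy := qp q (-c))
      (PowerSeries.C (ZS A B) * GS R) s κ t
    rw [PowerSeries.coeff_C_mul] at h2
    refine le_trans (le_of_eq ?_) (h2.trans ((SubNorm.mul_le' _ _ _).trans
      (le_of_eq (by rw [SubNorm.ext_C]))))
    rw [qp_pow, qp_pow, qp_pow, ← qp_add, ← qp_add]
    congr 2
    ring
  have h3 : ‖sqTerm j s κ t A B R e‖ₑ ≤ qp q (-(κ : ℝ) - s / 2 - t) * q * ‖X‖ₑ := by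
    rw [sqTerm, enorm_mul, enorm_mul, enorm_mul, enorm_mul, enorm_pow, enorm_pow, enorm_pow,
      enorm_q_inv, enorm_rq, qp_pow, qp_pow, qp_pow, ← qp_add, ← qp_add]
    refine mul_le_mul' (mul_le_mul' (le_of_eq ?_) (enorm_brk_le _ _)) le_rfl
    congr 1
    ring
  calc _ ≤ qp q (-(κ : ℝ) - s / 2 - t) * q * ‖X‖ₑ * qp q v := mul_le_mul_left h3 _
    _ = ‖X‖ₑ * qp q (-(a * s + b * κ + c * t)) *
        (q * qp q (-(κ : ℝ) - s / 2 - t + a * s + b * κ + c * t + v)) := by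
      have : -(κ : ℝ) - s / 2 - t + a * s + b * κ + c * t + v =
        (a * s + b * κ + c * t) + ((-(κ : ℝ) - s / 2 - t) + v) := by ring
      rw [this]
      generalize a * s + b * κ + c * t = E
      generalize -(κ : ℝ) - s / 2 - t = F
      rw [qp_add, qp_add]
      calc _ = 1 * (‖X‖ₑ * (q * (qp q F * qp q v))) := by ring
        _ = _ := by rw [← qp_mul_cancel (q := q) E]; ring
    _ ≤ N2 (qp q (-a)) (qp q (-b)) (ZS A B) * N3 (qp q (-a)) (qp q (-b)) (qp q (-c)) (GS R) *
        (q * qp q (-(1 / 2 + η) * (dg A + 2 * e : ℕ) + V)) :=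
      mul_le_mul' h1 (mul_le_mul_right (qp_mono (h _ hle)) _)
    _ = _ := by rw [qp_add]; ring

lemma enorm_sqSum_mul_le {a b c v V η : ℝ} {M : ℝ≥0∞} {j s κ t : ℕ}
    (hM : ∀ (S : Finset (MIrr q)) (N : ℕ),
      ∑ B ∈ S.powerset, ∑ A ∈ B.powerset, ∑ e ∈ Finset.range N, ∑ g ∈ mon q e,
        N2 (qp q (-a)) (qp q (-b)) (ZS A B) *
          N3 (qp q (-a)) (qp q (-b)) (qp q (-c)) (GS (B ∪ primeSet g)) *
          qp q (-(1 / 2 + η) * (dg A + 2 * e : ℕ)) ≤ M)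
    (h : ∀ i : ℕ, i + j + s ≤ κ →
      -(κ : ℝ) - s / 2 - t + a * s + b * κ + c * t + v ≤ -(1 / 2 + η) * i + V) :
    ‖sqSum q j s κ t‖ₑ * qp q v ≤ M * q * qp q V := by
  have h1 : ‖sqSum q j s κ t‖ₑ ≤ ∑ B ∈ (primesLE q κ).powerset, ∑ A ∈ B.powerset,
      ∑ e ∈ Finset.range κ, ∑ g ∈ mon q e, ‖sqTerm j s κ t A B (B ∪ primeSet g) e‖ₑ := by
    rw [sqSum]
    refine (enorm_sum_le _ _).trans (Finset.sum_le_sum fun B _ => ?_)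
    refine (enorm_sum_le _ _).trans (Finset.sum_le_sum fun A _ => ?_)
    refine (enorm_sum_le _ _).trans (Finset.sum_le_sum fun e _ => enorm_sum_le _ _)
  refine (mul_le_mul_left h1 _).trans (le_trans ?_
    ((mul_le_mul_left (hM (primesLE q κ) κ) (q * qp q V)).trans (le_of_eq (mul_assoc _ _ _).symm)))
  simp only [Finset.sum_mul]
  exact Finset.sum_le_sum fun B _ => Finset.sum_le_sum fun A _ => Finset.sum_le_sum fun e _ =>
    Finset.sum_le_sum fun g _ => enorm_sqTerm_mul_le A B _ h

lemma exists_enorm_sqSum_le {ε : ℝ} (hε : 0 < ε) (hε2 : ε < 1 / 2) :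
    ∃ M : ℝ≥0∞, M ≠ ⊤ ∧ ∀ τ : ℕ × ℕ × ℕ × ℕ,
      ‖sqSum q τ.1 τ.2.1 τ.2.2.1 τ.2.2.2‖ₑ * qp q (1 / 2 - ε) ^ sqHt τ ≤
        M * qp q (-(ε / 4) * (τ.1 + τ.2.1 + τ.2.2.1 + τ.2.2.2)) := by
  have hη : 0 < ε / 4 := by linarith
  obtain ⟨M, hM, hMle⟩ := exists_sum_N3_GS_le (q := q) (a := 1) (b := ε / 2) (c := 1 - ε / 4) hη
    (by linarith) (by linarith) (by linarith) (by linarith) (by linarith)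
  obtain ⟨M', hM', hMle'⟩ := exists_sum_N3_GS_le (q := q) (a := 1 / 2 + ε) (b := 1 / 2 - ε / 2)
    (c := 1 / 2 + 3 * ε / 4) hη
    (by linarith) (by linarith) (by linarith) (by linarith) (by linarith)
  refine ⟨(M + M') * q, by finiteness, fun ⟨j, s, κ, t⟩ => ?_⟩
  simp only [qp_pow, sqHt]
  have hj : (0 : ℝ) ≤ ε * j := by positivity
  have hs : (0 : ℝ) ≤ ε * s := by positivity
  have ht : (0 : ℝ) ≤ ε * t := by positivity
  have hκ : (0 : ℝ) ≤ ε * κ := by positivity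
  rcases le_total (j + s + t) κ with h | h
  · rw [max_eq_left h]
    refine (enorm_sqSum_mul_le hMle fun i hi => ?_).trans
      (mul_le_mul_left (mul_le_mul_left le_self_add _) _)
    have hi' : (i : ℝ) + j + s ≤ κ := by exact_mod_cast hi
    nlinarith [mul_le_mul_of_nonneg_left hi' (by linarith : 0 ≤ 1 / 2 + ε / 4)]
  · rw [max_eq_right h]
    refine (enorm_sqSum_mul_le hMle' fun i hi => ?_).trans
      (mul_le_mul_left (mul_le_mul_left le_add_self _) _)
    have hi' : (i : ℝ) + j + s ≤ κ := by exact_mod_cast hi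
    push_cast
    nlinarith [mul_le_mul_of_nonneg_left hi' (by linarith : 0 ≤ 1 / 2 + ε / 4)]

lemma tsum_sqSum_ne_top {ε : ℝ} (hε : 0 < ε) (hε2 : ε < 1 / 2) :
    ∑' τ : ℕ × ℕ × ℕ × ℕ, ‖sqSum q τ.1 τ.2.1 τ.2.2.1 τ.2.2.2‖ₑ *
      (1 + (τ.1 + τ.2.1 + τ.2.2.2 : ℕ)) * qp q (1 / 2 - ε) ^ sqHt τ ≠ ⊤ := by
  obtain ⟨M, hM, hMle⟩ := exists_enorm_sqSum_le (q := q) hε hε2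
  obtain ⟨C, hC, hCle⟩ := exists_pow_bound (q := q) 1 (by linarith : 0 < ε / 8)
  set x := qp q (-(ε / 8)) with hx
  have hG : ∑' n, x ^ n ≠ ⊤ := tsum_geometric_ne_top (qp_lt_one (by linarith))
  have hle (τ : ℕ × ℕ × ℕ × ℕ) : ‖sqSum q τ.1 τ.2.1 τ.2.2.1 τ.2.2.2‖ₑ *
      (1 + (τ.1 + τ.2.1 + τ.2.2.2 : ℕ)) * qp q (1 / 2 - ε) ^ sqHt τ ≤
      M * C * (x ^ τ.1 * (x ^ τ.2.1 * (x ^ τ.2.2.1 * x ^ τ.2.2.2))) := by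
    have h1 := hCle (τ.1 + τ.2.1 + τ.2.2.2)
    rw [pow_one, qp_pow] at h1
    calc _ = ‖sqSum q τ.1 τ.2.1 τ.2.2.1 τ.2.2.2‖ₑ * qp q (1 / 2 - ε) ^ sqHt τ *
          (1 + (τ.1 + τ.2.1 + τ.2.2.2 : ℕ)) := by ring
      _ ≤ M * qp q (-(ε / 4) * (τ.1 + τ.2.1 + τ.2.2.1 + τ.2.2.2)) *
          (C * qp q (ε / 8 * (τ.1 + τ.2.1 + τ.2.2.2 : ℕ))) := mul_le_mul' (hMle τ) h1
      _ = M * C * qp q (-(ε / 4) * (τ.1 + τ.2.1 + τ.2.2.1 + τ.2.2.2) +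
          ε / 8 * (τ.1 + τ.2.1 + τ.2.2.2 : ℕ)) := by rw [qp_add]; ring
      _ ≤ _ := by
        rw [hx, qp_pow, qp_pow, qp_pow, qp_pow, ← qp_add, ← qp_add, ← qp_add]
        refine mul_le_mul_right (qp_mono ?_) _
        have hκ : (0 : ℝ) ≤ ε * τ.2.2.1 := by positivity
        push_cast
        nlinarith
  refine ne_top_of_le_ne_top ?_ (ENNReal.tsum_le_tsum hle)
  rw [ENNReal.tsum_mul_left, ENNReal.tsum_prod']
  simp only [ENNReal.tsum_mul_left, ENNReal.tsum_prod', ENNReal.tsum_mul_right]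
  finiteness

end

noncomputable section

open scoped Classical ENNReal

variable {q : ℕ} [Fact q.Prime]

lemma sum_antidiagonal_range {M N : ℕ} (h : M ≤ N) (f : ℕ × ℕ → ℝ) :
    ∑ n ∈ Finset.range M, ∑ p ∈ Finset.HasAntidiagonal.antidiagonal n, f p =
      ∑ p ∈ (Finset.range N ×ˢ Finset.range N).filter (fun p => p.1 + p.2 < M), f p := by
  rw [← Finset.sum_fiberwise_of_maps_to (g := fun p : ℕ × ℕ => p.1 + p.2) (t := Finset.range M)
    (fun p hp => Finset.mem_range.2 (Finset.mem_filter.1 hp).2)]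
  refine Finset.sum_congr rfl fun n hn => Finset.sum_congr ?_ fun _ _ => rfl
  ext p
  simp only [Finset.HasAntidiagonal.mem_antidiagonal, Finset.mem_filter, Finset.mem_product,
    Finset.mem_range] at hn ⊢
  omega

lemma sq_sum_of_symm {N : ℕ} {u : ℕ → ℝ} (h : ∀ a ≤ N, u a = u (N - a)) :
    (∑ a ∈ Finset.range (N + 1), u a) ^ 2 =
      ∑ n ∈ Finset.range (N + 1), ∑ p ∈ Finset.HasAntidiagonal.antidiagonal n, u p.1 * u p.2 +
        ∑ n ∈ Finset.range N, ∑ p ∈ Finset.HasAntidiagonal.antidiagonal n, u p.1 * u p.2 := by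
  rw [sum_antidiagonal_range le_rfl, sum_antidiagonal_range (Nat.le_succ N), sq,
    Finset.sum_mul_sum, ← Finset.sum_product',
    ← Finset.sum_filter_add_sum_filter_not _ (fun p : ℕ × ℕ => p.1 + p.2 < N + 1)]
  congr 1
  refine Finset.sum_nbij' (fun p => (N - p.1, N - p.2)) (fun p => (N - p.1, N - p.2))
    ?_ ?_ ?_ ?_ ?_
  all_goals
    rintro ⟨a, b⟩ hp
    simp only [Finset.mem_filter, Finset.mem_product, Finset.mem_range, Prod.mk.injEq] at hp ⊢
  · omega
  · omega
  · omega
  · omega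
  · rw [h a (by omega), h b (by omega)]

lemma sq_sum_charSum (hq : q % 4 = 1) (T : Finset (MIrr q)) {g : ℕ} (hg : dg T = 2 * g + 1) :
    (∑ n ∈ Finset.range (2 * g + 1), rq q ^ n * (charSum T n : ℝ)) ^ 2 =
      ∑ n ∈ Finset.range (2 * g + 1), rq q ^ n * PowerSeries.coeff n (lser ℝ (qchar T) ^ 2) +
        ∑ n ∈ Finset.range (2 * g), rq q ^ n * PowerSeries.coeff n (lser ℝ (qchar T) ^ 2) := by
  have hq0 : (q : ℝ) ≠ 0 := q_real_pos.ne'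
  have hc (n : ℕ) : rq q ^ n * PowerSeries.coeff n (lser ℝ (qchar T) ^ 2) =
      ∑ p ∈ Finset.HasAntidiagonal.antidiagonal n,
        (rq q ^ p.1 * (charSum T p.1 : ℝ)) * (rq q ^ p.2 * (charSum T p.2 : ℝ)) := by
    rw [sq, PowerSeries.coeff_mul, Finset.mul_sum]
    refine Finset.sum_congr rfl fun p hp => ?_
    rw [lser, PowerSeries.coeff_mk, PowerSeries.coeff_mk,
      ← Finset.HasAntidiagonal.mem_antidiagonal.1 hp, charSum,
      charSum]
    ring
  simp only [hc]
  refine sq_sum_of_symm fun a ha => ?_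
  have h : (q : ℝ) ^ g * charSum T a = q ^ a * charSum T (2 * g - a) := by
    exact_mod_cast charSum_odd hq T hg ha
  have hr (k : ℕ) : rq q ^ (2 * k) * (q : ℝ) ^ k = 1 := by
    rw [pow_mul, ← mul_pow, rq_sq, one_pow]
  have h1 : rq q ^ (2 * g) = rq q ^ a * rq q ^ (2 * g - a) := by rw [← pow_add]; congr 1; omega
  have h2 := hr a
  have h3 := hr g
  rw [two_mul, pow_add] at h2
  rw [h1] at h3
  calc rq q ^ a * (charSum T a : ℝ) =
        (rq q ^ a * rq q ^ (2 * g - a) * q ^ g) * (rq q ^ a * charSum T a) := by rw [h3, one_mul]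
    _ = rq q ^ a * rq q ^ a * rq q ^ (2 * g - a) * (q ^ g * charSum T a) := by ring
    _ = (rq q ^ a * rq q ^ a * q ^ a) * (rq q ^ (2 * g - a) * charSum T (2 * g - a)) := by
      rw [h]; ring
    _ = _ := by rw [h2, one_mul]

lemma rq_pow_eq_inv_sqrt (n : ℕ) : rq q ^ n = (Real.sqrt ((q : ℝ) ^ n))⁻¹ := by
  refine eq_inv_of_mul_eq_one_left ?_
  refine (sq_eq_sq₀ (mul_nonneg (pow_nonneg rq_pos.le _) (Real.sqrt_nonneg _)) zero_le_one).1 ?_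
  rw [mul_pow, Real.sq_sqrt (pow_nonneg q_real_pos.le _), ← pow_mul, mul_comm n, pow_mul, ← mul_pow,
    rq_sq, one_pow, one_pow]

lemma Lhalf_pr (hq : q % 4 = 1) (T : Finset (MIrr q)) :
    Lhalf q (pr T) = ((∑ n ∈ Finset.range (dg T), rq q ^ n * (charSum T n : ℝ) : ℝ) : ℂ) := by
  rw [Lhalf, natDegree_pr, Complex.ofReal_sum]
  refine Finset.sum_congr rfl fun n _ => ?_
  rw [sumMn, if_pos (Int.natCast_nonneg n), Int.toNat_natCast, sum_monicOf n (chi q (pr T)),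
    rq_pow_eq_inv_sqrt, charSum, div_eq_inv_mul]
  push_cast
  congr 1
  refine Finset.sum_congr rfl fun f hf => ?_
  rw [chi, jacSym_eq_qchar hq T (mem_mon.1 hf).1]

lemma sumH_Lhalf_sq (hq : q % 4 = 1) (g : ℕ) :
    sumH q (2 * g + 1) (fun D => Lhalf q D ^ 2) = ((halfSum q (E q) g : ℝ) : ℂ) := by
  rw [sumH, sum_squarefree (2 * g + 1) (fun D => Lhalf q D ^ 2), halfSum]
  simp only [E, Finset.mul_sum]
  rw [Finset.sum_comm, Finset.sum_comm (s := Finset.range (2 * g)), ← Finset.sum_add_distrib,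
    Complex.ofReal_sum]
  refine Finset.sum_congr rfl fun T hT => ?_
  rw [Lhalf_pr hq, ← sq_sum_charSum hq T (mem_sqf.1 hT), Complex.ofReal_pow, mem_sqf.1 hT]

lemma halfSum_E (hq : q % 4 = 1) (g : ℕ) : halfSum q (E q) g = mainS q g +
    (halfSum q (twisted q IsSquare) g + halfSum q (twisted q fun V => ¬ IsSquare V) g) := by
  have h (n : ℕ) (hn : n < 2 * g + 1) := congrArg (rq q ^ n * ·) (E_split hq hn.le)
  simp only [mul_add] at h
  rw [halfSum, halfSum, halfSum, mainS,
    Finset.sum_congr rfl fun n hn => h n (Finset.mem_range.1 hn),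
    Finset.sum_congr rfl fun n hn => h n ((Finset.mem_range.1 hn).trans (Nat.lt_succ_self _))]
  simp only [Finset.sum_add_distrib]
  ring

lemma second_moment_asymptotic (hq : q % 4 = 1) : ∃ R : ℝ[X], R.natDegree ≤ 3 ∧
    R.coeff 3 = (∑' τ, mainW q τ) / 24 ∧
    Negl q fun g => halfSum q (E q) g - (q : ℝ) ^ (2 * g + 1) * R.eval (2 * g + 1 : ℝ) := by
  obtain ⟨R, hR, hR3, hN⟩ := main_contribution (q := q)
  obtain ⟨a, b, hab⟩ := square_contribution (q := q) fun ε hε hε2 => tsum_sqSum_ne_top hε hε2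
  have hns := negl_halfSum_nonsquare (q := q) (by omega)
  have hlin : (C a * X + C b : ℝ[X]).natDegree ≤ 1 := natDegree_linear_le
  refine ⟨R + (C a * X + C b), (natDegree_add_le _ _).trans (max_le hR (hlin.trans (by norm_num))),
    ?_, ?_⟩
  · rw [coeff_add, coeff_eq_zero_of_natDegree_lt (hlin.trans_lt (by norm_num)), add_zero, hR3]
  · convert (hN.add hab).add hns using 2 with g
    rw [halfSum_E hq, eval_add, eval_add, eval_mul, eval_C, eval_C, eval_X]
    ring

end

/-- the second moment of `L(1/2, χ_D)` over `H_{2g+1}`: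
there is a polynomial `P` of degree `3` with leading coefficient `B(1/q)(1-1/q)/24`
such that `∑_{D ∈ H_{2g+1}} L(1/2,χ_D)² = (q^{2g+1}/ζ(2)) P(2g+1) + O_ε(q^{g(1+ε)})`. -/
theorem second_moment_quadratic_L (q : ℕ) [Fact q.Prime] (hq4 : q % 4 = 1) :
    ∃ P : Polynomial ℂ, P.degree = 3 ∧
      P.coeff 3 = Bfun q (1 / q) * (1 - 1 / q) / 24 ∧
      ∀ ε : ℝ, 0 < ε → ∃ K : ℝ, 0 < K ∧ ∀ g : ℕ,
        ‖sumH q (2 * g + 1) (fun D => Lhalf q D ^ 2) -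
            (q : ℂ) ^ (2 * g + 1) * (1 - 1 / q) * P.eval ((2 * g + 1 : ℕ) : ℂ)‖ ≤
          K * (q : ℝ) ^ ((g : ℝ) * (1 + ε)) := by
  obtain ⟨R, hR, hR3, hN⟩ := second_moment_asymptotic hq4
  have hq1 : (1 - (q : ℂ)⁻¹) ≠ 0 := by
    rw [sub_ne_zero, ne_comm, Ne, inv_eq_one, Nat.cast_eq_one]
    exact (Fact.out : q.Prime).ne_one
  set P : ℂ[X] := C (1 - (q : ℂ)⁻¹)⁻¹ * R.map Complex.ofRealHom with hP
  have hP3 : P.coeff 3 = Bfun q (1 / q) * (1 - 1 / q) / 24 := by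
    rw [hP, coeff_C_mul, coeff_map, hR3, Complex.ofRealHom_eq_coe, Complex.ofReal_div, tsum_mainW,
      one_div]
    push_cast
    field_simp
  refine ⟨P, ?_, hP3, fun ε hε => ?_⟩
  · refine le_antisymm ?_ (le_degree_of_ne_zero (n := 3) ?_)
    · refine degree_le_of_natDegree_le ((natDegree_C_mul_le _ _).trans (natDegree_map_le.trans hR))
    · rw [hP3]
      refine div_ne_zero (mul_ne_zero Bfun_ne_zero ?_) (by norm_num)
      rwa [one_div]
  · obtain ⟨K, hK⟩ := hN ε hε
    refine ⟨|K| + 1, by positivity, fun g => ?_⟩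
    have h : sumH q (2 * g + 1) (fun D => Lhalf q D ^ 2) -
        (q : ℂ) ^ (2 * g + 1) * (1 - 1 / q) * P.eval ((2 * g + 1 : ℕ) : ℂ) =
        ((halfSum q (E q) g - (q : ℝ) ^ (2 * g + 1) * R.eval (2 * g + 1 : ℝ) : ℝ) : ℂ) := by
      have he : (R.map Complex.ofRealHom).eval ((2 * g + 1 : ℕ) : ℂ) =
          ((R.eval (2 * g + 1 : ℝ) : ℝ) : ℂ) := by
        have := eval_map_apply (f := Complex.ofRealHom) (p := R) (2 * g + 1 : ℝ)
        simpa using this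
      rw [sumH_Lhalf_sq hq4, hP, eval_mul, eval_C, he, one_div, mul_assoc, mul_inv_cancel_left₀ hq1]
      push_cast
      rfl
    rw [h, Complex.norm_real, Real.norm_eq_abs]
    refine (hK g).trans (mul_le_mul_of_nonneg_right ?_ (Real.rpow_nonneg q_real_pos.le _))
    linarith [le_abs_self K]
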